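/- For n ≥ 2, the connected sum of n tori T²_n contains an open subset homeomorphic to T² # T² minus a closed disk, and for n ≥ 5 the connected sum of n projective planes ℝP²_n contains an open subset homeomorphic to T² # T² minus a closed disk. -/

import Mathlib

open Set Metric Topology

noncomputable section

abbrev E2 := EuclideanSpace ℝ (Fin 2)
abbrev E3 := EuclideanSpace ℝ (Fin 3)

/-- The circle `S¹`. -/
abbrev Circ : Type := Metric.sphere (0 : E2) 1

/-- The 2-sphere as a bundled topological space. -/
def Sphere2 : TopCat := TopCat.of (Metric.sphere (0 : E3) 1)

/-- The torus `S¹ × S¹`. -/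
def Torus : TopCat := TopCat.of (Circ × Circ)

/-- The real projective plane: quotient of `S²` by the antipodal map. -/
def RP2 : TopCat :=
  TopCat.of (Quot (fun x y : Metric.sphere (0 : E3) 1 => (y : E3) = -(x : E3)))

/-- Identifications defining the Klein bottle from `[0,1] × [0,1]`:
`(x,0) ∼ (x,1)` and `(0,y) ∼ (1,1−y)`. -/
def KleinRel (p q : (Set.Icc (0:ℝ) 1) × (Set.Icc (0:ℝ) 1)) : Prop :=
  ((p.1 : ℝ) = (q.1 : ℝ) ∧ (p.2 : ℝ) = 0 ∧ (q.2 : ℝ) = 1) ∨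
  ((p.1 : ℝ) = 0 ∧ (q.1 : ℝ) = 1 ∧ (p.2 : ℝ) = 1 - (q.2 : ℝ))

/-- The Klein bottle. -/
def Klein : TopCat := TopCat.of (Quot KleinRel)

/-- The closed unit disk in the plane. -/
def Disk : Set E2 := Metric.closedBall 0 1

def diskInterior : Set Disk := {z : Disk | ‖(z : E2)‖ < 1}
def diskBoundary : Set Disk := {z : Disk | ‖(z : E2)‖ = 1}

/-- An embedded closed disk whose interior is open in the ambient space. -/
def IsDiskEmbedding {X : Type*} [TopologicalSpace X] (f : Disk → X) : Prop :=
  IsEmbedding f ∧ IsOpen (f '' diskInterior)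

/-- `Z` is a connected sum of `X` and `Y`: `Z` is covered by two closed pieces,
homeomorphic respectively to `X` and `Y` with an open embedded disk removed,
meeting exactly along the corresponding boundary circles. -/
def IsConnSum (Z X Y : TopCat.{0}) : Prop :=
  ∃ (A B : Set Z) (f : Disk → X) (g : Disk → Y),
    IsDiskEmbedding f ∧ IsDiskEmbedding g ∧
    IsClosed A ∧ IsClosed B ∧ A ∪ B = Set.univ ∧
    ∃ (hA : A ≃ₜ ((f '' diskInterior)ᶜ : Set X))
      (hB : B ≃ₜ ((g '' diskInterior)ᶜ : Set Y)),
      Subtype.val '' (hA '' {a : A | (a : Z) ∈ B}) = f '' diskBoundary ∧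
      Subtype.val '' (hB '' {b : B | (b : Z) ∈ A}) = g '' diskBoundary

/-- `Z` is a connected sum of `C` with `n` tori (`n = 0` meaning `Z ≃ₜ C`). -/
def IsSumToriWith (C : TopCat.{0}) : ℕ → TopCat.{0} → Prop
  | 0, Z => Nonempty (↥Z ≃ₜ ↥C)
  | n + 1, Z => ∃ W : TopCat.{0}, IsSumToriWith C n W ∧ IsConnSum Z W Torus

/-- `Z` is a connected sum of `n` tori (`n ≥ 1`). -/
def IsTorSum (n : ℕ) (Z : TopCat.{0}) : Prop :=
  1 ≤ n ∧ IsSumToriWith Torus (n - 1) Z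

/-- `Z` is a connected sum of `n` projective planes (`n ≥ 1`). -/
def IsProjSum : ℕ → TopCat.{0} → Prop
  | 0, _ => False
  | 1, Z => Nonempty (↥Z ≃ₜ ↥RP2)
  | n + 2, Z => ∃ W : TopCat.{0}, IsProjSum (n + 1) W ∧ IsConnSum Z W RP2

/-- `X` contains an open subset homeomorphic to `T² # T²` minus a closed disk. -/
def ContainsDoubleTorusMinusDisk (X : TopCat.{0}) : Prop :=
  ∃ U : Set X, IsOpen U ∧
    ∃ G : TopCat.{0}, IsConnSum G Torus Torus ∧
      ∃ f : Disk → G, IsDiskEmbedding f ∧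
        Nonempty (↥U ≃ₜ ((Set.range f)ᶜ : Set G))

/-! ### Logarithms in the plane -/

theorem pl_exists_log (F : ℂ → ℂ) (hF : Continuous F) (h0 : ∀ z, F z ≠ 0) :
    ∃ u : ℂ → ℂ, Continuous u ∧ ∀ z, Complex.exp (u z) = F z := by
  have hs : IsSimplyConnected (univ : Set ℂ) := by
    have : SimplyConnectedSpace (univ : Set ℂ) :=
      (Homeomorph.Set.univ ℂ).toHomotopyEquiv.simplyConnectedSpace
    exact this
  obtain ⟨f, hf, hf'⟩ := Complex.exists_continuousOn_eqOn_exp_comp hs isOpen_univ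
    hF.continuousOn (by rintro ⟨z, -, hz⟩; exact h0 z hz)
  exact ⟨f, continuousOn_univ.1 hf, fun z => hf' (mem_univ z)⟩

theorem pl_log_of_retract {X : Type*} [TopologicalSpace X] {S : Set X} (H : X → ℂ) (J : ℂ → X)
    (hH : ContinuousOn H S) (hJ : Continuous J) (hJS : ∀ z, J z ∈ S)
    (hJH : ∀ x ∈ S, J (H x) = x) (F : X → ℂ) (hF : ContinuousOn F S) (h0 : ∀ x ∈ S, F x ≠ 0) :
    ∃ u : X → ℂ, ContinuousOn u S ∧ ∀ x ∈ S, Complex.exp (u x) = F x := by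
  obtain ⟨u, hu, hu'⟩ := pl_exists_log (F ∘ J) (hF.comp_continuous hJ hJS)
    (fun z => h0 _ (hJS z))
  refine ⟨u ∘ H, hu.comp_continuousOn hH, fun x hx => ?_⟩
  simp [hu', hJH x hx]

/-- a continuous function on a preconnected set, with values in `2 π i ℤ`, is constant -/
theorem pl_const_of_exp_eq_one {X : Type*} [TopologicalSpace X] {S : Set X} (hS : IsPreconnected S)
    (v : X → ℂ) (hv : ContinuousOn v S) (h1 : ∀ x ∈ S, Complex.exp (v x) = 1) :
    ∀ x ∈ S, ∀ y ∈ S, v x = v y := by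
  have key : ∀ x ∈ S, ∃ n : ℤ, v x = n * (2 * Real.pi * Complex.I) := fun x hx =>
    Complex.exp_eq_one_iff.1 (h1 x hx)
  choose! n hn using key
  have hpi : (Real.pi : ℝ) ≠ 0 := Real.pi_ne_zero
  have hre : ∀ x ∈ S, (n x : ℝ) = (v x).im / (2 * Real.pi) := by
    intro x hx
    rw [hn x hx]
    simp
  have hc : ContinuousOn (fun x => (n x : ℝ)) S := by
    refine ContinuousOn.congr ?_ hre
    exact (Complex.continuous_im.comp_continuousOn hv).div_const _
  have hc' : ContinuousOn n S := by
    rw [Int.isClosedEmbedding_coe_real.isInducing.continuousOn_iff]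
    exact hc
  intro x hx y hy
  rw [hn x hx, hn y hy, hS.constant hc' hx hy]

theorem pl_exp_eq_const {X : Type*} [TopologicalSpace X] {S : Set X} (hS : IsPreconnected S)
    (u v : X → ℂ) (hu : ContinuousOn u S) (hv : ContinuousOn v S)
    (h1 : ∀ x ∈ S, Complex.exp (u x) = Complex.exp (v x)) :
    ∀ x ∈ S, ∀ y ∈ S, u x - v x = u y - v y :=
  pl_const_of_exp_eq_one hS (fun x => u x - v x) (hu.sub hv) (fun x hx => by
    rw [Complex.exp_sub, h1 x hx, div_self (Complex.exp_ne_zero _)])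

theorem pl_circle_no_log (p : ℂ) (R : ℝ) (hR : 0 < R) (u : ℂ → ℂ)
    (hu : ContinuousOn u (sphere p R)) (h : ∀ z ∈ sphere p R, Complex.exp (u z) = z - p) :
    False := by
  have hm : ∀ t : ℝ, circleMap p R t ∈ sphere p R := fun t => circleMap_mem_sphere p hR.le t
  have hc := pl_exp_eq_const (isPreconnected_univ (α := ℝ)) (fun t => u (circleMap p R t))
    (fun t : ℝ => Complex.log R + t * Complex.I)
    (hu.comp_continuous (continuous_circleMap p R) hm).continuousOn
    (by fun_prop) (by
      intro t _
      have hR' : (R : ℂ) ≠ 0 := by exact_mod_cast hR.ne'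
      show Complex.exp (u (circleMap p R t)) = _
      rw [h _ (hm t), Complex.exp_add, Complex.exp_log hR']
      simp [circleMap]) 0 trivial (2 * Real.pi) trivial
  have h2 : circleMap p R (2 * Real.pi) = circleMap p R 0 := by
    have := periodic_circleMap p R 0
    simpa using this
  simp only [h2] at hc
  have := congrArg Complex.im hc
  simp at this

/-- Lemma E -/
theorem pl_lemmaE (V : Set ℂ) (hVo : IsOpen V) (hVb : Bornology.IsBounded V) (p : ℂ) (hp : p ∈ V)
    (g : ℂ → ℂ) (hg : Continuous g) (hg0 : ∀ z ∈ V, g z ≠ 0) (u : ℂ → ℂ)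
    (hu : ContinuousOn u (frontier V))
    (h : ∀ z ∈ frontier V, Complex.exp (u z) * g z = z - p) : False := by
  classical
  obtain ⟨û, hû⟩ := ContinuousMap.exists_restrict_eq (isClosed_frontier (s := V))
    (⟨fun x : frontier V => u x, continuousOn_iff_continuous_domRestrict.1 hu⟩ : C(frontier V, ℂ))
  have hû' : ∀ z ∈ frontier V, û z = u z := fun z hz => by
    have := DFunLike.congr_fun hû ⟨z, hz⟩
    exact this
  set F : ℂ → ℂ := fun z => if z ∈ V then Complex.exp (û z) * g z else z - p with hF
  have hFc : Continuous F := by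
    refine Continuous.if ?_ (by fun_prop) (by fun_prop)
    intro z hz
    have hz' : z ∈ frontier V := hz
    rw [hû' z hz', h z hz']
  have hF0 : ∀ z, F z ≠ 0 := by
    intro z
    by_cases hz : z ∈ V
    · simp only [hF, hz, if_true]
      exact mul_ne_zero (Complex.exp_ne_zero _) (hg0 z hz)
    · simp only [hF, hz, if_false]
      rintro h0
      rw [sub_eq_zero] at h0
      exact hz (h0 ▸ hp)
  obtain ⟨L, hL, hL'⟩ := pl_exists_log F hFc hF0
  obtain ⟨R, hR⟩ := hVb.subset_ball p
  have hRp : 0 < R := by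
    have := hR hp
    simpa using this
  refine pl_circle_no_log p R hRp L hL.continuousOn (fun z hz => ?_)
  rw [hL']
  have : z ∉ V := fun hzV => by
    have := hR hzV
    simp only [mem_ball, mem_sphere] at this hz
    linarith
  simp [hF, this]

/-- retraction to the closed unit disc -/
def plRetr (z : ℂ) : ℂ := z / (max 1 ‖z‖ : ℝ)

theorem plRetr_continuous : Continuous plRetr := by
  unfold plRetr
  refine continuous_id.div ?_ ?_
  · exact Complex.continuous_ofReal.comp (continuous_const.max continuous_norm)
  · intro z
    have : (0:ℝ) < max 1 ‖z‖ := lt_of_lt_of_le one_pos (le_max_left _ _)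
    exact_mod_cast this.ne'

theorem plRetr_mem (z : ℂ) : plRetr z ∈ closedBall (0:ℂ) 1 := by
  have : (0:ℝ) < max 1 ‖z‖ := lt_of_lt_of_le one_pos (le_max_left _ _)
  simp only [plRetr, mem_closedBall, dist_zero_right, norm_div, Complex.norm_real, Real.norm_eq_abs,
    abs_of_pos this]
  rw [div_le_one this]
  exact le_max_right _ _

theorem plRetr_eq {z : ℂ} (hz : z ∈ closedBall (0:ℂ) 1) : plRetr z = z := by
  simp only [mem_closedBall, dist_zero_right] at hz
  simp [plRetr, max_eq_left hz]

theorem invFunOn_continuousOn {X Y : Type*} [TopologicalSpace X] [TopologicalSpace Y] [T2Space Y]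
    [Nonempty X] {f : X → Y} {K : Set X} (hK : IsCompact K) (hf : ContinuousOn f K)
    (hi : InjOn f K) : ContinuousOn (Function.invFunOn f K) (f '' K) := by
  rw [continuousOn_iff_isClosed]
  intro t ht
  refine ⟨f '' (K ∩ t), ?_, ?_⟩
  · exact ((hK.inter_right ht).image_of_continuousOn (hf.mono inter_subset_left)).isClosed
  · ext y
    constructor
    · rintro ⟨hy, x, hx, rfl⟩
      refine ⟨⟨x, ⟨hx, ?_⟩, rfl⟩, ⟨x, hx, rfl⟩⟩
      rwa [mem_preimage, hi.leftInvOn_invFunOn hx] at hy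
    · rintro ⟨⟨x, ⟨hx, hxt⟩, rfl⟩, -⟩
      refine ⟨?_, ⟨x, hx, rfl⟩⟩
      rwa [mem_preimage, hi.leftInvOn_invFunOn hx]

/-- the hypotheses on a disc embedding in the plane -/
structure PlDisc (χ : ℂ → ℂ) : Prop where
  cont : ContinuousOn χ (closedBall 0 1)
  inj : InjOn χ (closedBall 0 1)
  opn : IsOpen (χ '' ball 0 1)
  zero : χ 0 = 0

theorem PlDisc.isCompact_K {χ : ℂ → ℂ} (h : PlDisc χ) : IsCompact (χ '' closedBall 0 1) :=
  (isCompact_closedBall 0 1).image_of_continuousOn h.cont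

theorem PlDisc.log_K {χ : ℂ → ℂ} (h : PlDisc χ) (F : ℂ → ℂ)
    (hF : ContinuousOn F (χ '' closedBall 0 1)) (h0 : ∀ x ∈ χ '' closedBall 0 1, F x ≠ 0) :
    ∃ u : ℂ → ℂ, ContinuousOn u (χ '' closedBall 0 1) ∧
      ∀ x ∈ χ '' closedBall 0 1, Complex.exp (u x) = F x := by
  refine pl_log_of_retract (Function.invFunOn χ (closedBall 0 1)) (χ ∘ plRetr)
    (invFunOn_continuousOn (isCompact_closedBall 0 1) h.cont h.inj)
    (h.cont.comp_continuous plRetr_continuous plRetr_mem) (fun z => ⟨_, plRetr_mem z, rfl⟩)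
    ?_ F hF h0
  rintro _ ⟨x, hx, rfl⟩
  simp [h.inj.leftInvOn_invFunOn hx, plRetr_eq hx]

/-- components of the complement are unbounded -/
theorem pl_frontier_component {K : Set ℂ} (hK : IsClosed K) (z : ℂ) :
    frontier (connectedComponentIn Kᶜ z) ⊆ K := by
  intro x hx
  by_contra hxK
  have hz : z ∈ Kᶜ := by
    by_contra hz
    rw [connectedComponentIn_eq_empty hz] at hx
    simp at hx
  have ho : IsOpen (connectedComponentIn Kᶜ z) := hK.isOpen_compl.connectedComponentIn
  have ho' : IsOpen (connectedComponentIn Kᶜ x) := hK.isOpen_compl.connectedComponentIn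
  have hxx : x ∈ connectedComponentIn Kᶜ x := mem_connectedComponentIn hxK
  rw [ho.frontier_eq] at hx
  obtain ⟨y, hy1, hy2⟩ := mem_closure_iff.1 hx.1 _ ho' hxx
  apply hx.2
  rw [connectedComponentIn_eq hy1, ← connectedComponentIn_eq hy2] at hxx
  exact hxx

theorem pl_compl_closedBall (R : ℝ) (hR : 0 ≤ R) : IsPreconnected ((closedBall (0:ℂ) R)ᶜ) := by
  have h1 : IsPreconnected ((Ioi R) ×ˢ (univ : Set ℝ)) := isPreconnected_Ioi.prod isPreconnected_univ
  have : (closedBall (0:ℂ) R)ᶜ =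
      (fun q : ℝ × ℝ => circleMap 0 q.1 q.2) '' ((Ioi R) ×ˢ (univ : Set ℝ)) := by
    ext z
    constructor
    · intro hz
      have hz' : R < ‖z‖ := by simpa using hz
      refine ⟨(‖z‖, z.arg), ⟨hz', trivial⟩, ?_⟩
      simp [circleMap, Complex.norm_mul_exp_arg_mul_I]
    · rintro ⟨q, ⟨hq, -⟩, rfl⟩
      have hq' : R < q.1 := hq
      simp only [mem_compl_iff, mem_closedBall, dist_zero_right, norm_circleMap_zero, not_le]
      rwa [abs_of_pos (lt_of_le_of_lt hR hq')]
  rw [this]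
  refine h1.image _ (Continuous.continuousOn ?_)
  unfold circleMap
  fun_prop

theorem PlDisc.compl_preconnected {χ : ℂ → ℂ} (h : PlDisc χ) :
    IsPreconnected ((χ '' closedBall 0 1)ᶜ) := by
  set K := χ '' closedBall 0 1
  have hKc : IsCompact K := h.isCompact_K
  obtain ⟨R, hR0, hR⟩ : ∃ R : ℝ, 0 ≤ R ∧ K ⊆ closedBall 0 R := by
    obtain ⟨R, hR⟩ := hKc.isBounded.subset_closedBall 0
    exact ⟨max R 0, le_max_right _ _, hR.trans (closedBall_subset_closedBall (le_max_left _ _))⟩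
  have hO : IsPreconnected ((closedBall (0:ℂ) R)ᶜ) := pl_compl_closedBall R hR0
  have hub : ∀ z ∈ Kᶜ, (closedBall (0:ℂ) R)ᶜ ⊆ connectedComponentIn Kᶜ z := by
    intro z hz
    have hnb : ¬ Bornology.IsBounded (connectedComponentIn Kᶜ z) := by
      intro hb
      obtain ⟨u, hu, hu'⟩ := h.log_K (fun x => x - z) (by fun_prop) (by
        intro x hx h0
        rw [sub_eq_zero] at h0
        exact hz (h0 ▸ hx))
      refine pl_lemmaE _ hKc.isClosed.isOpen_compl.connectedComponentIn hb z
        (mem_connectedComponentIn hz) (fun _ => 1) continuous_const (by simp) u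
        (hu.mono (pl_frontier_component hKc.isClosed z)) ?_
      intro x hx
      simp [hu' x (pl_frontier_component hKc.isClosed z hx)]
    have : ¬ (connectedComponentIn Kᶜ z ⊆ closedBall 0 R) := fun hs =>
      hnb (isBounded_closedBall.subset hs)
    obtain ⟨y, hy, hyR⟩ := not_subset.1 this
    rw [connectedComponentIn_eq hy]
    exact hO.subset_connectedComponentIn hyR (compl_subset_compl.2 hR)
  obtain ⟨q, hq⟩ : ∃ q : ℂ, q ∈ (closedBall (0:ℂ) R)ᶜ := by
    refine ⟨((|R| + 1 : ℝ) : ℂ), ?_⟩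
    simp only [mem_compl_iff, mem_closedBall, dist_zero_right, Complex.norm_real, Real.norm_eq_abs]
    rw [abs_of_pos (by positivity)]
    have := le_abs_self R
    linarith
  have hqK : q ∈ Kᶜ := compl_subset_compl.2 hR hq
  have : Kᶜ = connectedComponentIn Kᶜ q := by
    refine Subset.antisymm (fun z hz => ?_) (connectedComponentIn_subset _ _)
    rw [← connectedComponentIn_eq (hub z hz hq)]
    exact mem_connectedComponentIn hz
  rw [this]
  exact isPreconnected_connectedComponentIn

/-- F4 -/
theorem PlDisc.boundary_mem_closure {χ : ℂ → ℂ} (h : PlDisc χ) {ζ : ℂ} (hζ : ‖ζ‖ = 1) :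
    χ ζ ∈ closure ((χ '' closedBall 0 1)ᶜ) := by
  set K := χ '' closedBall 0 1 with hKdef
  by_contra hcl
  rw [closure_compl, notMem_compl_iff] at hcl
  obtain ⟨ρ, hρ, hb⟩ := Metric.isOpen_iff.1 isOpen_interior _ hcl
  replace hb : ball (χ ζ) ρ ⊆ K := hb.trans interior_subset
  have hζD : ζ ∈ closedBall (0:ℂ) 1 := by simp [hζ]
  have hζ0 : ζ ≠ 0 := by
    rintro rfl
    simp at hζ
  -- log of `x - χ ζ` on `K \ {χ ζ}`
  set ret : ℂ → ℂ := fun w => ((max w.re 0 : ℝ) : ℂ) + w.im * Complex.I with hret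
  have hretc : Continuous ret := by
    apply Continuous.add
    · exact Complex.continuous_ofReal.comp (Complex.continuous_re.max continuous_const)
    · fun_prop
  have hretre : ∀ w, 0 ≤ (ret w).re := fun w => by simp [hret]
  have hreteq : ∀ w : ℂ, 0 ≤ w.re → ret w = w := fun w hw => by
    simp [hret, max_eq_left hw, Complex.re_add_im]
  have hne : ∀ w : ℂ, 0 ≤ w.re → w + 1 ≠ 0 := fun w hw h0 => by
    have := congrArg Complex.re h0
    simp at this
    linarith
  have hmem : ∀ w : ℂ, 0 ≤ w.re → ζ * ((w - 1) / (w + 1)) ∈ closedBall (0:ℂ) 1 := by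
    intro w hw
    simp only [mem_closedBall, dist_zero_right, norm_mul, hζ, one_mul, norm_div]
    rw [div_le_one (norm_pos_iff.2 (hne w hw))]
    rw [← sq_le_sq₀ (norm_nonneg _) (norm_nonneg _), Complex.sq_norm, Complex.sq_norm]
    simp [Complex.normSq_apply]
    nlinarith
  have hneζ : ∀ w : ℂ, 0 ≤ w.re → ζ * ((w - 1) / (w + 1)) ≠ ζ := by
    intro w hw h0
    have h1 : (w - 1) / (w + 1) = 1 := by
      have := mul_left_cancel₀ hζ0 (h0.trans (mul_one ζ).symm)
      exact this
    rw [div_eq_one_iff_eq (hne w hw)] at h1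
    have := congrArg Complex.re h1
    simp at this
    linarith
  have hinv := invFunOn_continuousOn (isCompact_closedBall 0 1) h.cont h.inj
  have hinvl : ∀ x ∈ closedBall (0:ℂ) 1, Function.invFunOn χ (closedBall 0 1) (χ x) = x :=
    fun x hx => h.inj.leftInvOn_invFunOn hx
  obtain ⟨u, hu, hu'⟩ := pl_log_of_retract (S := K \ {χ ζ})
    (fun x => (ζ + Function.invFunOn χ (closedBall 0 1) x) /
      (ζ - Function.invFunOn χ (closedBall 0 1) x))
    (fun w => χ (ζ * ((ret w - 1) / (ret w + 1))))
    (by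
      refine ContinuousOn.div (continuousOn_const.add (hinv.mono sdiff_subset))
        (continuousOn_const.sub (hinv.mono sdiff_subset)) ?_
      rintro _ ⟨⟨x, hx, rfl⟩, hx2⟩ h0
      rw [hinvl x hx, sub_eq_zero] at h0
      exact hx2 (by rw [h0]; rfl))
    (by
      refine h.cont.comp_continuous ?_ (fun w => hmem _ (hretre w))
      exact continuous_const.mul ((hretc.sub continuous_const).div (hretc.add continuous_const)
        (fun w => hne _ (hretre w))))
    (by
      intro w
      refine ⟨⟨_, hmem _ (hretre w), rfl⟩, fun h0 => ?_⟩
      exact hneζ _ (hretre w) (h.inj (hmem _ (hretre w)) hζD h0))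
    (by
      rintro _ ⟨⟨x, hx, rfl⟩, hx2⟩
      have hxζ : ζ - x ≠ 0 := fun h0 => hx2 (by rw [sub_eq_zero.1 h0]; rfl)
      simp only [hinvl x hx]
      have hx1 : x.re * x.re + x.im * x.im ≤ 1 := by
        have : ‖x‖ ≤ 1 := by simpa using hx
        rw [← Complex.normSq_apply, Complex.normSq_eq_norm_sq]
        nlinarith [norm_nonneg x]
      have hζ1 : ζ.re * ζ.re + ζ.im * ζ.im = 1 := by
        rw [← Complex.normSq_apply, Complex.normSq_eq_norm_sq, hζ]; norm_num
      have hre : 0 ≤ ((ζ + x) / (ζ - x)).re := by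
        rw [Complex.div_re, ← add_div]
        refine div_nonneg ?_ (Complex.normSq_nonneg _)
        simp
        nlinarith
      rw [hreteq _ hre]
      congr 1
      have h2 : (ζ + x) / (ζ - x) + 1 ≠ 0 := hne _ hre
      have h3 : (ζ + x) / (ζ - x) - 1 = 2 * x / (ζ - x) := by
        field_simp; ring
      have h4 : (ζ + x) / (ζ - x) + 1 = 2 * ζ / (ζ - x) := by
        field_simp; ring
      rw [h3, h4]
      field_simp)
    (fun x => x - χ ζ) (by fun_prop) (by
      rintro x hx h0
      exact hx.2 (sub_eq_zero.1 h0))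
  have hsub : sphere (χ ζ) (ρ / 2) ⊆ K \ {χ ζ} := by
    intro x hx
    rw [mem_sphere] at hx
    refine ⟨hb ?_, ?_⟩
    · rw [mem_ball]; linarith
    · rintro rfl
      rw [dist_self] at hx
      linarith
  exact pl_circle_no_log (χ ζ) (ρ / 2) (by positivity) u (hu.mono hsub)
    (fun z hz => hu' z (hsub hz))

theorem hasDerivAt_of_sq {p q : ℂ → ℂ} {z d : ℂ} (hq : ContinuousAt q z) (hq0 : q z ≠ 0)
    (h : ∀ᶠ w in 𝓝 z, q w ^ 2 = p w) (hp : HasDerivAt p d z) :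
    HasDerivAt q (d / (2 * q z)) z := by
  rw [hasDerivAt_iff_tendsto_slope] at hp ⊢
  have hz : q z ^ 2 = p z := h.self_of_nhds
  have h2 : Filter.Tendsto (fun w => q w + q z) (𝓝[≠] z) (𝓝 (2 * q z)) := by
    rw [two_mul]
    exact (hq.tendsto.mono_left nhdsWithin_le_nhds).add tendsto_const_nhds
  have h20 : 2 * q z ≠ 0 := mul_ne_zero two_ne_zero hq0
  refine (hp.div h2 h20).congr' ?_
  filter_upwards [h.filter_mono nhdsWithin_le_nhds, h2.eventually_ne h20] with w hw hw0
  simp only [Pi.div_apply, slope_def_field]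
  rw [← hw, ← hz, div_div, mul_comm (w - z), ← div_div]
  congr 1
  rw [div_eq_iff hw0]
  ring

/-- the Moebius map -/
def mob (a z : ℂ) : ℂ := (z - a) / (1 - (starRingEnd ℂ) a * z)

theorem mob_den {a z : ℂ} (ha : ‖a‖ < 1) (hz : ‖z‖ < 1) : 1 - (starRingEnd ℂ) a * z ≠ 0 := by
  intro h
  have h1 : (starRingEnd ℂ) a * z = 1 := (sub_eq_zero.1 h).symm
  have := congrArg norm h1
  simp at this
  nlinarith [norm_nonneg a, norm_nonneg z]

theorem mob_norm {a z : ℂ} (ha : ‖a‖ < 1) (hz : ‖z‖ < 1) : ‖mob a z‖ < 1 := by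
  rw [mob, norm_div, div_lt_one (norm_pos_iff.2 (mob_den ha hz)),
    ← sq_lt_sq₀ (norm_nonneg _) (norm_nonneg _), Complex.sq_norm, Complex.sq_norm]
  have ha' : a.re * a.re + a.im * a.im < 1 := by
    rw [← Complex.normSq_apply, Complex.normSq_eq_norm_sq]
    nlinarith [norm_nonneg a]
  have hz' : z.re * z.re + z.im * z.im < 1 := by
    rw [← Complex.normSq_apply, Complex.normSq_eq_norm_sq]
    nlinarith [norm_nonneg z]
  simp [Complex.normSq_apply]
  nlinarith

theorem mob_inj {a z w : ℂ} (ha : ‖a‖ < 1) (hz : ‖z‖ < 1) (hw : ‖w‖ < 1) (h : mob a z = mob a w) :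
    z = w := by
  rw [mob, mob, div_eq_div_iff (mob_den ha hz) (mob_den ha hw)] at h
  have h1 : (z - w) * (1 - (starRingEnd ℂ) a * a) = 0 := by linear_combination h
  rcases mul_eq_zero.1 h1 with h2 | h2
  · exact sub_eq_zero.1 h2
  · exact absurd h2 (mob_den ha ha)

theorem mob_deriv {a z : ℂ} (ha : ‖a‖ < 1) (hz : ‖z‖ < 1) :
    HasDerivAt (mob a) ((1 - (starRingEnd ℂ) a * a) / (1 - (starRingEnd ℂ) a * z) ^ 2) z := by
  have h1 : HasDerivAt (fun z : ℂ => z - a) 1 z := (hasDerivAt_id z).sub_const a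
  have h2 : HasDerivAt (fun z : ℂ => 1 - (starRingEnd ℂ) a * z) (-(starRingEnd ℂ) a) z := by
    simpa using ((hasDerivAt_id z).const_mul ((starRingEnd ℂ) a)).const_sub 1
  have := h1.div h2 (mob_den ha hz)
  refine HasDerivAt.congr_deriv (f := mob a) this ?_
  congr 1
  ring

structure RClass (Ω : Set ℂ) (f : ℂ → ℂ) : Prop where
  inj : InjOn f Ω
  maps : ∀ z ∈ Ω, ‖f z‖ < 1
  zero : f 0 = 0
  der : ∀ z ∈ Ω, deriv f z ≠ 0

def SqrtProp (Ω : Set ℂ) : Prop := ∀ p : ℂ → ℂ, ContinuousOn p Ω → (∀ z ∈ Ω, p z ≠ 0) →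
  ∃ q : ℂ → ℂ, ContinuousOn q Ω ∧ ∀ z ∈ Ω, q z ^ 2 = p z

theorem RClass.diff {Ω : Set ℂ} {f : ℂ → ℂ} (h : RClass Ω f) {z : ℂ} (hz : z ∈ Ω) :
    HasDerivAt f (deriv f z) z :=
  (differentiableAt_of_deriv_ne_zero (h.der z hz)).hasDerivAt

theorem koebe_step {Ω : Set ℂ} (hΩ : IsOpen Ω) (h0 : (0:ℂ) ∈ Ω) (hs : SqrtProp Ω) {f : ℂ → ℂ}
    (hf : RClass Ω f) {a : ℂ} (ha : ‖a‖ < 1) (ha' : ∀ z ∈ Ω, f z ≠ a) :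
    ∃ g, RClass Ω g ∧ ‖deriv g 0‖ * (2 * Real.sqrt ‖a‖) = ‖deriv f 0‖ * (1 + ‖a‖) := by
  have ha0 : a ≠ 0 := fun h => ha' 0 h0 (by rw [hf.zero, h])
  set p : ℂ → ℂ := fun z => mob a (f z) with hp
  have hpd : ∀ z ∈ Ω, HasDerivAt p ((1 - (starRingEnd ℂ) a * a) /
      (1 - (starRingEnd ℂ) a * f z) ^ 2 * deriv f z) z := fun z hz =>
    (mob_deriv ha (hf.maps z hz)).comp z (hf.diff hz)
  have hp0 : ∀ z ∈ Ω, p z ≠ 0 := by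
    intro z hz h
    exact ha' z hz (mob_inj ha (hf.maps z hz) ha (by simpa [mob, hp] using h))
  have hpn : ∀ z ∈ Ω, ‖p z‖ < 1 := fun z hz => mob_norm ha (hf.maps z hz)
  obtain ⟨q, hqc, hq⟩ := hs p (fun z hz => (hpd z hz).continuousAt.continuousWithinAt) hp0
  have hq0 : ∀ z ∈ Ω, q z ≠ 0 := fun z hz h => hp0 z hz (by rw [← hq z hz, h]; simp)
  have hqn : ∀ z ∈ Ω, ‖q z‖ < 1 := by
    intro z hz
    have h1 := hpn z hz
    rw [← hq z hz, norm_pow] at h1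
    nlinarith [norm_nonneg (q z)]
  have hqd : ∀ z ∈ Ω, HasDerivAt q ((1 - (starRingEnd ℂ) a * a) /
      (1 - (starRingEnd ℂ) a * f z) ^ 2 * deriv f z / (2 * q z)) z := fun z hz =>
    hasDerivAt_of_sq (hqc.continuousAt (hΩ.mem_nhds hz)) (hq0 z hz)
      (Filter.eventually_of_mem (hΩ.mem_nhds hz) hq) (hpd z hz)
  set b := q 0 with hb
  have hbn : ‖b‖ < 1 := hqn 0 h0
  have hgd : ∀ z ∈ Ω, HasDerivAt (fun z => mob b (q z)) ((1 - (starRingEnd ℂ) b * b) /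
      (1 - (starRingEnd ℂ) b * q z) ^ 2 * ((1 - (starRingEnd ℂ) a * a) /
      (1 - (starRingEnd ℂ) a * f z) ^ 2 * deriv f z / (2 * q z))) z := fun z hz =>
    (mob_deriv hbn (hqn z hz)).comp z (hqd z hz)
  refine ⟨fun z => mob b (q z), ⟨?_, ?_, ?_, ?_⟩, ?_⟩
  · intro z hz w hw h
    have h1 := mob_inj hbn (hqn z hz) (hqn w hw) h
    have h2 : p z = p w := by rw [← hq z hz, ← hq w hw, h1]
    exact hf.inj hz hw (mob_inj ha (hf.maps z hz) (hf.maps w hw) h2)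
  · intro z hz
    exact mob_norm hbn (hqn z hz)
  · simp [mob, hb]
  · intro z hz
    rw [(hgd z hz).deriv]
    have h1 := mob_den hbn hbn
    have h2 := mob_den ha ha
    have h3 := mob_den hbn (hqn z hz)
    have h4 := mob_den ha (hf.maps z hz)
    have h5 := hf.der z hz
    have h6 := hq0 z hz
    exact mul_ne_zero (div_ne_zero h1 (pow_ne_zero _ h3)) (div_ne_zero (mul_ne_zero
      (div_ne_zero h2 (pow_ne_zero _ h4)) h5) (mul_ne_zero two_ne_zero h6))
  · rw [(hgd 0 h0).deriv]
    have hcj : ∀ c : ℂ, (starRingEnd ℂ) c * c = ((‖c‖ ^ 2 : ℝ) : ℂ) := fun c => by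
      rw [← Complex.normSq_eq_conj_mul_self, Complex.normSq_eq_norm_sq]
    have hbb : ‖b‖ ^ 2 = ‖a‖ := by
      have := congrArg norm (hq 0 h0)
      simpa [hp, mob, hf.zero] using this
    have hsq : Real.sqrt ‖a‖ = ‖b‖ := by rw [← hbb, Real.sqrt_sq (norm_nonneg _)]
    have hb0 : ‖b‖ ≠ 0 := norm_ne_zero_iff.2 (hq0 0 h0)
    have hcn : ∀ c : ℂ, ‖c‖ < 1 → ‖1 - (starRingEnd ℂ) c * c‖ = 1 - ‖c‖ ^ 2 := by
      intro c hc
      rw [hcj, ← Complex.ofReal_one, ← Complex.ofReal_sub, Complex.norm_real, Real.norm_eq_abs,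
        abs_of_pos]
      nlinarith [norm_nonneg c]
    rw [hsq, ← hb, hf.zero]
    simp only [norm_mul, norm_div, norm_pow, mul_zero, sub_zero, hcn b hbn, hcn a ha]
    simp only [norm_one, one_pow, div_one, Complex.norm_ofNat]
    rw [hbb]
    have h1a : 1 - ‖a‖ ≠ 0 := by linarith
    field_simp
    ring

theorem rmt_approx {Ω : Set ℂ} (hΩ : IsOpen Ω) (h0 : (0:ℂ) ∈ Ω) (hs : SqrtProp Ω)
    (hb : Bornology.IsBounded Ω) {s : ℝ} (hs0 : 0 < s) (hs1 : s < 1) :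
    ∃ f, RClass Ω f ∧ ball 0 s ⊆ f '' Ω := by
  set S : Set ℝ := {m | ∃ f, RClass Ω f ∧ m = ‖deriv f 0‖} with hS
  obtain ⟨ρ, hρ, hρΩ⟩ := Metric.isOpen_iff.1 hΩ 0 h0
  have hbdd : BddAbove S := by
    refine ⟨1 / ρ, ?_⟩
    rintro _ ⟨f, hf, rfl⟩
    refine Complex.norm_deriv_le_div_of_mapsTo_ball (R₁ := ρ) (R₂ := 1) (c := 0) ?_ ?_ hρ
    · exact fun z hz => (hf.diff (hρΩ hz)).differentiableAt.differentiableWithinAt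
    · intro z hz
      rw [hf.zero]
      simpa using (hf.maps z (hρΩ hz)).le
  obtain ⟨R, hR⟩ := hb.subset_ball 0
  have hRp : 0 < R := by simpa using hR h0
  have hne : (1 / R) ∈ S := by
    have hR0 : (R:ℂ) ≠ 0 := by exact_mod_cast hRp.ne'
    have hd : ∀ z : ℂ, HasDerivAt (fun z : ℂ => z / R) (1 / R) z := fun z =>
      (hasDerivAt_id z).div_const _
    refine ⟨fun z => z / R, ⟨?_, ?_, by simp, ?_⟩, ?_⟩
    · intro z _ w _ h
      simpa [hR0] using h
    · intro z hz
      have : ‖z‖ < R := by simpa using hR hz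
      simpa [abs_of_pos hRp, div_lt_one hRp] using this
    · intro z _
      rw [(hd z).deriv]
      simpa using hRp.ne'
    · rw [(hd 0).deriv]
      simp [abs_of_pos hRp]
  have hM : 0 < sSup S := lt_of_lt_of_le (by positivity) (le_csSup hbdd hne)
  set τ := Real.sqrt s
  have hτ0 : 0 < τ := Real.sqrt_pos.2 hs0
  have hτ2 : τ ^ 2 = s := Real.sq_sqrt hs0.le
  have hτ1 : τ < 1 := by nlinarith
  have hlt : sSup S * (2 * τ / (1 + s)) < sSup S := by
    have : 2 * τ / (1 + s) < 1 := by
      rw [div_lt_one (by positivity)]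
      nlinarith
    nlinarith
  obtain ⟨_, ⟨f, hf, rfl⟩, hfM⟩ := exists_lt_of_lt_csSup ⟨_, hne⟩ hlt
  refine ⟨f, hf, ?_⟩
  intro a ha
  by_contra hna
  have ha1 : ‖a‖ < s := by simpa using ha
  obtain ⟨g, hg, hgd⟩ := koebe_step hΩ h0 hs hf (ha1.trans hs1) (fun z hz h => hna ⟨z, hz, h⟩)
  have hgM : ‖deriv g 0‖ ≤ sSup S := le_csSup hbdd ⟨g, hg, rfl⟩
  set t := Real.sqrt ‖a‖
  have ht0 : 0 ≤ t := Real.sqrt_nonneg _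
  have ht2 : t ^ 2 = ‖a‖ := Real.sq_sqrt (norm_nonneg _)
  have htτ : t ≤ τ := Real.sqrt_le_sqrt ha1.le
  have h1 : sSup S * (2 * τ) < ‖deriv f 0‖ * (1 + s) := by
    rw [mul_div_assoc', div_lt_iff₀ (by positivity)] at hfM
    exact hfM
  have h2 : ‖deriv f 0‖ * (1 + ‖a‖) ≤ sSup S * (2 * t) := by
    rw [← hgd]
    exact mul_le_mul_of_nonneg_right hgM (by positivity)
  have h3 : (1 + s) * t ≤ (1 + ‖a‖) * τ := by
    rw [← ht2, ← hτ2]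
    nlinarith [mul_nonneg (sub_nonneg.2 htτ) (by nlinarith : (0:ℝ) ≤ 1 - t * τ)]
  have h4 : ‖deriv f 0‖ * (1 + ‖a‖) * τ ≤ sSup S * (2 * t) * τ :=
    mul_le_mul_of_nonneg_right h2 hτ0.le
  have h5 : ‖deriv f 0‖ * ((1 + s) * t) ≤ ‖deriv f 0‖ * ((1 + ‖a‖) * τ) :=
    mul_le_mul_of_nonneg_left h3 (norm_nonneg _)
  rcases ht0.eq_or_lt with ht | ht
  · rw [← ht] at h2
    have hd := norm_pos_iff.2 (hf.der 0 h0)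
    nlinarith [norm_nonneg a]
  · nlinarith

theorem continuousOn_two_closed {X Y : Type*} [TopologicalSpace X] [TopologicalSpace Y]
    {f : X → Y} {A B S : Set X} (hA : IsClosed A) (hB : IsClosed B) (hS : S ⊆ A ∪ B)
    (h1 : ContinuousOn f (S ∩ A)) (h2 : ContinuousOn f (S ∩ B)) : ContinuousOn f S := by
  have key : ∀ A : Set X, IsClosed A → ContinuousOn f (S ∩ A) → ∀ x ∈ S,
      ContinuousWithinAt f (S ∩ A) x := by
    intro A hA h x hx
    by_cases hxA : x ∈ A
    · exact h x ⟨hx, hxA⟩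
    · refine continuousWithinAt_of_notMem_closure (fun hc => hxA ?_)
      exact hA.closure_subset_iff.2 inter_subset_right hc
  intro x hx
  have := (key A hA h1 x hx).union (key B hB h2 x hx)
  rwa [← inter_union_distrib_left, inter_eq_left.2 hS] at this

/-- the outer domain in the coordinate `w = 1/z` -/
def Om (χ : ℂ → ℂ) (r : ℝ) : Set ℂ := {w | w = 0 ∨ w⁻¹ ∉ χ '' closedBall 0 r}

def plInv (χ : ℂ → ℂ) : ℂ → ℂ := Function.invFunOn χ (closedBall 0 1)

theorem PlDisc.plInv_left {χ : ℂ → ℂ} (h : PlDisc χ) {z : ℂ} (hz : z ∈ closedBall (0:ℂ) 1) :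
    plInv χ (χ z) = z := h.inj.leftInvOn_invFunOn hz

theorem PlDisc.plInv_cont {χ : ℂ → ℂ} (h : PlDisc χ) :
    ContinuousOn (plInv χ) (χ '' closedBall 0 1) :=
  invFunOn_continuousOn (isCompact_closedBall 0 1) h.cont h.inj

theorem PlDisc.isOpen_image {χ : ℂ → ℂ} (h : PlDisc χ) {U : Set ℂ} (hU : IsOpen U)
    (hU1 : U ⊆ ball 0 1) : IsOpen (χ '' U) := by
  have h1 : ContinuousOn (plInv χ) (χ '' ball 0 1) :=
    h.plInv_cont.mono (image_mono ball_subset_closedBall)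
  have h2 := h1.isOpen_inter_preimage h.opn hU
  convert h2 using 1
  ext y
  constructor
  · rintro ⟨x, hx, rfl⟩
    refine ⟨⟨x, hU1 hx, rfl⟩, ?_⟩
    rwa [mem_preimage, h.plInv_left (ball_subset_closedBall (hU1 hx))]
  · rintro ⟨⟨x, hx, rfl⟩, hx2⟩
    rw [mem_preimage, h.plInv_left (ball_subset_closedBall hx)] at hx2
    exact ⟨x, hx2, rfl⟩

theorem PlDisc.isOpen_Om {χ : ℂ → ℂ} (h : PlDisc χ) {r : ℝ} (hr : r ≤ 1) : IsOpen (Om χ r) := by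
  have hK : IsCompact (χ '' closedBall 0 r) := (isCompact_closedBall 0 r).image_of_continuousOn
    (h.cont.mono (closedBall_subset_closedBall hr))
  rw [isOpen_iff_mem_nhds]
  intro w hw
  by_cases hw0 : w = 0
  · subst hw0
    obtain ⟨R, hR⟩ := hK.isBounded.subset_ball 0
    filter_upwards [ball_mem_nhds (0:ℂ) (show (0:ℝ) < (|R| + 1)⁻¹ by positivity)] with y hy
    by_cases hy0 : y = 0
    · exact Or.inl hy0
    · refine Or.inr (fun hyK => ?_)
      have h1 : ‖y⁻¹‖ < R := by simpa using hR hyK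
      have h2 : ‖y‖ < (|R| + 1)⁻¹ := by simpa using hy
      have h3 : |R| + 1 < ‖y‖⁻¹ := by
        rw [lt_inv_comm₀ (by positivity) (norm_pos_iff.2 hy0)]
        exact h2
      rw [norm_inv] at h1
      linarith [le_abs_self R]
  · have h1 : w⁻¹ ∈ (χ '' closedBall 0 r)ᶜ := hw.resolve_left hw0
    filter_upwards [(continuousAt_inv₀ hw0).preimage_mem_nhds
      (hK.isClosed.isOpen_compl.mem_nhds h1)] with y hy
    exact Or.inr hy

theorem Om_anti {χ : ℂ → ℂ} {r s : ℝ} (hrs : r ≤ s) : Om χ s ⊆ Om χ r := by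
  rintro w (hw | hw)
  · exact Or.inl hw
  · exact Or.inr (fun hh => hw (image_mono (closedBall_subset_closedBall hrs) hh))

theorem PlDisc.Om_bdd {χ : ℂ → ℂ} (h : PlDisc χ) {r : ℝ} (hr0 : 0 < r) (hr : r ≤ 1) :
    ∃ R, 0 < R ∧ ∀ w ∈ Om χ r, ‖w‖ < R := by
  have ho : IsOpen (χ '' ball 0 r) := h.isOpen_image isOpen_ball (ball_subset_ball hr)
  obtain ⟨ρ, hρ, hb⟩ := Metric.isOpen_iff.1 ho 0 ⟨0, by simpa using hr0, h.zero⟩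
  refine ⟨ρ⁻¹ + 1, by positivity, ?_⟩
  rintro w (rfl | hw)
  · simp; positivity
  · by_contra hlt
    push Not at hlt
    apply hw
    have : w⁻¹ ∈ ball (0:ℂ) ρ := by
      have h1 : ρ⁻¹ < ‖w‖ := by linarith
      simp only [mem_ball, dist_zero_right, norm_inv]
      rwa [inv_lt_comm₀ (lt_trans (by positivity) h1) hρ]
    exact image_mono ball_subset_closedBall (hb this)

/-- conjugate a map of the disc, extended by the identity, in the coordinate `1/z` -/
def plConj (χ : ℂ → ℂ) (m : ℂ → ℂ) : ℂ → ℂ := by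
  classical exact fun w => if w ∈ Om χ 1 then w else (χ (m (plInv χ w⁻¹)))⁻¹

theorem plConj_out {χ : ℂ → ℂ} {m : ℂ → ℂ} {w : ℂ} (hw : w ∈ Om χ 1) : plConj χ m w = w := by
  simp [plConj, hw]

theorem plConj_in {χ : ℂ → ℂ} {m : ℂ → ℂ} {w : ℂ} (hw : w ∉ Om χ 1) :
    plConj χ m w = (χ (m (plInv χ w⁻¹)))⁻¹ := by
  simp [plConj, hw]

theorem PlDisc.Om_compl {χ : ℂ → ℂ} (h : PlDisc χ) {r : ℝ} (hr0 : 0 ≤ r) (hr1 : r ≤ 1) {w : ℂ} :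
    w ∉ Om χ r ↔ w ≠ 0 ∧ ∃ z, z ≠ 0 ∧ ‖z‖ ≤ r ∧ w⁻¹ = χ z := by
  simp only [Om, mem_setOf_eq, not_or, not_not]
  constructor
  · rintro ⟨h0, z, hz, hzw⟩
    refine ⟨h0, z, ?_, by simpa using hz, hzw.symm⟩
    rintro rfl
    rw [h.zero] at hzw
    exact h0 (inv_eq_zero.1 hzw.symm)
  · rintro ⟨h0, z, -, hz, hzw⟩
    exact ⟨h0, z, by simpa using hz, hzw.symm⟩

theorem PlDisc.ne_zero {χ : ℂ → ℂ} (h : PlDisc χ) {z : ℂ} (hz : ‖z‖ ≤ 1) (hz0 : z ≠ 0) :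
    χ z ≠ 0 := by
  intro hh
  rw [← h.zero] at hh
  exact hz0 (h.inj (by simpa using hz) (by simp) hh)

theorem PlDisc.Om_mem_of {χ : ℂ → ℂ} (h : PlDisc χ) {r : ℝ} (hr1 : r ≤ 1) {z : ℂ}
    (hz : ‖z‖ ≤ 1) : (χ z)⁻¹ ∈ Om χ r ↔ z = 0 ∨ r < ‖z‖ := by
  constructor
  · rintro (h1 | h1)
    · left
      by_contra h0
      exact h.ne_zero hz h0 (inv_eq_zero.1 h1)
    · right
      by_contra hlt
      rw [inv_inv] at h1
      exact h1 ⟨z, by simpa using hlt, rfl⟩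
  · rintro (rfl | h1)
    · left; simp [h.zero]
    · right
      rw [inv_inv]
      rintro ⟨z', hz', hzz⟩
      have h2 := h.inj (closedBall_subset_closedBall hr1 hz') (by simpa using hz) hzz
      subst h2
      simp at hz'
      linarith

theorem PlDisc.plConj_cont {χ : ℂ → ℂ} (h : PlDisc χ) {m : ℂ → ℂ} {A S : Set ℂ}
    (hm : ContinuousOn m A) (hmD : ∀ z ∈ A, ‖m z‖ ≤ 1 ∧ m z ≠ 0) (hm1 : ∀ z, ‖z‖ = 1 → m z = z)
    (hSA : ∀ z, z ≠ 0 → ‖z‖ ≤ 1 → (χ z)⁻¹ ∈ S → z ∈ A) : ContinuousOn (plConj χ m) S := by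
  have hO : IsOpen {w : ℂ | w ≠ 0 ∧ w⁻¹ ∈ χ '' ball 0 1} := by
    have : ContinuousOn (fun w : ℂ => w⁻¹) {0}ᶜ := continuousOn_inv₀
    exact this.isOpen_inter_preimage isOpen_compl_singleton h.opn
  refine continuousOn_two_closed (h.isOpen_Om le_rfl).isClosed_compl hO.isClosed_compl ?_ ?_ ?_
  · intro w _
    by_cases hw : w ∈ Om χ 1
    · right
      rintro ⟨h0, h1⟩
      rcases hw with hw | hw
      · exact h0 hw
      · exact hw (image_mono ball_subset_closedBall h1)
    · exact Or.inl hw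
  · have key : ContinuousOn (fun w => (χ (m (plInv χ w⁻¹)))⁻¹) (S ∩ (Om χ 1)ᶜ) := by
      have hA : MapsTo (fun w => plInv χ w⁻¹) (S ∩ (Om χ 1)ᶜ) A := by
        rintro w ⟨hwS, hw⟩
        obtain ⟨h0, z, hz0, hz, hzw⟩ := (h.Om_compl zero_le_one le_rfl).1 hw
        simp only [hzw, h.plInv_left (show z ∈ closedBall (0:ℂ) 1 by simpa using hz)]
        refine hSA z hz0 hz ?_
        rwa [← hzw, inv_inv]
      have c1 : ContinuousOn (fun w => plInv χ w⁻¹) (S ∩ (Om χ 1)ᶜ) := by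
        refine h.plInv_cont.comp (continuousOn_inv₀.mono ?_) ?_
        · rintro w ⟨-, hw⟩
          exact ((h.Om_compl zero_le_one le_rfl).1 hw).1
        · rintro w ⟨-, hw⟩
          obtain ⟨h0, z, hz0, hz, hzw⟩ := (h.Om_compl zero_le_one le_rfl).1 hw
          exact ⟨z, by simpa using hz, hzw.symm⟩
      have c2 : ContinuousOn (fun w => m (plInv χ w⁻¹)) (S ∩ (Om χ 1)ᶜ) := hm.comp c1 hA
      have c3 : ContinuousOn (fun w => χ (m (plInv χ w⁻¹))) (S ∩ (Om χ 1)ᶜ) :=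
        h.cont.comp c2 (fun w hw => by simpa using (hmD _ (hA hw)).1)
      refine c3.inv₀ (fun w hw => ?_)
      exact h.ne_zero (hmD _ (hA hw)).1 (hmD _ (hA hw)).2
    exact key.congr (fun w hw => plConj_in hw.2)
  · refine (continuousOn_id).congr (fun w hw => ?_)
    by_cases hwO : w ∈ Om χ 1
    · exact plConj_out hwO
    · obtain ⟨h0, z, hz0, hz, hzw⟩ := (h.Om_compl zero_le_one le_rfl).1 hwO
      have hz1 : ‖z‖ = 1 := by
        by_contra hne
        exact hw.2 ⟨h0, z, by simpa using lt_of_le_of_ne hz hne, hzw.symm⟩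
      rw [plConj_in hwO, hzw, h.plInv_left (by simp [hz1]), hm1 z hz1, ← hzw, inv_inv]
      rfl

theorem PlDisc.plConj_inv {χ : ℂ → ℂ} (h : PlDisc χ) {m : ℂ → ℂ} {z : ℂ} (hz : ‖z‖ ≤ 1)
    (hz0 : z ≠ 0) : plConj χ m (χ z)⁻¹ = (χ (m z))⁻¹ := by
  have : (χ z)⁻¹ ∉ Om χ 1 := by
    rw [h.Om_mem_of le_rfl hz]
    push Not
    exact ⟨hz0, hz⟩
  rw [plConj_in this, inv_inv, h.plInv_left (by simpa using hz)]

theorem PlDisc.Om_sqrt {χ : ℂ → ℂ} (h : PlDisc χ) {r : ℝ} (hr0 : 0 < r) (hr1 : r < 1) :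
    SqrtProp (Om χ r) := by
  set push : ℂ → ℂ := fun z => z * (((‖z‖ - r) / ((1 - r) * ‖z‖) : ℝ) : ℂ) with hpush
  set pull : ℂ → ℂ := fun z => z * (((r + (1 - r) * ‖z‖) / ‖z‖ : ℝ) : ℂ) with hpull
  have h1r : 0 < 1 - r := by linarith
  have npush : ∀ z : ℂ, r < ‖z‖ → ‖push z‖ = (‖z‖ - r) / (1 - r) := by
    intro z hz
    have : 0 < ‖z‖ := by linarith
    simp only [hpush, norm_mul, Complex.norm_real, Real.norm_eq_abs]
    rw [abs_of_pos (div_pos (by linarith) (by positivity))]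
    field_simp
  have npull : ∀ z : ℂ, z ≠ 0 → ‖pull z‖ = r + (1 - r) * ‖z‖ := by
    intro z hz
    have : 0 < ‖z‖ := norm_pos_iff.2 hz
    simp only [hpull, norm_mul, Complex.norm_real, Real.norm_eq_abs]
    rw [abs_of_pos (by positivity)]
    field_simp
  intro p hp hp0
  obtain ⟨u, hu, hu'⟩ := pl_log_of_retract (S := Om χ r) (plConj χ push) (plConj χ pull)
    (by
      refine h.plConj_cont (A := {z | r < ‖z‖ ∧ ‖z‖ ≤ 1}) ?_ ?_ ?_ ?_
      · refine continuousOn_id.mul (Complex.continuous_ofReal.comp_continuousOn ?_)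
        refine ContinuousOn.div (by fun_prop) (by fun_prop) ?_
        rintro z ⟨hz, -⟩
        have : 0 < ‖z‖ := by linarith
        positivity
      · rintro z ⟨hz, hz1⟩
        have h1 := npush z hz
        have h2 : 0 < ‖push z‖ := by rw [h1]; exact div_pos (by linarith) h1r
        refine ⟨?_, norm_pos_iff.1 h2⟩
        rw [h1, div_le_one h1r]
        linarith
      · intro z hz
        simp only [hpush, hz]
        rw [mul_one, div_self h1r.ne']
        simp
      · intro z hz0 hz hzS
        rw [h.Om_mem_of hr1.le hz] at hzS
        exact ⟨hzS.resolve_left hz0, hz⟩)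
    (by
      rw [← continuousOn_univ]
      refine h.plConj_cont (A := {z | z ≠ 0 ∧ ‖z‖ ≤ 1}) ?_ ?_ ?_ ?_
      · refine continuousOn_id.mul (Complex.continuous_ofReal.comp_continuousOn ?_)
        refine ContinuousOn.div (by fun_prop) (by fun_prop) ?_
        rintro z ⟨hz, -⟩
        exact norm_ne_zero_iff.2 hz
      · rintro z ⟨hz, hz1⟩
        have h1 := npull z hz
        have h2 : 0 < ‖pull z‖ := by rw [h1]; positivity
        refine ⟨?_, norm_pos_iff.1 h2⟩
        rw [h1]
        nlinarith
      · intro z hz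
        simp only [hpull, hz]
        norm_num
      · intro z hz0 hz _
        exact ⟨hz0, hz⟩)
    (by
      intro w
      by_cases hw : w ∈ Om χ 1
      · rw [plConj_out hw]
        exact Om_anti hr1.le hw
      · obtain ⟨h0, z, hz0, hz, hzw⟩ := (h.Om_compl zero_le_one le_rfl).1 hw
        have hw' : w = (χ z)⁻¹ := by rw [← hzw, inv_inv]
        rw [hw', h.plConj_inv hz hz0]
        have hn := npull z hz0
        have hpos := norm_pos_iff.2 hz0
        rw [h.Om_mem_of hr1.le (by rw [hn]; nlinarith), hn]
        right
        nlinarith)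
    (by
      intro w hwr
      by_cases hw : w ∈ Om χ 1
      · rw [plConj_out hw, plConj_out hw]
      · obtain ⟨h0, z, hz0, hz, hzw⟩ := (h.Om_compl zero_le_one le_rfl).1 hw
        have hw' : w = (χ z)⁻¹ := by rw [← hzw, inv_inv]
        rw [hw', h.Om_mem_of hr1.le hz] at hwr
        have hrz : r < ‖z‖ := hwr.resolve_left hz0
        have hn := npush z hrz
        have hpz : 0 < ‖push z‖ := by rw [hn]; exact div_pos (by linarith) h1r
        rw [hw', h.plConj_inv hz hz0, h.plConj_inv (by rw [hn, div_le_one h1r]; linarith)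
          (norm_pos_iff.1 hpz)]
        congr 2
        simp only [hpull]
        rw [hn]
        simp only [hpush]
        have hzpos : 0 < ‖z‖ := by linarith
        have hzr : ‖z‖ - r ≠ 0 := by linarith
        rw [mul_assoc, ← Complex.ofReal_mul]
        have : (‖z‖ - r) / ((1 - r) * ‖z‖) *
            ((r + (1 - r) * ((‖z‖ - r) / (1 - r))) / ((‖z‖ - r) / (1 - r))) = 1 := by
          field_simp
          ring
        rw [this]
        simp)
    p hp hp0
  refine ⟨fun z => Complex.exp (u z / 2), by fun_prop, fun z hz => ?_⟩
  rw [← Complex.exp_nat_mul, ← hu' z hz]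
  congr 1
  push_cast
  ring

theorem montel_ultra (𝒰 : Ultrafilter ℕ) (F : ℕ → ℂ → ℂ) (U : Set ℂ) (R : ℝ) (hR : 0 < R)
    (hU : ∀ z ∈ U, ∃ ρ > 0, ball z ρ ⊆ U ∧ ∀ᶠ n in (𝒰 : Filter ℕ), DifferentiableOn ℂ (F n) (ball z ρ) ∧
      ∀ w ∈ ball z ρ, ‖F n w‖ < R) :
    ∃ f : ℂ → ℂ, DifferentiableOn ℂ f U ∧ TendstoLocallyUniformlyOn F f 𝒰 U := by
  have hlim : ∀ z : ℂ, ∃ l : ℂ, z ∈ U → Filter.Tendsto (fun n => F n z) 𝒰 (𝓝 l) := by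
    intro z
    by_cases hz : z ∈ U
    · obtain ⟨ρ, hρ, -, hev⟩ := hU z hz
      have hK : IsCompact (closedBall (0:ℂ) R) := isCompact_closedBall 0 R
      obtain ⟨l, -, hl⟩ := hK.ultrafilter_le_nhds (𝒰.map (fun n => F n z)) (by
        rw [Filter.le_principal_iff]
        show ∀ᶠ n in (𝒰 : Filter ℕ), F n z ∈ closedBall (0:ℂ) R
        filter_upwards [hev] with n hn
        simpa using (hn.2 z (mem_ball_self hρ)).le)
      exact ⟨l, fun _ => hl⟩
    · exact ⟨0, fun h => absurd h hz⟩
  choose f hf using hlim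
  have hloc : TendstoLocallyUniformlyOn F f 𝒰 U := by
    rw [Metric.tendstoLocallyUniformlyOn_iff]
    intro ε hε z hz
    obtain ⟨ρ, hρ, hρU, hev⟩ := hU z hz
    set η := min (ρ / 2) (ε * ρ / (8 * R)) / 2 with hη
    have hη0 : 0 < η := by positivity
    have hη1 : η < ρ / 2 := by
      have := min_le_left (ρ / 2) (ε * ρ / (8 * R))
      rw [hη]; linarith
    have hη2 : 2 * R / ρ * η ≤ ε / 8 := by
      have h1 : η ≤ ε * ρ / (8 * R) / 2 := by
        rw [hη]; gcongr; exact min_le_right _ _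
      calc 2 * R / ρ * η ≤ 2 * R / ρ * (ε * ρ / (8 * R) / 2) := by gcongr
        _ = ε / 8 := by field_simp
    have hlip : ∀ᶠ n in (𝒰 : Filter ℕ), ∀ w ∈ ball z η, dist (F n w) (F n z) ≤ ε / 8 := by
      filter_upwards [hev] with n hn w hw
      have h1 : dist (F n w) (F n z) ≤ 2 * R / ρ * dist w z := by
        refine Complex.dist_le_div_mul_dist_of_mapsTo_ball hn.1 ?_ (ball_subset_ball (by linarith) hw)
        intro y hy
        have h1 := hn.2 y hy
        have h2 := hn.2 z (mem_ball_self hρ)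
        rw [mem_closedBall, dist_eq_norm]
        have := norm_sub_le (F n y) (F n z)
        linarith
      have h2 : dist w z < η := hw
      calc dist (F n w) (F n z) ≤ 2 * R / ρ * dist w z := h1
        _ ≤ 2 * R / ρ * η := by gcongr
        _ ≤ ε / 8 := hη2
    refine ⟨ball z η, mem_nhdsWithin_of_mem_nhds (ball_mem_nhds z hη0), ?_⟩
    have hz1 : ∀ᶠ n in (𝒰 : Filter ℕ), dist (F n z) (f z) < ε / 8 :=
      (Metric.tendsto_nhds.1 (hf z hz)) (ε / 8) (by positivity)
    filter_upwards [hlip, hz1] with n hn hnz w hw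
    have hwU : w ∈ U := hρU (ball_subset_ball (by linarith) hw)
    have hfw : dist (f w) (f z) ≤ ε / 8 := by
      refine le_of_tendsto ((hf w hwU).dist (hf z hz)) ?_
      filter_upwards [hlip] with m hm using hm w hw
    have h1 := hn w hw
    calc dist (f w) (F n w) ≤ dist (f w) (f z) + dist (f z) (F n z) + dist (F n z) (F n w) :=
          dist_triangle4 _ _ _ _
      _ < ε := by rw [dist_comm (f z), dist_comm (F n z) (F n w)]; linarith
  refine ⟨f, ?_, hloc⟩
  intro z hz
  obtain ⟨ρ, hρ, hρU, hev⟩ := hU z hz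
  have h1 : DifferentiableOn ℂ f (ball z ρ) :=
    (hloc.mono hρU).differentiableOn (hev.mono fun n hn => hn.1) isOpen_ball
  exact (h1.differentiableAt (ball_mem_nhds z hρ)).differentiableWithinAt

theorem PlDisc.Om_preconnected {χ : ℂ → ℂ} (h : PlDisc χ) : IsPreconnected (Om χ 1) := by
  have h0K : (0:ℂ) ∈ χ '' closedBall 0 1 := ⟨0, by simp, h.zero⟩
  have h1 : IsPreconnected ((fun z : ℂ => z⁻¹) '' (χ '' closedBall 0 1)ᶜ) := by
    refine h.compl_preconnected.image _ (continuousOn_inv₀.mono ?_)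
    intro z hz h0
    have : z = 0 := h0
    exact hz (this ▸ h0K)
  refine h1.subset_closure ?_ ?_
  · rintro _ ⟨z, hz, rfl⟩
    right
    simpa using hz
  · rintro w (rfl | hw)
    · rw [Metric.mem_closure_iff]
      intro ε hε
      obtain ⟨ρ, hρ, hb⟩ := Metric.isOpen_iff.1 (h.isOpen_Om le_rfl) 0 (Or.inl rfl)
      set t := min ε ρ / 2
      have ht0 : 0 < t := by positivity
      have ht1 : t < ε := by have := min_le_left ε ρ; simp only [t]; linarith
      have ht2 : t < ρ := by have := min_le_right ε ρ; simp only [t]; linarith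
      refine ⟨(t : ℂ), ?_, by simpa [abs_of_pos ht0] using ht1⟩
      have h2 : (t:ℂ) ∈ Om χ 1 := hb (by simpa [abs_of_pos ht0] using ht2)
      rcases h2 with h2 | h2
      · exact absurd h2 (by exact_mod_cast ht0.ne')
      · exact ⟨_, h2, by simp⟩
    · exact subset_closure ⟨w⁻¹, hw, by simp⟩

theorem RClass.inv_deriv {Ω : Set ℂ} (hΩ : IsOpen Ω) {f : ℂ → ℂ} (hf : RClass Ω f) {z : ℂ}
    (hz : z ∈ Ω) : DifferentiableAt ℂ (Function.invFunOn f Ω) (f z) := by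
  have h1 : DifferentiableOn ℂ f Ω := fun x hx =>
    (hf.diff hx).differentiableAt.differentiableWithinAt
  have h2 : HasStrictDerivAt f (deriv f z) z := (h1.analyticAt (hΩ.mem_nhds hz)).hasStrictDerivAt
  have h3 := h2.to_local_left_inverse (hf.der z hz) (g := Function.invFunOn f Ω) (by
    filter_upwards [hΩ.mem_nhds hz] with x hx using hf.inj.leftInvOn_invFunOn hx)
  exact h3.hasDerivAt.differentiableAt

structure RMap (χ f ψ : ℂ → ℂ) : Prop where
  df : DifferentiableOn ℂ f (Om χ 1)
  dψ : DifferentiableOn ℂ ψ (ball 0 1)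
  mf : ∀ z ∈ Om χ 1, f z ∈ ball (0:ℂ) 1
  mψ : ∀ w ∈ ball (0:ℂ) 1, ψ w ∈ Om χ 1
  left : ∀ z ∈ Om χ 1, ψ (f z) = z
  right : ∀ w ∈ ball (0:ℂ) 1, f (ψ w) = w
  zero : ψ 0 = 0

theorem PlDisc.riemann {χ : ℂ → ℂ} (h : PlDisc χ) : ∃ f ψ, RMap χ f ψ := by
  set r : ℕ → ℝ := fun n => 1 - 1 / ((n:ℝ) + 2) with hr
  have hr0 : ∀ n, 1 / 2 ≤ r n := by
    intro n
    have : 1 / ((n:ℝ) + 2) ≤ 1 / 2 := one_div_le_one_div_of_le (by norm_num) (by linarith [n.cast_nonneg (α := ℝ)])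
    simp only [hr]; linarith
  have hr1 : ∀ n, r n < 1 := fun n => by
    have : 0 < 1 / ((n:ℝ) + 2) := by positivity
    simp only [hr]; linarith
  set 𝒰 : Ultrafilter ℕ := Filter.hyperfilter ℕ
  have h𝒰 : (𝒰 : Filter ℕ) ≤ Filter.atTop := by
    rw [← Nat.cofinite_eq_atTop]; exact Filter.hyperfilter_le_cofinite
  have hrt : Filter.Tendsto r 𝒰 (𝓝 1) := by
    refine Filter.Tendsto.mono_left ?_ h𝒰
    have h1 : Filter.Tendsto (fun n : ℕ => 1 / ((n:ℝ) + 2)) Filter.atTop (𝓝 0) :=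
      tendsto_const_nhds.div_atTop
        (Filter.tendsto_atTop_add_const_right _ _ tendsto_natCast_atTop_atTop)
    have h2 := h1.const_sub 1
    rw [sub_zero] at h2
    exact h2
  have hrgt : ∀ t < 1, ∀ᶠ n in (𝒰 : Filter ℕ), t < r n := fun t ht => hrt.eventually_const_lt ht
  have hrp : ∀ n, 0 < r n := fun n => by linarith [hr0 n]
  have hopen : ∀ n, IsOpen (Om χ (r n)) := fun n => h.isOpen_Om (hr1 n).le
  obtain ⟨R, hR0, hR⟩ := h.Om_bdd (r := 1 / 2) (by norm_num) (by norm_num)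
  have hRn : ∀ n, ∀ w ∈ Om χ (r n), ‖w‖ < R := fun n w hw => hR w (Om_anti (hr0 n) hw)
  have hex : ∀ n, ∃ f, RClass (Om χ (r n)) f ∧ ball 0 (r n) ⊆ f '' Om χ (r n) := fun n =>
    rmt_approx (hopen n) (Or.inl rfl) (h.Om_sqrt (hrp n) (hr1 n))
      (isBounded_ball.subset (fun w hw => by simpa using hRn n w hw : _ ⊆ ball (0:ℂ) R))
      (hrp n) (hr1 n)
  choose F hF hFim using hex
  set P : ℕ → ℂ → ℂ := fun n => Function.invFunOn (F n) (Om χ (r n)) with hP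
  have hPl : ∀ n, ∀ z ∈ Om χ (r n), P n (F n z) = z := fun n z hz =>
    (hF n).inj.leftInvOn_invFunOn hz
  have hPm : ∀ n, ∀ w ∈ ball (0:ℂ) (r n), P n w ∈ Om χ (r n) ∧ F n (P n w) = w := by
    intro n w hw
    obtain ⟨z, hz, rfl⟩ := hFim n hw
    rw [hPl n z hz]
    exact ⟨hz, rfl⟩
  have hOm1 : IsOpen (Om χ 1) := h.isOpen_Om le_rfl
  have hsub : ∀ n, Om χ 1 ⊆ Om χ (r n) := fun n => Om_anti (hr1 n).le
  obtain ⟨f, hfd, hft⟩ := montel_ultra 𝒰 F (Om χ 1) 1 one_pos (by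
    intro z hz
    obtain ⟨ρ, hρ, hb⟩ := Metric.isOpen_iff.1 hOm1 z hz
    refine ⟨ρ, hρ, hb, Filter.Eventually.of_forall fun n => ⟨?_, ?_⟩⟩
    · exact fun w hw => ((hF n).diff (hsub n (hb hw))).differentiableAt.differentiableWithinAt
    · exact fun w hw => (hF n).maps w (hsub n (hb hw)))
  obtain ⟨ψ, hψd, hψt⟩ := montel_ultra 𝒰 P (ball 0 1) R hR0 (by
    intro z hz
    have hz' : ‖z‖ < 1 := by simpa using hz
    have hsb : ball z ((1 - ‖z‖) / 2) ⊆ ball 0 ((1 + ‖z‖) / 2) := by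
      intro w hw
      rw [mem_ball, dist_eq_norm] at hw
      have := norm_le_norm_add_norm_sub' w z
      rw [mem_ball, dist_zero_right]
      linarith
    refine ⟨(1 - ‖z‖) / 2, by linarith, hsb.trans (ball_subset_ball (by linarith)), ?_⟩
    filter_upwards [hrgt ((1 + ‖z‖) / 2) (by linarith)] with n hn
    refine ⟨fun w hw => ?_, fun w hw => ?_⟩
    · have hw' : w ∈ ball (0:ℂ) (r n) := ball_subset_ball hn.le (hsb hw)
      have h1 := (hF n).inv_deriv (hopen n) (hPm n w hw').1
      rw [(hPm n w hw').2] at h1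
      exact h1.differentiableWithinAt
    · exact hRn n _ (hPm n w (ball_subset_ball hn.le (hsb hw))).1)
  have hfpt : ∀ z ∈ Om χ 1, Filter.Tendsto (fun n => F n z) 𝒰 (𝓝 (f z)) := fun z hz =>
    hft.tendsto_at hz
  have hψpt : ∀ z ∈ ball (0:ℂ) 1, Filter.Tendsto (fun n => P n z) 𝒰 (𝓝 (ψ z)) := fun z hz =>
    hψt.tendsto_at hz
  have h0Om : (0:ℂ) ∈ Om χ 1 := Or.inl rfl
  have hf0 : f 0 = 0 := by
    refine tendsto_nhds_unique (hfpt 0 h0Om) ?_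
    simp only [(hF _).zero]
    exact tendsto_const_nhds
  have hf1 : ∀ z ∈ Om χ 1, ‖f z‖ ≤ 1 := fun z hz =>
    le_of_tendsto (hfpt z hz).norm (Filter.Eventually.of_forall fun n =>
      ((hF n).maps z (hsub n hz)).le)
  have hfm : ∀ z ∈ Om χ 1, f z ∈ ball (0:ℂ) 1 := by
    intro z hz
    rw [mem_ball, dist_zero_right]
    refine lt_of_le_of_ne (hf1 z hz) (fun heq => ?_)
    have hmax : IsMaxOn (norm ∘ f) (Om χ 1) z := fun w hw => by
      show ‖f w‖ ≤ ‖f z‖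
      rw [heq]; exact hf1 w hw
    have := Complex.norm_eqOn_of_isPreconnected_of_isMaxOn h.Om_preconnected hOm1 hfd hz hmax h0Om
    simp [hf0, heq] at this
  have hleft : ∀ z ∈ Om χ 1, ψ (f z) = z := by
    intro z hz
    have hb := hfm z hz
    have h1 : Filter.Tendsto (fun n => F n z) 𝒰 (𝓝[ball 0 1] (f z)) :=
      tendsto_nhdsWithin_iff.2 ⟨hfpt z hz, Filter.Eventually.of_forall fun n => by
        simpa using (hF n).maps z (hsub n hz)⟩
    have h2 := hψt.tendsto_comp (hψd.continuousOn _ hb) hb h1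
    refine tendsto_nhds_unique h2 ?_
    have : (fun n => P n (F n z)) = fun _ => z := funext fun n => hPl n z (hsub n hz)
    rw [this]
    exact tendsto_const_nhds
  -- image of ψ misses the inside
  have hmiss : ∀ w ∈ ball (0:ℂ) 1, ∀ z : ℂ, ‖z‖ < 1 → z ≠ 0 → ψ w ≠ (χ z)⁻¹ := by
    intro w hw z hz hz0 heq
    obtain ⟨t, ht1, ht2⟩ := exists_between hz
    have hO : IsOpen {x : ℂ | x ≠ 0 ∧ x⁻¹ ∈ χ '' ball 0 t} :=
      (continuousOn_inv₀ (G₀ := ℂ)).isOpen_inter_preimage isOpen_compl_singleton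
        (h.isOpen_image isOpen_ball (ball_subset_ball ht2.le))
    have hmem : ψ w ∈ {x : ℂ | x ≠ 0 ∧ x⁻¹ ∈ χ '' ball 0 t} := by
      rw [heq]
      exact ⟨inv_ne_zero (h.ne_zero hz.le hz0), by rw [inv_inv]; exact ⟨z, by simpa using ht1, rfl⟩⟩
    have hwn : ‖w‖ < 1 := by simpa using hw
    obtain ⟨n, hn1, hn2, hn3⟩ := ((((hψpt w hw).eventually (hO.mem_nhds hmem)).and
      ((hrgt t ht2).and (hrgt ‖w‖ hwn))).exists)
    have h1 := (hPm n w (by simpa using hn3)).1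
    rcases h1 with h1 | h1
    · exact hn1.1 h1
    · exact h1 (image_mono (ball_subset_closedBall.trans (closedBall_subset_closedBall hn2.le)) hn1.2)
  have hψopen : IsOpen (ψ '' ball 0 1) := by
    have han : AnalyticOnNhd ℂ ψ (ball 0 1) := hψd.analyticOnNhd isOpen_ball
    rcases han.is_constant_or_isOpen (convex_ball _ _).isPreconnected with ⟨c, hc⟩ | hop
    · exfalso
      have hall : ∀ z ∈ Om χ 1, z = c := fun z hz => by rw [← hleft z hz, hc _ (hfm z hz)]
      have : Om χ 1 ⊆ {c} := hall
      obtain ⟨ρ, hρ, hb⟩ := Metric.isOpen_iff.1 hOm1 0 h0Om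
      have h1 := hall ((ρ / 2 : ℝ) : ℂ) (hb (by simp [abs_of_pos hρ]; exact hρ))
      rw [← hall 0 h0Om] at h1
      have h2 : ρ / 2 = 0 := by exact_mod_cast h1
      linarith
    · exact hop _ Subset.rfl isOpen_ball
  have hψm : ∀ w ∈ ball (0:ℂ) 1, ψ w ∈ Om χ 1 := by
    intro w hw
    by_contra hout
    obtain ⟨h0, z, hz0, hz, hzw⟩ := (h.Om_compl zero_le_one le_rfl).1 hout
    have hψw : ψ w = (χ z)⁻¹ := by rw [← hzw, inv_inv]
    have ht : Filter.Tendsto (fun t : ℝ => (χ (t * z))⁻¹) (𝓝[<] 1) (𝓝 (χ z)⁻¹) := by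
      refine Filter.Tendsto.inv₀ ?_ (h.ne_zero hz hz0)
      have hc : ContinuousWithinAt χ (closedBall 0 1) z := h.cont z (by simpa using hz)
      refine hc.tendsto.comp (tendsto_nhdsWithin_iff.2 ⟨?_, ?_⟩)
      · have : Continuous fun t : ℝ => (t:ℂ) * z := by fun_prop
        have h1 := (this.tendsto 1).mono_left (nhdsWithin_le_nhds (s := Iio 1))
        simpa using h1
      · filter_upwards [Ioo_mem_nhdsLT (show (0:ℝ) < 1 by norm_num)] with t ht
        simp only [mem_closedBall, dist_zero_right, norm_mul, Complex.norm_real, Real.norm_eq_abs,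
          abs_of_pos ht.1]
        nlinarith [ht.1, ht.2, norm_nonneg z]
    have hev := ht.eventually (hψopen.mem_nhds (hψw ▸ ⟨w, hw, rfl⟩ : (χ z)⁻¹ ∈ ψ '' ball 0 1))
    obtain ⟨t, ⟨w', hw', hw'e⟩, ht0, ht1⟩ :=
      (hev.and (Ioo_mem_nhdsLT (show (0:ℝ) < 1 by norm_num))).exists
    refine hmiss w' hw' (t * z) ?_ (mul_ne_zero (by exact_mod_cast ht0.ne') hz0) hw'e
    simp only [norm_mul, Complex.norm_real, Real.norm_eq_abs, abs_of_pos ht0]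
    nlinarith [norm_nonneg z]
  refine ⟨f, ψ, hfd, hψd, hfm, hψm, hleft, ?_, ?_⟩
  · intro w hw
    have hwn : ‖w‖ < 1 := by simpa using hw
    have h1 : Filter.Tendsto (fun n => P n w) 𝒰 (𝓝[Om χ 1] (ψ w)) :=
      tendsto_nhdsWithin_iff.2 ⟨hψpt w hw, (hψpt w hw).eventually (hOm1.mem_nhds (hψm w hw))⟩
    have h2 := hft.tendsto_comp (hfd.continuousOn _ (hψm w hw)) (hψm w hw) h1
    refine tendsto_nhds_unique h2 ?_
    refine tendsto_const_nhds.congr' ?_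
    filter_upwards [hrgt ‖w‖ hwn] with n hn
    exact ((hPm n w (by simpa using hn)).2).symm
  · have := hleft 0 h0Om
    rwa [hf0] at this

theorem circleMap_mem_ball_one {r θ : ℝ} (hr : 0 < r) :
    circleMap 0 r θ ∈ ball (1:ℂ) 1 ↔ r < 2 * Real.cos θ := by
  rw [mem_ball, dist_eq_norm, ← sq_lt_sq₀ (norm_nonneg _) zero_le_one, Complex.sq_norm]
  have h1 : (circleMap 0 r θ).re = r * Real.cos θ := by
    simp [circleMap, Complex.exp_re]
  have h2 : (circleMap 0 r θ).im = r * Real.sin θ := by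
    simp [circleMap, Complex.exp_im]
  simp only [Complex.normSq_apply, Complex.sub_re, Complex.sub_im, h1, h2, Complex.one_re,
    Complex.one_im, one_pow, sub_zero]
  have h3 := Real.sin_sq_add_cos_sq θ
  have h4 : (r * Real.cos θ - 1) * (r * Real.cos θ - 1) + r * Real.sin θ * (r * Real.sin θ)
      = r * (r - 2 * Real.cos θ) + 1 := by
    linear_combination r ^ 2 * h3
  rw [h4]
  constructor
  · intro h
    by_contra hc
    have : 0 ≤ r * (r - 2 * Real.cos θ) := mul_nonneg hr.le (by linarith)
    linarith
  · intro h
    have : r * (r - 2 * Real.cos θ) < 0 := mul_neg_of_pos_of_neg hr (by linarith)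
    linarith

theorem cos_between {a b t : ℝ} (ha : -Real.pi < a) (hb : b < Real.pi) (hat : a ≤ t) (htb : t ≤ b)
    {m : ℝ} (h1 : m < Real.cos a) (h2 : m < Real.cos b) : m < Real.cos t := by
  rcases le_total 0 t with h0 | h0
  · exact h2.trans_le (Real.cos_le_cos_of_nonneg_of_le_pi h0 hb.le htb)
  · refine h1.trans_le ?_
    rw [← Real.cos_neg a, ← Real.cos_neg t]
    exact Real.cos_le_cos_of_nonneg_of_le_pi (by linarith) (by linarith) (by linarith)

open MeasureTheory in
theorem arc_est {g : ℂ → ℂ} (hg : DifferentiableOn ℂ g (ball 1 1)) {r δ a b : ℝ} (hr : 0 < r)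
    (hδ : 0 < δ) (ha : -Real.pi < a) (hb : b < Real.pi) (hab : a ≤ b)
    (hza : circleMap 0 r a ∈ ball (1:ℂ) 1) (hzb : circleMap 0 r b ∈ ball (1:ℂ) 1)
    (hd : δ < ‖g (circleMap 0 r b) - g (circleMap 0 r a)‖) :
    ENNReal.ofReal (δ ^ 2 / (2 * Real.pi) / r) ≤ ∫⁻ θ in Ioo (-Real.pi) Real.pi,
      ENNReal.ofReal r * (ball (1:ℂ) 1).indicator (fun u => ENNReal.ofReal (‖deriv g u‖ ^ 2))
        (circleMap 0 r θ) := by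
  have hin : ∀ θ ∈ Icc a b, circleMap 0 r θ ∈ ball (1:ℂ) 1 := by
    intro θ hθ
    rw [circleMap_mem_ball_one hr] at hza hzb ⊢
    have := cos_between ha hb hθ.1 hθ.2 (m := r / 2) (by linarith) (by linarith)
    linarith
  have hgd : ∀ θ ∈ Icc a b, HasDerivAt (fun θ => g (circleMap 0 r θ))
      (deriv g (circleMap 0 r θ) * (circleMap 0 r θ * Complex.I)) θ := by
    intro θ hθ
    have h1 := (hg.differentiableAt (isOpen_ball.mem_nhds (hin θ hθ))).hasDerivAt
    exact h1.comp_of_eq θ (hasDerivAt_circleMap 0 r θ) rfl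
  have hcd : ContinuousOn (fun θ => deriv g (circleMap 0 r θ)) (Icc a b) :=
    (hg.deriv isOpen_ball).continuousOn.comp (continuous_circleMap 0 r).continuousOn hin
  have hcont : ContinuousOn (fun θ => deriv g (circleMap 0 r θ) * (circleMap 0 r θ * Complex.I))
      (Icc a b) := hcd.mul (by fun_prop)
  have hIntg : IntervalIntegrable
      (fun θ => deriv g (circleMap 0 r θ) * (circleMap 0 r θ * Complex.I)) volume a b :=
    (hcont.mono (by rw [uIcc_of_le hab])).intervalIntegrable
  have hftc := intervalIntegral.integral_eq_sub_of_hasDerivAt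
    (fun x hx => hgd x (by rwa [uIcc_of_le hab] at hx)) hIntg
  have hn := intervalIntegral.norm_integral_le_integral_norm
    (f := fun θ => deriv g (circleMap 0 r θ) * (circleMap 0 r θ * Complex.I)) (μ := volume) hab
  rw [hftc] at hn
  have hnorm : ∀ θ, ‖deriv g (circleMap 0 r θ) * (circleMap 0 r θ * Complex.I)‖ =
      r * ‖deriv g (circleMap 0 r θ)‖ := by
    intro θ
    simp [abs_of_pos hr]
    ring
  simp only [hnorm] at hn
  have hpi := Real.pi_pos
  have hc2 : ContinuousOn (fun θ => r * ‖deriv g (circleMap 0 r θ)‖) (Icc a b) :=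
    continuousOn_const.mul hcd.norm
  have hc3 : ContinuousOn (fun θ => r * ‖deriv g (circleMap 0 r θ)‖ ^ 2) (Icc a b) :=
    continuousOn_const.mul (hcd.norm.pow 2)
  have hii : IntervalIntegrable (fun θ => r * ‖deriv g (circleMap 0 r θ)‖ ^ 2) volume a b :=
    (hc3.mono (by rw [uIcc_of_le hab])).intervalIntegrable
  -- AM-GM
  have hle : ∫ θ in a..b, r * ‖deriv g (circleMap 0 r θ)‖ ≤
      ∫ θ in a..b, ((Real.pi * r / δ) * (r * ‖deriv g (circleMap 0 r θ)‖ ^ 2) + δ / (4 * Real.pi)) := by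
    refine intervalIntegral.integral_mono_on hab
      ((hc2.mono (by rw [uIcc_of_le hab])).intervalIntegrable)
      ((hii.const_mul _).add (by simp)) ?_
    intro θ _
    set x := r * ‖deriv g (circleMap 0 r θ)‖
    have h1 : (Real.pi * r / δ) * (r * ‖deriv g (circleMap 0 r θ)‖ ^ 2) = Real.pi / δ * x ^ 2 := by
      simp only [x]; ring
    rw [h1]
    have h2 : Real.pi / δ * x ^ 2 + δ / (4 * Real.pi) - x =
        Real.pi / δ * (x - δ / (2 * Real.pi)) ^ 2 := by
      field_simp
      ring
    have h3 : 0 ≤ Real.pi / δ * (x - δ / (2 * Real.pi)) ^ 2 := by positivity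
    linarith
  rw [intervalIntegral.integral_add (hii.const_mul _) (by simp),
    intervalIntegral.integral_const_mul (Real.pi * r / δ), intervalIntegral.integral_const] at hle
  set I := ∫ θ in a..b, r * ‖deriv g (circleMap 0 r θ)‖ ^ 2 with hI
  have hba : (b - a) * (δ / (4 * Real.pi)) ≤ δ / 2 := by
    have : b - a ≤ 2 * Real.pi := by linarith
    calc (b - a) * (δ / (4 * Real.pi)) ≤ (2 * Real.pi) * (δ / (4 * Real.pi)) := by gcongr
      _ = δ / 2 := by field_simp; norm_num
  have hIge : δ ^ 2 / (2 * Real.pi) / r ≤ I := by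
    have h1 : δ / 2 ≤ Real.pi * r / δ * I := by
      simp only [smul_eq_mul] at hle
      linarith
    rw [div_div, div_le_iff₀ (by positivity)]
    have h2 : Real.pi * r / δ * I = (Real.pi * r * I) / δ := by ring
    rw [h2, le_div_iff₀ hδ] at h1
    nlinarith
  refine (ENNReal.ofReal_le_ofReal hIge).trans ?_
  rw [hI, intervalIntegral.integral_of_le hab, ofReal_integral_eq_lintegral_ofReal]
  · have hsub : Ioc a b ⊆ Ioo (-Real.pi) Real.pi := fun x hx =>
      ⟨ha.trans hx.1, hx.2.trans_lt hb⟩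
    refine le_trans ?_ (lintegral_mono_set hsub)
    refine le_of_eq (setLIntegral_congr_fun measurableSet_Ioc (fun θ hθ => ?_))
    rw [indicator_of_mem (hin θ ⟨hθ.1.le, hθ.2⟩), ENNReal.ofReal_mul hr.le]
  · exact hii.1
  · exact Filter.Eventually.of_forall fun θ => by positivity

open MeasureTheory in
theorem area_finite {g : ℂ → ℂ} (hg : DifferentiableOn ℂ g (ball 1 1)) (hi : InjOn g (ball 1 1))
    {R : ℝ} (hR : ∀ z ∈ ball (1:ℂ) 1, ‖g z‖ < R) :
    ∫⁻ u, (ball (1:ℂ) 1).indicator (fun u => ENNReal.ofReal (‖deriv g u‖ ^ 2)) u < ⊤ := by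
  rw [lintegral_indicator measurableSet_ball]
  have h1 := lintegral_image_eq_lintegral_abs_det_fderiv_mul (volume : Measure ℂ)
    (s := ball (1:ℂ) 1) (f := g) (f' := fun u => deriv g u • (1 : ℂ →L[ℝ] ℂ)) measurableSet_ball
    (fun x hx => (hg.differentiableAt
      (isOpen_ball.mem_nhds hx)).hasDerivAt.complexToReal_fderiv.hasFDerivWithinAt) hi (fun _ => 1)
  have hdet : ∀ c : ℂ, |(c • (1 : ℂ →L[ℝ] ℂ)).det| = ‖c‖ ^ 2 := by
    intro c
    have : (c • (1 : ℂ →L[ℝ] ℂ)).det = LinearMap.det ((Algebra.lmul ℝ ℂ) c) := by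
      rw [ContinuousLinearMap.det]
      congr 1
    rw [this, ← Algebra.norm_apply, Algebra.norm_complex_apply, Complex.normSq_eq_norm_sq,
      abs_of_nonneg (by positivity)]
  simp only [hdet, mul_one, lintegral_const, one_mul, Measure.restrict_apply_univ] at h1
  rw [← h1]
  refine lt_of_le_of_lt (measure_mono ?_) (measure_ball_lt_top (x := (0:ℂ)) (r := R))
  rintro _ ⟨z, hz, rfl⟩
  simpa using hR z hz

open MeasureTheory in
theorem length_area_aux {g : ℂ → ℂ} (hg : DifferentiableOn ℂ g (ball 1 1)) (hi : InjOn g (ball 1 1))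
    {R : ℝ} (hR : ∀ z ∈ ball (1:ℂ) 1, ‖g z‖ < R) {δ r₀ : ℝ} (hδ : 0 < δ) (hr₀ : 0 < r₀) :
    ∃ r, 0 < r ∧ r < r₀ ∧ ∀ z ∈ ball (1:ℂ) 1, ∀ w ∈ ball (1:ℂ) 1, ‖z‖ = r → ‖w‖ = r →
      ‖g z - g w‖ ≤ δ := by
  by_contra hcon
  push Not at hcon
  set h : ℂ → ENNReal := (ball (1:ℂ) 1).indicator (fun u => ENNReal.ofReal (‖deriv g u‖ ^ 2)) with hh
  have hmeas : Measurable h :=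
    (((measurable_deriv g).norm.pow_const 2).ennreal_ofReal).indicator measurableSet_ball
  have hcm : Measurable fun q : ℝ × ℝ => circleMap 0 q.1 q.2 := by
    refine Continuous.measurable ?_
    unfold circleMap
    fun_prop
  have hlow : ∀ r ∈ Ioo 0 r₀, ENNReal.ofReal (δ ^ 2 / (2 * Real.pi) / r) ≤
      ∫⁻ θ in Ioo (-Real.pi) Real.pi, ENNReal.ofReal r * h (circleMap 0 r θ) := by
    intro r hr
    obtain ⟨z, hz, w, hw, hzr, hwr, hzw⟩ := hcon r hr.1 hr.2
    have hz' : circleMap 0 r z.arg = z := by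
      rw [← hzr]; simp [circleMap, Complex.norm_mul_exp_arg_mul_I]
    have hw' : circleMap 0 r w.arg = w := by
      rw [← hwr]; simp [circleMap, Complex.norm_mul_exp_arg_mul_I]
    have hlt : ∀ y : ℂ, y ∈ ball (1:ℂ) 1 → y.arg < Real.pi := by
      intro y hy
      refine lt_of_le_of_ne (Complex.arg_le_pi y) (fun he => ?_)
      rw [Complex.arg_eq_pi_iff] at he
      rw [mem_ball, dist_eq_norm] at hy
      have := (Complex.abs_re_le_norm (y - 1)).trans_lt hy
      rw [abs_lt] at this
      simp at this
      linarith [he.1]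
    rcases le_total z.arg w.arg with hle | hle
    · refine arc_est hg hr.1 hδ (Complex.neg_pi_lt_arg z) (hlt w hw) hle (by rwa [hz']) (by rwa [hw'])
        ?_
      rw [hz', hw', norm_sub_rev]; exact hzw
    · refine arc_est hg hr.1 hδ (Complex.neg_pi_lt_arg w) (hlt z hz) hle (by rwa [hw']) (by rwa [hz'])
        ?_
      rw [hz', hw']; exact hzw
  have hpol := Complex.lintegral_comp_polarCoord_symm h
  have hfin := area_finite hg hi hR
  rw [← hh, ← hpol] at hfin
  have htar : polarCoord.target = Ioi (0:ℝ) ×ˢ Ioo (-Real.pi) Real.pi := rfl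
  have hsy : ∀ p : ℝ × ℝ, Complex.polarCoord.symm p = circleMap 0 p.1 p.2 := by
    intro p
    rw [Complex.polarCoord_symm_apply]
    simp [circleMap, Complex.exp_mul_I]
  simp only [hsy, smul_eq_mul] at hfin
  rw [htar, Measure.volume_eq_prod, ← Measure.prod_restrict, lintegral_prod _ (by
    refine Measurable.aemeasurable ?_
    exact (measurable_fst.ennreal_ofReal).mul (hmeas.comp hcm))] at hfin
  have hlow2 : ∫⁻ r in Ioo 0 r₀, ENNReal.ofReal (δ ^ 2 / (2 * Real.pi) / r) < ⊤ := by
    refine lt_of_le_of_lt ?_ hfin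
    refine le_trans ?_ (lintegral_mono_set (Ioo_subset_Ioi_self : Ioo (0:ℝ) r₀ ⊆ Ioi 0))
    exact setLIntegral_mono' measurableSet_Ioo hlow
  have hc : 0 < δ ^ 2 / (2 * Real.pi) := by positivity
  have hIntg : IntegrableOn (fun r : ℝ => δ ^ 2 / (2 * Real.pi) / r) (Ioo 0 r₀) := by
    refine ⟨(measurable_const.div measurable_id).aestronglyMeasurable, ?_⟩
    rw [hasFiniteIntegral_iff_ofReal]
    · exact hlow2
    · refine (ae_restrict_iff' measurableSet_Ioo).2 (Filter.Eventually.of_forall fun r hr => ?_)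
      have := hr.1
      positivity
  have hIntg2 : IntegrableOn (fun r : ℝ => r⁻¹) (Ioc 0 r₀) := by
    rw [integrableOn_Ioc_iff_integrableOn_Ioo]
    have := hIntg.const_mul (δ ^ 2 / (2 * Real.pi))⁻¹
    refine this.congr (Filter.Eventually.of_forall fun r => ?_)
    simp only
    field_simp
  have := (intervalIntegrable_iff_integrableOn_Ioc_of_le hr₀.le).2 hIntg2
  rw [intervalIntegrable_inv_iff] at this
  rcases this with h1 | h1
  · exact hr₀.ne h1
  · exact h1 (by rw [uIcc_of_le hr₀.le]; exact ⟨le_rfl, hr₀.le⟩)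

theorem length_area {ψ : ℂ → ℂ} (hd : DifferentiableOn ℂ ψ (ball 0 1)) (hi : InjOn ψ (ball 0 1))
    {R : ℝ} (hR : ∀ z ∈ ball (0:ℂ) 1, ‖ψ z‖ < R) {ζ : ℂ} (hζ : ‖ζ‖ = 1) {δ r₀ : ℝ} (hδ : 0 < δ)
    (hr₀ : 0 < r₀) :
    ∃ r, 0 < r ∧ r < r₀ ∧ ∀ z ∈ ball (0:ℂ) 1, ∀ w ∈ ball (0:ℂ) 1, dist z ζ = r → dist w ζ = r →
      dist (ψ z) (ψ w) ≤ δ := by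
  have hζ0 : ζ ≠ 0 := by rintro rfl; simp at hζ
  have hm : MapsTo (fun u => ζ * (1 - u)) (ball (1:ℂ) 1) (ball 0 1) := by
    intro u hu
    simpa [hζ, dist_eq_norm, norm_sub_rev] using hu
  obtain ⟨r, h0, h1, h2⟩ := length_area_aux (g := fun u => ψ (ζ * (1 - u)))
    (hd.comp (by fun_prop) hm) (by
      intro u hu v hv huv
      have := hi (hm hu) (hm hv) huv
      have := mul_left_cancel₀ hζ0 this
      linear_combination -this) (fun z hz => hR _ (hm hz)) hδ hr₀
  refine ⟨r, h0, h1, ?_⟩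
  intro z hz w hw hzr hwr
  have key : ∀ y : ℂ, ζ * (1 - (1 - y / ζ)) = y := fun y => by field_simp; ring
  have kb : ∀ y ∈ ball (0:ℂ) 1, (1 - y / ζ) ∈ ball (1:ℂ) 1 := fun y hy => by
    simpa [dist_eq_norm, hζ] using hy
  have kn : ∀ y : ℂ, ‖1 - y / ζ‖ = dist y ζ := fun y => by
    have : 1 - y / ζ = (ζ - y) / ζ := by field_simp
    rw [this, norm_div, hζ, div_one, dist_eq_norm, norm_sub_rev]
  have := h2 _ (kb z hz) _ (kb w hw) (by rw [kn, hzr]) (by rw [kn, hwr])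
  simp only [key] at this
  rwa [dist_eq_norm]

/-- principal logarithm of `z - p` on a ball not containing `p` -/
theorem pl_log_ball (a p : ℂ) (ε : ℝ) (hp : ε < dist p a) (hε : 0 < ε) :
    ∃ u : ℂ → ℂ, ContinuousOn u (closedBall a ε) ∧ ∀ z ∈ closedBall a ε, Complex.exp (u z) = z - p := by
  have hap : a - p ≠ 0 := by
    intro h
    rw [dist_comm, dist_eq_norm, h, norm_zero] at hp
    linarith
  have hs : ∀ z ∈ closedBall a ε, (z - p) / (a - p) ∈ Complex.slitPlane := by
    intro z hz
    have h1 : ‖(z - a) / (a - p)‖ < 1 := by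
      rw [norm_div, div_lt_one (norm_pos_iff.2 hap)]
      rw [mem_closedBall, dist_eq_norm] at hz
      rw [dist_comm, dist_eq_norm] at hp
      linarith
    have h2 := Complex.mem_slitPlane_of_norm_lt_one h1
    have h3 : (z - p) / (a - p) = 1 + (z - a) / (a - p) := by field_simp; ring
    rw [h3]; exact h2
  refine ⟨fun z => Complex.log ((z - p) / (a - p)) + Complex.log (a - p), ?_, ?_⟩
  · exact (ContinuousOn.clog (by fun_prop) hs).add continuousOn_const
  · intro z hz
    rw [Complex.exp_add, Complex.exp_log (Complex.slitPlane_ne_zero (hs z hz)), Complex.exp_log hap]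
    field_simp

theorem PlDisc.small_sep {χ : ℂ → ℂ} (h : PlDisc χ) {ε : ℝ} (hε : 0 < ε) :
    ∃ δ > 0, ∀ (a : ℂ) (V : Set ℂ), IsOpen V → Bornology.IsBounded V →
      V ⊆ (χ '' closedBall 0 1)ᶜ → frontier V ⊆ χ '' closedBall 0 1 ∪ closedBall a δ →
      V ⊆ closedBall a ε := by
  classical
  obtain ⟨η, hη, hη'⟩ := Metric.uniformContinuousOn_iff.1
    ((isCompact_closedBall (0:ℂ) 1).uniformContinuousOn_of_continuous h.cont) (ε/2) (by positivity)
  obtain ⟨δ, hδ, hδ'⟩ := Metric.uniformContinuousOn_iff.1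
    (h.isCompact_K.uniformContinuousOn_of_continuous h.plInv_cont) η hη
  set K := χ '' closedBall 0 1 with hK
  refine ⟨min (δ/3) (ε/2), by positivity, ?_⟩
  intro a V hVo hVb hVK hfr p hp
  by_contra hpa
  rw [mem_closedBall, not_le] at hpa
  obtain ⟨uK, huK, huK'⟩ := h.log_K (fun z => z - p) (by fun_prop)
    (fun x hx h0 => hVK hp (by rw [sub_eq_zero] at h0; rwa [← h0]))
  obtain ⟨uB, huB, huB'⟩ := pl_log_ball a p ε hpa hε
  set d := min (δ/3) (ε/2)
  have hd1 : d ≤ δ/3 := min_le_left _ _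
  have hd2 : d ≤ ε/2 := min_le_right _ _
  have hconst : ∀ x ∈ K ∩ closedBall a d, ∀ y ∈ K ∩ closedBall a d,
      uK x - uB x = uK y - uB y := by
    rintro x ⟨⟨s, hs, rfl⟩, hxa⟩ y ⟨⟨t, ht, rfl⟩, hya⟩
    have hst : dist s t < η := by
      have := hδ' (χ s) ⟨s, hs, rfl⟩ (χ t) ⟨t, ht, rfl⟩ (by
        rw [mem_closedBall] at hxa hya
        have := dist_triangle_right (χ s) (χ t) a
        linarith)
      rwa [h.plInv_left hs, h.plInv_left ht] at this
    have hseg : segment ℝ s t ⊆ closedBall (0:ℂ) 1 := (convex_closedBall 0 1).segment_subset hs ht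
    have hpre : IsPreconnected (χ '' segment ℝ s t) :=
      (convex_segment s t).isPreconnected.image _ (h.cont.mono hseg)
    have hsubK : χ '' segment ℝ s t ⊆ K := image_mono hseg
    have hsubB : χ '' segment ℝ s t ⊆ closedBall a ε := by
      rintro _ ⟨z, hz, rfl⟩
      have hzs : dist z s < η := by
        have : dist z s ≤ dist s t := by
          have := (convex_closedBall s (dist s t)).segment_subset (x := s) (y := t)
            (by simp [dist_nonneg]) (by simp [dist_comm]) hz
          simpa using this
        linarith
      have h1 := hη' z (hseg hz) s hs hzs
      rw [mem_closedBall] at hxa ⊢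
      have := dist_triangle (χ z) (χ s) a
      linarith
    refine pl_exp_eq_const hpre uK uB (huK.mono hsubK) (huB.mono hsubB) ?_ _
      ⟨s, left_mem_segment ℝ s t, rfl⟩ _ ⟨t, right_mem_segment ℝ s t, rfl⟩
    intro x hx
    rw [huK' x (hsubK hx), huB' x (hsubB hx)]
  obtain ⟨c, hc, hc1⟩ : ∃ c : ℂ, (∀ x ∈ K ∩ closedBall a d, uK x = uB x + c) ∧ Complex.exp c = 1 := by
    by_cases hne : (K ∩ closedBall a d).Nonempty
    · obtain ⟨x, hx⟩ := hne
      refine ⟨uK x - uB x, fun y hy => ?_, ?_⟩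
      · rw [hconst x hx y hy]; ring
      · rw [Complex.exp_sub, huK' x hx.1, huB' x (closedBall_subset_closedBall (by linarith) hx.2)]
        refine div_self ?_
        intro h0
        rw [sub_eq_zero] at h0
        exact hVK hp (h0 ▸ hx.1)
    · exact ⟨0, fun x hx => (hne ⟨x, hx⟩).elim, by simp⟩
  set u : ℂ → ℂ := fun z => if z ∈ K then uK z else uB z + c with hu
  have huK2 : ∀ z ∈ K, u z = uK z := fun z hz => by simp [hu, hz]
  have huB2 : ∀ z ∈ closedBall a d, u z = uB z + c := fun z hz => by
    by_cases hzK : z ∈ K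
    · rw [huK2 z hzK, hc z ⟨hzK, hz⟩]
    · simp [hu, hzK]
  have hdε : closedBall a d ⊆ closedBall a ε := closedBall_subset_closedBall (by linarith)
  have hucont : ContinuousOn u (K ∪ closedBall a d) := by
    refine continuousOn_two_closed (A := K) (B := closedBall a d) h.isCompact_K.isClosed
      isClosed_closedBall Subset.rfl ?_ ?_
    · exact (huK.congr huK2).mono inter_subset_right
    · exact (((huB.mono hdε).add continuousOn_const).congr huB2).mono inter_subset_right
  refine pl_lemmaE V hVo hVb p hp (fun _ => 1) continuous_const (fun _ _ => one_ne_zero) u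
    (hucont.mono hfr) ?_
  intro z hz
  rw [mul_one]
  rcases hfr hz with h1 | h1
  · rw [huK2 z h1, huK' z h1]
  · rw [huB2 z h1, Complex.exp_add, hc1, mul_one, huB' z (hdε h1)]

theorem RMap.inj {χ f ψ : ℂ → ℂ} (hm : RMap χ f ψ) : InjOn ψ (ball 0 1) := by
  intro z hz w hw h
  rw [← hm.right z hz, ← hm.right w hw, h]

theorem RMap.f_zero {χ f ψ : ℂ → ℂ} (hm : RMap χ f ψ) : f 0 = 0 := by
  have := hm.right 0 (by simp)
  rwa [hm.zero] at this

theorem PlDisc.osc {χ f ψ : ℂ → ℂ} (h : PlDisc χ) (hm : RMap χ f ψ) {ζ : ℂ} (hζ : ‖ζ‖ = 1)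
    {ε : ℝ} (hε : 0 < ε) :
    ∃ r > 0, ∀ z ∈ ball (0:ℂ) 1, ∀ w ∈ ball (0:ℂ) 1, dist z ζ < r → dist w ζ < r →
      dist (ψ z) (ψ w) ≤ ε := by
  set K := χ '' closedBall 0 1 with hK
  have hOo : IsOpen (Om χ 1) := h.isOpen_Om le_rfl
  have h0O : (0:ℂ) ∈ Om χ 1 := Or.inl rfl
  obtain ⟨R, hR0, hR⟩ := h.Om_bdd one_pos le_rfl
  -- ψ is bounded below away from 0
  obtain ⟨m, hm0, hmb⟩ : ∃ m > 0, ∀ z ∈ ball (0:ℂ) 1, dist z ζ < 1/2 → m ≤ ‖ψ z‖ := by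
    have hfc : ContinuousAt f 0 := (hm.df 0 h0O).continuousWithinAt.continuousAt (hOo.mem_nhds h0O)
    obtain ⟨m, hm0, hmb⟩ := Metric.continuousAt_iff.1 hfc (1/2) (by norm_num)
    refine ⟨m, hm0, fun z hz hzζ => ?_⟩
    by_contra hlt
    rw [not_le] at hlt
    have := hmb (x := ψ z) (by simpa using hlt)
    rw [hm.right z hz, hm.f_zero] at this
    rw [dist_zero_right] at this
    rw [dist_comm, dist_eq_norm] at hzζ
    have h3 := norm_sub_norm_le ζ z
    linarith
  obtain ⟨δ, hδ, hsep⟩ := h.small_sep (ε := ε / (2 * R^2)) (by positivity)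
  obtain ⟨r, hr, hr2, hosc⟩ := length_area hm.dψ hm.inj (fun z hz => hR _ (hm.mψ z hz)) hζ
    (δ := δ * m^2) (r₀ := 1/2) (by positivity) (by norm_num)
  -- the arc is nonempty
  obtain ⟨z₀, hz₀, hz₀r⟩ : ∃ z₀ ∈ ball (0:ℂ) 1, dist z₀ ζ = r := by
    refine ⟨((1 - r : ℝ) : ℂ) * ζ, ?_, ?_⟩
    · rw [mem_ball_zero_iff, norm_mul, hζ, mul_one, Complex.norm_real, Real.norm_eq_abs, abs_lt]
      constructor <;> linarith
    · rw [dist_eq_norm]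
      have : ((1 - r : ℝ) : ℂ) * ζ - ζ = ((-r : ℝ) : ℂ) * ζ := by push_cast; ring
      rw [this, norm_mul, hζ, mul_one, Complex.norm_real, Real.norm_eq_abs, abs_neg, abs_of_pos hr]
  set S : Set ℂ := ball 0 1 ∩ ball ζ r with hS
  have hS1 : ∀ z ∈ S, m ≤ ‖ψ z‖ := fun z hz => hmb z hz.1 (by have := hz.2; rw [mem_ball] at this; linarith)
  set V : Set ℂ := (fun z => (ψ z)⁻¹) '' S with hV
  have hψc : ContinuousOn ψ (ball 0 1) := hm.dψ.continuousOn
  have hdist : ∀ x y : ℂ, x ≠ 0 → y ≠ 0 → dist x⁻¹ y⁻¹ = dist x y / (‖x‖ * ‖y‖) := by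
    intro x y hx hy
    rw [dist_inv_inv₀ hx hy]
  have hVeq : V = {x | x ≠ 0 ∧ x⁻¹ ∈ Om χ 1 ∩ f ⁻¹' (ball ζ r)} := by
    ext x
    constructor
    · rintro ⟨z, hz, rfl⟩
      refine ⟨inv_ne_zero (norm_pos_iff.1 (hm0.trans_le (hS1 z hz))), ?_⟩
      simp only [inv_inv]
      exact ⟨hm.mψ z hz.1, by rw [mem_preimage, hm.right z hz.1]; exact hz.2⟩
    · rintro ⟨hx0, hx1, hx2⟩
      exact ⟨f x⁻¹, ⟨hm.mf _ hx1, hx2⟩, by simp only [hm.left _ hx1, inv_inv]⟩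
  have hVo : IsOpen V := by
    rw [hVeq]
    have h1 : IsOpen (Om χ 1 ∩ f ⁻¹' (ball ζ r)) := hm.df.continuousOn.isOpen_inter_preimage hOo isOpen_ball
    have h2 : ContinuousOn (fun x : ℂ => x⁻¹) {0}ᶜ := continuousOn_inv₀
    exact h2.isOpen_inter_preimage isOpen_compl_singleton h1
  have hVb : Bornology.IsBounded V := by
    refine (isBounded_iff_forall_norm_le).2 ⟨m⁻¹, ?_⟩
    rintro _ ⟨z, hz, rfl⟩
    simp only [norm_inv]
    exact inv_anti₀ hm0 (hS1 z hz)
  have hVK : V ⊆ Kᶜ := by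
    rw [hVeq]
    rintro x ⟨hx0, hx1, -⟩
    rcases hx1 with h1 | h1
    · exact (hx0 (inv_eq_zero.1 h1)).elim
    · rwa [inv_inv] at h1
  have hfr : frontier V ⊆ K ∪ closedBall (ψ z₀)⁻¹ δ := by
    intro x hx
    by_cases hxK : x ∈ K
    · exact Or.inl hxK
    right
    have hx0 : x ≠ 0 := by
      rintro rfl
      exact hxK ⟨0, by simp, h.zero⟩
    have hxO : x⁻¹ ∈ Om χ 1 := Or.inr (by rwa [inv_inv])
    have hxV : x ∉ V := by
      rw [frontier, hVo.interior_eq] at hx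
      exact hx.2
    have hxc : x ∈ closure V := frontier_subset_closure hx
    have hy : f x⁻¹ ∈ closedBall ζ r := by
      have hcont : ContinuousAt (fun x => f x⁻¹) x := by
        refine ContinuousAt.comp (g := f) ?_ (continuousAt_inv₀ hx0)
        exact (hm.df _ hxO).continuousWithinAt.continuousAt (hOo.mem_nhds hxO)
      have h1 : f x⁻¹ ∈ closure ((fun x => f x⁻¹) '' V) :=
        hcont.continuousWithinAt.mem_closure_image hxc
      refine closure_minimal ?_ isClosed_closedBall h1
      rintro _ ⟨y, hy, rfl⟩
      rw [hVeq] at hy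
      exact ball_subset_closedBall hy.2.2
    have hy2 : dist (f x⁻¹) ζ = r := by
      refine le_antisymm hy ?_
      by_contra hlt
      rw [not_le] at hlt
      apply hxV
      rw [hVeq]
      exact ⟨hx0, hxO, hlt⟩
    have h2 := hosc _ (hm.mf _ hxO) z₀ hz₀ hy2 hz₀r
    have h3 : m ≤ ‖ψ (f x⁻¹)‖ := hmb _ (hm.mf _ hxO) (by rw [hy2]; exact hr2)
    have h4 : m ≤ ‖ψ z₀‖ := hmb _ hz₀ (by rw [hz₀r]; exact hr2)
    have h5 : x = (ψ (f x⁻¹))⁻¹ := by rw [hm.left _ hxO, inv_inv]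
    rw [mem_closedBall, h5, hdist _ _ (norm_pos_iff.1 (hm0.trans_le h3)) (norm_pos_iff.1 (hm0.trans_le h4)),
      div_le_iff₀ (by have := hm0.trans_le h3; have := hm0.trans_le h4; positivity)]
    refine h2.trans ?_
    rw [sq]
    gcongr
  have hfin := hsep (ψ z₀)⁻¹ V hVo hVb hVK hfr
  refine ⟨r, hr, fun z hz w hw hzr hwr => ?_⟩
  have hz' : z ∈ S := ⟨hz, hzr⟩
  have hw' : w ∈ S := ⟨hw, hwr⟩
  have h1 := hfin ⟨z, hz', rfl⟩
  have h2 := hfin ⟨w, hw', rfl⟩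
  simp only [mem_closedBall] at h1 h2
  have h3 := dist_triangle_right (ψ z)⁻¹ (ψ w)⁻¹ (ψ z₀)⁻¹
  have pz := hm0.trans_le (hS1 z hz')
  have pw := hm0.trans_le (hS1 w hw')
  rw [hdist _ _ (norm_pos_iff.1 pz) (norm_pos_iff.1 pw)] at h3
  have h4 : dist (ψ z) (ψ w) / (‖ψ z‖ * ‖ψ w‖) ≤ ε / R^2 := by
    have : ε / (2 * R^2) + ε / (2 * R^2) = ε / R^2 := by field_simp; norm_num
    linarith
  rw [div_le_iff₀ (by positivity)] at h4
  refine h4.trans ?_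
  have h5 := (hR _ (hm.mψ z hz)).le
  have h6 := (hR _ (hm.mψ w hw)).le
  calc ε / R^2 * (‖ψ z‖ * ‖ψ w‖) ≤ ε / R^2 * (R * R) := by gcongr
    _ = ε := by field_simp

/-- the continuous extension of the Riemann map to the closed disc -/
theorem PlDisc.extension {χ f ψ : ℂ → ℂ} (h : PlDisc χ) (hm : RMap χ f ψ) :
    ∃ φ : ℂ → ℂ, ContinuousOn φ (closedBall 0 1) ∧ EqOn φ ψ (ball 0 1) ∧
      (∀ ζ, ‖ζ‖ = 1 → φ ζ ∉ Om χ 1) ∧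
      φ '' closedBall 0 1 = {w | w = 0 ∨ w⁻¹ ∉ χ '' ball 0 1} := by
  have hψc : ContinuousOn ψ (ball 0 1) := hm.dψ.continuousOn
  have hOo : IsOpen (Om χ 1) := h.isOpen_Om le_rfl
  have hcl : closure (ball (0:ℂ) 1) = closedBall 0 1 := closure_ball 0 one_ne_zero
  have hlim : ∀ x ∈ closedBall (0:ℂ) 1, ∃ y, Filter.Tendsto ψ (𝓝[ball 0 1] x) (𝓝 y) := by
    intro x hx
    by_cases hx1 : x ∈ ball (0:ℂ) 1
    · exact ⟨ψ x, hψc x hx1⟩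
    have hx1' : ‖x‖ = 1 := by
      rw [mem_ball_zero_iff, not_lt] at hx1
      rw [mem_closedBall_zero_iff] at hx
      linarith
    have : (𝓝[ball 0 1] x).NeBot := mem_closure_iff_nhdsWithin_neBot.1 (by rwa [hcl])
    have hca : Cauchy (Filter.map ψ (𝓝[ball 0 1] x)) := by
      rw [Metric.cauchy_iff]
      refine ⟨inferInstance, fun ε hε => ?_⟩
      obtain ⟨r, hr, hr'⟩ := h.osc hm hx1' (ε := ε/2) (by positivity)
      refine ⟨ψ '' (ball x r ∩ ball 0 1), Filter.image_mem_map
        (Filter.inter_mem (mem_nhdsWithin_of_mem_nhds (ball_mem_nhds x hr)) self_mem_nhdsWithin), ?_⟩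
      rintro _ ⟨z, hz, rfl⟩ _ ⟨w, hw, rfl⟩
      have := hr' z hz.2 w hw.2 hz.1 hw.1
      linarith
    exact cauchy_map_iff_exists_tendsto.1 hca
  have hφc : ContinuousOn (extendFrom (ball 0 1) ψ) (closedBall 0 1) :=
    continuousOn_extendFrom hcl.ge hlim
  have hφeq : EqOn (extendFrom (ball 0 1) ψ) ψ (ball 0 1) := extendFrom_extends hψc
  set φ := extendFrom (ball 0 1) ψ
  have hsph : ∀ ζ, ‖ζ‖ = 1 → φ ζ ∉ Om χ 1 := by
    intro ζ hζ hO
    have hζD : ζ ∈ closedBall (0:ℂ) 1 := by simp [hζ]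
    have : (𝓝[ball 0 1] ζ).NeBot := mem_closure_iff_nhdsWithin_neBot.1 (by rwa [hcl])
    have hfc : ContinuousAt f (φ ζ) := (hm.df _ hO).continuousWithinAt.continuousAt (hOo.mem_nhds hO)
    have h1 : Filter.Tendsto φ (𝓝[ball 0 1] ζ) (𝓝 (φ ζ)) :=
      (hφc ζ hζD).mono_left (nhdsWithin_mono _ ball_subset_closedBall)
    have h2 := hfc.tendsto.comp h1
    have h3 : Filter.Tendsto (f ∘ φ) (𝓝[ball 0 1] ζ) (𝓝 ζ) := by
      refine Filter.Tendsto.congr' (f₁ := id) ?_ (Filter.tendsto_id.mono_left nhdsWithin_le_nhds)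
      filter_upwards [self_mem_nhdsWithin] with z hz
      simp [hφeq hz, hm.right z hz]
    have h4 := tendsto_nhds_unique h2 h3
    have h5 := hm.mf _ hO
    rw [h4, mem_ball_zero_iff, hζ] at h5
    exact lt_irrefl _ h5
  have hOmimg : Om χ 1 ⊆ φ '' closedBall 0 1 := fun w hw =>
    ⟨f w, ball_subset_closedBall (hm.mf w hw), by rw [hφeq (hm.mf w hw), hm.left w hw]⟩
  have himgc : IsCompact (φ '' closedBall 0 1) := (isCompact_closedBall 0 1).image_of_continuousOn hφc
  have hO2 : IsOpen {w : ℂ | w ≠ 0 ∧ w⁻¹ ∈ χ '' ball 0 1} := by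
    have : ContinuousOn (fun w : ℂ => w⁻¹) {0}ᶜ := continuousOn_inv₀
    exact this.isOpen_inter_preimage isOpen_compl_singleton h.opn
  refine ⟨φ, hφc, hφeq, hsph, ?_⟩
  apply Subset.antisymm
  · rintro _ ⟨z, hz, rfl⟩
    by_contra hcon
    have hmem : φ z ∈ {w : ℂ | w ≠ 0 ∧ w⁻¹ ∈ χ '' ball 0 1} := by
      have := not_or.1 hcon
      exact ⟨this.1, not_not.1 this.2⟩
    have hz' : z ∈ closure (ball (0:ℂ) 1) := by rwa [hcl]
    have h1 : φ z ∈ closure (φ '' ball 0 1) :=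
      ((hφc z hz).mono ball_subset_closedBall).mem_closure_image hz'
    obtain ⟨_, hy, x, hx, rfl⟩ := mem_closure_iff.1 h1 _ hO2 hmem
    have h2 := hm.mψ x hx
    rw [← hφeq hx] at h2
    rcases h2 with h2 | h2
    · exact hy.1 h2
    · exact h2 (image_mono ball_subset_closedBall hy.2)
  · rintro w hw
    by_cases hwO : w ∈ Om χ 1
    · exact hOmimg hwO
    rw [h.Om_compl zero_le_one le_rfl] at hwO
    obtain ⟨hw0, z, hz0, hz1, hzw⟩ := hwO
    have hz1' : ‖z‖ = 1 := by
      rcases hw with hw | hw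
      · exact (hw0 hw).elim
      · refine le_antisymm hz1 ?_
        by_contra hlt
        exact hw ⟨z, by simpa using hlt, hzw.symm⟩
    have h1 := h.boundary_mem_closure hz1'
    have h2 : w ∈ closure (Om χ 1) := by
      have hcont : ContinuousAt (fun x : ℂ => x⁻¹) (χ z) :=
        continuousAt_inv₀ (h.ne_zero hz1 hz0)
      have := hcont.continuousWithinAt.mem_closure_image h1
      have hw' : (χ z)⁻¹ = w := by rw [← hzw, inv_inv]
      rw [hw'] at this
      refine closure_mono ?_ this
      rintro _ ⟨y, hy, rfl⟩
      exact Or.inr (by simpa using hy)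
    exact closure_minimal hOmimg himgc.isClosed h2

/-- if `p`, `q` are in the same component of the complement of a compact set `J`, then
`(z-p)/(z-q)` has a logarithm on `J` -/
theorem pl_log_ratio {J C : Set ℂ} (hJ : IsCompact J) (hC : IsPreconnected C) (hCJ : Disjoint C J)
    {p q : ℂ} (hp : p ∈ C) (hq : q ∈ C) :
    ∃ u : ℂ → ℂ, ContinuousOn u J ∧ ∀ z ∈ J, Complex.exp (u z) * (z - q) = z - p := by
  classical
  set P : ℂ → Prop := fun x => ∃ u : ℂ → ℂ, ContinuousOn u J ∧ ∀ z ∈ J, Complex.exp (u z) * (z - x) = z - p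
  have hloc : ∀ x ∈ C, ∃ ε > 0, ∀ y ∈ C, dist y x < ε → (P x ↔ P y) := by
    intro x hx
    have hxJ : x ∈ Jᶜ := fun h => (disjoint_left.1 hCJ) hx h
    obtain ⟨ε, hε, hb⟩ := Metric.isOpen_iff.1 hJ.isClosed.isOpen_compl x hxJ
    have hfar : ∀ z ∈ J, ε ≤ ‖z - x‖ := fun z hz => by
      by_contra hlt
      rw [not_le, ← dist_eq_norm] at hlt
      exact hb hlt hz
    refine ⟨ε/2, by positivity, fun y hy hyx => ?_⟩
    have key : ∀ a b : ℂ, dist a b < ε/2 → (∀ z ∈ J, ε/2 ≤ ‖z - b‖) → P b → P a := by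
      rintro a b hab hfb ⟨u, hu, hu'⟩
      have hnz : ∀ z ∈ J, z - b ≠ 0 := fun z hz h => by
        have := hfb z hz
        rw [h, norm_zero] at this
        linarith
      have hs : ∀ z ∈ J, (z - a) / (z - b) ∈ Complex.slitPlane := by
        intro z hz
        have h1 : ‖(b - a) / (z - b)‖ < 1 := by
          rw [norm_div, div_lt_one (norm_pos_iff.2 (hnz z hz)), ← dist_eq_norm, dist_comm]
          exact hab.trans_le (hfb z hz)
        have h2 := Complex.mem_slitPlane_of_norm_lt_one h1
        have h3 : (z - a) / (z - b) = 1 + (b - a) / (z - b) := by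
          have := hnz z hz
          field_simp; ring
        rw [h3]; exact h2
      refine ⟨fun z => u z - Complex.log ((z - a) / (z - b)), hu.sub (ContinuousOn.clog ?_ hs), ?_⟩
      · exact ContinuousOn.div (by fun_prop) (by fun_prop) hnz
      · intro z hz
        have h4 := Complex.slitPlane_ne_zero (hs z hz)
        have h5 : z - a ≠ 0 := fun h => h4 (by rw [h, zero_div])
        rw [Complex.exp_sub, Complex.exp_log h4, ← hu' z hz]
        have := hnz z hz
        field_simp
    constructor
    · exact key y x hyx (fun z hz => by linarith [hfar z hz])
    · refine key x y (by rwa [dist_comm]) (fun z hz => ?_)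
      have h1 := hfar z hz
      have h2 := dist_triangle z y x
      rw [← dist_eq_norm] at h1 ⊢
      linarith
  have hPp : P p := ⟨fun _ => 0, continuousOn_const, fun z _ => by simp⟩
  have hclop : ∀ x ∈ C, P x := by
    by_contra hcon
    push Not at hcon
    obtain ⟨x, hx, hPx⟩ := hcon
    set T : Set ℂ := ⋃ y ∈ {y | y ∈ C ∧ P y}, ball y (if h : y ∈ C then (hloc y h).choose else 1)
    set F : Set ℂ := ⋃ y ∈ {y | y ∈ C ∧ ¬ P y}, ball y (if h : y ∈ C then (hloc y h).choose else 1)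
    have hpos : ∀ y (h : y ∈ C), 0 < (if h : y ∈ C then (hloc y h).choose else 1) := fun y h => by
      simp only [h, dif_pos]; exact (hloc y h).choose_spec.1
    have hspec : ∀ y (h : y ∈ C), ∀ z ∈ C, z ∈ ball y (if h : y ∈ C then (hloc y h).choose else 1) →
        (P y ↔ P z) := fun y h z hz hzb => by
      simp only [h, dif_pos] at hzb; exact (hloc y h).choose_spec.2 z hz hzb
    have hTo : IsOpen T := isOpen_biUnion fun _ _ => isOpen_ball
    have hFo : IsOpen F := isOpen_biUnion fun _ _ => isOpen_ball
    obtain ⟨z, hzC, hzT, hzF⟩ := hC T F hTo hFo (by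
      intro y hy
      by_cases hPy : P y
      · exact Or.inl (mem_biUnion (x := y) ⟨hy, hPy⟩ (mem_ball_self (hpos y hy)))
      · exact Or.inr (mem_biUnion (x := y) ⟨hy, hPy⟩ (mem_ball_self (hpos y hy))))
      ⟨p, hp, mem_biUnion (x := p) ⟨hp, hPp⟩ (mem_ball_self (hpos p hp))⟩
      ⟨x, hx, mem_biUnion (x := x) ⟨hx, hPx⟩ (mem_ball_self (hpos x hx))⟩
    obtain ⟨y1, hy1, hz1⟩ := mem_iUnion₂.1 hzT
    obtain ⟨y2, hy2, hz2⟩ := mem_iUnion₂.1 hzF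
    have e1 := (hspec y1 hy1.1 z hzC hz1).1 hy1.2
    exact hy2.2 ((hspec y2 hy2.1 z hzC hz2).2 e1)
  exact hclop q hq

/-- a function continuous on the closed disc and holomorphic inside, constant on an arc of
the boundary, is constant -/
theorem pl_arc_const {φ : ℂ → ℂ} (hc : ContinuousOn φ (closedBall 0 1))
    (hd : DifferentiableOn ℂ φ (ball 0 1)) {a ζ₀ : ℂ} (hζ₀ : ‖ζ₀‖ = 1) {η : ℝ} (hη : 0 < η)
    (h : ∀ ζ, ‖ζ‖ = 1 → dist ζ ζ₀ < η → φ ζ = a) : φ 0 = a := by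
  classical
  -- finitely many rotations
  have hcov : ∃ t : Finset ℂ, (∀ c ∈ t, ‖c‖ = 1) ∧ ∀ ζ : ℂ, ‖ζ‖ = 1 → ∃ c ∈ t, dist (c * ζ) ζ₀ < η := by
    obtain ⟨t, ht, hcov⟩ := (isCompact_sphere (0:ℂ) 1).elim_nhds_subcover
      (fun x => ball x η) (fun x _ => ball_mem_nhds x hη)
    refine ⟨t.image (fun x => ζ₀ / x), ?_, ?_⟩
    · intro c hc
      obtain ⟨x, hx, rfl⟩ := Finset.mem_image.1 hc
      have := ht x hx
      rw [mem_sphere_zero_iff_norm] at this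
      rw [norm_div, hζ₀, this, div_one]
    · intro ζ hζ
      obtain ⟨x, hx, hxb⟩ := mem_iUnion₂.1 (hcov (by simpa using hζ : ζ ∈ sphere (0:ℂ) 1))
      refine ⟨ζ₀ / x, Finset.mem_image_of_mem _ hx, ?_⟩
      have hx1 := ht x hx
      rw [mem_sphere_zero_iff_norm] at hx1
      have hx0 : x ≠ 0 := by rintro rfl; simp at hx1
      rw [dist_eq_norm]
      have : ζ₀ / x * ζ - ζ₀ = ζ₀ / x * (ζ - x) := by field_simp
      rw [this, norm_mul, norm_div, hζ₀, hx1, div_one, one_mul, ← dist_eq_norm]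
      exact hxb
  obtain ⟨t, ht1, ht2⟩ := hcov
  set F : ℂ → ℂ := fun z => ∏ c ∈ t, (φ (c * z) - a)
  have hmD : ∀ c ∈ t, MapsTo (fun z => c * z) (closedBall (0:ℂ) 1) (closedBall 0 1) := by
    intro c hc z hz
    simpa [ht1 c hc] using hz
  have hmB : ∀ c ∈ t, MapsTo (fun z => c * z) (ball (0:ℂ) 1) (ball 0 1) := by
    intro c hc z hz
    simpa [ht1 c hc] using hz
  have hFc : ContinuousOn F (closedBall 0 1) :=
    continuousOn_finsetProd _ fun c hct =>
      (hc.comp (by fun_prop) (hmD c hct)).sub continuousOn_const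
  have hFd : DifferentiableOn ℂ F (ball 0 1) :=
    DifferentiableOn.fun_finsetProd fun c hct =>
      (hd.comp (by fun_prop) (hmB c hct)).sub_const _
  have hdc : DiffContOnCl ℂ F (ball 0 1) := ⟨hFd, by rwa [closure_ball (0:ℂ) one_ne_zero]⟩
  have h0 : ‖F 0‖ ≤ 0 := by
    refine Complex.norm_le_of_forall_mem_frontier_norm_le isBounded_ball hdc ?_ (subset_closure (by simp))
    intro z hz
    rw [frontier_ball (0:ℂ) one_ne_zero, mem_sphere_zero_iff_norm] at hz
    obtain ⟨c, hct, hcz⟩ := ht2 z hz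
    have : F z = 0 := Finset.prod_eq_zero hct (by
      rw [h (c * z) (by rw [norm_mul, ht1 c hct, hz, one_mul]) hcz, sub_self])
    rw [this, norm_zero]
  have h1 : F 0 = 0 := norm_le_zero_iff.1 h0
  obtain ⟨c, hct, hc0⟩ := Finset.prod_eq_zero_iff.1 h1
  rw [mul_zero, sub_eq_zero] at hc0
  exact hc0

theorem pl_punctured_ball : IsPreconnected (ball (0:ℂ) 1 \ {0}) := by
  have h : ball (0:ℂ) 1 \ {0} = Complex.exp '' {z | z.re < 0} := by
    ext w
    constructor
    · rintro ⟨h1, h2⟩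
      have hw : w ≠ 0 := h2
      refine ⟨Complex.log w, ?_, Complex.exp_log hw⟩
      rw [mem_ball_zero_iff] at h1
      show (Complex.log w).re < 0
      rw [Complex.log_re]
      exact Real.log_neg (norm_pos_iff.2 hw) h1
    · rintro ⟨z, hz, rfl⟩
      refine ⟨?_, Complex.exp_ne_zero z⟩
      rw [mem_ball_zero_iff, Complex.norm_exp]
      rw [← Real.exp_zero]
      exact Real.exp_lt_exp.2 hz
  rw [h]
  refine IsPreconnected.image ?_ _ Complex.continuous_exp.continuousOn
  exact (convex_halfSpace_re_lt 0).isPreconnected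

def chordF (ζ₁ ζ₂ z : ℂ) : ℝ := ((z - ζ₁) * (starRingEnd ℂ) (ζ₂ - ζ₁)).im

theorem chordF_cont (ζ₁ ζ₂ : ℂ) : Continuous (chordF ζ₁ ζ₂) := by
  unfold chordF; fun_prop

theorem chordF_convex_pos (ζ₁ ζ₂ : ℂ) : Convex ℝ {z | 0 < chordF ζ₁ ζ₂ z} := by
  intro x hx y hy a b ha hb hab
  have : chordF ζ₁ ζ₂ (a • x + b • y) = a * chordF ζ₁ ζ₂ x + b * chordF ζ₁ ζ₂ y := by
    have hb' : b = 1 - a := by linarith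
    subst hb'
    simp [chordF]; ring
  simp only [mem_ofPred_eq] at hx hy ⊢
  rw [this]
  rcases ha.eq_or_lt with rfl | ha
  · have : b = 1 := by linarith
    subst this; linarith
  · have := mul_pos ha hx
    have := mul_nonneg hb hy.le
    linarith

theorem chordF_swap (ζ₁ ζ₂ z : ℂ) : chordF ζ₂ ζ₁ z = - chordF ζ₁ ζ₂ z := by
  simp [chordF]; ring

theorem chordF_re {ζ₁ ζ₂ : ℂ} (h1 : ‖ζ₁‖ = 1) (h2 : ‖ζ₂‖ = 1) :
    ζ₁.re ^ 2 + ζ₁.im ^ 2 = 1 ∧ ζ₂.re ^ 2 + ζ₂.im ^ 2 = 1 := by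
  have e : ∀ z : ℂ, ‖z‖ = 1 → z.re ^ 2 + z.im ^ 2 = 1 := fun z hz => by
    rw [← Complex.sq_norm_sub_sq_re z, hz]; ring
  exact ⟨e _ h1, e _ h2⟩

theorem chordF_zero {ζ₁ ζ₂ z : ℂ} (h1 : ‖ζ₁‖ = 1) (h2 : ‖ζ₂‖ = 1) (hne : ζ₁ ≠ ζ₂) (hz : ‖z‖ = 1)
    (h : chordF ζ₁ ζ₂ z = 0) : z = ζ₁ ∨ z = ζ₂ := by
  obtain ⟨e1, e2⟩ := chordF_re h1 h2
  obtain ⟨e3, -⟩ := chordF_re hz hz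
  -- determinant identity: three unimodular numbers
  have key : (z - ζ₁) * (z - ζ₂) * (starRingEnd ℂ) (ζ₂ - ζ₁) = 0 ∨ ζ₁ = ζ₂ := by
    left
    have u : ∀ w : ℂ, ‖w‖ = 1 → w * (starRingEnd ℂ) w = 1 := fun w hw => by
      rw [Complex.mul_conj, Complex.normSq_eq_norm_sq, hw]; simp
    have hreal : (z - ζ₁) * (starRingEnd ℂ) (ζ₂ - ζ₁) = (starRingEnd ℂ) ((z - ζ₁) * (starRingEnd ℂ) (ζ₂ - ζ₁)) :=
      ((Complex.conj_eq_iff_im).2 h).symm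
    simp only [map_mul, map_sub, Complex.conj_conj] at hreal ⊢
    have u1 := u _ h1
    have u2 := u _ h2
    have u3 := u _ hz
    have g : ∀ a b : ℂ, a * (starRingEnd ℂ) a = 1 → b * (starRingEnd ℂ) b = 1 →
        a * b * ((starRingEnd ℂ) a - (starRingEnd ℂ) b) = b - a := by
      intro a b ha hb
      linear_combination b * ha - a * hb
    have g1 := g z ζ₁ u3 u1
    -- (z-ζ₁) conj(ζ₂-ζ₁) = conj(z-ζ₁) (ζ₂-ζ₁)
    have e5 : (z - ζ₁) * (ζ₂ * ζ₁ * ((starRingEnd ℂ) ζ₂ - (starRingEnd ℂ) ζ₁)) * z =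
        ζ₂ * (z * ζ₁ * ((starRingEnd ℂ) z - (starRingEnd ℂ) ζ₁)) * (ζ₂ - ζ₁) := by
      linear_combination (ζ₁ * ζ₂ * z) * hreal
    rw [g ζ₂ ζ₁ u2 u1, g1] at e5
    have e6 : (z - ζ₁) * (z - ζ₂) * (ζ₂ - ζ₁) = 0 := by linear_combination -e5
    have e7 : ζ₂ - ζ₁ ≠ 0 := sub_ne_zero.2 hne.symm
    rcases mul_eq_zero.1 e6 with e8 | e8
    · rw [e8, zero_mul]
    · exact (e7 e8).elim
  rcases key with key | key
  · rcases mul_eq_zero.1 key with k | k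
    · rcases mul_eq_zero.1 k with k | k
      · exact Or.inl (sub_eq_zero.1 k)
      · exact Or.inr (sub_eq_zero.1 k)
    · exfalso
      rw [map_eq_zero, sub_eq_zero] at k
      exact hne k.symm
  · exact (hne key).elim

theorem chordF_exists_pos {ζ₁ ζ₂ : ℂ} (h1 : ‖ζ₁‖ = 1) (h2 : ‖ζ₂‖ = 1) (hne : ζ₁ ≠ ζ₂) :
    ∃ z, ‖z‖ = 1 ∧ 0 < chordF ζ₁ ζ₂ z := by
  have hd : ζ₂ - ζ₁ ≠ 0 := sub_ne_zero.2 hne.symm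
  set d := ζ₂ - ζ₁ with hdd
  have hn : 0 < ‖d‖ := norm_pos_iff.2 hd
  refine ⟨Complex.I * d / ‖d‖, by simp [hn.ne'], ?_⟩
  have e1 : chordF ζ₁ ζ₂ (Complex.I * d / ‖d‖) = ‖d‖ - (ζ₁ * (starRingEnd ℂ) d).im := by
    unfold chordF
    rw [← hdd, sub_mul, Complex.sub_im]
    congr 1
    have : Complex.I * d / ‖d‖ * (starRingEnd ℂ) d = Complex.I * (‖d‖ : ℂ) := by
      have e : d * (starRingEnd ℂ) d = (‖d‖ : ℂ) ^ 2 := Complex.mul_conj' d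
      have hn' : (‖d‖ : ℂ) ≠ 0 := by exact_mod_cast hn.ne'
      field_simp
      linear_combination e
    rw [this]; simp
  rw [e1]
  obtain ⟨f1, f2⟩ := chordF_re h1 h2
  have hdn : ‖d‖ ^ 2 = d.re ^ 2 + d.im ^ 2 := by
    rw [← Complex.sq_norm_sub_sq_re d]; ring
  have hre : d.re = ζ₂.re - ζ₁.re := by simp [hdd]
  have him : d.im = ζ₂.im - ζ₁.im := by simp [hdd]
  have him2 : (ζ₁ * (starRingEnd ℂ) d).im = ζ₁.im * d.re - ζ₁.re * d.im := by simp; ring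
  rw [him2]
  have hre2 : 2 * (ζ₁.re * d.re + ζ₁.im * d.im) = - ‖d‖ ^ 2 := by rw [hdn, hre, him]; linear_combination f2 - f1
  have hsum : (ζ₁.re * d.re + ζ₁.im * d.im) ^ 2 + (ζ₁.im * d.re - ζ₁.re * d.im) ^ 2 = ‖d‖ ^ 2 := by
    rw [hdn]; linear_combination (d.re ^ 2 + d.im ^ 2) * f1
  have hpos : 0 < (ζ₁.re * d.re + ζ₁.im * d.im) ^ 2 := by
    have : ζ₁.re * d.re + ζ₁.im * d.im ≠ 0 := by
      intro h0
      rw [h0] at hre2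
      have := sq_pos_of_pos hn
      linarith
    positivity
  have : ζ₁.im * d.re - ζ₁.re * d.im < ‖d‖ := by
    refine lt_of_pow_lt_pow_left₀ 2 hn.le ?_
    linarith
  linarith

theorem PlDisc.ext_two_arcs {χ f ψ φ : ℂ → ℂ} (h : PlDisc χ) (hm : RMap χ f ψ)
    (hφc : ContinuousOn φ (closedBall 0 1)) (hφψ : EqOn φ ψ (ball 0 1))
    (hsph : ∀ ζ, ‖ζ‖ = 1 → φ ζ ∉ Om χ 1)
    (himg : φ '' closedBall 0 1 = {w | w = 0 ∨ w⁻¹ ∉ χ '' ball 0 1})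
    {ζ₁ ζ₂ : ℂ} (h1 : ‖ζ₁‖ = 1) (h2 : ‖ζ₂‖ = 1) (hne : ζ₁ ≠ ζ₂) (heq : φ ζ₁ = φ ζ₂)
    {ζ₃ ζ₄ : ℂ} (h3 : ‖ζ₃‖ = 1) (h4 : ‖ζ₄‖ = 1) (l3 : 0 < chordF ζ₁ ζ₂ ζ₃)
    (l4 : chordF ζ₁ ζ₂ ζ₄ < 0) (n3 : φ ζ₃ ≠ φ ζ₁) (n4 : φ ζ₄ ≠ φ ζ₁) : False := by
  classical
  set a := φ ζ₁ with ha
  set l := chordF ζ₁ ζ₂ with hl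
  have hlc : Continuous l := chordF_cont ζ₁ ζ₂
  have hOo : IsOpen (Om χ 1) := h.isOpen_Om le_rfl
  have hconv : Convex ℝ {z | 0 < l z} := chordF_convex_pos ζ₁ ζ₂
  have hconv' : Convex ℝ {z | l z < 0} := by
    have := chordF_convex_pos ζ₂ ζ₁
    convert this using 3 with z
    rw [chordF_swap, ← hl]; simp
  have hbO : ∀ z ∈ ball (0:ℂ) 1, φ z ∈ Om χ 1 := fun z hz => by rw [hφψ hz]; exact hm.mψ z hz
  have hDcase : ∀ z ∈ closedBall (0:ℂ) 1, z ∈ ball (0:ℂ) 1 ∨ ‖z‖ = 1 := fun z hz => by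
    rw [mem_closedBall_zero_iff] at hz
    rw [mem_ball_zero_iff]
    exact hz.lt_or_eq
  have hfφ : ∀ z ∈ ball (0:ℂ) 1, f (φ z) = z := fun z hz => by rw [hφψ hz, hm.right z hz]
  set J := φ '' (closedBall 0 1 ∩ {z | l z = 0}) with hJ
  have hJc : IsCompact J := ((isCompact_closedBall (0:ℂ) 1).inter_right
    (isClosed_eq hlc continuous_const)).image_of_continuousOn (hφc.mono inter_subset_left)
  set Vp := φ '' (ball 0 1 ∩ {z | 0 < l z}) with hVp
  set Vm := φ '' (ball 0 1 ∩ {z | l z < 0}) with hVm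
  have haO : a ∉ Om χ 1 := hsph ζ₁ h1
  have hJK : ∀ x ∈ J, x ∉ Om χ 1 → x = a := by
    rintro _ ⟨z, ⟨hz, hlz⟩, rfl⟩ hx
    rcases hDcase z hz with hz1 | hz1
    · exact (hx (hbO z hz1)).elim
    · rcases chordF_zero h1 h2 hne hz1 hlz with rfl | rfl
      · rfl
      · exact heq.symm
  -- the connected set
  obtain ⟨s₀, hs₀, hs₀a⟩ : ∃ s₀, ‖s₀‖ = 1 ∧ a⁻¹ = χ s₀ := by
    obtain ⟨ha0, z, hz0, hz1, hz⟩ := (h.Om_compl zero_le_one le_rfl).1 haO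
    refine ⟨z, le_antisymm hz1 ?_, hz⟩
    have : a ∈ {w : ℂ | w = 0 ∨ w⁻¹ ∉ χ '' ball 0 1} := by
      rw [← himg]; exact ⟨ζ₁, by simp [h1], rfl⟩
    rcases this with h0 | h0
    · exact (ha0 h0).elim
    · by_contra hlt
      exact h0 ⟨z, by simpa using hlt, hz.symm⟩
  have hKpre : IsPreconnected ((Om χ 1)ᶜ \ {a}) := by
    have hS : IsPreconnected (closedBall (0:ℂ) 1 \ {0, s₀}) := by
      refine pl_punctured_ball.subset_closure ?_ ?_
      · rintro z ⟨hz, hz0⟩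
        refine ⟨ball_subset_closedBall hz, ?_⟩
        rintro (hz1 | hz1)
        · exact hz0 hz1
        · rw [mem_ball_zero_iff] at hz
          rw [mem_singleton_iff] at hz1
          rw [hz1, hs₀] at hz
          exact lt_irrefl _ hz
      · rintro z ⟨hz, hz0⟩
        have hz0' : z ≠ 0 := fun h => hz0 (by simp [h])
        have : z ∈ {0}ᶜ ∩ closure (ball (0:ℂ) 1) := ⟨hz0', by rwa [closure_ball (0:ℂ) one_ne_zero]⟩
        have := isOpen_compl_singleton.inter_closure this
        rwa [inter_comm] at this
    have heq : (Om χ 1)ᶜ \ {a} = (fun s => (χ s)⁻¹) '' (closedBall (0:ℂ) 1 \ {0, s₀}) := by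
      ext w
      constructor
      · rintro ⟨hw, hwa⟩
        obtain ⟨hw0, z, hz0, hz1, hz⟩ := (h.Om_compl zero_le_one le_rfl).1 hw
        refine ⟨z, ⟨by simpa using hz1, ?_⟩, by simp only [← hz, inv_inv]⟩
        rintro (hh | hh)
        · exact hz0 hh
        · rw [mem_singleton_iff] at hh
          rw [hh, ← hs₀a] at hz
          exact hwa (inv_injective hz)
      · rintro ⟨s, ⟨hs, hs0⟩, rfl⟩
        have hs1 : ‖s‖ ≤ 1 := by simpa using hs
        have hs0' : s ≠ 0 := fun h => hs0 (by simp [h])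
        refine ⟨?_, ?_⟩
        · show _ ∉ _
          rw [h.Om_mem_of le_rfl hs1]
          push Not
          exact ⟨hs0', hs1⟩
        · intro hsa
          rw [mem_singleton_iff] at hsa
          have : χ s = χ s₀ := by rw [← hs₀a, ← hsa, inv_inv]
          exact hs0 (by simp [h.inj hs (by simp [hs₀]) this])
    rw [heq]
    refine hS.image _ (ContinuousOn.inv₀ (h.cont.mono sdiff_subset) ?_)
    rintro s ⟨hs, hs0⟩
    exact h.ne_zero (by simpa using hs) (fun h => hs0 (by simp [h]))
  have hside : ∀ (S : Set ℂ), Convex ℝ S → IsOpen S → ∀ ζ, ‖ζ‖ = 1 → ζ ∈ S →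
      φ ζ ∈ closure (φ '' (ball 0 1 ∩ S)) ∧ (ball 0 1 ∩ S).Nonempty ∧ IsPreconnected (φ '' (ball 0 1 ∩ S)) := by
    intro S hS hSo ζ hζ hζS
    have hcl : ζ ∈ closure (ball 0 1 ∩ S) := by
      have := hSo.inter_closure (t := ball (0:ℂ) 1) ⟨hζS, by rw [closure_ball (0:ℂ) one_ne_zero]; simp [hζ]⟩
      rwa [inter_comm] at this
    refine ⟨?_, closure_nonempty_iff.1 ⟨ζ, hcl⟩, ?_⟩
    · exact ((hφc ζ (by simp [hζ])).mono (inter_subset_left.trans ball_subset_closedBall)).mem_closure_image hcl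
    · exact ((convex_ball 0 1).inter hS).isPreconnected.image _
        (hφc.mono (inter_subset_left.trans ball_subset_closedBall))
  obtain ⟨cp, ⟨p', hp'⟩, prp⟩ := hside _ hconv (isOpen_lt continuous_const hlc) ζ₃ h3 l3
  obtain ⟨cm, ⟨q', hq'⟩, prm⟩ := hside _ hconv' (isOpen_lt hlc continuous_const) ζ₄ h4 l4
  set C := (insert (φ ζ₃) Vp) ∪ ((Om χ 1)ᶜ \ {a}) ∪ (insert (φ ζ₄) Vm) with hC
  have hCpre : IsPreconnected C := by
    have c1 : IsPreconnected (insert (φ ζ₃) Vp) := prp.subset_closure (subset_insert _ _)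
      (insert_subset cp subset_closure)
    have c2 : IsPreconnected (insert (φ ζ₄) Vm) := prm.subset_closure (subset_insert _ _)
      (insert_subset cm subset_closure)
    have m3 : φ ζ₃ ∈ (Om χ 1)ᶜ \ {a} := ⟨hsph ζ₃ h3, n3⟩
    have m4 : φ ζ₄ ∈ (Om χ 1)ᶜ \ {a} := ⟨hsph ζ₄ h4, n4⟩
    exact IsPreconnected.union (φ ζ₄) (Or.inr m4) (mem_insert _ _)
      (IsPreconnected.union (φ ζ₃) (mem_insert _ _) m3 c1 hKpre) c2
  have hVJ : ∀ z ∈ ball (0:ℂ) 1, φ z ∈ J → l z = 0 := by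
    rintro z hz ⟨y, ⟨hy, hly⟩, hyz⟩
    rcases hDcase y hy with hy1 | hy1
    · have : y = z := by rw [← hfφ y hy1, ← hfφ z hz, hyz]
      rwa [← this]
    · exact (hsph y hy1 (hyz ▸ hbO z hz)).elim
  have hdis : Disjoint C J := by
    rw [disjoint_left]
    rintro x ((hx | hx) | hx) hxJ
    · rcases hx with rfl | ⟨z, hz, rfl⟩
      · exact n3 (hJK _ hxJ (hsph ζ₃ h3))
      · have := hVJ z hz.1 hxJ
        exact (ne_of_gt hz.2) this
    · exact hx.2 (hJK _ hxJ hx.1)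
    · rcases hx with rfl | ⟨z, hz, rfl⟩
      · exact n4 (hJK _ hxJ (hsph ζ₄ h4))
      · have := hVJ z hz.1 hxJ
        exact (ne_of_lt hz.2) this
  have hpV : φ p' ∈ Vp := ⟨p', hp', rfl⟩
  have hqV : φ q' ∈ Vm := ⟨q', hq', rfl⟩
  have hpO := hbO p' hp'.1
  have hqO := hbO q' hq'.1
  set p := φ p'
  set q := φ q'
  obtain ⟨u1, hu1, hu1'⟩ := pl_log_ratio hJc hCpre hdis (p := p) (q := q)
    (Or.inl (Or.inl (Or.inr hpV))) (Or.inr (Or.inr hqV))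
  have hnzO : ∀ y ∈ Om χ 1, ∀ x ∈ χ '' closedBall 0 1, 1 - y * x ≠ 0 := by
    intro y hy x hx h0
    have h1 : y * x = 1 := by linear_combination -h0
    have hy0 : y ≠ 0 := by rintro rfl; simp at h1
    have : y⁻¹ = x := by field_simp; exact h1.symm
    rcases hy with hy | hy
    · exact hy0 hy
    · exact hy (this ▸ hx)
  obtain ⟨u2, hu2, hu2'⟩ := h.log_K (fun x => (1 - p * x) / (1 - q * x))
    (ContinuousOn.div (by fun_prop) (by fun_prop) (hnzO q hqO))
    (fun x hx => div_ne_zero (hnzO p hpO x hx) (hnzO q hqO x hx))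
  have hOc : ∀ w, w ∉ Om χ 1 → w ≠ 0 ∧ w⁻¹ ∈ χ '' closedBall 0 1 := fun w hw => by
    have := not_or.1 hw
    exact ⟨this.1, not_not.1 this.2⟩
  have hv2 : ContinuousOn (fun w => u2 w⁻¹) (Om χ 1)ᶜ :=
    hu2.comp (continuousOn_inv₀.mono fun w hw => (hOc w hw).1) (fun w hw => (hOc w hw).2)
  have hv2' : ∀ w ∈ (Om χ 1)ᶜ, Complex.exp (u2 w⁻¹) * (w - q) = w - p := by
    intro w hw
    obtain ⟨w0, wK⟩ := hOc w hw
    rw [hu2' _ wK]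
    have := hnzO q hqO _ wK
    have h5 : w - q ≠ 0 := by
      intro h0
      apply this
      rw [← sub_eq_zero.1 h0]; field_simp; ring
    field_simp
  have haq : a - q ≠ 0 := fun h0 => haO (by rw [sub_eq_zero.1 h0]; exact hqO)
  have hap : a - p ≠ 0 := fun h0 => haO (by rw [sub_eq_zero.1 h0]; exact hpO)
  have haJ : a ∈ J := ⟨ζ₁, ⟨by simp [h1], by simp [hl, chordF]⟩, rfl⟩
  set c := u1 a - u2 a⁻¹ with hc
  have hc1 : Complex.exp c = 1 := by
    have e1 := hu1' a haJ
    have e2 := hv2' a haO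
    rw [hc, Complex.exp_sub, div_eq_one_iff_eq (Complex.exp_ne_zero _)]
    exact mul_right_cancel₀ haq (e1.trans e2.symm)
  set u : ℂ → ℂ := fun z => if z ∈ J then u1 z else u2 z⁻¹ + c with hu
  have huJ : ∀ z ∈ J, u z = u1 z := fun z hz => by simp [hu, hz]
  have huK : ∀ z ∈ (Om χ 1)ᶜ, u z = u2 z⁻¹ + c := fun z hz => by
    by_cases hzJ : z ∈ J
    · rw [huJ z hzJ, hJK z hzJ hz, hc]; ring
    · simp [hu, hzJ]
  have hucont : ContinuousOn u (J ∪ (Om χ 1)ᶜ) := by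
    refine continuousOn_two_closed (A := J) (B := (Om χ 1)ᶜ) hJc.isClosed
      hOo.isClosed_compl Subset.rfl ?_ ?_
    · exact (hu1.congr huJ).mono inter_subset_right
    · exact ((hv2.add continuousOn_const).congr huK).mono inter_subset_right
  have hVo : IsOpen Vp := by
    have : Vp = Om χ 1 ∩ f ⁻¹' {z | 0 < l z} := by
      ext x
      constructor
      · rintro ⟨z, hz, rfl⟩
        exact ⟨hbO z hz.1, by rw [mem_preimage, hfφ z hz.1]; exact hz.2⟩
      · rintro ⟨hx, hx2⟩
        exact ⟨f x, ⟨hm.mf x hx, hx2⟩, by rw [hφψ (hm.mf x hx), hm.left x hx]⟩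
    rw [this]
    exact hm.df.continuousOn.isOpen_inter_preimage hOo (isOpen_lt continuous_const hlc)
  have hT : IsCompact (φ '' (closedBall 0 1 ∩ {z | 0 ≤ l z})) :=
    ((isCompact_closedBall (0:ℂ) 1).inter_right
    (isClosed_le continuous_const hlc)).image_of_continuousOn (hφc.mono inter_subset_left)
  have hVT : Vp ⊆ φ '' (closedBall 0 1 ∩ {z | 0 ≤ l z}) :=
    image_mono fun z hz => ⟨ball_subset_closedBall hz.1, (le_of_lt hz.2 : 0 ≤ l z)⟩
  have hfr : frontier Vp ⊆ J ∪ (Om χ 1)ᶜ := by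
    intro x hx
    rw [frontier, hVo.interior_eq] at hx
    obtain ⟨z, ⟨hz, hlz⟩, rfl⟩ := closure_minimal hVT hT.isClosed hx.1
    rcases hDcase z hz with hz1 | hz1
    · left
      refine ⟨z, ⟨hz, ?_⟩, rfl⟩
      by_contra hne0
      exact hx.2 ⟨z, ⟨hz1, lt_of_le_of_ne hlz (Ne.symm hne0)⟩, rfl⟩
    · exact Or.inr (hsph z hz1)
  refine pl_lemmaE Vp hVo (hT.isBounded.subset hVT) p hpV (fun z => z - q) (by fun_prop) ?_ u
    (hucont.mono hfr) ?_
  · rintro _ ⟨z, hz, rfl⟩ h0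
    have : z = q' := by rw [← hfφ z hz.1, ← hfφ q' hq'.1, sub_eq_zero.1 h0]
    have h6 : 0 < l z := hz.2
    have h7 : l q' < 0 := hq'.2
    rw [this] at h6
    exact lt_asymm h6 h7
  · intro z hz
    rcases hfr hz with h1 | h1
    · rw [huJ z h1, hu1' z h1]
    · rw [huK z h1, Complex.exp_add, hc1, mul_one, hv2' z h1]

theorem PlDisc.caratheodory_outer {χ : ℂ → ℂ} (h : PlDisc χ) :
    ∃ φ : ℂ → ℂ, ContinuousOn φ (closedBall 0 1) ∧ InjOn φ (closedBall 0 1) ∧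
      DifferentiableOn ℂ φ (ball 0 1) ∧ φ 0 = 0 ∧ φ '' ball 0 1 = Om χ 1 ∧
      φ '' closedBall 0 1 = {w | w = 0 ∨ w⁻¹ ∉ χ '' ball 0 1} ∧ deriv φ 0 ≠ 0 := by
  obtain ⟨f, ψ, hm⟩ := h.riemann
  obtain ⟨φ, hφc, hφψ, hsph, himg⟩ := h.extension hm
  have hd : DifferentiableOn ℂ φ (ball 0 1) := hm.dψ.congr hφψ
  have h0 : φ 0 = 0 := by rw [hφψ (by simp), hm.zero]
  have hbO : ∀ z ∈ ball (0:ℂ) 1, φ z ∈ Om χ 1 := fun z hz => by rw [hφψ hz]; exact hm.mψ z hz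
  have hDcase : ∀ z ∈ closedBall (0:ℂ) 1, z ∈ ball (0:ℂ) 1 ∨ ‖z‖ = 1 := fun z hz => by
    rw [mem_closedBall_zero_iff] at hz
    rw [mem_ball_zero_iff]
    exact hz.lt_or_eq
  have harc : ∀ ζ₁ ζ₂ : ℂ, ‖ζ₁‖ = 1 → ‖ζ₂‖ = 1 → ζ₁ ≠ ζ₂ →
      ∃ ζ, ‖ζ‖ = 1 ∧ 0 < chordF ζ₁ ζ₂ ζ ∧ φ ζ ≠ φ ζ₁ := by
    intro ζ₁ ζ₂ h1 h2 hne
    by_contra hcon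
    push Not at hcon
    obtain ⟨ζ₀, hζ₀, hl⟩ := chordF_exists_pos h1 h2 hne
    obtain ⟨η, hη, hb⟩ := Metric.isOpen_iff.1 (isOpen_lt continuous_const (chordF_cont ζ₁ ζ₂)) ζ₀ hl
    have := pl_arc_const hφc hd (a := φ ζ₁) hζ₀ hη (fun ζ hζ hd => hcon ζ hζ (hb hd))
    refine hsph ζ₁ h1 ?_
    rw [← this, h0]
    exact Or.inl rfl
  have hder : deriv φ 0 ≠ 0 := by
    intro hz
    have h1 : HasDerivAt φ 0 0 := by
      have := (hd.differentiableAt (ball_mem_nhds (0:ℂ) one_pos)).hasDerivAt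
      rwa [hz] at this
    have h2 : DifferentiableAt ℂ f (φ 0) := by
      rw [h0]
      exact hm.df.differentiableAt ((h.isOpen_Om le_rfl).mem_nhds (Or.inl rfl))
    have h3 := h2.hasDerivAt.comp (0:ℂ) h1
    have h4 : HasDerivAt (f ∘ φ) 1 0 := by
      refine (hasDerivAt_id (0:ℂ)).congr_of_eventuallyEq ?_
      filter_upwards [ball_mem_nhds (0:ℂ) one_pos] with z hz
      simp [hφψ hz, hm.right z hz]
    have h5 := h3.unique h4
    simp at h5
  refine ⟨φ, hφc, ?_, hd, h0, ?_, himg, hder⟩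
  · intro z hz w hw hzw
    rcases hDcase z hz with hz1 | hz1 <;> rcases hDcase w hw with hw1 | hw1
    · rw [hφψ hz1, hφψ hw1] at hzw
      exact hm.inj hz1 hw1 hzw
    · exact (hsph w hw1 (hzw ▸ hbO z hz1)).elim
    · exact (hsph z hz1 (hzw ▸ hbO w hw1)).elim
    · by_contra hne
      obtain ⟨ζ₃, a1, a2, a3⟩ := harc z w hz1 hw1 hne
      obtain ⟨ζ₄, b1, b2, b3⟩ := harc w z hw1 hz1 (Ne.symm hne)
      rw [chordF_swap] at b2
      exact h.ext_two_arcs hm hφc hφψ hsph himg hz1 hw1 hne hzw a1 b1 a2 (by linarith) a3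
        (by rwa [hzw])
  · apply Subset.antisymm
    · rintro _ ⟨z, hz, rfl⟩
      exact hbO z hz
    · intro w hw
      exact ⟨f w, hm.mf w hw, by rw [hφψ (hm.mf w hw), hm.left w hw]⟩

/-- continuous proper bijections of the plane are homeomorphisms -/
theorem homeoOfProper (f : ℂ → ℂ) (hf : Continuous f) (hi : Function.Injective f)
    (hs : Function.Surjective f) (hp : ∀ R : ℝ, ∃ R' : ℝ, ∀ z, ‖f z‖ ≤ R → ‖z‖ ≤ R') :
    ∃ H : ℂ ≃ₜ ℂ, ∀ z, H z = f z := by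
  have hprop : IsProperMap f := by
    rw [isProperMap_iff_tendsto_cocompact]
    refine ⟨hf, ?_⟩
    rw [← Metric.cobounded_eq_cocompact, ← tendsto_norm_atTop_iff_cobounded, Filter.tendsto_atTop]
    intro b
    obtain ⟨R', hR'⟩ := hp b
    have : ∀ᶠ z in Bornology.cobounded ℂ, R' < ‖z‖ :=
      (tendsto_norm_atTop_iff_cobounded.2 Filter.tendsto_id).eventually_gt_atTop R'
    filter_upwards [this] with z hz
    by_contra hlt
    exact absurd (hR' z (not_le.1 hlt).le) (not_le.2 hz)
  exact ⟨(Equiv.ofBijective f ⟨hi, hs⟩).toHomeomorphOfContinuousClosed hf hprop.isClosedMap,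
    fun z => rfl⟩

structure IsCone (c : ℂ ≃ₜ ℂ) : Prop where
  norm : ∀ z, ‖c z‖ = ‖z‖
  smul : ∀ (r : ℝ) (z : ℂ), 0 ≤ r → c (r * z) = r * c z

theorem IsCone.refl : IsCone (Homeomorph.refl ℂ) := ⟨fun _ => rfl, fun _ _ _ => rfl⟩

theorem IsCone.trans {c d : ℂ ≃ₜ ℂ} (hc : IsCone c) (hd : IsCone d) : IsCone (c.trans d) :=
  ⟨fun z => by simp [hd.norm, hc.norm], fun r z hr => by simp [hc.smul r z hr, hd.smul r _ hr]⟩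

theorem IsCone.symm {c : ℂ ≃ₜ ℂ} (hc : IsCone c) : IsCone c.symm :=
  ⟨fun z => by rw [← hc.norm, c.apply_symm_apply], fun r z hr => by
    apply c.injective
    rw [hc.smul r _ hr]; simp⟩

theorem IsCone.zero {c : ℂ ≃ₜ ℂ} (hc : IsCone c) : c 0 = 0 := by
  rw [← norm_eq_zero, hc.norm, norm_zero]

theorem IsCone.rot (a : ℂ) (ha : ‖a‖ = 1) : ∃ c : ℂ ≃ₜ ℂ, IsCone c ∧ ∀ z, c z = a * z := by
  have ha0 : a ≠ 0 := by rintro rfl; simp at ha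
  refine ⟨Homeomorph.mulLeft₀ a ha0, ⟨fun z => ?_, fun r z _ => ?_⟩, fun z => rfl⟩
  · simp [ha]
  · simp; ring

theorem IsCone.conj : ∃ c : ℂ ≃ₜ ℂ, IsCone c ∧ ∀ z, c z = (starRingEnd ℂ) z := by
  refine ⟨Complex.conjCLE.toHomeomorph, ⟨fun z => ?_, fun r z _ => ?_⟩, fun z => rfl⟩
  · exact Complex.norm_conj z
  · show (starRingEnd ℂ) _ = _ * (starRingEnd ℂ) _
    simp

theorem mkCone (τ : ℂ → ℂ) (hc : ContinuousOn τ (sphere 0 1)) (hi : InjOn τ (sphere 0 1))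
    (him : τ '' sphere 0 1 = sphere 0 1) :
    ∃ c : ℂ ≃ₜ ℂ, IsCone c ∧ ∀ z ∈ sphere (0:ℂ) 1, c z = τ z := by
  set f : ℂ → ℂ := fun z => ‖z‖ * τ (z / ‖z‖) with hf
  have hu : ∀ z : ℂ, z ≠ 0 → z / ‖z‖ ∈ sphere (0:ℂ) 1 := fun z hz => by simp [hz]
  have hτ : ∀ z ∈ sphere (0:ℂ) 1, ‖τ z‖ = 1 := fun z hz => by
    have : τ z ∈ τ '' sphere 0 1 := ⟨z, hz, rfl⟩
    rw [him] at this
    simpa using this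
  have hn : ∀ z, ‖f z‖ = ‖z‖ := by
    intro z
    by_cases hz : z = 0
    · simp [hf, hz]
    · simp only [hf, norm_mul, Complex.norm_real, norm_norm]
      rw [hτ _ (hu z hz), mul_one]
  have hfc : Continuous f := by
    rw [continuous_iff_continuousAt]
    intro z
    by_cases hz : z = 0
    · subst hz
      have h0 : f 0 = 0 := by simp [hf]
      rw [ContinuousAt, h0, tendsto_zero_iff_norm_tendsto_zero]
      simp only [hn]
      simpa using (continuous_norm (E := ℂ)).tendsto 0
    · have hc1 : ContinuousOn f {0}ᶜ := by
        refine ContinuousOn.mul (by fun_prop) (hc.comp ?_ (fun z hz => hu z hz))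
        refine ContinuousOn.div (by fun_prop) (by fun_prop) ?_
        intro x hx
        simpa using hx
      exact hc1.continuousAt (isOpen_compl_singleton.mem_nhds hz)
  have hfi : Function.Injective f := by
    intro z w hzw
    have hnn : ‖z‖ = ‖w‖ := by rw [← hn z, ← hn w, hzw]
    by_cases hz : z = 0
    · rw [hz, norm_zero] at hnn
      rw [hz, norm_eq_zero.1 hnn.symm]
    · have hw : w ≠ 0 := fun h => hz (by rw [h, norm_zero] at hnn; exact norm_eq_zero.1 hnn)
      simp only [hf] at hzw
      rw [hnn] at hzw
      have hw' : (‖w‖ : ℂ) ≠ 0 := by simpa using hw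
      have h1 := mul_left_cancel₀ hw' hzw
      have h2 := hi (by have := hu z hz; rwa [hnn] at this) (hu w hw) h1
      field_simp at h2
      exact h2
  have hfs : Function.Surjective f := by
    intro w
    by_cases hw : w = 0
    · exact ⟨0, by simp [hf, hw]⟩
    · have h1 := hu w hw
      rw [← him] at h1
      obtain ⟨ζ, hζ, hζw⟩ := h1
      have hζ1 : ‖ζ‖ = 1 := by simpa using hζ
      refine ⟨‖w‖ * ζ, ?_⟩
      have hw' : (‖w‖ : ℂ) ≠ 0 := by simpa using hw
      simp only [hf, norm_mul, Complex.norm_real, norm_norm, hζ1, mul_one]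
      rw [mul_div_cancel_left₀ _ hw', hζw]
      field_simp
  obtain ⟨H, hH⟩ := homeoOfProper f hfc hfi hfs (fun R => ⟨R, fun z hz => by rwa [hn] at hz⟩)
  refine ⟨H, ⟨fun z => by rw [hH, hn], fun r z hr => ?_⟩, fun z hz => ?_⟩
  · rw [hH, hH]
    simp only [hf, norm_mul, Complex.norm_real, Real.norm_eq_abs, abs_of_nonneg hr]
    rcases hr.eq_or_lt with rfl | hr
    · simp
    · have : (r : ℂ) ≠ 0 := by exact_mod_cast hr.ne'
      push_cast
      rw [mul_div_mul_left _ _ this]; ring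
  · rw [hH]
    have : ‖z‖ = 1 := by simpa using hz
    simp [hf, this]

/-- radial homeomorphisms -/
theorem radialHomeo (e : ℝ ≃o ℝ) (he : e 0 = 0) :
    ∃ H : ℂ ≃ₜ ℂ, ∀ z, H z = ((e ‖z‖ / ‖z‖ : ℝ) : ℂ) * z := by
  have key : ∀ e : ℝ ≃o ℝ, e 0 = 0 → ∀ z : ℂ, ‖((e ‖z‖ / ‖z‖ : ℝ) : ℂ) * z‖ = e ‖z‖ := by
    intro e he z
    by_cases hz : z = 0
    · simp [hz, he]
    · have hz' : 0 < ‖z‖ := norm_pos_iff.2 hz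
      have : 0 < e ‖z‖ := by rw [← he]; exact e.strictMono hz'
      rw [norm_mul, Complex.norm_real, Real.norm_eq_abs, abs_of_pos (by positivity)]
      field_simp
  have kinv : ∀ e : ℝ ≃o ℝ, e 0 = 0 → ∀ z : ℂ,
      (fun w : ℂ => ((e.symm ‖w‖ / ‖w‖ : ℝ) : ℂ) * w) (((e ‖z‖ / ‖z‖ : ℝ) : ℂ) * z) = z := by
    intro e he z
    simp only
    rw [key e he z]
    by_cases hz : z = 0
    · simp [hz]
    · have hz' : 0 < ‖z‖ := norm_pos_iff.2 hz
      have h2 : 0 < e ‖z‖ := by rw [← he]; exact e.strictMono hz'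
      have h3 : (‖z‖ : ℂ) ≠ 0 := by exact_mod_cast hz'.ne'
      have h4 : (e ‖z‖ : ℂ) ≠ 0 := by exact_mod_cast h2.ne'
      rw [e.symm_apply_apply]
      push_cast
      field_simp
  have kc : ∀ e : ℝ ≃o ℝ, e 0 = 0 → Continuous (fun w : ℂ => ((e ‖w‖ / ‖w‖ : ℝ) : ℂ) * w) := by
    intro e he
    have hec : Continuous e := e.continuous
    rw [continuous_iff_continuousAt]
    intro z
    by_cases hz : z = 0
    · subst hz
      rw [ContinuousAt]
      simp only [mul_zero]
      rw [tendsto_zero_iff_norm_tendsto_zero]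
      simp only [key e he]
      have := (hec.comp (continuous_norm (E := ℂ))).tendsto 0
      simpa [he, Function.comp_def] using this
    · have : ContinuousAt (fun w : ℂ => e ‖w‖ / ‖w‖) z := by
        refine ContinuousAt.div (by fun_prop) (by fun_prop) (by simpa using hz)
      exact (Complex.continuous_ofReal.continuousAt.comp this).mul continuousAt_id
  have hes : e.symm 0 = 0 := by rw [OrderIso.symm_apply_eq, he]
  refine ⟨⟨⟨fun w => ((e ‖w‖ / ‖w‖ : ℝ) : ℂ) * w, fun w => ((e.symm ‖w‖ / ‖w‖ : ℝ) : ℂ) * w,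
    kinv e he, ?_⟩, kc e he, kc e.symm hes⟩, fun z => rfl⟩
  intro w
  have := kinv e.symm hes w
  simp only [OrderIso.symm_symm] at this
  exact this

/-- order isomorphisms of the line: scale by `1/l` on `[0,1]·l`, identity far away -/
theorem scaleIso (l : ℝ) (hl : 0 < l) (A : ℝ) :
    ∃ (e : ℝ ≃o ℝ) (M : ℝ), e 0 = 0 ∧ (∀ t, 0 ≤ t → t ≤ A → e (l * t) = t) ∧ ∀ t, M ≤ t → e t = t := by
  have key : ∀ l : ℝ, 1 ≤ l → ∀ A : ℝ, ∃ (e : ℝ ≃o ℝ) (M : ℝ), e 0 = 0 ∧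
      (∀ t, 0 ≤ t → t ≤ A → e (l * t) = t) ∧ ∀ t, M ≤ t → e t = t := by
    intro l hl A
    have hl0 : 0 < l := by linarith
    set M : ℝ := 2 * l * max A 1 with hM
    have hMpos : 0 < M := by
      have : 0 < max A 1 := lt_max_of_lt_right one_pos
      positivity
    set g : ℝ → ℝ := fun t => min t (max (t / l) (2 * t - M)) with hg
    have hgm : StrictMono g := by
      intro a b hab
      exact min_lt_min hab (max_lt_max (div_lt_div_of_pos_right hab hl0) (by linarith))
    have hgc : Continuous g := by fun_prop
    have hgl : ∀ t, M ≤ t → g t = t := by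
      intro t ht
      simp only [hg]
      exact min_eq_left (le_max_of_le_right (by linarith))
    have hgn : ∀ t, t ≤ 0 → g t ≤ t := fun t ht => min_le_left _ _
    have hgs : Function.Surjective g := by
      refine hgc.surjective ?_ ?_
      · refine Filter.tendsto_atTop_mono' _ ?_ Filter.tendsto_id
        filter_upwards [Filter.eventually_ge_atTop M] with t ht
        rw [hgl t ht]; rfl
      · refine Filter.tendsto_atBot_mono' _ ?_ Filter.tendsto_id
        filter_upwards [Filter.eventually_le_atBot 0] with t ht
        exact hgn t ht
    refine ⟨hgm.orderIsoOfSurjective g hgs, M, ?_, ?_, ?_⟩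
    · show g 0 = 0
      simp [hg, hMpos.le]
    · intro t ht0 htA
      show g (l * t) = t
      have h1 : l * t / l = t := by field_simp
      have h2 : 2 * (l * t) - M ≤ t := by
        have : l * t ≤ l * max A 1 := by gcongr; exact htA.trans (le_max_left _ _)
        have : 2 * (l * t) ≤ M := by rw [hM]; linarith
        linarith
      simp only [hg, h1, max_eq_left h2]
      refine min_eq_right ?_
      nlinarith
    · exact hgl
  rcases le_total 1 l with h | h
  · exact key l h A
  · obtain ⟨e, M, h0, h1, h2⟩ := key l⁻¹ ((one_le_inv₀ hl).2 h) (l * A)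
    refine ⟨e.symm, M, by rw [OrderIso.symm_apply_eq, h0], ?_, ?_⟩
    · intro t ht htA
      rw [OrderIso.symm_apply_eq]
      have := h1 (l * t) (by positivity) (by gcongr)
      rw [← mul_assoc, inv_mul_cancel₀ hl.ne', one_mul] at this
      exact this.symm
    · intro t ht
      rw [OrderIso.symm_apply_eq, h2 t ht]

theorem scaleHomeo (l : ℝ) (hl : 0 < l) (A : ℝ) :
    ∃ (H : ℂ ≃ₜ ℂ) (M : ℝ), H 0 = 0 ∧ (∀ z : ℂ, ‖z‖ ≤ A → H (l * z) = z) ∧ ∀ z, M ≤ ‖z‖ → H z = z := by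
  obtain ⟨e, M, h0, h1, h2⟩ := scaleIso l hl A
  obtain ⟨H, hH⟩ := radialHomeo e h0
  refine ⟨H, M, by rw [hH]; simp, fun z hz => ?_, fun z hz => ?_⟩
  · rw [hH, norm_mul, Complex.norm_real, Real.norm_eq_abs, abs_of_pos hl, h1 _ (norm_nonneg z) hz]
    by_cases hz0 : z = 0
    · simp [hz0]
    · have : (‖z‖ : ℂ) ≠ 0 := by simpa using hz0
      have : (l : ℂ) ≠ 0 := by exact_mod_cast hl.ne'
      push_cast
      field_simp
  · rw [hH, h2 _ hz]
    by_cases hz0 : z = 0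
    · simp [hz0]
    · have : ‖z‖ ≠ 0 := by simpa using hz0
      rw [div_self this]; simp

/-- inversion in the unit circle -/
def cinv (z : ℂ) : ℂ := ((starRingEnd ℂ) z)⁻¹

theorem cinv_cinv (z : ℂ) : cinv (cinv z) = z := by simp [cinv]
theorem norm_cinv (z : ℂ) : ‖cinv z‖ = ‖z‖⁻¹ := by simp [cinv]
theorem cinv_eq_zero {z : ℂ} : cinv z = 0 ↔ z = 0 := by simp [cinv]
theorem cinv_injective : Function.Injective cinv := fun z w h => by
  rw [← cinv_cinv z, h, cinv_cinv]
theorem cinv_zero : cinv 0 = 0 := by simp [cinv]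
theorem cinv_continuousOn : ContinuousOn cinv {0}ᶜ := by
  unfold cinv
  refine ContinuousOn.inv₀ (by fun_prop) ?_
  intro x hx
  simpa using hx
theorem cinv_eq (z : ℂ) : cinv z = ((‖z‖ ^ 2)⁻¹ : ℝ) * z := by
  by_cases hz : z = 0
  · simp [cinv, hz]
  · have h1 : (starRingEnd ℂ) z ≠ 0 := by simpa using hz
    rw [cinv, inv_eq_iff_eq_inv, mul_inv]
    push_cast
    rw [inv_inv, ← Complex.mul_conj']
    field_simp

theorem cinv_of_norm_one {z : ℂ} (hz : ‖z‖ = 1) : cinv z = z := by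
  rw [cinv_eq, hz]; simp

theorem IsCone.cinv {c : ℂ ≃ₜ ℂ} (hc : IsCone c) (z : ℂ) : c (cinv z) = _root_.cinv (c z) := by
  rw [cinv_eq, cinv_eq, hc.norm, hc.smul _ _ (by positivity)]

theorem invConj (m : ℂ ≃ₜ ℂ) (h0 : m 0 = 0) (ε : ℝ) (hε : 0 < ε) (hm : ∀ w, ε ≤ ‖w‖ → m w = w) :
    ∃ n : ℂ ≃ₜ ℂ, ∀ w, n w = (m w⁻¹)⁻¹ := by
  have key : ∀ m : ℂ ≃ₜ ℂ, m 0 = 0 → (∀ w, ε ≤ ‖w‖ → m w = w) →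
      Continuous (fun w => (m w⁻¹)⁻¹) := by
    intro m h0 hm
    rw [continuous_iff_continuousAt]
    intro w
    by_cases hw : w = 0
    · have : (fun w => (m w⁻¹)⁻¹) =ᶠ[𝓝 w] fun w => w := by
        subst hw
        have : ball (0:ℂ) ε⁻¹ ∈ 𝓝 (0:ℂ) := ball_mem_nhds _ (by positivity)
        filter_upwards [this] with z hz
        by_cases hz0 : z = 0
        · simp [hz0, h0]
        · rw [hm z⁻¹, inv_inv]
          rw [norm_inv]
          have h1 : ‖z‖ < ε⁻¹ := by simpa using hz
          rw [le_inv_comm₀ hε (norm_pos_iff.2 hz0)]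
          exact h1.le
      exact continuousAt_id.congr this.symm
    · have h1 : m w⁻¹ ≠ 0 := by
        intro h
        rw [← h0] at h
        exact inv_ne_zero hw (m.injective h)
      exact (m.continuous.continuousAt.comp (continuousAt_inv₀ hw)).inv₀ h1
  have hm' : ∀ w, ε ≤ ‖w‖ → m.symm w = w := fun w hw => by
    rw [Homeomorph.symm_apply_eq, hm w hw]
  have h0' : m.symm 0 = 0 := by rw [Homeomorph.symm_apply_eq, h0]
  exact ⟨⟨⟨fun w => (m w⁻¹)⁻¹, fun w => (m.symm w⁻¹)⁻¹, fun w => by simp, fun w => by simp⟩,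
    key m h0 hm, key m.symm h0' hm'⟩, fun w => rfl⟩

/-- linearisation of a germ -/
theorem germ_lin (φ : ℂ → ℂ) (a : ℂ) (ha : a ≠ 0) (h : HasStrictDerivAt φ a 0) (h0 : φ 0 = 0)
    (ε : ℝ) (hε : 0 < ε) : ∃ (m : ℂ ≃ₜ ℂ) (s : ℝ), 0 < s ∧ m 0 = 0 ∧
      (∀ w, ‖w‖ ≤ s → m (φ w) = a * w) ∧ ∀ w, ε ≤ ‖w‖ → m w = w := by
  have hap : 0 < ‖a‖ := norm_pos_iff.2 ha
  obtain ⟨s0, hs0, hL⟩ : ∃ s0 > 0, ∀ x y : ℂ, ‖x‖ < s0 → ‖y‖ < s0 →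
      ‖φ x - φ y - a * (x - y)‖ ≤ ‖a‖ / 6 * ‖x - y‖ := by
    have h1 := h.hasStrictFDerivAt.isLittleO.def (c := ‖a‖ / 6) (by positivity)
    rw [Metric.eventually_nhds_iff] at h1
    obtain ⟨s0, hs0, h2⟩ := h1
    refine ⟨s0, hs0, fun x y hx hy => ?_⟩
    have := @h2 (x, y) (by rw [Prod.dist_eq]; simp [hx, hy])
    simpa [mul_comm] using this
  set s : ℝ := min (s0 / 2) (ε / (2 * ‖a‖)) with hs
  have hsp : 0 < s := by positivity
  have hss0 : s < s0 := lt_of_le_of_lt (min_le_left _ _) (by linarith)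
  have hsε : 2 * s * ‖a‖ ≤ ε := by
    have : s ≤ ε / (2 * ‖a‖) := min_le_right _ _
    rw [le_div_iff₀ (by positivity)] at this
    linarith
  set ρ : ℂ → ℝ := fun w => max 0 (min 1 (2 - ‖w‖ / s)) with hρ
  have hρ0 : ∀ w, 0 ≤ ρ w := fun w => le_max_left _ _
  have hρ1 : ∀ w, ρ w ≤ 1 := fun w => max_le (by norm_num) (min_le_left _ _)
  have hρbig : ∀ w, 2 * s ≤ ‖w‖ → ρ w = 0 := fun w hw => by
    have : 2 ≤ ‖w‖ / s := by rwa [le_div_iff₀ hsp]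
    exact max_eq_left ((min_le_right _ _).trans (by linarith))
  have hρsmall : ∀ w, ‖w‖ ≤ s → ρ w = 1 := fun w hw => by
    have : ‖w‖ / s ≤ 1 := by rwa [div_le_one hsp]
    simp only [hρ]
    rw [min_eq_left (by linarith), max_eq_right (by norm_num)]
  have hρL : ∀ x y, |ρ x - ρ y| ≤ ‖x - y‖ / s := by
    intro x y
    have h1 : |ρ x - ρ y| ≤ |(min 1 (2 - ‖x‖ / s)) - (min 1 (2 - ‖y‖ / s))| := by
      have := abs_max_sub_max_le_max 0 (min 1 (2 - ‖x‖ / s)) 0 (min 1 (2 - ‖y‖ / s))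
      simpa using this
    have h2 : |(min 1 (2 - ‖x‖ / s)) - (min 1 (2 - ‖y‖ / s))| ≤ |(2 - ‖x‖ / s) - (2 - ‖y‖ / s)| := by
      have := abs_min_sub_min_le_max 1 (2 - ‖x‖ / s) 1 (2 - ‖y‖ / s)
      simpa using this
    have h3 : |(2 - ‖x‖ / s) - (2 - ‖y‖ / s)| = |‖x‖ - ‖y‖| / s := by
      rw [show (2 - ‖x‖ / s) - (2 - ‖y‖ / s) = -((‖x‖ - ‖y‖) / s) by ring, abs_neg, abs_div,
        abs_of_pos hsp]
    have h4 : |‖x‖ - ‖y‖| / s ≤ ‖x - y‖ / s := by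
      gcongr; exact abs_norm_sub_norm_le x y
    linarith
  set π : ℂ → ℂ := fun w => (ρ w : ℂ) * w with hπ
  have hπn : ∀ w, ‖π w‖ = ρ w * ‖w‖ := fun w => by
    simp only [hπ, norm_mul, Complex.norm_real, Real.norm_eq_abs, abs_of_nonneg (hρ0 w)]
  have hπs : ∀ w, ‖π w‖ < s0 := by
    intro w
    rw [hπn]
    refine lt_of_le_of_lt ?_ hss0
    rcases le_total ‖w‖ s with h1 | h1
    · calc ρ w * ‖w‖ ≤ 1 * ‖w‖ := by gcongr; exact hρ1 w
        _ ≤ s := by linarith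
    · rcases le_total (2 * s) ‖w‖ with h2 | h2
      · rw [hρbig w h2]; linarith
      · have : ρ w ≤ 2 - ‖w‖ / s := by
          refine max_le ?_ (min_le_right _ _)
          have : ‖w‖ / s ≤ 2 := by rwa [div_le_iff₀ hsp]
          linarith
        have h3 : ρ w * ‖w‖ ≤ (2 - ‖w‖ / s) * ‖w‖ := by gcongr
        have h4 : (2 - ‖w‖ / s) * ‖w‖ ≤ s := by
          have : s - (2 - ‖w‖ / s) * ‖w‖ = (s - ‖w‖) ^ 2 / s := by field_simp; ring
          have : 0 ≤ (s - ‖w‖) ^ 2 / s := by positivity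
          linarith
        linarith
  have hπL1 : ∀ x y, ‖y‖ ≤ 2 * s → ‖π x - π y‖ ≤ 3 * ‖x - y‖ := by
    intro x y hy
    have h1 : π x - π y = (ρ x : ℂ) * (x - y) + ((ρ x - ρ y : ℝ) : ℂ) * y := by
      simp only [hπ]; push_cast; ring
    rw [h1]
    refine (norm_add_le _ _).trans ?_
    rw [norm_mul, norm_mul, Complex.norm_real, Complex.norm_real, Real.norm_eq_abs,
      Real.norm_eq_abs, abs_of_nonneg (hρ0 x)]
    have h2 : ρ x * ‖x - y‖ ≤ 1 * ‖x - y‖ := by gcongr; exact hρ1 x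
    have h3 : |ρ x - ρ y| * ‖y‖ ≤ ‖x - y‖ / s * (2 * s) := by
      gcongr; exact hρL x y
    have h4 : ‖x - y‖ / s * (2 * s) = 2 * ‖x - y‖ := by field_simp
    linarith
  have hπL : ∀ x y, ‖π x - π y‖ ≤ 3 * ‖x - y‖ := by
    intro x y
    rcases le_total ‖y‖ (2 * s) with h1 | h1
    · exact hπL1 x y h1
    · rcases le_total ‖x‖ (2 * s) with h2 | h2
      · rw [norm_sub_rev, norm_sub_rev x y]; exact hπL1 y x h2
      · simp only [hπ, hρbig x h2, hρbig y h1]; simp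
  set κ : ℂ → ℂ := fun w => w + a⁻¹ * (φ (π w) - a * π w) with hκ
  have hA : ApproximatesLinearOn κ ((ContinuousLinearEquiv.refl ℂ ℂ : ℂ ≃L[ℂ] ℂ) : ℂ →L[ℂ] ℂ)
      univ (1/2 : NNReal) := by
    intro x _ y _
    have h1 : κ x - κ y - (x - y) = a⁻¹ * (φ (π x) - φ (π y) - a * (π x - π y)) := by
      simp only [hκ]; ring
    have h2 := hL (π x) (π y) (hπs x) (hπs y)
    have h3 := hπL x y
    show ‖κ x - κ y - (x - y)‖ ≤ _
    rw [h1, norm_mul, norm_inv]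
    calc ‖a‖⁻¹ * ‖φ (π x) - φ (π y) - a * (π x - π y)‖
        ≤ ‖a‖⁻¹ * (‖a‖ / 6 * (3 * ‖x - y‖)) := by gcongr; exact h2.trans (by gcongr)
      _ = 1 / 2 * ‖x - y‖ := by field_simp; ring
      _ = _ := by norm_num
  have hn1 : ‖((ContinuousLinearEquiv.refl ℂ ℂ).symm : ℂ →L[ℂ] ℂ)‖₊ = 1 := by
    have : ((ContinuousLinearEquiv.refl ℂ ℂ).symm : ℂ →L[ℂ] ℂ) = ContinuousLinearMap.id ℂ ℂ := rfl
    rw [this]; ext; simp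
  set K := hA.toHomeomorph κ (Or.inr (by
    rw [hn1]
    rw [inv_one, ← NNReal.coe_lt_coe]; norm_num)) with hK
  have hKv : ∀ w, K w = κ w := fun w => rfl
  have hKsmall : ∀ w, ‖w‖ ≤ s → K w = a⁻¹ * φ w := fun w hw => by
    rw [hKv]
    simp only [hκ, hπ, hρsmall w hw]
    field_simp
    simp
  have hKbig : ∀ w, 2 * s ≤ ‖w‖ → K w = w := fun w hw => by
    rw [hKv]
    simp only [hκ, hπ, hρbig w hw]
    simp [h0]
  have hK0 : K 0 = 0 := by rw [hKsmall 0 (by simpa using hsp.le), h0, mul_zero]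
  refine ⟨((Homeomorph.mulLeft₀ a⁻¹ (inv_ne_zero ha)).trans K.symm).trans (Homeomorph.mulLeft₀ a ha),
    s, hsp, ?_, ?_, ?_⟩
  · simp [hK0, Homeomorph.symm_apply_eq]
  · intro w hw
    have : K.symm (a⁻¹ * φ w) = w := by rw [Homeomorph.symm_apply_eq, hKsmall w hw]
    simp [this]
  · intro w hw
    have : K.symm (a⁻¹ * w) = a⁻¹ * w := by
      rw [Homeomorph.symm_apply_eq, hKbig]
      rw [norm_mul, norm_inv, ← div_eq_inv_mul, le_div_iff₀ hap]
      linarith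
    simp [this, ha]

/-- extension of a disc to the plane through the outer Riemann map -/
theorem PlDisc.outer {χ : ℂ → ℂ} (h : PlDisc χ) : ∃ (φ : ℂ → ℂ) (c : ℂ ≃ₜ ℂ) (H : ℂ ≃ₜ ℂ),
    DifferentiableOn ℂ φ (ball 0 1) ∧ φ 0 = 0 ∧ deriv φ 0 ≠ 0 ∧ IsCone c ∧
    (∀ z, ‖z‖ ≤ 1 → H z = χ z) ∧ ∀ z, 1 < ‖z‖ → H z = (φ (c (cinv z)))⁻¹ := by
  obtain ⟨φ, hφc, hφi, hφd, hφ0, hφo, hφcl, hφ'⟩ := h.caratheodory_outer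
  have hp : PlDisc φ := ⟨hφc, hφi, by rw [hφo]; exact h.isOpen_Om le_rfl, hφ0⟩
  have mcb : ∀ {z : ℂ}, ‖z‖ ≤ 1 → z ∈ closedBall (0:ℂ) 1 := fun hz => by simpa using hz
  set τ : ℂ → ℂ := fun ζ => plInv φ (χ ζ)⁻¹ with hτ
  have h1 : ∀ ζ : ℂ, ‖ζ‖ = 1 → (χ ζ)⁻¹ ∈ φ '' closedBall 0 1 ∧ ‖τ ζ‖ = 1 ∧ φ (τ ζ) = (χ ζ)⁻¹ := by
    intro ζ hζ
    have hm : (χ ζ)⁻¹ ∈ φ '' closedBall 0 1 := by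
      rw [hφcl]
      right
      rw [inv_inv]
      rintro ⟨z, hz, hzζ⟩
      have := h.inj (ball_subset_closedBall hz) (mcb hζ.le) hzζ
      rw [this] at hz
      simp [hζ] at hz
    refine ⟨hm, ?_⟩
    obtain ⟨z, hz, hzζ⟩ := hm
    have h2 : τ ζ = z := by simp only [hτ]; rw [← hzζ, hp.plInv_left hz]
    have hz1 : ‖z‖ ≤ 1 := by simpa using hz
    refine ⟨?_, by rw [h2, hzζ]⟩
    rw [h2]
    by_contra hne
    have h3 : (χ ζ)⁻¹ ∈ Om χ 1 := by
      rw [← hφo]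
      exact ⟨z, by simpa using lt_of_le_of_ne hz1 hne, hzζ⟩
    rcases (h.Om_mem_of le_rfl hζ.le).1 h3 with h4 | h4
    · rw [h4] at hζ; simp at hζ
    · linarith
  have hχne : ∀ ζ : ℂ, ‖ζ‖ = 1 → χ ζ ≠ 0 := fun ζ hζ =>
    h.ne_zero hζ.le (by rintro rfl; simp at hζ)
  have hτc : ContinuousOn τ (sphere 0 1) := by
    refine hp.plInv_cont.comp (ContinuousOn.inv₀ (h.cont.mono sphere_subset_closedBall) ?_) ?_
    · intro ζ hζ; exact hχne ζ (by simpa using hζ)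
    · intro ζ hζ; exact (h1 ζ (by simpa using hζ)).1
  have hτi : InjOn τ (sphere 0 1) := by
    intro x hx y hy hxy
    have hx1 : ‖x‖ = 1 := by simpa using hx
    have hy1 : ‖y‖ = 1 := by simpa using hy
    have := (h1 x hx1).2.2
    rw [hxy, (h1 y hy1).2.2, inv_inj] at this
    exact h.inj (mcb hx1.le) (mcb hy1.le) this.symm
  have hτs : τ '' sphere 0 1 = sphere 0 1 := by
    apply subset_antisymm
    · rintro _ ⟨x, hx, rfl⟩
      simpa using (h1 x (by simpa using hx)).2.1
    · intro ξ hξ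
      have hξ1 : ‖ξ‖ = 1 := by simpa using hξ
      have h2 : φ ξ ∉ Om χ 1 := by
        rw [← hφo]
        rintro ⟨z, hz, hzξ⟩
        rw [hφi (ball_subset_closedBall hz) (mcb hξ1.le) hzξ] at hz
        simp [hξ1] at hz
      obtain ⟨h3, z, hz0, hz1, hz⟩ := (h.Om_compl zero_le_one le_rfl).1 h2
      have h4 : φ ξ ∈ φ '' closedBall 0 1 := ⟨ξ, mcb hξ1.le, rfl⟩
      rw [hφcl] at h4
      have h5 : ‖z‖ = 1 := by
        by_contra hne
        rcases h4 with h4 | h4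
        · exact h3 h4
        · exact h4 ⟨z, by simpa using lt_of_le_of_ne hz1 hne, hz.symm⟩
      refine ⟨z, by simpa using h5, ?_⟩
      simp only [hτ]
      rw [← hz, inv_inv, hp.plInv_left (mcb hξ1.le)]
  obtain ⟨c, hc, hcτ⟩ := mkCone τ hτc hτi hτs
  set f : ℂ → ℂ := fun z => if ‖z‖ ≤ 1 then χ z else (φ (c (cinv z)))⁻¹ with hf
  have hf1 : ∀ z, ‖z‖ ≤ 1 → f z = χ z := fun z hz => if_pos hz
  have hf2 : ∀ z, 1 ≤ ‖z‖ → f z = (φ (c (cinv z)))⁻¹ := by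
    intro z hz
    rcases hz.eq_or_lt with hz | hz
    · rw [hf1 z hz.ge, cinv_of_norm_one hz.symm, hcτ z (by simpa using hz.symm),
        (h1 z hz.symm).2.2, inv_inv]
    · exact if_neg (not_le.2 hz)
  have hcn : ∀ z : ℂ, 1 ≤ ‖z‖ → ‖c (cinv z)‖ ≤ 1 := fun z hz => by
    rw [hc.norm, norm_cinv]; exact inv_le_one_of_one_le₀ hz
  have hcn' : ∀ z : ℂ, 1 < ‖z‖ → ‖c (cinv z)‖ < 1 := fun z hz => by
    rw [hc.norm, norm_cinv]; exact inv_lt_one_of_one_lt₀ hz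
  have hz0 : ∀ z : ℂ, 1 ≤ ‖z‖ → z ≠ 0 := fun z hz h => by rw [h, norm_zero] at hz; linarith
  have hcne : ∀ z : ℂ, 1 ≤ ‖z‖ → c (cinv z) ≠ 0 := fun z hz h => by
    rw [← norm_eq_zero, hc.norm, norm_eq_zero, cinv_eq_zero] at h
    exact hz0 z hz h
  have hfc : Continuous f := by
    rw [← continuousOn_univ]
    refine continuousOn_two_closed (A := {z : ℂ | ‖z‖ ≤ 1}) (B := {z : ℂ | 1 ≤ ‖z‖})
      (isClosed_le continuous_norm continuous_const) (isClosed_le continuous_const continuous_norm)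
      (fun z _ => (le_total ‖z‖ 1 : _ ∨ _)) ?_ ?_
    · rw [univ_inter]
      refine ContinuousOn.congr ?_ hf1
      exact h.cont.mono (fun z hz => mcb hz)
    · rw [univ_inter]
      refine ContinuousOn.congr ?_ hf2
      refine ContinuousOn.inv₀ (hφc.comp (c.continuous.comp_continuousOn
        (cinv_continuousOn.mono (fun z hz => hz0 z hz))) (fun z hz => mcb (hcn z hz))) ?_
      intro z hz
      exact hp.ne_zero (hcn z hz) (hcne z hz)
  have hmix : ∀ z w, ‖z‖ ≤ 1 → 1 < ‖w‖ → f z ≠ f w := by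
    intro z w hz hw hzw
    rw [hf1 z hz, hf2 w hw.le] at hzw
    have h2 : φ (c (cinv w)) ∈ Om χ 1 := by
      rw [← hφo]; exact ⟨_, by simpa using hcn' w hw, rfl⟩
    rcases h2 with h2 | h2
    · exact hp.ne_zero (hcn w hw.le) (hcne w hw.le) h2
    · exact h2 ⟨z, mcb hz, hzw⟩
  have hfi : Function.Injective f := by
    intro z w hzw
    rcases le_or_gt ‖z‖ 1 with hz | hz <;> rcases le_or_gt ‖w‖ 1 with hw | hw
    · rw [hf1 z hz, hf1 w hw] at hzw
      exact h.inj (mcb hz) (mcb hw) hzw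
    · exact absurd hzw (hmix z w hz hw)
    · exact absurd hzw.symm (hmix w z hw hz)
    · rw [hf2 z hz.le, hf2 w hw.le, inv_inj] at hzw
      exact cinv_injective (c.injective (hφi (mcb (hcn z hz.le)) (mcb (hcn w hw.le)) hzw))
  have hfs : Function.Surjective f := by
    intro w
    by_cases hw : w ∈ χ '' closedBall 0 1
    · obtain ⟨z, hz, rfl⟩ := hw
      exact ⟨z, hf1 z (by simpa using hz)⟩
    · have h2 : w⁻¹ ∈ φ '' ball 0 1 := by
        rw [hφo]; right; rwa [inv_inv]
      obtain ⟨v, hv, hvw⟩ := h2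
      have hw0 : w ≠ 0 := by
        rintro rfl
        exact hw ⟨0, by simp, h.zero⟩
      have hv0 : v ≠ 0 := by
        rintro rfl
        rw [hφ0] at hvw
        exact hw0 (by simpa using hvw.symm)
      have hv1 : ‖v‖ < 1 := by simpa using hv
      refine ⟨cinv (c.symm v), ?_⟩
      rw [hf2, cinv_cinv, c.apply_symm_apply, hvw, inv_inv]
      rw [norm_cinv, hc.symm.norm]
      exact (one_le_inv₀ (norm_pos_iff.2 hv0)).2 hv1.le
  have hfp : ∀ R : ℝ, ∃ R' : ℝ, ∀ z, ‖f z‖ ≤ R → ‖z‖ ≤ R' := by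
    intro R
    have hcont : ContinuousAt φ 0 := hφc.continuousAt (closedBall_mem_nhds _ one_pos)
    rw [Metric.continuousAt_iff] at hcont
    obtain ⟨δ, hδ, hd⟩ := hcont (1 / (|R| + 1)) (by positivity)
    refine ⟨max 1 δ⁻¹, fun z hz => ?_⟩
    by_contra hlt
    rw [not_le, max_lt_iff] at hlt
    have hpos : 0 < ‖z‖ := by linarith
    have h3 : ‖c (cinv z)‖ < δ := by
      rw [hc.norm, norm_cinv]; exact inv_lt_of_inv_lt₀ hδ hlt.2
    have h4 := @hd (c (cinv z)) (by simpa using h3)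
    rw [hφ0, dist_zero_right] at h4
    have h5 : 0 < ‖φ (c (cinv z))‖ := norm_pos_iff.2 (hp.ne_zero (hcn z hlt.1.le) (hcne z hlt.1.le))
    rw [hf2 z hlt.1.le, norm_inv] at hz
    have h6 : |R| + 1 < ‖φ (c (cinv z))‖⁻¹ := by
      rw [lt_inv_comm₀ (by positivity) h5]; simpa using h4
    have := le_abs_self R
    linarith
  obtain ⟨H, hH⟩ := homeoOfProper f hfc hfi hfs hfp
  exact ⟨φ, c, H, hφd, hφ0, hφ', hc, fun z hz => by rw [hH, hf1 z hz],
    fun z hz => by rw [hH, hf2 z hz.le]⟩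

/-- Lemma S (Schoenflies with compact support) -/
theorem PlDisc.straighten {χ : ℂ → ℂ} (h : PlDisc χ) : ∃ (H : ℂ ≃ₜ ℂ) (R : ℝ) (c : ℂ ≃ₜ ℂ),
    IsCone c ∧ (∀ w, R ≤ ‖w‖ → H w = w) ∧ ∀ z, ‖z‖ ≤ 1 → H (χ z) = c z := by
  obtain ⟨φ, c1, H1, hφd, hφ0, hφ', hc1, hH1, hH1'⟩ := h.outer
  set a := deriv φ 0 with ha
  have hap : 0 < ‖a‖ := norm_pos_iff.2 hφ'
  have hstrict : HasStrictDerivAt φ a 0 := by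
    have h1 : AnalyticAt ℂ φ 0 := (hφd.analyticOnNhd isOpen_ball) 0 (by simp)
    exact h1.hasStrictDerivAt
  obtain ⟨B, hB0, hB⟩ : ∃ B : ℝ, 0 < B ∧ ∀ z, ‖z‖ ≤ 1 → ‖χ z‖ ≤ B := by
    obtain ⟨B, hB⟩ := h.isCompact_K.isBounded.exists_norm_le
    exact ⟨max B 1, lt_max_of_lt_right one_pos, fun z hz =>
      (hB _ ⟨z, by simpa using hz, rfl⟩).trans (le_max_left _ _)⟩
  obtain ⟨m, s, hs, hm0, hm1, hm2⟩ := germ_lin φ a hφ' hstrict hφ0 B⁻¹ (by positivity)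
  obtain ⟨n, hn⟩ := invConj m hm0 B⁻¹ (by positivity) hm2
  obtain ⟨cc, hcc, hccv⟩ := IsCone.conj
  have hu : ‖(‖a‖ : ℂ) / a‖ = 1 := by
    rw [norm_div, Complex.norm_real, norm_norm, div_self hap.ne']
  obtain ⟨cr, hcr, hcrv⟩ := IsCone.rot _ hu
  set c := (c1.trans cc).trans cr with hcdef
  have hc : IsCone c := (hc1.trans hcc).trans hcr
  set l : ℝ := ‖a‖⁻¹ with hl
  have hlp : 0 < l := by positivity
  have hlc : (l : ℂ) ≠ 0 := by exact_mod_cast hlp.ne'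
  set T := H1.trans n with hT
  have hT1 : ∀ z, ‖z‖ ≤ 1 → T z = χ z := by
    intro z hz
    show n (H1 z) = _
    rw [hH1 z hz, hn]
    by_cases h0 : χ z = 0
    · simp [h0, hm0]
    · rw [hm2, inv_inv]
      rw [norm_inv]
      exact inv_anti₀ (norm_pos_iff.2 h0) (hB z hz)
  set N : ℝ := max 2 s⁻¹ with hN
  have hT2 : ∀ z, N ≤ ‖z‖ → T z = l * c z := by
    intro z hz
    have hz1 : 1 < ‖z‖ := lt_of_lt_of_le (by norm_num) ((le_max_left _ _).trans hz)
    have hz0 : z ≠ 0 := by rintro rfl; simp at hz1; linarith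
    show n (H1 z) = _
    rw [hH1' z hz1, hn, inv_inv, hm1]
    · show _ = (l : ℂ) * (cr (cc (c1 z)))
      rw [hcrv, hccv, hc1.cinv, cinv, hl]
      push_cast
      have : (‖a‖ : ℂ) ≠ 0 := by exact_mod_cast hap.ne'
      rw [mul_inv, inv_inv]
      field_simp
    · rw [hc1.norm, norm_cinv]
      exact inv_le_of_inv_le₀ hs ((le_max_right _ _).trans hz)
  set H0 := (T.symm.trans c).trans (Homeomorph.mulLeft₀ (l : ℂ) hlc) with hH0
  have hH0v : ∀ z, H0 (T z) = l * c z := fun z => by simp [hH0]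
  obtain ⟨S, M, hS0, hS1, hS2⟩ := scaleHomeo l hlp 1
  obtain ⟨R0, hR0⟩ := (((isCompact_closedBall (0:ℂ) N).image T.continuous).isBounded).exists_norm_le
  refine ⟨H0.trans S, max (R0 + 1) M, c, hc, ?_, ?_⟩
  · intro w hw
    have h1 : R0 + 1 ≤ ‖w‖ := (le_max_left _ _).trans hw
    have h2 : N ≤ ‖T.symm w‖ := by
      by_contra hlt
      have := hR0 w ⟨T.symm w, by simpa using (not_le.1 hlt).le, by simp⟩
      linarith
    have h3 : H0 w = w := by
      have h4 := hH0v (T.symm w)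
      rw [← hT2 _ h2, T.apply_symm_apply] at h4
      exact h4
    show S (H0 w) = w
    rw [h3, hS2 w ((le_max_right _ _).trans hw)]
  · intro z hz
    show S (H0 (χ z)) = c z
    rw [← hT1 z hz, hH0v, hS1]
    rwa [hc.norm]

theorem chartHomeo {W : Type*} [TopologicalSpace W] [T2Space W] {ψ : ℂ → W} (hψ : IsOpenEmbedding ψ)
    (H : ℂ ≃ₜ ℂ) (R : ℝ) (hR : ∀ w, R ≤ ‖w‖ → H w = w) :
    ∃ k : W ≃ₜ W, (∀ z, k (ψ z) = ψ (H z)) ∧ ∀ w, w ∉ range ψ → k w = w := by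
  have e1 : ∀ (H : ℂ ≃ₜ ℂ) z, Function.extend ψ (ψ ∘ H) id (ψ z) = ψ (H z) := fun H z =>
    hψ.injective.extend_apply _ _ z
  have e2 : ∀ (H : ℂ ≃ₜ ℂ) w, w ∉ range ψ → Function.extend ψ (ψ ∘ H) id w = w := fun H w hw =>
    Function.extend_apply' _ _ _ hw
  have key : ∀ H : ℂ ≃ₜ ℂ, (∀ w, R ≤ ‖w‖ → H w = w) → Continuous (Function.extend ψ (ψ ∘ H) id) := by
    intro H hH
    rw [continuous_iff_continuousAt]
    intro x
    by_cases hx : x ∈ range ψ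
    · obtain ⟨z, rfl⟩ := hx
      rw [← hψ.continuousAt_iff]
      have : Function.extend ψ (ψ ∘ H) id ∘ ψ = ψ ∘ H := funext (e1 H)
      rw [this]
      exact (hψ.continuous.comp H.continuous).continuousAt
    · have hcl : IsClosed (ψ '' closedBall 0 R) :=
        ((isCompact_closedBall 0 R).image hψ.continuous).isClosed
      have hmem : (ψ '' closedBall 0 R)ᶜ ∈ 𝓝 x := by
        refine hcl.isOpen_compl.mem_nhds ?_
        rintro ⟨z, _, rfl⟩
        exact hx ⟨z, rfl⟩
      refine continuousAt_id.congr ?_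
      filter_upwards [hmem] with y hy
      by_cases hy' : y ∈ range ψ
      · obtain ⟨z, rfl⟩ := hy'
        rw [e1, hH z]; rfl
        by_contra hlt
        exact hy ⟨z, by simpa using (not_le.1 hlt).le, rfl⟩
      · rw [e2 H y hy']; rfl
  have kinv : ∀ H : ℂ ≃ₜ ℂ, ∀ x, Function.extend ψ (ψ ∘ H.symm) id
      (Function.extend ψ (ψ ∘ H) id x) = x := by
    intro H x
    by_cases hx : x ∈ range ψ
    · obtain ⟨z, rfl⟩ := hx
      rw [e1, e1, H.symm_apply_apply]
    · rw [e2 H x hx, e2 _ x hx]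
  have hRs : ∀ w, R ≤ ‖w‖ → H.symm w = w := fun w hw => by
    rw [Homeomorph.symm_apply_eq, hR w hw]
  exact ⟨⟨⟨Function.extend ψ (ψ ∘ H) id, Function.extend ψ (ψ ∘ H.symm) id, kinv H, kinv H.symm⟩,
    key H hR, key H.symm hRs⟩, e1 H, e2 H⟩

/-- a compactly supported homeomorphism moving one point to another -/
theorem moveHomeo (a b : ℂ) : ∃ (H : ℂ ≃ₜ ℂ) (R : ℝ), (∀ w, R ≤ ‖w‖ → H w = w) ∧ H a = b := by
  obtain ⟨S, M, -, h1, h2⟩ := scaleHomeo (1 / 2) (by norm_num) ‖2 * (b - a)‖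
  set q := 2 * a - b with hq
  refine ⟨((Homeomorph.addRight (-q)).trans S).trans (Homeomorph.addRight q), M + ‖q‖, ?_, ?_⟩
  · intro w hw
    have : M ≤ ‖w + -q‖ := by
      have := norm_sub_norm_le w q
      rw [← sub_eq_add_neg]; linarith
    simp [h2 _ this]
  · have h3 := h1 (2 * (b - a)) le_rfl
    have h4 : a + -q = ((1 / 2 : ℝ) : ℂ) * (2 * (b - a)) := by rw [hq]; push_cast; ring
    show S (a + -q) + q = b
    rw [h4, h3, hq]; ring

structure Surf (W : Type*) [TopologicalSpace W] : Prop where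
  compact : CompactSpace W
  t2 : T2Space W
  conn : PreconnectedSpace W
  chart : ∀ x : W, ∃ ψ : ℂ → W, IsOpenEmbedding ψ ∧ x ∈ range ψ

theorem Surf.homog {W : Type*} [TopologicalSpace W] (hW : Surf W) (x y : W) : ∃ k : W ≃ₜ W, k x = y := by
  have := hW.t2
  have := hW.conn
  have hloc : ∀ a : W, ∃ U : Set W, IsOpen U ∧ a ∈ U ∧ ∀ b ∈ U, ∃ k : W ≃ₜ W, k a = b := by
    intro a
    obtain ⟨ψ, hψ, z, rfl⟩ := hW.chart a
    refine ⟨range ψ, hψ.isOpen_range, ⟨z, rfl⟩, ?_⟩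
    rintro _ ⟨w, rfl⟩
    obtain ⟨H, R, hR, hH⟩ := moveHomeo z w
    obtain ⟨k, hk, -⟩ := chartHomeo hψ H R hR
    exact ⟨k, by rw [hk, hH]⟩
  set S : Set W := {y | ∃ k : W ≃ₜ W, k x = y} with hS
  have hSo : IsOpen S := by
    rw [isOpen_iff_mem_nhds]
    rintro a ⟨k, hk⟩
    obtain ⟨U, hU, haU, h⟩ := hloc a
    filter_upwards [hU.mem_nhds haU] with b hb
    obtain ⟨k', hk'⟩ := h b hb
    exact ⟨k.trans k', by simp [hk, hk']⟩
  have hSc : IsClosed S := by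
    rw [← isOpen_compl_iff, isOpen_iff_mem_nhds]
    intro a ha
    obtain ⟨U, hU, haU, h⟩ := hloc a
    filter_upwards [hU.mem_nhds haU] with b hb
    rintro ⟨k, hk⟩
    obtain ⟨k', hk'⟩ := h b hb
    exact ha ⟨k.trans k'.symm, by rw [Homeomorph.trans_apply, hk, Homeomorph.symm_apply_eq, hk']⟩
  have : S = univ := IsClopen.eq_univ ⟨hSc, hSo⟩ ⟨x, Homeomorph.refl W, rfl⟩
  have hy : y ∈ S := by rw [this]; trivial
  exact hy

/-- the germ of a chart can be replaced by the whole unit disc -/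
theorem chartScale {W : Type*} [TopologicalSpace W] [T2Space W] {ψ : ℂ → W} (hψ : IsOpenEmbedding ψ)
    (δ : ℝ) (hδ : 0 < δ) (A : ℝ) : ∃ k : W ≃ₜ W, (∀ z : ℂ, ‖z‖ ≤ A → k (ψ (δ * z)) = ψ z) ∧
      ∀ w, w ∉ range ψ → k w = w := by
  obtain ⟨S, M, -, h1, h2⟩ := scaleHomeo δ hδ A
  obtain ⟨k, hk, hk'⟩ := chartHomeo hψ S M h2
  exact ⟨k, fun z hz => by rw [hk, h1 z hz], hk'⟩

/-- straightening of charts -/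
theorem Surf.straighten {W : Type*} [TopologicalSpace W] (hW : Surf W) {ψ ψ' : ℂ → W}
    (hψ : IsOpenEmbedding ψ) (hψ' : IsOpenEmbedding ψ') :
    ∃ (k : W ≃ₜ W) (c : ℂ ≃ₜ ℂ), IsCone c ∧ ∀ z, ‖z‖ ≤ 1 → k (ψ z) = ψ' (c z) := by
  have := hW.t2
  obtain ⟨k1, hk1⟩ := hW.homog (ψ 0) (ψ' 0)
  have ho : IsOpenEmbedding (k1 ∘ ψ) := k1.isOpenEmbedding.comp hψ
  have hpre : IsOpen ((k1 ∘ ψ) ⁻¹' range ψ') := hψ'.isOpen_range.preimage ho.continuous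
  obtain ⟨δ, hδ, hb⟩ := Metric.isOpen_iff.1 hpre 0 ⟨0, hk1.symm⟩
  set ε := δ / 2 with hε
  have hε0 : 0 < ε := by positivity
  have hmem : ∀ z : ℂ, ‖z‖ ≤ 1 → k1 (ψ (ε * z)) ∈ range ψ' := by
    intro z hz
    refine hb ?_
    rw [mem_ball_zero_iff, norm_mul, Complex.norm_real, Real.norm_eq_abs, abs_of_pos hε0]
    nlinarith
  set inv := Function.invFun ψ' with hinv
  have hinvl : ∀ z, inv (ψ' z) = z := Function.leftInverse_invFun hψ'.injective
  have hinvr : ∀ w ∈ range ψ', ψ' (inv w) = w := by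
    rintro _ ⟨z, rfl⟩; rw [hinvl]
  set χ : ℂ → ℂ := fun z => inv (k1 (ψ (ε * z))) with hχ
  have hχr : ∀ z : ℂ, ‖z‖ ≤ 1 → ψ' (χ z) = k1 (ψ (ε * z)) := fun z hz => hinvr _ (hmem z hz)
  have hεc : (ε : ℂ) ≠ 0 := by exact_mod_cast hε0.ne'
  have hP : PlDisc χ := by
    have hcont : ContinuousOn χ (closedBall 0 1) := by
      have : ContinuousOn (ψ' ∘ χ) (closedBall 0 1) := by
        refine ContinuousOn.congr (f := fun z : ℂ => k1 (ψ (ε * z))) ?_ (fun z hz => hχr z (by simpa using hz))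
        exact (k1.continuous.comp (hψ.continuous.comp (by fun_prop))).continuousOn
      exact hψ'.isEmbedding.isInducing.continuousOn_iff.2 this
    refine ⟨hcont, ?_, ?_, ?_⟩
    · intro z hz w hw hzw
      have h1 := hχr z (by simpa using hz)
      rw [hzw, hχr w (by simpa using hw)] at h1
      exact (mul_left_cancel₀ hεc (hψ.injective (k1.injective h1))).symm
    · have : χ '' ball 0 1 = ψ' ⁻¹' ((k1 ∘ ψ) '' ((fun z => (ε : ℂ) * z) '' ball 0 1)) := by
        ext w
        constructor
        · rintro ⟨z, hz, rfl⟩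
          exact ⟨ε * z, ⟨z, hz, rfl⟩, (hχr z (by simpa using (mem_ball_zero_iff.1 hz).le)).symm⟩
        · rintro ⟨_, ⟨z, hz, rfl⟩, hzw⟩
          refine ⟨z, hz, hψ'.injective ?_⟩
          rw [hχr z (by simpa using (mem_ball_zero_iff.1 hz).le), ← hzw]; rfl
      rw [this]
      refine IsOpen.preimage hψ'.continuous (ho.isOpenMap _ ?_)
      exact (Homeomorph.mulLeft₀ (ε : ℂ) hεc).isOpenMap _ isOpen_ball
    · simp only [hχ, mul_zero, hk1, hinvl]
  obtain ⟨H, R, c, hc, hHR, hH⟩ := hP.straighten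
  obtain ⟨k2, hk2, -⟩ := chartHomeo hψ' H R hHR
  obtain ⟨k3, hk3, -⟩ := chartScale hψ ε hε0 1
  refine ⟨(k3.symm.trans k1).trans k2, c, hc, fun z hz => ?_⟩
  have : k3.symm (ψ z) = ψ (ε * z) := by rw [Homeomorph.symm_apply_eq, hk3 z hz]
  simp only [Homeomorph.trans_apply, this]
  rw [← hχr z hz, hk2, hH z hz]

/-- closed gluing of `W` minus a chart ball and `Y` minus a chart ball along the boundary circles -/
structure CSData {Z W Y : Type*} [TopologicalSpace Z] [TopologicalSpace W] [TopologicalSpace Y]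
    (ψ : ℂ → W) (η : ℂ → Y) (i : W → Z) (j : Y → Z) : Prop where
  hψ : IsOpenEmbedding ψ
  hη : IsOpenEmbedding η
  ci : ContinuousOn i (ψ '' ball 0 1)ᶜ
  cj : ContinuousOn j (η '' ball 0 1)ᶜ
  ii : InjOn i (ψ '' ball 0 1)ᶜ
  ij : InjOn j (η '' ball 0 1)ᶜ
  seam : ∀ ζ, ‖ζ‖ = 1 → i (ψ ζ) = j (η ζ)
  ovl : ∀ w ∉ ψ '' ball 0 1, ∀ y ∉ η '' ball 0 1, i w = j y → ∃ ζ, ‖ζ‖ = 1 ∧ w = ψ ζ ∧ y = η ζ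
  cov : ∀ z, (∃ w ∉ ψ '' ball 0 1, i w = z) ∨ ∃ y ∉ η '' ball 0 1, j y = z

def CSum (Z W : Type*) [TopologicalSpace Z] [TopologicalSpace W] (ψ : ℂ → W)
    (Y : Type*) [TopologicalSpace Y] (η : ℂ → Y) : Prop :=
  ∃ (i : W → Z) (j : Y → Z), CSData ψ η i j

section
variable {Z Z' W W' Y P : Type*} [TopologicalSpace Z] [TopologicalSpace Z'] [TopologicalSpace W]
  [TopologicalSpace W'] [TopologicalSpace Y] [TopologicalSpace P]
  {ψ : ℂ → W} {η : ℂ → Y} {i : W → Z} {j : Y → Z}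

theorem not_mem_chart_ball {ψ : ℂ → W} (hψ : IsOpenEmbedding ψ) {z : ℂ} {r : ℝ} :
    ψ z ∉ ψ '' ball 0 r ↔ r ≤ ‖z‖ := by
  rw [hψ.injective.mem_set_image]; simp

theorem isClosed_compl_chart {ψ : ℂ → W} (hψ : IsOpenEmbedding ψ) (r : ℝ) : IsClosed (ψ '' ball 0 r)ᶜ :=
  (hψ.isOpenMap _ isOpen_ball).isClosed_compl

theorem CSData.symm (h : CSData ψ η i j) : CSData η ψ j i where
  hψ := h.hη
  hη := h.hψ
  ci := h.cj
  cj := h.ci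
  ii := h.ij
  ij := h.ii
  seam := fun ζ hζ => (h.seam ζ hζ).symm
  ovl := fun y hy w hw hyw => by
    obtain ⟨ζ, h1, h2, h3⟩ := h.ovl w hw y hy hyw.symm
    exact ⟨ζ, h1, h3, h2⟩
  cov := fun z => (h.cov z).symm

theorem CSum.symm (h : CSum Z W ψ Y η) : CSum Z Y η W ψ := by
  obtain ⟨i, j, h⟩ := h
  exact ⟨j, i, h.symm⟩

theorem CSum.change (h : CSum Z W ψ Y η) (k : W ≃ₜ W') (c : ℂ ≃ₜ ℂ) (hc : IsCone c) {ψ' : ℂ → W'}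
    (hψ' : IsOpenEmbedding ψ') (hk : ∀ z, ‖z‖ ≤ 1 → k (ψ z) = ψ' (c z)) :
    CSum Z W' ψ' Y (η ∘ c.symm) := by
  obtain ⟨i, j, h⟩ := h
  have hk' : ∀ z, ‖z‖ ≤ 1 → k.symm (ψ' z) = ψ (c.symm z) := fun z hz => by
    rw [Homeomorph.symm_apply_eq, hk _ (by rwa [hc.symm.norm]), c.apply_symm_apply]
  have hb : ∀ w, w ∉ ψ' '' ball 0 1 ↔ k.symm w ∉ ψ '' ball 0 1 := by
    intro w
    rw [not_iff_not]
    constructor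
    · rintro ⟨z, hz, rfl⟩
      have hz1 : ‖z‖ < 1 := by simpa using hz
      exact ⟨c.symm z, by simpa [hc.symm.norm] using hz1, (hk' z hz1.le).symm⟩
    · rintro ⟨z, hz, hzw⟩
      have hz1 : ‖z‖ < 1 := by simpa using hz
      refine ⟨c z, by simpa [hc.norm] using hz1, ?_⟩
      rw [← hk z hz1.le, hzw, k.apply_symm_apply]
  have he : (η ∘ c.symm) '' ball 0 1 = η '' ball 0 1 := by
    rw [image_comp]
    congr 1
    ext z
    constructor
    · rintro ⟨w, hw, rfl⟩
      simpa [hc.symm.norm] using hw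
    · intro hz
      exact ⟨c z, by simpa [hc.norm] using hz, by simp⟩
  refine ⟨i ∘ k.symm, j, ⟨hψ', h.hη.comp c.symm.isOpenEmbedding, ?_, by rw [he]; exact h.cj, ?_,
    by rw [he]; exact h.ij, ?_, ?_, ?_⟩⟩
  · exact h.ci.comp k.symm.continuous.continuousOn (fun w hw => (hb w).1 hw)
  · intro x hx y hy hxy
    exact k.symm.injective (h.ii ((hb x).1 hx) ((hb y).1 hy) hxy)
  · intro ζ hζ
    simp only [Function.comp_apply]
    rw [hk' ζ hζ.le, h.seam _ (by rwa [hc.symm.norm])]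
  · intro w hw y hy hwy
    rw [he] at hy
    obtain ⟨ζ, h1, h2, h3⟩ := h.ovl _ ((hb w).1 hw) y hy hwy
    refine ⟨c ζ, by rwa [hc.norm], ?_, by simp [h3]⟩
    rw [← hk ζ h1.le, ← h2, k.apply_symm_apply]
  · intro z
    rw [he]
    rcases h.cov z with ⟨w, hw, rfl⟩ | h1
    · left
      exact ⟨k w, by rw [hb]; simpa using hw, by simp⟩
    · exact Or.inr h1

/-- transport along a homeomorphism of the sum -/
theorem CSum.transport (h : CSum Z W ψ Y η) (k : Z ≃ₜ Z') : CSum Z' W ψ Y η := by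
  obtain ⟨i, j, h⟩ := h
  refine ⟨k ∘ i, k ∘ j, ⟨h.hψ, h.hη, k.continuous.comp_continuousOn h.ci,
    k.continuous.comp_continuousOn h.cj, k.injective.comp_injOn h.ii, k.injective.comp_injOn h.ij,
    fun ζ hζ => congrArg k (h.seam ζ hζ), fun w hw y hy hwy => h.ovl w hw y hy (k.injective hwy), ?_⟩⟩
  intro z
  rcases h.cov (k.symm z) with ⟨w, hw, hz⟩ | ⟨w, hw, hz⟩
  · left; exact ⟨w, hw, by simp [hz]⟩
  · right; exact ⟨w, hw, by simp [hz]⟩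

theorem CSData.closed_crit [T2Space Z] [CompactSpace W] [CompactSpace Y] (h : CSData ψ η i j) (S : Set Z)
    (h1 : IsClosed {w | w ∉ ψ '' ball 0 1 ∧ i w ∈ S}) (h2 : IsClosed {y | y ∉ η '' ball 0 1 ∧ j y ∈ S}) :
    IsClosed S := by
  have : S = i '' {w | w ∉ ψ '' ball 0 1 ∧ i w ∈ S} ∪ j '' {y | y ∉ η '' ball 0 1 ∧ j y ∈ S} := by
    apply subset_antisymm
    · intro z hz
      rcases h.cov z with ⟨w, hw, rfl⟩ | ⟨w, hw, rfl⟩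
      · left; exact ⟨w, ⟨hw, hz⟩, rfl⟩
      · right; exact ⟨w, ⟨hw, hz⟩, rfl⟩
    · rintro z (⟨w, hw, rfl⟩ | ⟨w, hw, rfl⟩)
      · exact hw.2
      · exact hw.2
  rw [this]
  refine IsClosed.union (IsCompact.isClosed (h1.isCompact.image_of_continuousOn (h.ci.mono ?_)))
    (IsCompact.isClosed (h2.isCompact.image_of_continuousOn (h.cj.mono ?_)))
  · intro w hw; exact hw.1
  · intro w hw; exact hw.1

theorem CSData.desc [T2Space Z] [CompactSpace W] [CompactSpace Y] (h : CSData ψ η i j)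
    (a : W → P) (b : Y → P) (ha : ContinuousOn a (ψ '' ball 0 1)ᶜ) (hb : ContinuousOn b (η '' ball 0 1)ᶜ)
    (hab : ∀ ζ, ‖ζ‖ = 1 → a (ψ ζ) = b (η ζ)) :
    ∃ F : Z → P, Continuous F ∧ (∀ w ∉ ψ '' ball 0 1, F (i w) = a w) ∧
      ∀ y ∉ η '' ball 0 1, F (j y) = b y := by
  have hex : ∀ z, ∃ p, (∀ w ∉ ψ '' ball 0 1, i w = z → a w = p) ∧
      ∀ y ∉ η '' ball 0 1, j y = z → b y = p := by
    intro z
    rcases h.cov z with ⟨w, hw, rfl⟩ | ⟨y, hy, rfl⟩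
    · refine ⟨a w, fun w' hw' he => by rw [h.ii hw' hw he], fun y hy he => ?_⟩
      obtain ⟨ζ, h1, h2, h3⟩ := h.ovl w hw y hy he.symm
      rw [h2, h3, hab ζ h1]
    · refine ⟨b y, fun w hw he => ?_, fun y' hy' he => by rw [h.ij hy' hy he]⟩
      obtain ⟨ζ, h1, h2, h3⟩ := h.ovl w hw y hy he
      rw [h2, h3, hab ζ h1]
  choose F hF1 hF2 using hex
  refine ⟨F, ?_, fun w hw => (hF1 _ w hw rfl).symm, fun y hy => (hF2 _ y hy rfl).symm⟩
  rw [continuous_iff_isClosed]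
  intro C hC
  refine h.closed_crit _ ?_ ?_
  · have : {w | w ∉ ψ '' ball 0 1 ∧ i w ∈ F ⁻¹' C} = (ψ '' ball 0 1)ᶜ ∩ a ⁻¹' C := by
      ext w
      refine and_congr_right fun hw => ?_
      rw [mem_preimage, mem_preimage, hF1 _ w hw rfl]
    rw [this]
    exact ha.preimage_isClosed_of_isClosed (isClosed_compl_chart h.hψ 1) hC
  · have : {w | w ∉ η '' ball 0 1 ∧ j w ∈ F ⁻¹' C} = (η '' ball 0 1)ᶜ ∩ b ⁻¹' C := by
      ext w
      refine and_congr_right fun hw => ?_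
      rw [mem_preimage, mem_preimage, hF2 _ w hw rfl]
    rw [this]
    exact hb.preimage_isClosed_of_isClosed (isClosed_compl_chart h.hη 1) hC

theorem CSum.unique [T2Space Z] [T2Space Z'] [CompactSpace W] [CompactSpace Y]
    (h : CSum Z W ψ Y η) (h' : CSum Z' W ψ Y η) : Nonempty (Z ≃ₜ Z') := by
  obtain ⟨i, j, h⟩ := h
  obtain ⟨i', j', h'⟩ := h'
  obtain ⟨F, hF, hF1, hF2⟩ := h.desc i' j' h'.ci h'.cj h'.seam
  obtain ⟨G, hG, hG1, hG2⟩ := h'.desc i j h.ci h.cj h.seam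
  refine ⟨⟨⟨F, G, ?_, ?_⟩, hF, hG⟩⟩
  · intro z
    rcases h.cov z with ⟨w, hw, rfl⟩ | ⟨w, hw, rfl⟩
    · rw [hF1 w hw, hG1 w hw]
    · rw [hF2 w hw, hG2 w hw]
  · intro z
    rcases h'.cov z with ⟨w, hw, rfl⟩ | ⟨w, hw, rfl⟩
    · rw [hG1 w hw, hF1 w hw]
    · rw [hG2 w hw, hF2 w hw]

theorem CSum.compactSpace [CompactSpace W] [CompactSpace Y] (h : CSum Z W ψ Y η) : CompactSpace Z := by
  obtain ⟨i, j, h⟩ := h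
  constructor
  have : (univ : Set Z) = i '' (ψ '' ball 0 1)ᶜ ∪ j '' (η '' ball 0 1)ᶜ := by
    symm
    rw [eq_univ_iff_forall]
    intro z
    rcases h.cov z with ⟨w, hw, rfl⟩ | ⟨w, hw, rfl⟩
    · left; exact ⟨w, hw, rfl⟩
    · right; exact ⟨w, hw, rfl⟩
  rw [this]
  exact ((isClosed_compl_chart h.hψ 1).isCompact.image_of_continuousOn h.ci).union
    ((isClosed_compl_chart h.hη 1).isCompact.image_of_continuousOn h.cj)

theorem preconn_compl_chart [T2Space W] [PreconnectedSpace W] {ψ : ℂ → W} (hψ : IsOpenEmbedding ψ) :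
    IsPreconnected (ψ '' ball 0 1)ᶜ := by
  have hcl := isClosed_compl_chart hψ 1
  have hDc : IsClosed (ψ '' closedBall 0 1) := ((isCompact_closedBall 0 1).image hψ.continuous).isClosed
  have hsp : IsPreconnected (ψ '' sphere 0 1) := by
    refine IsPreconnected.image ?_ _ hψ.continuous.continuousOn
    refine isPreconnected_sphere ?_ 0 1
    rw [Complex.rank_real_complex]; exact Nat.one_lt_ofNat
  have hsub : ψ '' sphere 0 1 ⊆ (ψ '' ball 0 1)ᶜ := by
    rintro _ ⟨z, hz, rfl⟩
    rw [mem_compl_iff, not_mem_chart_ball hψ]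
    have : ‖z‖ = 1 := by simpa using hz
    exact this.ge
  rw [isPreconnected_closed_iff]
  -- key : if the circle is inside `s`, then the part of `t` is all closed and open
  have key : ∀ s t : Set W, IsClosed s → IsClosed t → (ψ '' ball 0 1)ᶜ ⊆ s ∪ t →
      ((ψ '' ball 0 1)ᶜ ∩ s).Nonempty → ((ψ '' ball 0 1)ᶜ ∩ t).Nonempty →
      ψ '' sphere 0 1 ⊆ s → ((ψ '' ball 0 1)ᶜ ∩ (s ∩ t)).Nonempty := by
    intro s t hs ht hst _ ht' hss
    by_contra hne
    rw [not_nonempty_iff_eq_empty] at hne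
    have hpre := PreconnectedSpace.isPreconnected_univ (α := W)
    rw [isPreconnected_closed_iff] at hpre
    obtain ⟨x, hx1, hx2⟩ := ht'
    obtain ⟨y, -, hy1, hy2⟩ := hpre (ψ '' closedBall 0 1 ∪ ((ψ '' ball 0 1)ᶜ ∩ s)) ((ψ '' ball 0 1)ᶜ ∩ t)
      (hDc.union (hcl.inter hs)) (hcl.inter ht) (by
        intro w _
        by_cases hw : w ∈ ψ '' ball 0 1
        · left; left; exact image_mono ball_subset_closedBall hw
        · rcases hst hw with h | h
          · left; right; exact ⟨hw, h⟩
          · right; exact ⟨hw, h⟩)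
      ⟨ψ 0, trivial, Or.inl ⟨0, by simp, rfl⟩⟩ ⟨x, trivial, hx1, hx2⟩
    have : y ∈ (ψ '' ball 0 1)ᶜ ∩ (s ∩ t) := by
      refine ⟨hy2.1, ?_, hy2.2⟩
      rcases hy1 with ⟨z, hz, rfl⟩ | h
      · have h1 := (not_mem_chart_ball hψ).1 hy2.1
        have h2 : ‖z‖ ≤ 1 := by simpa using hz
        exact hss ⟨z, by simpa using le_antisymm h2 h1, rfl⟩
      · exact h.2
    rw [hne] at this
    exact this
  intro s t hs ht hst hs' ht'
  by_contra hne
  have h1 := (isPreconnected_iff_subset_of_disjoint_closed.1 hsp) s t hs ht (hsub.trans hst) (by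
    rw [not_nonempty_iff_eq_empty] at hne
    rw [eq_empty_iff_forall_notMem] at hne ⊢
    rintro x ⟨hx, hx'⟩
    exact hne x ⟨hsub hx, hx'⟩)
  rcases h1 with h1 | h1
  · exact hne (key s t hs ht hst hs' ht' h1)
  · rw [inter_comm s t] at hne
    exact hne (key t s ht hs (by rwa [union_comm]) ht' hs' h1)

theorem CSum.preconnectedSpace [T2Space W] [T2Space Y] [PreconnectedSpace W] [PreconnectedSpace Y]
    (h : CSum Z W ψ Y η) : PreconnectedSpace Z := by
  obtain ⟨i, j, h⟩ := h
  constructor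
  have : (univ : Set Z) = i '' (ψ '' ball 0 1)ᶜ ∪ j '' (η '' ball 0 1)ᶜ := by
    symm
    rw [eq_univ_iff_forall]
    intro z
    rcases h.cov z with ⟨w, hw, rfl⟩ | ⟨w, hw, rfl⟩
    · left; exact ⟨w, hw, rfl⟩
    · right; exact ⟨w, hw, rfl⟩
  rw [this]
  refine IsPreconnected.union (i (ψ 1)) ?_ ?_ ((preconn_compl_chart h.hψ).image _ h.ci)
    ((preconn_compl_chart h.hη).image _ h.cj)
  · exact ⟨ψ 1, by rw [mem_compl_iff, not_mem_chart_ball h.hψ]; simp, rfl⟩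
  · exact ⟨η 1, by rw [mem_compl_iff, not_mem_chart_ball h.hη]; simp, by rw [h.seam 1 (by simp)]⟩

end

theorem squeeze (r R : ℝ) (hr : 0 < r) (hR : r < R) : ∃ σ : ℂ → ℂ, IsOpenEmbedding σ ∧
    (∀ z, ‖z‖ ≤ r → σ z = z) ∧ ∀ z, ‖σ z‖ < R := by
  set d := R - r with hd
  have hdp : 0 < d := by linarith
  set f : ℝ → ℝ := fun s => min s r + d * max (s - r) 0 / (max (s - r) 0 + d) with hf
  set g : ℝ → ℝ := fun t => min t r + d * max (t - r) 0 / (R - t) with hg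
  have hf1 : ∀ s, s ≤ r → f s = s := fun s hs => by
    simp only [hf]; rw [min_eq_left hs, max_eq_right (by linarith)]; simp
  have hg1 : ∀ s, s ≤ r → g s = s := fun s hs => by
    simp only [hg]; rw [min_eq_left hs, max_eq_right (by linarith)]; simp
  have hf2 : ∀ s, r ≤ s → f s = r + d * (s - r) / (s - r + d) := fun s hs => by
    simp only [hf]; rw [min_eq_right hs, max_eq_left (by linarith)]
  have hg2 : ∀ s, r ≤ s → g s = r + d * (s - r) / (R - s) := fun s hs => by
    simp only [hg]; rw [min_eq_right hs, max_eq_left (by linarith)]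
  have hfR : ∀ s, f s < R := by
    intro s
    rcases le_total s r with h | h
    · rw [hf1 s h]; linarith
    · rw [hf2 s h]
      have hp : 0 < s - r + d := by linarith
      have : d * (s - r) / (s - r + d) < d := by
        rw [div_lt_iff₀ hp]; nlinarith
      linarith
  have hfr : ∀ s, r ≤ s → r ≤ f s := fun s hs => by
    rw [hf2 s hs]
    have : 0 ≤ d * (s - r) / (s - r + d) :=
      div_nonneg (mul_nonneg hdp.le (by linarith)) (by linarith)
    linarith
  have hgr : ∀ s, r ≤ s → s < R → r ≤ g s := fun s hs hsR => by
    rw [hg2 s hs]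
    have : 0 ≤ d * (s - r) / (R - s) := div_nonneg (mul_nonneg hdp.le (by linarith)) (by linarith)
    linarith
  have hgf : ∀ s, g (f s) = s := by
    intro s
    rcases le_total s r with h | h
    · rw [hf1 s h, hg1 s h]
    · rw [hg2 _ (hfr s h), hf2 s h]
      have hp : s - r + d ≠ 0 := by linarith
      have h1 : R - (r + d * (s - r) / (s - r + d)) = d * d / (s - r + d) := by
        rw [show R = r + d by rw [hd]; ring]; field_simp; ring
      rw [h1]
      field_simp
      ring
  have hfg : ∀ t, t < R → f (g t) = t := by
    intro s hsR
    rcases le_total s r with h | h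
    · rw [hg1 s h, hf1 s h]
    · rw [hf2 _ (hgr s h hsR), hg2 s h]
      have hp : R - s ≠ 0 := by linarith
      have h1 : r + d * (s - r) / (R - s) - r + d = d * d / (R - s) := by
        field_simp; rw [hd]; ring
      rw [h1]
      field_simp
      ring
  have hf0 : ∀ s, 0 < s → 0 < f s := fun s hs => by
    rcases le_total s r with h | h
    · rwa [hf1 s h]
    · exact hr.trans_le (hfr s h)
  have hg0 : ∀ s, 0 < s → s < R → 0 < g s := fun s hs hsR => by
    rcases le_total s r with h | h
    · rwa [hg1 s h]
    · exact hr.trans_le (hgr s h hsR)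
  have hfc : Continuous f := by
    simp only [hf]
    refine Continuous.add (by fun_prop) (Continuous.div (by fun_prop) (by fun_prop) ?_)
    intro s
    have := le_max_right (s - r) 0
    linarith
  have hgc : ContinuousOn g (Iio R) := by
    simp only [hg]
    refine ContinuousOn.add (by fun_prop) (ContinuousOn.div (by fun_prop) (by fun_prop) ?_)
    intro s hs
    have : s < R := hs
    linarith
  -- radial maps
  have rn : ∀ (h : ℝ → ℝ) (z : ℂ), z ≠ 0 → 0 < h ‖z‖ → ‖((h ‖z‖ / ‖z‖ : ℝ) : ℂ) * z‖ = h ‖z‖ := by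
    intro h z hz hp
    have hz' : 0 < ‖z‖ := norm_pos_iff.2 hz
    rw [norm_mul, Complex.norm_real, Real.norm_eq_abs, abs_of_pos (by positivity)]
    field_simp
  have rid : ∀ (h : ℝ → ℝ) (z : ℂ), h ‖z‖ = ‖z‖ → ((h ‖z‖ / ‖z‖ : ℝ) : ℂ) * z = z := by
    intro h z hz
    by_cases hz0 : z = 0
    · simp [hz0]
    · have : ‖z‖ ≠ 0 := by simpa using hz0
      rw [hz, div_self this]; simp
  have rinv : ∀ (h k : ℝ → ℝ) (z : ℂ), 0 < h ‖z‖ → k (h ‖z‖) = ‖z‖ →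
      ((k ‖((h ‖z‖ / ‖z‖ : ℝ) : ℂ) * z‖ / ‖((h ‖z‖ / ‖z‖ : ℝ) : ℂ) * z‖ : ℝ) : ℂ) *
        (((h ‖z‖ / ‖z‖ : ℝ) : ℂ) * z) = z := by
    intro h k z hp hk
    by_cases hz : z = 0
    · simp [hz]
    · rw [rn h z hz hp, hk]
      have h3 : (‖z‖ : ℂ) ≠ 0 := by simpa using hz
      have h4 : (h ‖z‖ : ℂ) ≠ 0 := by exact_mod_cast hp.ne'
      push_cast
      field_simp
  have rcont : ∀ (h : ℝ → ℝ) (S : Set ℝ), IsOpen S → (∀ s, s ≤ r → h s = s) → ContinuousOn h S →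
      ContinuousOn (fun z : ℂ => ((h ‖z‖ / ‖z‖ : ℝ) : ℂ) * z) {z | ‖z‖ ∈ S} := by
    intro h S hS h1 hc z hz
    apply ContinuousAt.continuousWithinAt
    by_cases hz0 : z = 0
    · subst hz0
      refine continuousAt_id.congr ?_
      filter_upwards [ball_mem_nhds (0:ℂ) hr] with w hw
      exact (rid h w (h1 _ (by simpa using (mem_ball_zero_iff.1 hw).le))).symm
    · have h2 : ContinuousAt (fun w : ℂ => h ‖w‖ / ‖w‖) z := by
        have h3 : ContinuousAt h ‖z‖ := hc.continuousAt (hS.mem_nhds hz)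
        exact ContinuousAt.div (ContinuousAt.comp (f := fun w : ℂ => ‖w‖) h3 continuous_norm.continuousAt)
          continuous_norm.continuousAt (by simpa using hz0)
      exact (Complex.continuous_ofReal.continuousAt.comp h2).mul continuousAt_id
  set σ : ℂ → ℂ := fun z => ((f ‖z‖ / ‖z‖ : ℝ) : ℂ) * z with hσ
  set τ : ℂ → ℂ := fun z => ((g ‖z‖ / ‖z‖ : ℝ) : ℂ) * z with hτ
  have hσ0 : σ 0 = 0 := by simp [hσ]
  have hτ0 : τ 0 = 0 := by simp [hτ]
  have hRp : 0 < R := hr.trans hR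
  have hσR : ∀ z, ‖σ z‖ < R := by
    intro z
    by_cases hz : z = 0
    · rw [hz, hσ0, norm_zero]; exact hRp
    · simp only [hσ]
      rw [rn f z hz (hf0 _ (norm_pos_iff.2 hz))]; exact hfR _
  have hτσ : ∀ z, τ (σ z) = z := by
    intro z
    by_cases hz : z = 0
    · rw [hz, hσ0, hτ0]
    · exact rinv f g z (hf0 _ (norm_pos_iff.2 hz)) (hgf _)
  have hστ : ∀ z, ‖z‖ < R → σ (τ z) = z := by
    intro z hzR
    by_cases hz : z = 0
    · rw [hz, hτ0, hσ0]
    · exact rinv g f z (hg0 _ (norm_pos_iff.2 hz) hzR) (hfg _ hzR)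
  have hσc : Continuous σ := by
    rw [← continuousOn_univ]
    exact (rcont f univ isOpen_univ hf1 hfc.continuousOn).mono (fun z _ => trivial)
  have hτc : ContinuousOn τ (ball 0 R) :=
    (rcont g (Iio R) isOpen_Iio hg1 hgc).mono (fun z hz => by simpa using hz)
  refine ⟨σ, ?_, fun z hz => rid f z (hf1 _ hz), hσR⟩
  refine IsOpenEmbedding.of_continuous_injective_isOpenMap hσc
    (Function.LeftInverse.injective hτσ) ?_
  intro U hU
  have : σ '' U = ball 0 R ∩ τ ⁻¹' U := by
    ext w
    constructor
    · rintro ⟨z, hz, rfl⟩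
      exact ⟨by simpa using hσR z, by rw [mem_preimage, hτσ]; exact hz⟩
    · rintro ⟨hw, hwU⟩
      exact ⟨τ w, hwU, hστ w (by simpa using hw)⟩
  rw [this]
  exact hτc.isOpen_inter_preimage isOpen_ball hU

section
variable {Z W Y : Type*} [TopologicalSpace Z] [TopologicalSpace W] [TopologicalSpace Y]
  {ψ : ℂ → W} {η : ℂ → Y} {i : W → Z} {j : Y → Z}

/-- a chart with values in a given open set -/
theorem chart_at {φ : ℂ → W} (hφ : IsOpenEmbedding φ) (z : ℂ) (O : Set W) (hO : IsOpen O) (hz : φ z ∈ O) :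
    ∃ φ' : ℂ → W, IsOpenEmbedding φ' ∧ φ' 0 = φ z ∧ range φ' ⊆ O := by
  obtain ⟨ε, hε, hb⟩ := Metric.isOpen_iff.1 (hO.preimage hφ.continuous) z hz
  obtain ⟨σ, hσ, hσ1, hσ2⟩ := squeeze (ε / 2) ε (by linarith) (by linarith)
  refine ⟨fun w => φ (z + σ w), hφ.comp ((Homeomorph.addLeft z).isOpenEmbedding.comp hσ), ?_, ?_⟩
  · simp only; rw [hσ1 0 (by simpa using by linarith), add_zero]
  · rintro _ ⟨w, rfl⟩
    refine hb ?_
    simpa using hσ2 w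

theorem Surf.chart_at {W : Type*} [TopologicalSpace W] (hW : Surf W) (x : W) (O : Set W) (hO : IsOpen O)
    (hx : x ∈ O) : ∃ φ : ℂ → W, IsOpenEmbedding φ ∧ φ 0 = x ∧ range φ ⊆ O := by
  obtain ⟨φ, hφ, z, rfl⟩ := hW.chart x
  exact _root_.chart_at hφ z O hO hx

theorem CSData.isOpen_image [T2Space Z] [CompactSpace W] [CompactSpace Y] (h : CSData ψ η i j)
    {O : Set W} (hO : IsOpen O) (hd : ∀ w ∈ O, w ∉ ψ '' closedBall 0 1) : IsOpen (i '' O) := by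
  have hd' : ∀ w ∈ O, w ∉ ψ '' ball 0 1 := fun w hw hh =>
    hd w hw (image_mono ball_subset_closedBall hh)
  rw [← isClosed_compl_iff]
  refine h.closed_crit _ ?_ ?_
  · have : {w | w ∉ ψ '' ball 0 1 ∧ i w ∈ (i '' O)ᶜ} = (ψ '' ball 0 1)ᶜ ∩ Oᶜ := by
      ext w
      refine and_congr_right fun hw => not_congr ?_
      constructor
      · rintro ⟨x, hx, hxw⟩
        rwa [← h.ii (hd' x hx) hw hxw]
      · intro hw'; exact ⟨w, hw', rfl⟩
    rw [this]
    exact (isClosed_compl_chart h.hψ 1).inter hO.isClosed_compl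
  · have : {y | y ∉ η '' ball 0 1 ∧ j y ∈ (i '' O)ᶜ} = (η '' ball 0 1)ᶜ := by
      ext y
      constructor
      · exact fun hy => hy.1
      · intro hy
        refine ⟨hy, ?_⟩
        rintro ⟨x, hx, hxy⟩
        obtain ⟨ζ, h1, h2, h3⟩ := h.ovl x (hd' x hx) y hy hxy
        exact hd x hx ⟨ζ, by simpa using h1.le, h2.symm⟩
    rw [this]
    exact isClosed_compl_chart h.hη 1

theorem CSData.chart_left [T2Space Z] [CompactSpace W] [CompactSpace Y] (h : CSData ψ η i j)
    {φ : ℂ → W} (hφ : IsOpenEmbedding φ) (hd : ∀ z, φ z ∉ ψ '' closedBall 0 1) :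
    IsOpenEmbedding (i ∘ φ) := by
  have hd' : ∀ z, φ z ∉ ψ '' ball 0 1 := fun z hh =>
    hd z (image_mono ball_subset_closedBall hh)
  refine IsOpenEmbedding.of_continuous_injective_isOpenMap (h.ci.comp_continuous hφ.continuous hd') ?_ ?_
  · intro z w hzw
    exact hφ.injective (h.ii (hd' z) (hd' w) hzw)
  · intro U hU
    rw [image_comp]
    refine h.isOpen_image (hφ.isOpenMap U hU) ?_
    rintro _ ⟨z, _, rfl⟩
    exact hd z

/-- the neck of the sum -/
theorem CSData.neck [T2Space Z] [CompactSpace W] [CompactSpace Y] (h : CSData ψ η i j) :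
    ∃ ν : ℂ → Z, (∀ z, 1 ≤ ‖z‖ → ν z = i (ψ z)) ∧ ∀ θ : ℂ → ℂ, IsOpenEmbedding θ → (∀ z, θ z ≠ 0) →
      IsOpenEmbedding (ν ∘ θ) := by
  set ν : ℂ → Z := fun z => if 1 ≤ ‖z‖ then i (ψ z) else j (η (cinv z)) with hν
  have h1 : ∀ z, 1 ≤ ‖z‖ → ν z = i (ψ z) := fun z hz => if_pos hz
  have h2 : ∀ z, ‖z‖ ≤ 1 → ν z = j (η (cinv z)) := by
    intro z hz
    rcases hz.lt_or_eq with hz | hz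
    · exact if_neg (not_le.2 hz)
    · rw [h1 z hz.ge, h.seam z hz, cinv_of_norm_one hz]
  have n1 : ∀ z, 1 ≤ ‖z‖ → ψ z ∉ ψ '' ball 0 1 := fun z hz => (not_mem_chart_ball h.hψ).2 hz
  have n2' : ∀ z, z ≠ 0 → ‖z‖ ≤ 1 → 1 ≤ ‖cinv z‖ := fun z hz0 hz => by
    rw [norm_cinv]; exact (one_le_inv₀ (norm_pos_iff.2 hz0)).2 hz
  have n2 : ∀ z, z ≠ 0 → ‖z‖ ≤ 1 → η (cinv z) ∉ η '' ball 0 1 := fun z hz0 hz =>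
    (not_mem_chart_ball h.hη).2 (n2' z hz0 hz)
  have hc : ContinuousOn ν {0}ᶜ := by
    refine continuousOn_two_closed (A := {z : ℂ | ‖z‖ ≤ 1}) (B := {z : ℂ | 1 ≤ ‖z‖})
      (isClosed_le continuous_norm continuous_const) (isClosed_le continuous_const continuous_norm)
      (fun z _ => (le_total ‖z‖ 1 : _ ∨ _)) ?_ ?_
    · refine ContinuousOn.congr (f := fun z => j (η (cinv z))) ?_ (fun z hz => h2 z hz.2)
      exact h.cj.comp (h.hη.continuous.comp_continuousOn (cinv_continuousOn.mono inter_subset_left))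
        (fun z hz => n2 z hz.1 hz.2)
    · refine ContinuousOn.congr (f := fun z => i (ψ z)) ?_ (fun z hz => h1 z hz.2)
      exact h.ci.comp h.hψ.continuous.continuousOn (fun z hz => n1 z hz.2)
  have hmix : ∀ z w, 1 ≤ ‖z‖ → ‖w‖ ≤ 1 → w ≠ 0 → i (ψ z) = j (η (cinv w)) → z = w := by
    intro z w hz hw hw0 hzw
    obtain ⟨ζ, h3, h4, h5⟩ := h.ovl _ (n1 z hz) _ (n2 w hw0 hw) hzw
    rw [h.hψ.injective h4, ← cinv_cinv w, h.hη.injective h5, cinv_of_norm_one h3]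
  have hi : ∀ z w, z ≠ 0 → w ≠ 0 → ν z = ν w → z = w := by
    intro z w hz0 hw0 hzw
    rcases le_total ‖z‖ 1 with hz | hz <;> rcases le_total ‖w‖ 1 with hw | hw
    · rw [h2 z hz, h2 w hw] at hzw
      exact cinv_injective (h.hη.injective (h.ij (n2 z hz0 hz) (n2 w hw0 hw) hzw))
    · rw [h2 z hz, h1 w hw] at hzw
      exact (hmix w z hw hz hz0 hzw.symm).symm
    · rw [h1 z hz, h2 w hw] at hzw
      exact hmix z w hz hw hw0 hzw
    · rw [h1 z hz, h1 w hw] at hzw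
      exact h.hψ.injective (h.ii (n1 z hz) (n1 w hw) hzw)
  have ho : ∀ U : Set ℂ, IsOpen U → (∀ z ∈ U, z ≠ 0) → IsOpen (ν '' U) := by
    intro U hU hU0
    rw [← isClosed_compl_iff]
    refine h.closed_crit _ ?_ ?_
    · have : {w | w ∉ ψ '' ball 0 1 ∧ i w ∈ (ν '' U)ᶜ} = (ψ '' (ball 0 1 ∪ U))ᶜ := by
        ext w
        rw [image_union, mem_compl_iff, mem_union, not_or]
        refine and_congr_right fun hw => not_congr ?_
        constructor
        · rintro ⟨z, hz, hzw⟩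
          rcases le_total ‖z‖ 1 with hz1 | hz1
          · rw [h2 z hz1] at hzw
            obtain ⟨ζ, h3, h4, h5⟩ := h.ovl w hw _ (n2 z (hU0 z hz) hz1) hzw.symm
            have : z = ζ := by rw [← cinv_cinv z, h.hη.injective h5, cinv_of_norm_one h3]
            exact ⟨z, hz, by rw [h4, this]⟩
          · rw [h1 z hz1] at hzw
            exact ⟨z, hz, h.ii (n1 z hz1) hw hzw⟩
        · rintro ⟨z, hz, rfl⟩
          exact ⟨z, hz, h1 z ((not_mem_chart_ball h.hψ).1 hw)⟩
      rw [this]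
      exact (h.hψ.isOpenMap _ (isOpen_ball.union hU)).isClosed_compl
    · have hcU : IsOpen {z | z ≠ 0 ∧ cinv z ∈ U} :=
        cinv_continuousOn.isOpen_inter_preimage isOpen_compl_singleton hU
      have : {y | y ∉ η '' ball 0 1 ∧ j y ∈ (ν '' U)ᶜ} = (η '' (ball 0 1 ∪ {z | z ≠ 0 ∧ cinv z ∈ U}))ᶜ := by
        ext y
        rw [image_union, mem_compl_iff, mem_union, not_or]
        refine and_congr_right fun hy => not_congr ?_
        constructor
        · rintro ⟨z, hz, hzy⟩
          have hz0 := hU0 z hz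
          refine ⟨cinv z, ⟨fun hh => hz0 (cinv_eq_zero.1 hh), by rwa [cinv_cinv]⟩, ?_⟩
          rcases le_total ‖z‖ 1 with hz1 | hz1
          · rw [h2 z hz1] at hzy
            exact h.ij (n2 z hz0 hz1) hy hzy
          · rw [h1 z hz1] at hzy
            obtain ⟨ζ, h3, h4, h5⟩ := h.ovl _ (n1 z hz1) y hy hzy
            rw [h.hψ.injective h4, cinv_of_norm_one h3, h5]
        · rintro ⟨z, ⟨hz0, hz⟩, rfl⟩
          refine ⟨cinv z, hz, ?_⟩
          have := (not_mem_chart_ball h.hη).1 hy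
          rw [h2, cinv_cinv]
          rw [norm_cinv]
          exact inv_le_one_of_one_le₀ this
      rw [this]
      exact (h.hη.isOpenMap _ (isOpen_ball.union hcU)).isClosed_compl
  refine ⟨ν, h1, fun θ hθ hθ0 => ?_⟩
  refine IsOpenEmbedding.of_continuous_injective_isOpenMap (hc.comp_continuous hθ.continuous hθ0) ?_ ?_
  · intro z w hzw
    exact hθ.injective (hi _ _ (hθ0 z) (hθ0 w) hzw)
  · intro U hU
    rw [image_comp]
    refine ho _ (hθ.isOpenMap U hU) ?_
    rintro _ ⟨z, _, rfl⟩
    exact hθ0 z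

theorem CSum.surf [T2Space Z] (hW : Surf W) (hY : Surf Y) (h : CSum Z W ψ Y η) : Surf Z := by
  have := hW.compact
  have := hY.compact
  have := hW.t2
  have := hY.t2
  have := hW.conn
  have := hY.conn
  refine ⟨h.compactSpace, inferInstance, h.preconnectedSpace, ?_⟩
  obtain ⟨i, j, h⟩ := h
  obtain ⟨ν, hν1, hν2⟩ := h.neck
  have seamc : ∀ ζ : ℂ, ‖ζ‖ = 1 → ∃ φ : ℂ → Z, IsOpenEmbedding φ ∧ i (ψ ζ) ∈ range φ := by
    intro ζ hζ
    have hζ0 : ζ ≠ 0 := by rintro rfl; simp at hζ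
    obtain ⟨θ, hθ, hθ0, hθr⟩ := _root_.chart_at (φ := id) IsOpenEmbedding.id ζ {0}ᶜ
      isOpen_compl_singleton hζ0
    refine ⟨ν ∘ θ, hν2 θ hθ (fun z => hθr ⟨z, rfl⟩), 0, ?_⟩
    simp only [Function.comp_apply, hθ0, id]
    exact hν1 ζ hζ.ge
  intro z
  rcases h.cov z with ⟨w, hw, rfl⟩ | ⟨y, hy, rfl⟩
  · by_cases hw' : w ∈ ψ '' closedBall 0 1
    · obtain ⟨ζ, hζ, rfl⟩ := hw'
      exact seamc ζ (le_antisymm (by simpa using hζ) ((not_mem_chart_ball h.hψ).1 hw))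
    · obtain ⟨φ, hφ, hφ0, hφr⟩ := hW.chart_at w _
        ((isCompact_closedBall 0 1).image h.hψ.continuous).isClosed.isOpen_compl hw'
      exact ⟨i ∘ φ, h.chart_left hφ (fun z => hφr ⟨z, rfl⟩), 0, by simp [hφ0]⟩
  · by_cases hy' : y ∈ η '' closedBall 0 1
    · obtain ⟨ζ, hζ, rfl⟩ := hy'
      have h1 : ‖ζ‖ = 1 := le_antisymm (by simpa using hζ) ((not_mem_chart_ball h.hη).1 hy)
      rw [← h.seam ζ h1]
      exact seamc ζ h1
    · obtain ⟨φ, hφ, hφ0, hφr⟩ := hY.chart_at y _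
        ((isCompact_closedBall 0 1).image h.hη.continuous).isClosed.isOpen_compl hy'
      exact ⟨j ∘ φ, h.symm.chart_left hφ (fun z => hφr ⟨z, rfl⟩), 0, by simp [hφ0]⟩

end

section
variable {Z W Y : Type*} [TopologicalSpace Z] [TopologicalSpace W] [TopologicalSpace Y]

/-- A collapse map of the complement of a chart disc onto the disc. -/
theorem collapse [T2Space W] {ψ : ℂ → W} (hψ : IsOpenEmbedding ψ) :
    ∃ χ : W → ℂ, Continuous χ ∧ (∀ ζ, ‖ζ‖ = 1 → χ (ψ ζ) = ζ) ∧
      ∀ w ∉ ψ '' ball 0 1, 1 ≤ ‖χ w‖ → ∃ ζ, ‖ζ‖ = 1 ∧ w = ψ ζ := by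
  set ρ : ℂ → ℂ := fun z => ((max 0 (2 - max 1 ‖z‖) / max 1 ‖z‖ : ℝ) : ℂ) * z with hρ
  have hρc : Continuous ρ := by
    refine Continuous.mul (Complex.continuous_ofReal.comp (Continuous.div (by fun_prop) (by fun_prop) ?_))
      continuous_id
    intro z
    have : (1:ℝ) ≤ max 1 ‖z‖ := le_max_left _ _
    positivity
  have e1 : ∀ z, Function.extend ψ ρ 0 (ψ z) = ρ z := fun z => hψ.injective.extend_apply _ _ z
  have e2 : ∀ w, w ∉ range ψ → Function.extend ψ ρ 0 w = 0 := fun w hw =>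
    Function.extend_apply' _ _ _ hw
  have hn : ∀ z : ℂ, 1 ≤ ‖z‖ → ‖ρ z‖ = max 0 (2 - ‖z‖) := by
    intro z hz
    have h0 : ‖z‖ ≠ 0 := by positivity
    simp only [hρ, max_eq_right hz, norm_mul, Complex.norm_real, norm_div, norm_norm]
    rw [div_mul_cancel₀ _ h0, Real.norm_eq_abs, abs_of_nonneg (le_max_left _ _)]
  refine ⟨Function.extend ψ ρ 0, ?_, ?_, ?_⟩
  · rw [continuous_iff_continuousAt]
    intro x
    by_cases hx : x ∈ range ψ
    · obtain ⟨z, rfl⟩ := hx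
      rw [← hψ.continuousAt_iff]
      have : Function.extend ψ ρ 0 ∘ ψ = ρ := funext e1
      rw [this]
      exact hρc.continuousAt
    · have hcl : IsClosed (ψ '' closedBall 0 2) :=
        ((isCompact_closedBall 0 2).image hψ.continuous).isClosed
      have hmem : (ψ '' closedBall 0 2)ᶜ ∈ 𝓝 x := by
        refine hcl.isOpen_compl.mem_nhds ?_
        rintro ⟨z, _, rfl⟩
        exact hx ⟨z, rfl⟩
      refine (continuousAt_const (y := (0:ℂ))).congr ?_
      filter_upwards [hmem] with y hy
      by_cases hy' : y ∈ range ψ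
      · obtain ⟨z, rfl⟩ := hy'
        rw [e1]
        have h2 : 2 ≤ ‖z‖ := by
          by_contra hlt
          exact hy ⟨z, by simpa using (not_le.1 hlt).le, rfl⟩
        symm
        rw [← norm_eq_zero, hn z (by linarith), max_eq_left (by linarith)]
      · rw [e2 y hy']
  · intro ζ hζ
    rw [e1]
    simp [hρ, hζ]
    norm_num
  · intro w hw h1
    by_cases hy' : w ∈ range ψ
    · obtain ⟨z, rfl⟩ := hy'
      have hz := (not_mem_chart_ball hψ).1 hw
      rw [e1, hn z hz] at h1
      refine ⟨z, le_antisymm ?_ hz, rfl⟩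
      rcases le_max_iff.1 h1 with h | h <;> linarith
    · rw [e2 w hy'] at h1
      norm_num at h1

theorem csum_exists [T2Space W] [T2Space Y] {ψ : ℂ → W} (hψ : IsOpenEmbedding ψ) {η : ℂ → Y}
    (hη : IsOpenEmbedding η) : ∃ S : Set (W × Y), CSum S W ψ Y η := by
  classical
  obtain ⟨χ, hχ, hχ1, hχ2⟩ := collapse hψ
  obtain ⟨θ, hθ, hθ1, hθ2⟩ := collapse hη
  let I : W → W × Y := fun w => (w, η (χ w))
  let J : Y → W × Y := fun y => (ψ (θ y), y)
  let S : Set (W × Y) := I '' (ψ '' ball 0 1)ᶜ ∪ J '' (η '' ball 0 1)ᶜ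
  have hψ1 : ψ 1 ∈ (ψ '' ball 0 1)ᶜ := (not_mem_chart_ball hψ).2 (by simp)
  have hη1 : η 1 ∈ (η '' ball 0 1)ᶜ := (not_mem_chart_ball hη).2 (by simp)
  have hI : ∀ w ∈ (ψ '' ball 0 1)ᶜ, I w ∈ S := fun w hw => Or.inl ⟨w, hw, rfl⟩
  have hJ : ∀ w ∈ (η '' ball 0 1)ᶜ, J w ∈ S := fun w hw => Or.inr ⟨w, hw, rfl⟩
  let i : W → S := fun w => if h : w ∈ (ψ '' ball 0 1)ᶜ then ⟨I w, hI w h⟩ else ⟨I (ψ 1), hI _ hψ1⟩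
  let j : Y → S := fun w => if h : w ∈ (η '' ball 0 1)ᶜ then ⟨J w, hJ w h⟩ else ⟨J (η 1), hJ _ hη1⟩
  have hi : ∀ w ∈ (ψ '' ball 0 1)ᶜ, (i w : W × Y) = I w := fun w hw => by simp only [i, dif_pos hw]
  have hj : ∀ w ∈ (η '' ball 0 1)ᶜ, (j w : W × Y) = J w := fun w hw => by simp only [j, dif_pos hw]
  refine ⟨S, i, j, hψ, hη, ?_, ?_, ?_, ?_, ?_, ?_, ?_⟩
  · rw [IsInducing.subtypeVal.continuousOn_iff]
    have : Continuous I := continuous_id.prodMk (hη.continuous.comp hχ)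
    exact this.continuousOn.congr hi
  · rw [IsInducing.subtypeVal.continuousOn_iff]
    have : Continuous J := (hψ.continuous.comp hθ).prodMk continuous_id
    exact this.continuousOn.congr hj
  · intro a ha b hb hab
    have := congrArg Subtype.val hab
    rw [hi a ha, hi b hb] at this
    exact congrArg Prod.fst this
  · intro a ha b hb hab
    have := congrArg Subtype.val hab
    rw [hj a ha, hj b hb] at this
    exact congrArg Prod.snd this
  · intro ζ hζ
    apply Subtype.ext
    rw [hi _ ((not_mem_chart_ball hψ).2 hζ.ge), hj _ ((not_mem_chart_ball hη).2 hζ.ge)]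
    simp only [I, J, hχ1 ζ hζ, hθ1 ζ hζ]
  · intro w hw y hy hwy
    have := congrArg Subtype.val hwy
    rw [hi w hw, hj y hy] at this
    have h1 : w = ψ (θ y) := congrArg Prod.fst this
    have h2 : 1 ≤ ‖θ y‖ := by
      rw [h1] at hw
      exact (not_mem_chart_ball hψ).1 hw
    obtain ⟨ζ, hζ, rfl⟩ := hθ2 y hy h2
    rw [hθ1 ζ hζ] at h1
    exact ⟨ζ, hζ, h1, rfl⟩
  · rintro ⟨z, (⟨w, hw, rfl⟩ | ⟨w, hw, rfl⟩)⟩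
    · left; exact ⟨w, hw, Subtype.ext (hi w hw)⟩
    · right; exact ⟨w, hw, Subtype.ext (hj w hw)⟩

end

/-- An embedded closed disc with open interior, parametrised by the unit disc of `ℂ`. -/
structure IsDisc {W : Type*} [TopologicalSpace W] (f : ℂ → W) : Prop where
  cont : ContinuousOn f (closedBall 0 1)
  inj : InjOn f (closedBall 0 1)
  opn : IsOpen (f '' ball 0 1)

section
variable {Z W Y : Type*} [TopologicalSpace Z] [TopologicalSpace W] [TopologicalSpace Y]
  {f : ℂ → W} {g : ℂ → Y} {i : W → Z} {j : Y → Z}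

theorem IsDisc.not_mem (h : IsDisc f) {z : ℂ} (hz : ‖z‖ ≤ 1) {r : ℝ} (hr : r ≤ 1) :
    f z ∉ f '' ball 0 r ↔ r ≤ ‖z‖ := by
  constructor
  · intro h1
    by_contra h2
    exact h1 ⟨z, by simpa using h2, rfl⟩
  · rintro h1 ⟨w, hw, he⟩
    have hw' : ‖w‖ < r := by simpa using hw
    have := h.inj (by simp; linarith) (by simpa using hz) he
    subst this
    linarith

theorem IsDisc.isOpen_image [T2Space W] (h : IsDisc f) {O : Set ℂ} (hO : IsOpen O) (hs : O ⊆ ball 0 1) :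
    IsOpen (f '' O) := by
  have hc : IsCompact (closedBall (0:ℂ) 1 \ O) := (isCompact_closedBall _ _).diff hO
  have hcl := (hc.image_of_continuousOn (h.cont.mono sdiff_subset)).isClosed
  have : f '' O = f '' ball 0 1 \ f '' (closedBall 0 1 \ O) := by
    apply subset_antisymm
    · rintro _ ⟨z, hz, rfl⟩
      refine ⟨⟨z, hs hz, rfl⟩, ?_⟩
      rintro ⟨w, hw, he⟩
      have := h.inj hw.1 (ball_subset_closedBall (hs hz)) he
      exact hw.2 (this ▸ hz)
    · rintro _ ⟨⟨z, hz, rfl⟩, h2⟩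
      by_cases hzO : z ∈ O
      · exact ⟨z, hzO, rfl⟩
      · exact absurd ⟨z, ⟨ball_subset_closedBall hz, hzO⟩, rfl⟩ h2
  rw [this]
  exact h.opn.sdiff hcl

theorem IsDisc.comp_openEmbedding [T2Space W] (h : IsDisc f) {σ : ℂ → ℂ} (hσ : IsOpenEmbedding σ)
    (hb : ∀ z, ‖σ z‖ < 1) : IsOpenEmbedding (f ∘ σ) := by
  have hm : ∀ z, σ z ∈ closedBall (0:ℂ) 1 := fun z => by simpa using (hb z).le
  refine IsOpenEmbedding.of_continuous_injective_isOpenMap (h.cont.comp_continuous hσ.continuous hm) ?_ ?_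
  · intro a b hab
    exact hσ.injective (h.inj (hm a) (hm b) hab)
  · intro O hO
    rw [image_comp]
    refine h.isOpen_image (hσ.isOpenMap O hO) ?_
    rintro _ ⟨z, _, rfl⟩
    simpa using hb z

theorem IsOpenEmbedding.isDisc {ψ : ℂ → W} (h : IsOpenEmbedding ψ) : IsDisc ψ :=
  ⟨h.continuous.continuousOn, h.injective.injOn, h.isOpenMap _ isOpen_ball⟩

/-- Data extracted from `IsConnSum`. -/
structure PreSum (f : ℂ → W) (g : ℂ → Y) (i : W → Z) (j : Y → Z) : Prop where
  hf : IsDisc f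
  hg : IsDisc g
  ci : ContinuousOn i (f '' ball 0 1)ᶜ
  cj : ContinuousOn j (g '' ball 0 1)ᶜ
  ii : InjOn i (f '' ball 0 1)ᶜ
  ij : InjOn j (g '' ball 0 1)ᶜ
  ovl : ∀ w ∉ f '' ball 0 1, ∀ y ∉ g '' ball 0 1, i w = j y → w ∈ f '' sphere 0 1 ∧ y ∈ g '' sphere 0 1
  s1 : ∀ ζ ∈ sphere (0:ℂ) 1, ∃ ξ ∈ sphere (0:ℂ) 1, i (f ζ) = j (g ξ)
  s2 : ∀ ζ ∈ sphere (0:ℂ) 1, ∃ ξ ∈ sphere (0:ℂ) 1, j (g ζ) = i (f ξ)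
  cov : ∀ z, (∃ w ∉ f '' ball 0 1, i w = z) ∨ ∃ y ∉ g '' ball 0 1, j y = z

theorem PreSum.step2 [T2Space Z] [T2Space W] [T2Space Y] {η : ℂ → Y} (hη : IsOpenEmbedding η)
    (hf : IsDisc f) (ci : ContinuousOn i (f '' ball 0 1)ᶜ) (cj : ContinuousOn j (η '' ball 0 1)ᶜ)
    (ii : InjOn i (f '' ball 0 1)ᶜ) (ij : InjOn j (η '' ball 0 1)ᶜ)
    (seam : ∀ ζ, ‖ζ‖ = 1 → i (f ζ) = j (η ζ))
    (ovl : ∀ w ∉ f '' ball 0 1, ∀ y ∉ η '' ball 0 1, i w = j y → ∃ ζ, ‖ζ‖ = 1 ∧ w = f ζ ∧ y = η ζ)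
    (cov : ∀ z, (∃ w ∉ f '' ball 0 1, i w = z) ∨ ∃ y ∉ η '' ball 0 1, j y = z) :
    ∃ ψ : ℂ → W, CSum Z W ψ Y η := by
  classical
  obtain ⟨σ, hσ, hσ1, hσ2⟩ := squeeze (1/2) 1 (by norm_num) (by norm_num)
  obtain ⟨E, hE, -⟩ := chartScale hη (1/2) (by norm_num) 2
  have hE' : ∀ z, ‖z‖ ≤ 1 → E (η z) = η (2 * z) := by
    intro z hz
    have := hE (2 * z) (by simp; linarith)
    rw [← this]; congr 3; push_cast; ring
  let h2 : ℂ ≃ₜ ℂ := Homeomorph.mulLeft₀ (1/2 : ℂ) (by norm_num)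
  set ψ : ℂ → W := f ∘ σ ∘ h2 with hψd
  have hψ : IsOpenEmbedding ψ := hf.comp_openEmbedding (hσ.comp h2.isOpenEmbedding) (fun z => hσ2 _)
  have hψv : ∀ z, ‖z‖ ≤ 1 → ψ z = f (z / 2) := by
    intro z hz
    have : h2 z = z / 2 := by simp only [h2, Homeomorph.mulLeft₀]; change (1/2:ℂ) * z = _; ring
    simp only [hψd, Function.comp_apply, this]
    rw [hσ1]
    simp; linarith
  have hψb : ψ '' ball 0 1 = f '' ball 0 (1/2) := by
    apply subset_antisymm
    · rintro _ ⟨z, hz, rfl⟩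
      have hz' : ‖z‖ < 1 := by simpa using hz
      exact ⟨z / 2, by simp; linarith, (hψv z hz'.le).symm⟩
    · rintro _ ⟨z, hz, rfl⟩
      have hz' : ‖z‖ < 1 / 2 := by simpa using hz
      refine ⟨2 * z, by simp; linarith, ?_⟩
      rw [hψv _ (by simp; linarith)]; congr 1; ring
  set θ : W → ℂ := Function.invFunOn f (closedBall 0 1) with hθ
  have hθc : ContinuousOn θ (f '' closedBall 0 1) :=
    invFunOn_continuousOn (isCompact_closedBall _ _) hf.cont hf.inj
  have hθf : ∀ z, ‖z‖ ≤ 1 → θ (f z) = z := fun z hz => hf.inj.leftInvOn_invFunOn (by simpa using hz)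
  set i' : W → Z := fun w => if w ∈ f '' ball 0 1 then j (η (cinv (θ w))) else i w with hi'
  have i1 : ∀ w, w ∉ f '' ball 0 1 → i' w = i w := fun w hw => by simp only [hi', if_neg hw]
  have i2 : ∀ z, ‖z‖ ≤ 1 → i' (f z) = j (η (cinv z)) := by
    intro z hz
    rcases hz.lt_or_eq with h | h
    · have : f z ∈ f '' ball 0 1 := ⟨z, by simpa using h, rfl⟩
      simp only [hi', if_pos this, hθf z hz]
    · rw [i1 _ ((hf.not_mem hz le_rfl).2 h.ge), seam z h, cinv_of_norm_one h]
  have hc1 : ∀ z : ℂ, ‖z‖ ≤ 1 → z ≠ 0 → 1 ≤ ‖cinv z‖ := fun z hz h0 => by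
    rw [norm_cinv]; exact (one_le_inv₀ (by positivity)).2 hz
  have hηn : ∀ z : ℂ, 1 ≤ ‖z‖ → η z ∉ η '' ball 0 1 := fun z hz => (not_mem_chart_ball hη).2 hz
  have hEn : ∀ y, y ∉ η '' ball 0 1 → E y ∉ η '' ball 0 2 := by
    rintro y hy ⟨z, hz, he⟩
    have hz' : ‖z‖ < 2 := by simpa using hz
    apply hy
    refine ⟨z / 2, by simp; linarith, E.injective ?_⟩
    rw [hE' _ (by simp; linarith), ← he]; congr 1; ring
  have hb12 : ∀ y, y ∉ η '' ball 0 2 → y ∉ η '' ball 0 1 := fun y hy h =>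
    hy (image_mono (ball_subset_ball (by norm_num)) h)
  have hcases : ∀ w, w ∉ ψ '' ball 0 1 → w ∉ f '' ball 0 1 ∨ ∃ v, 1/2 ≤ ‖v‖ ∧ ‖v‖ < 1 ∧ w = f v := by
    intro w hw
    by_cases h : w ∈ f '' ball 0 1
    · obtain ⟨v, hv, rfl⟩ := h
      have hv' : ‖v‖ < 1 := by simpa using hv
      rw [hψb, hf.not_mem hv'.le (by norm_num)] at hw
      exact Or.inr ⟨v, hw, hv', rfl⟩
    · exact Or.inl h
  refine ⟨ψ, i', j ∘ E, hψ, hη, ?_, ?_, ?_, ?_, ?_, ?_, ?_⟩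
  · have hcl1 : IsClosed (f '' ball 0 1)ᶜ := hf.opn.isClosed_compl
    have hcl2 : IsClosed (f '' closedBall 0 1) :=
      ((isCompact_closedBall _ _).image_of_continuousOn hf.cont).isClosed
    refine continuousOn_two_closed hcl1 hcl2 ?_ ?_ ?_
    · intro w _
      by_cases h : w ∈ f '' ball 0 1
      · exact Or.inr (image_mono ball_subset_closedBall h)
      · exact Or.inl h
    · exact (ci.mono inter_subset_right).congr (fun w hw => i1 w hw.2)
    · have hcz : ContinuousOn (fun w => j (η (cinv (θ w)))) ((ψ '' ball 0 1)ᶜ ∩ f '' closedBall 0 1) := by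
        have hne : ∀ w ∈ (ψ '' ball 0 1)ᶜ ∩ f '' closedBall 0 1, θ w ≠ 0 ∧ ‖θ w‖ ≤ 1 := by
          rintro _ ⟨hw, ⟨z, hz, rfl⟩⟩
          have hz' : ‖z‖ ≤ 1 := by simpa using hz
          rw [hθf z hz']
          refine ⟨?_, hz'⟩
          rintro rfl
          exact hw (by rw [hψb]; exact ⟨0, by simp, rfl⟩)
        have h1 : ContinuousOn (fun w => η (cinv (θ w))) ((ψ '' ball 0 1)ᶜ ∩ f '' closedBall 0 1) :=
          hη.continuous.comp_continuousOn
            (cinv_continuousOn.comp (hθc.mono inter_subset_right) (fun w hw => (hne w hw).1))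
        exact cj.comp h1 (fun w hw => hηn _ (hc1 _ (hne w hw).2 (hne w hw).1))
      refine hcz.congr ?_
      rintro _ ⟨hw, ⟨z, hz, rfl⟩⟩
      have hz' : ‖z‖ ≤ 1 := by simpa using hz
      simp only [i2 z hz', hθf z hz']
  · exact cj.comp E.continuous.continuousOn (fun y hy => hb12 _ (hEn y hy))
  · have mixed : ∀ a v, a ∉ f '' ball 0 1 → 1/2 ≤ ‖v‖ → ‖v‖ < 1 → i' a = i' (f v) → False := by
      intro a v ha hv1 hv2 he
      have hv0 : v ≠ 0 := by rintro rfl; norm_num at hv1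
      rw [i1 a ha, i2 v hv2.le] at he
      obtain ⟨ζ, hζ, -, h3⟩ := ovl a ha _ (hηn _ (hc1 v hv2.le hv0)) he
      have := congrArg norm (hη.injective h3)
      rw [norm_cinv, hζ, inv_eq_one] at this
      linarith
    intro a ha b hb hab
    rcases hcases a ha with ha | ⟨v, hv1, hv2, rfl⟩ <;> rcases hcases b hb with hb | ⟨u, hu1, hu2, rfl⟩
    · rw [i1 a ha, i1 b hb] at hab
      exact ii ha hb hab
    · exact (mixed _ _ ha hu1 hu2 hab).elim
    · exact (mixed _ _ hb hv1 hv2 hab.symm).elim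
    · have hv0 : v ≠ 0 := by rintro rfl; norm_num at hv1
      have hu0 : u ≠ 0 := by rintro rfl; norm_num at hu1
      rw [i2 v hv2.le, i2 u hu2.le] at hab
      have := ij (hηn _ (hc1 v hv2.le hv0)) (hηn _ (hc1 u hu2.le hu0)) hab
      rw [cinv_injective (hη.injective this)]
  · intro a ha b hb hab
    exact E.injective (ij (hb12 _ (hEn a ha)) (hb12 _ (hEn b hb)) hab)
  · intro ζ hζ
    rw [hψv ζ hζ.le, i2 _ (by simp; linarith), Function.comp_apply, hE' ζ hζ.le]
    congr 2
    rw [cinv_eq]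
    simp [hζ]
    ring
  · intro w hw y hy he
    rcases hcases w hw with hw | ⟨v, hv1, hv2, rfl⟩
    · rw [i1 w hw] at he
      obtain ⟨ζ, hζ, -, h3⟩ := ovl w hw _ (hb12 _ (hEn y hy)) he
      exact absurd ⟨ζ, by simp [hζ], h3.symm⟩ (hEn y hy)
    · have hv0 : v ≠ 0 := by rintro rfl; norm_num at hv1
      rw [i2 v hv2.le] at he
      have h3 := ij (hηn _ (hc1 v hv2.le hv0)) (hb12 _ (hEn y hy)) he
      have h4 : 2 ≤ ‖cinv v‖ := by
        have := hEn y hy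
        rw [← h3] at this
        exact (not_mem_chart_ball hη).1 this
      have h5 : ‖v‖ = 1/2 := by
        refine le_antisymm ?_ hv1
        rw [norm_cinv] at h4
        have := inv_anti₀ (by norm_num) h4
        rw [inv_inv] at this
        linarith
      have h6 : ‖2 * v‖ = 1 := by simp [h5]
      refine ⟨2 * v, h6, ?_, E.injective ?_⟩
      · rw [hψv _ h6.le]; congr 1; ring
      · rw [hE' _ h6.le, ← h3, cinv_eq, h5]
        congr 1; push_cast; ring
  · intro z
    rcases cov z with ⟨w, hw, rfl⟩ | ⟨y, hy, rfl⟩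
    · left
      refine ⟨w, ?_, i1 w hw⟩
      rw [hψb]
      exact fun h => hw (image_mono (ball_subset_ball (by norm_num)) h)
    · by_cases hy2 : y ∈ η '' ball 0 2
      · obtain ⟨u, hu, rfl⟩ := hy2
        have hu2 : ‖u‖ < 2 := by simpa using hu
        have hu1 := (not_mem_chart_ball hη).1 hy
        have hn : ‖cinv u‖ ≤ 1 := by rw [norm_cinv]; exact inv_le_one_of_one_le₀ hu1
        left
        refine ⟨f (cinv u), ?_, ?_⟩
        · rw [hψb, hf.not_mem hn (by norm_num), norm_cinv]
          have := inv_anti₀ (by linarith) hu2.le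
          linarith
        · rw [i2 _ hn, cinv_cinv]
      · right
        refine ⟨E.symm y, ?_, by simp⟩
        rintro ⟨v, hv, he⟩
        have hv' : ‖v‖ < 1 := by simpa using hv
        apply hy2
        refine ⟨2 * v, by simp; linarith, ?_⟩
        rw [← hE' v hv'.le, he, E.apply_symm_apply]

theorem PreSum.toCSum [T2Space Z] [T2Space W] [T2Space Y] (h : PreSum f g i j) {γ : ℂ → Y}
    (hγ : IsOpenEmbedding γ) (hγg : ∀ z, ‖z‖ ≤ 1 → γ z = g z) :
    ∃ (ψ : ℂ → W) (η : ℂ → Y), CSum Z W ψ Y η := by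
  have sb : ∀ z ∈ sphere (0:ℂ) 1, z ∈ closedBall (0:ℂ) 1 := fun z hz => sphere_subset_closedBall hz
  have nz : ∀ z ∈ sphere (0:ℂ) 1, ‖z‖ = 1 := fun z hz => by simpa using hz
  have hfn : ∀ z ∈ sphere (0:ℂ) 1, f z ∈ (f '' ball 0 1)ᶜ := fun z hz =>
    (h.hf.not_mem (nz z hz).le le_rfl).2 (nz z hz).ge
  have hgn : ∀ z ∈ sphere (0:ℂ) 1, g z ∈ (g '' ball 0 1)ᶜ := fun z hz =>
    (h.hg.not_mem (nz z hz).le le_rfl).2 (nz z hz).ge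
  have cjg : ContinuousOn (j ∘ g) (sphere 0 1) := h.cj.comp (h.hg.cont.mono sphere_subset_closedBall) hgn
  have cif : ContinuousOn (i ∘ f) (sphere 0 1) := h.ci.comp (h.hf.cont.mono sphere_subset_closedBall) hfn
  have ijg : InjOn (j ∘ g) (sphere 0 1) := fun a ha b hb hab =>
    h.hg.inj (sb a ha) (sb b hb) (h.ij (hgn a ha) (hgn b hb) hab)
  have iif : InjOn (i ∘ f) (sphere 0 1) := fun a ha b hb hab =>
    h.hf.inj (sb a ha) (sb b hb) (h.ii (hfn a ha) (hfn b hb) hab)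
  have hm : ∀ ζ ∈ sphere (0:ℂ) 1, (i ∘ f) ζ ∈ (j ∘ g) '' sphere 0 1 := fun ζ hζ => by
    obtain ⟨ξ, hξ, he⟩ := h.s1 ζ hζ
    exact ⟨ξ, hξ, he.symm⟩
  set τ : ℂ → ℂ := fun z => Function.invFunOn (j ∘ g) (sphere 0 1) ((i ∘ f) z) with hτ
  have hτ1 : ∀ ζ ∈ sphere (0:ℂ) 1, τ ζ ∈ sphere (0:ℂ) 1 := fun ζ hζ => Function.invFunOn_mem (hm ζ hζ)
  have hτ2 : ∀ ζ ∈ sphere (0:ℂ) 1, j (g (τ ζ)) = i (f ζ) := fun ζ hζ => Function.invFunOn_eq (hm ζ hζ)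
  obtain ⟨c, hc, hcτ⟩ := mkCone τ
    ((invFunOn_continuousOn (isCompact_sphere _ _) cjg ijg).comp cif hm)
    (fun a ha b hb hab => iif ha hb (by
      change i (f a) = i (f b)
      rw [← hτ2 a ha, ← hτ2 b hb, hab]))
    (by
      apply subset_antisymm
      · rintro _ ⟨z, hz, rfl⟩; exact hτ1 z hz
      · intro z hz
        obtain ⟨ξ, hξ, he⟩ := h.s2 z hz
        exact ⟨ξ, hξ, ijg (hτ1 ξ hξ) hz ((hτ2 ξ hξ).trans he.symm)⟩)
  have hη : IsOpenEmbedding (γ ∘ c) := hγ.comp c.isOpenEmbedding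
  have hηb : (γ ∘ c) '' ball 0 1 = g '' ball 0 1 := by
    apply subset_antisymm
    · rintro _ ⟨z, hz, rfl⟩
      have hz' : ‖z‖ < 1 := by simpa using hz
      exact ⟨c z, by simpa [hc.norm] using hz', (hγg _ (by rw [hc.norm]; exact hz'.le)).symm⟩
    · rintro _ ⟨z, hz, rfl⟩
      have hz' : ‖z‖ < 1 := by simpa using hz
      exact ⟨c.symm z, by simpa [hc.symm.norm] using hz', by simp [hγg z hz'.le]⟩
  have seam : ∀ ζ, ‖ζ‖ = 1 → i (f ζ) = j ((γ ∘ c) ζ) := by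
    intro ζ hζ
    have hs : ζ ∈ sphere (0:ℂ) 1 := by simpa using hζ
    rw [Function.comp_apply, hγg _ (by rw [hc.norm, hζ]), hcτ ζ hs, hτ2 ζ hs]
  obtain ⟨ψ, hψ⟩ := PreSum.step2 (i := i) (j := j) hη h.hf h.ci (by rw [hηb]; exact h.cj) h.ii
    (by rw [hηb]; exact h.ij) seam (by
      rw [hηb]
      intro w hw y hy he
      obtain ⟨⟨ζ, hζ, rfl⟩, -⟩ := h.ovl w hw y hy he
      refine ⟨ζ, nz ζ hζ, rfl, ?_⟩
      rw [seam ζ (nz ζ hζ)] at he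
      refine (h.ij ?_ hy he).symm
      rw [← hηb]
      exact (not_mem_chart_ball hη).2 (nz ζ hζ).ge) (by rw [hηb]; exact h.cov)
  exact ⟨ψ, γ ∘ c, hψ⟩

end

theorem t2_of_closed_cover {Z : Type*} [TopologicalSpace Z] {A B : Set Z} (hA : IsClosed A) (hB : IsClosed B)
    (hAB : A ∪ B = univ) [T2Space A] [T2Space B] : T2Space Z := by
  rw [t2_iff_isClosed_diagonal]
  have key : ∀ A : Set Z, IsClosed A → T2Space A →
      IsClosed ((Prod.map Subtype.val Subtype.val : A × A → Z × Z) '' diagonal A) := by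
    intro A hA h
    exact (hA.isClosedEmbedding_subtypeVal.prodMap hA.isClosedEmbedding_subtypeVal).isClosedMap _
      isClosed_diagonal
  have : diagonal Z = (Prod.map Subtype.val Subtype.val : A × A → Z × Z) '' diagonal A ∪
      (Prod.map Subtype.val Subtype.val : B × B → Z × Z) '' diagonal B := by
    apply subset_antisymm
    · rintro ⟨x, y⟩ hxy
      have hxy : x = y := hxy
      subst hxy
      have : x ∈ A ∪ B := hAB ▸ mem_univ x
      rcases this with h | h
      · left; exact ⟨(⟨x, h⟩, ⟨x, h⟩), rfl, rfl⟩
      · right; exact ⟨(⟨x, h⟩, ⟨x, h⟩), rfl, rfl⟩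
    · rintro _ (⟨⟨x, y⟩, h, rfl⟩ | ⟨⟨x, y⟩, h, rfl⟩)
      · have h : x = y := h
        subst h; rfl
      · have h : x = y := h
        subst h; rfl
  rw [this]
  exact (key A hA inferInstance).union (key B hB inferInstance)

def eC : ℂ ≃ₗᵢ[ℝ] E2 := Complex.orthonormalBasisOneI.repr

def ofD (z : Disk) : ℂ := eC.symm z
def toD (z : ℂ) : Disk := if h : ‖z‖ ≤ 1 then ⟨eC z, by simpa [Disk] using h⟩ else ⟨0, by simp [Disk]⟩

theorem toD_val {z : ℂ} (h : ‖z‖ ≤ 1) : (toD z : E2) = eC z := by simp [toD, dif_pos h]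
theorem norm_ofD (z : Disk) : ‖ofD z‖ = ‖(z : E2)‖ := by simp [ofD]
theorem norm_ofD_le (z : Disk) : ‖ofD z‖ ≤ 1 := by
  rw [norm_ofD]; simpa [Disk] using z.2
theorem toD_ofD (z : Disk) : toD (ofD z) = z := by
  apply Subtype.ext; rw [toD_val (norm_ofD_le z)]; simp [ofD]
theorem ofD_toD {z : ℂ} (h : ‖z‖ ≤ 1) : ofD (toD z) = z := by
  simp [ofD, toD_val h]
theorem continuous_ofD : Continuous ofD := eC.symm.continuous.comp continuous_subtype_val
theorem continuousOn_toD : ContinuousOn toD (closedBall 0 1) := by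
  rw [IsInducing.subtypeVal.continuousOn_iff]
  exact eC.continuous.continuousOn.congr (fun z hz => toD_val (by simpa using hz))

theorem toD_image_ball : toD '' ball 0 1 = diskInterior := by
  ext z
  constructor
  · rintro ⟨w, hw, rfl⟩
    have hw' : ‖w‖ < 1 := by simpa using hw
    change ‖(toD w : E2)‖ < 1
    rw [toD_val hw'.le]; simpa using hw'
  · intro hz
    exact ⟨ofD z, by simpa [norm_ofD] using (show ‖(z : E2)‖ < 1 from hz), toD_ofD z⟩
theorem toD_image_sphere : toD '' sphere 0 1 = diskBoundary := by
  ext z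
  constructor
  · rintro ⟨w, hw, rfl⟩
    have hw' : ‖w‖ = 1 := by simpa using hw
    change ‖(toD w : E2)‖ = 1
    rw [toD_val hw'.le]; simpa using hw'
  · intro hz
    exact ⟨ofD z, by simpa [norm_ofD] using (show ‖(z : E2)‖ = 1 from hz), toD_ofD z⟩
theorem ofD_image_interior : ofD '' diskInterior = ball 0 1 := by
  rw [← toD_image_ball, ← image_comp]
  ext z
  constructor
  · rintro ⟨w, hw, rfl⟩
    have hw' : ‖w‖ < 1 := by simpa using hw
    rwa [Function.comp_apply, ofD_toD hw'.le]
  · intro hz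
    have hw' : ‖z‖ < 1 := by simpa using hz
    exact ⟨z, hz, ofD_toD hw'.le⟩
theorem ofD_image_boundary : ofD '' diskBoundary = sphere 0 1 := by
  rw [← toD_image_sphere, ← image_comp]
  ext z
  constructor
  · rintro ⟨w, hw, rfl⟩
    have hw' : ‖w‖ = 1 := by simpa using hw
    rwa [Function.comp_apply, ofD_toD hw'.le]
  · intro hz
    have hw' : ‖z‖ = 1 := by simpa using hz
    exact ⟨z, hz, ofD_toD hw'.le⟩
theorem range_ofD : range ofD = closedBall 0 1 := by
  ext z
  constructor
  · rintro ⟨w, rfl⟩; simpa using norm_ofD_le w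
  · intro hz; exact ⟨toD z, ofD_toD (by simpa using hz)⟩

theorem compactSpace_disk : CompactSpace Disk := isCompact_iff_compactSpace.1 (isCompact_closedBall _ _)

theorem isDisc_of_emb {X : Type*} [TopologicalSpace X] {f : Disk → X} (hf : IsDiskEmbedding f) :
    IsDisc (f ∘ toD) := by
  refine ⟨hf.1.continuous.comp_continuousOn continuousOn_toD, ?_, ?_⟩
  · intro a ha b hb hab
    rw [← ofD_toD (z := a) (by simpa using ha), ← ofD_toD (z := b) (by simpa using hb), hf.1.injective hab]
  · rw [image_comp, toD_image_ball]; exact hf.2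

theorem emb_of_isDisc {X : Type*} [TopologicalSpace X] [T2Space X] {f : ℂ → X} (hf : IsDisc f) :
    IsDiskEmbedding (f ∘ ofD) := by
  have := compactSpace_disk
  refine ⟨(Continuous.isClosedEmbedding (hf.cont.comp_continuous continuous_ofD
    (fun z => by simpa using norm_ofD_le z)) ?_).isEmbedding, ?_⟩
  · intro a b hab
    rw [← toD_ofD a, ← toD_ofD b]
    rw [hf.inj (by simpa using norm_ofD_le a) (by simpa using norm_ofD_le b) hab]
  · rw [image_comp, ofD_image_interior]; exact hf.opn

/-- Every embedded disc of `Y` extends to an open embedding of the plane. -/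
def Collared (Y : Type*) [TopologicalSpace Y] : Prop :=
  ∀ g : ℂ → Y, IsDisc g → ∃ γ : ℂ → Y, IsOpenEmbedding γ ∧ ∀ z, ‖z‖ ≤ 1 → γ z = g z

theorem pieceMap {Z X : Type*} [TopologicalSpace Z] [TopologicalSpace X] {A : Set Z} {S : Set X}
    (h : A ≃ₜ S) (hS : S.Nonempty) : ∃ i : X → Z, (∀ x (hx : x ∈ S), i x = h.symm ⟨x, hx⟩) ∧
      ContinuousOn i S ∧ InjOn i S := by
  classical
  obtain ⟨s, hs⟩ := hS
  have e : ∀ x (hx : x ∈ S), (fun x => if hx : x ∈ S then (h.symm ⟨x, hx⟩ : Z) else h.symm ⟨s, hs⟩) x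
      = h.symm ⟨x, hx⟩ := fun x hx => by simp only [dif_pos hx]
  refine ⟨fun x => if hx : x ∈ S then h.symm ⟨x, hx⟩ else h.symm ⟨s, hs⟩, e, ?_, ?_⟩
  · rw [continuousOn_iff_continuous_domRestrict]
    refine (continuous_subtype_val.comp h.symm.continuous).congr ?_
    rintro ⟨x, hx⟩
    exact (e x hx).symm
  · intro a ha b hb hab
    rw [e a ha, e b hb] at hab
    have := h.symm.injective (Subtype.ext hab)
    exact congrArg Subtype.val this

theorem IsConnSum.pre {Z X Y : TopCat.{0}} [T2Space X] [T2Space Y] (h : IsConnSum Z X Y) :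
    T2Space Z ∧ ∃ (f : ℂ → X) (g : ℂ → Y) (i : X → Z) (j : Y → Z), PreSum f g i j := by
  obtain ⟨A, B, f, g, hf, hg, cA, cB, hAB, hA, hB, e1, e2⟩ := h
  have tA : T2Space A := hA.symm.t2Space
  have tB : T2Space B := hB.symm.t2Space
  refine ⟨t2_of_closed_cover cA cB hAB, f ∘ toD, g ∘ toD, ?_⟩
  have df := isDisc_of_emb hf
  have dg := isDisc_of_emb hg
  have bf : (f ∘ toD) '' ball 0 1 = f '' diskInterior := by rw [image_comp, toD_image_ball]
  have bg : (g ∘ toD) '' ball 0 1 = g '' diskInterior := by rw [image_comp, toD_image_ball]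
  have sf : (f ∘ toD) '' sphere 0 1 = f '' diskBoundary := by rw [image_comp, toD_image_sphere]
  have sg : (g ∘ toD) '' sphere 0 1 = g '' diskBoundary := by rw [image_comp, toD_image_sphere]
  have pk := (⟨hA, hB, e1, e2⟩ : ∃ (hA : A ≃ₜ ((f '' diskInterior)ᶜ : Set X))
      (hB : B ≃ₜ ((g '' diskInterior)ᶜ : Set Y)),
      Subtype.val '' (hA '' {a : A | (a : Z) ∈ B}) = f '' diskBoundary ∧
      Subtype.val '' (hB '' {b : B | (b : Z) ∈ A}) = g '' diskBoundary)
  clear e1 e2 hA hB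
  rw [← bf, ← bg, ← sf, ← sg] at pk
  obtain ⟨hA, hB, e1, e2⟩ := pk
  have nf : ∀ ζ ∈ sphere (0:ℂ) 1, (f ∘ toD) ζ ∈ ((f ∘ toD) '' ball 0 1)ᶜ := fun ζ hζ => by
    have : ‖ζ‖ = 1 := by simpa using hζ
    exact (df.not_mem this.le le_rfl).2 this.ge
  have ng : ∀ ζ ∈ sphere (0:ℂ) 1, (g ∘ toD) ζ ∈ ((g ∘ toD) '' ball 0 1)ᶜ := fun ζ hζ => by
    have : ‖ζ‖ = 1 := by simpa using hζ
    exact (dg.not_mem this.le le_rfl).2 this.ge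
  obtain ⟨i, hi, ci, ii⟩ := pieceMap hA ⟨_, nf 1 (by simp)⟩
  obtain ⟨j, hj, cj, ij⟩ := pieceMap hB ⟨_, ng 1 (by simp)⟩
  -- points of the overlap
  have ovA : ∀ w (hw : w ∈ ((f ∘ toD) '' ball 0 1)ᶜ), i w ∈ B ↔ w ∈ (f ∘ toD) '' sphere 0 1 := by
    intro w hw
    rw [← e1, hi w hw]
    constructor
    · intro h
      exact ⟨⟨w, hw⟩, ⟨hA.symm ⟨w, hw⟩, h, by simp⟩, rfl⟩
    · rintro ⟨_, ⟨a, ha, rfl⟩, rfl⟩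
      simpa using ha
  have ovB : ∀ w (hw : w ∈ ((g ∘ toD) '' ball 0 1)ᶜ), j w ∈ A ↔ w ∈ (g ∘ toD) '' sphere 0 1 := by
    intro w hw
    rw [← e2, hj w hw]
    constructor
    · intro h
      exact ⟨⟨w, hw⟩, ⟨hB.symm ⟨w, hw⟩, h, by simp⟩, rfl⟩
    · rintro ⟨_, ⟨a, ha, rfl⟩, rfl⟩
      simpa using ha
  have iA : ∀ w ∈ ((f ∘ toD) '' ball 0 1)ᶜ, i w ∈ A := fun w hw => by rw [hi w hw]; exact Subtype.coe_prop _
  have jB : ∀ w ∈ ((g ∘ toD) '' ball 0 1)ᶜ, j w ∈ B := fun w hw => by rw [hj w hw]; exact Subtype.coe_prop _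
  have Ai : ∀ z ∈ A, ∃ w ∈ ((f ∘ toD) '' ball 0 1)ᶜ, i w = z := fun z hz =>
    ⟨hA ⟨z, hz⟩, (hA ⟨z, hz⟩).2, by rw [hi _ (hA ⟨z, hz⟩).2]; simp⟩
  have Bj : ∀ z ∈ B, ∃ w ∈ ((g ∘ toD) '' ball 0 1)ᶜ, j w = z := fun z hz =>
    ⟨hB ⟨z, hz⟩, (hB ⟨z, hz⟩).2, by rw [hj _ (hB ⟨z, hz⟩).2]; simp⟩
  refine ⟨i, j, df, dg, ci, cj, ii, ij, ?_, ?_, ?_, ?_⟩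
  · intro w hw y hy he
    exact ⟨(ovA w hw).1 (he ▸ jB y hy), (ovB y hy).1 (he ▸ iA w hw)⟩
  · intro ζ hζ
    have h1 := (ovA _ (nf ζ hζ)).2 ⟨ζ, hζ, rfl⟩
    obtain ⟨y, hy, he⟩ := Bj _ h1
    obtain ⟨ξ, hξ, rfl⟩ := (ovB y hy).1 (he ▸ iA _ (nf ζ hζ))
    exact ⟨ξ, hξ, he.symm⟩
  · intro ζ hζ
    have h1 := (ovB _ (ng ζ hζ)).2 ⟨ζ, hζ, rfl⟩
    obtain ⟨y, hy, he⟩ := Ai _ h1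
    obtain ⟨ξ, hξ, rfl⟩ := (ovA y hy).1 (he ▸ jB _ (ng ζ hζ))
    exact ⟨ξ, hξ, he.symm⟩
  · intro z
    have : z ∈ A ∪ B := hAB ▸ mem_univ z
    rcases this with h | h
    · exact Or.inl (Ai z h)
    · exact Or.inr (Bj z h)

theorem IsConnSum.csum {Z X Y : TopCat.{0}} [T2Space X] [T2Space Y] (hY : Collared Y)
    (h : IsConnSum Z X Y) : T2Space Z ∧ ∃ (ψ : ℂ → X) (η : ℂ → Y), CSum Z X ψ Y η := by
  obtain ⟨hT, f, g, i, j, h⟩ := h.pre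
  obtain ⟨γ, h1, h2⟩ := hY g h.hg
  exact ⟨hT, h.toCSum h1 h2⟩

theorem CSum.isConnSum {Z X Y : TopCat.{0}} [T2Space X] [T2Space Y] [T2Space Z] [CompactSpace X]
    [CompactSpace Y] {ψ : ℂ → X} {η : ℂ → Y} (h : CSum Z X ψ Y η) : IsConnSum Z X Y := by
  obtain ⟨i, j, h⟩ := h
  have bψ : (ψ ∘ ofD) '' diskInterior = ψ '' ball 0 1 := by rw [image_comp, ofD_image_interior]
  have bη : (η ∘ ofD) '' diskInterior = η '' ball 0 1 := by rw [image_comp, ofD_image_interior]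
  have sψ : (ψ ∘ ofD) '' diskBoundary = ψ '' sphere 0 1 := by rw [image_comp, ofD_image_boundary]
  have sη : (η ∘ ofD) '' diskBoundary = η '' sphere 0 1 := by rw [image_comp, ofD_image_boundary]
  have kX : IsCompact (ψ '' ball 0 1)ᶜ := (isClosed_compl_chart h.hψ 1).isCompact
  have kY : IsCompact (η '' ball 0 1)ᶜ := (isClosed_compl_chart h.hη 1).isCompact
  have hh : ∀ (V : TopCat.{0}) (S : Set V) (i : V → Z), IsCompact S → ContinuousOn i S → InjOn i S →
      ∃ H : (i '' S) ≃ₜ S, ∀ a, i (H a) = a := by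
    intro V S i hS hc hi
    have := isCompact_iff_compactSpace.1 hS
    let e := Equiv.Set.imageOfInjOn i S hi
    have he : Continuous e := Continuous.subtype_mk (continuousOn_iff_continuous_domRestrict.1 hc) _
    refine ⟨(Continuous.homeoOfEquivCompactToT2 (f := e) he).symm, ?_⟩
    intro a
    change i (e.symm a) = a
    exact congrArg Subtype.val (e.apply_symm_apply a)
  obtain ⟨hA, hA'⟩ := hh X _ i kX h.ci h.ii
  obtain ⟨hB, hB'⟩ := hh Y _ j kY h.cj h.ij
  refine ⟨i '' (ψ '' ball 0 1)ᶜ, j '' (η '' ball 0 1)ᶜ, ψ ∘ ofD, η ∘ ofD,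
    emb_of_isDisc (IsOpenEmbedding.isDisc h.hψ), emb_of_isDisc (IsOpenEmbedding.isDisc h.hη),
    (kX.image_of_continuousOn h.ci).isClosed, (kY.image_of_continuousOn h.cj).isClosed, ?_, ?_⟩
  · rw [eq_univ_iff_forall]
    intro z
    rcases h.cov z with ⟨w, hw, rfl⟩ | ⟨w, hw, rfl⟩
    · exact Or.inl ⟨w, hw, rfl⟩
    · exact Or.inr ⟨w, hw, rfl⟩
  rw [bψ, bη, sψ, sη]
  refine ⟨hA, hB, ?_, ?_⟩
  · ext w
    constructor
    · rintro ⟨_, ⟨a, ⟨y, hy, he⟩, rfl⟩, rfl⟩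
      obtain ⟨ζ, hζ, h1, -⟩ := h.ovl _ (hA a).2 y hy (by rw [hA', he])
      exact ⟨ζ, by simpa using hζ, h1.symm⟩
    · rintro ⟨ζ, hζ, rfl⟩
      have hζ' : ‖ζ‖ = 1 := by simpa using hζ
      have n1 := (not_mem_chart_ball h.hψ).2 hζ'.ge
      have n2 := (not_mem_chart_ball h.hη).2 hζ'.ge
      refine ⟨hA ⟨i (ψ ζ), _, n1, rfl⟩, ⟨_, ⟨_, n2, (h.seam ζ hζ').symm⟩, rfl⟩, ?_⟩
      exact h.ii (hA _).2 n1 (hA' _)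
  · ext w
    constructor
    · rintro ⟨_, ⟨a, ⟨y, hy, he⟩, rfl⟩, rfl⟩
      obtain ⟨ζ, hζ, -, h1⟩ := h.ovl y hy _ (hB a).2 (by rw [hB', he])
      exact ⟨ζ, by simpa using hζ, h1.symm⟩
    · rintro ⟨ζ, hζ, rfl⟩
      have hζ' : ‖ζ‖ = 1 := by simpa using hζ
      have n1 := (not_mem_chart_ball h.hψ).2 hζ'.ge
      have n2 := (not_mem_chart_ball h.hη).2 hζ'.ge
      refine ⟨hB ⟨j (η ζ), _, n2, rfl⟩, ⟨_, ⟨_, n1, h.seam ζ hζ'⟩, rfl⟩, ?_⟩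
      exact h.ij (hB _).2 n2 (hB' _)

/-- A disc that lifts through an open, locally injective map from the plane is collared. -/
theorem collar_of_lift {Y : Type*} [TopologicalSpace Y] [T2Space Y] (p : ℂ → Y) (hp : Continuous p)
    (ho : IsOpenMap p) (hl : ∀ x, ∃ u ∈ 𝓝 x, InjOn p u) {g : ℂ → Y} (hg : IsDisc g) (k : ℂ → ℂ)
    (hk : ContinuousOn k (closedBall 0 1)) (hpk : ∀ z, ‖z‖ ≤ 1 → p (k z) = g z) :
    ∃ γ : ℂ → Y, IsOpenEmbedding γ ∧ ∀ z, ‖z‖ ≤ 1 → γ z = g z := by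
  have hki : InjOn k (closedBall 0 1) := by
    intro a ha b hb hab
    apply hg.inj ha hb
    rw [← hpk a (by simpa using ha), ← hpk b (by simpa using hb), hab]
  have hopen : IsOpen (k '' ball 0 1) := by
    rw [isOpen_iff_mem_nhds]
    rintro _ ⟨z, hz, rfl⟩
    have hz' : ‖z‖ < 1 := by simpa using hz
    obtain ⟨u, hu, hinj⟩ := hl (k z)
    have hzn : closedBall (0:ℂ) 1 ∈ 𝓝 z := Filter.mem_of_superset (isOpen_ball.mem_nhds hz) ball_subset_closedBall
    set θ : Y → ℂ := Function.invFunOn g (closedBall 0 1) with hθ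
    have hθg : ∀ z, ‖z‖ ≤ 1 → θ (g z) = z := fun z hz => hg.inj.leftInvOn_invFunOn (by simpa using hz)
    have hgn : g '' ball 0 1 ∈ 𝓝 (p (k z)) := by
      rw [hpk z hz'.le]; exact hg.opn.mem_nhds ⟨z, hz, rfl⟩
    have hθc : ContinuousAt θ (p (k z)) :=
      (invFunOn_continuousOn (isCompact_closedBall _ _) hg.cont hg.inj).continuousAt
        (Filter.mem_of_superset hgn (image_mono ball_subset_closedBall))
    have e0 : θ (p (k z)) = z := by rw [hpk z hz'.le, hθg z hz'.le]
    have hkc : ContinuousAt k (θ (p (k z))) := by rw [e0]; exact hk.continuousAt hzn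
    have hc : ContinuousAt (fun w => k (θ (p w))) (k z) :=
      ContinuousAt.comp (f := fun w => θ (p w)) (g := k) hkc
        (ContinuousAt.comp (f := p) (g := θ) hθc hp.continuousAt)
    have h1 : ∀ᶠ w in 𝓝 (k z), k (θ (p w)) ∈ u := by
      apply hc.eventually
      change u ∈ 𝓝 (k (θ (p (k z))))
      rw [e0]; exact hu
    have h2 : ∀ᶠ w in 𝓝 (k z), p w ∈ g '' ball 0 1 := hp.continuousAt.eventually hgn
    filter_upwards [h1, h2, hu] with w hw1 hw2 hw3
    obtain ⟨v, hv, he⟩ := hw2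
    have hv' : ‖v‖ < 1 := by simpa using hv
    rw [← he, hθg v hv'.le] at hw1
    exact ⟨v, hv, hinj hw1 hw3 (by rw [hpk v hv'.le, he])⟩
  have hχ : PlDisc (fun z => k z - k 0) := by
    refine ⟨hk.sub continuousOn_const, ?_, ?_, by simp⟩
    · intro a ha b hb hab
      exact hki ha hb (sub_left_injective hab)
    · have : (fun z => k z - k 0) '' ball 0 1 = (fun w => w - k 0) '' (k '' ball 0 1) := by
        rw [image_image]
      rw [this]
      exact (Homeomorph.subRight (k 0)).isOpenMap _ hopen
  obtain ⟨H, R, c, hc, -, hH⟩ := hχ.straighten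
  set Ψ : ℂ ≃ₜ ℂ := (c.trans H.symm).trans (Homeomorph.addRight (k 0)) with hΨ
  have hΨk : ∀ z, ‖z‖ ≤ 1 → Ψ z = k z := by
    intro z hz
    have : Ψ z = H.symm (c z) + k 0 := rfl
    rw [this, ← hH z hz, H.symm_apply_apply]; ring
  have hPg : ∀ z, ‖z‖ ≤ 1 → p (Ψ z) = g z := fun z hz => by rw [hΨk z hz, hpk z hz]
  have hloc : ∀ x, ∃ u ∈ 𝓝 x, InjOn (p ∘ Ψ) u := by
    intro x
    obtain ⟨u, hu, hi⟩ := hl (Ψ x)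
    refine ⟨Ψ ⁻¹' u, Ψ.continuous.continuousAt hu, ?_⟩
    intro a ha b hb hab
    exact Ψ.injective (hi ha hb hab)
  have hinj : InjOn (p ∘ Ψ) (closedBall 0 1) := by
    intro a ha b hb hab
    apply hg.inj ha hb
    rw [← hPg a (by simpa using ha), ← hPg b (by simpa using hb)]; exact hab
  obtain ⟨t, ht, hti⟩ := hinj.exists_mem_nhdsSet (isCompact_closedBall _ _)
    (fun x _ => (hp.comp Ψ.continuous).continuousAt) (fun x _ => hloc x)
  obtain ⟨O, hO, hO1, hO2⟩ := mem_nhdsSet_iff_exists.1 ht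
  obtain ⟨ε, hε, hsub⟩ := (isCompact_closedBall (0:ℂ) 1).exists_thickening_subset_open hO hO1
  rw [thickening_closedBall hε zero_le_one] at hsub
  obtain ⟨σ, hσ, hσ1, hσ2⟩ := squeeze 1 (ε + 1) one_pos (by linarith)
  refine ⟨p ∘ Ψ ∘ σ, ?_, ?_⟩
  · refine IsOpenEmbedding.of_continuous_injective_isOpenMap (hp.comp (Ψ.continuous.comp hσ.continuous)) ?_
      (ho.comp (Ψ.isOpenMap.comp hσ.isOpenMap))
    intro a b hab
    have hm : ∀ z, σ z ∈ t := fun z => hO2 (hsub (by simpa using hσ2 z))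
    exact hσ.injective (hti (hm a) (hm b) hab)
  · intro z hz
    simp only [Function.comp_apply, hσ1 z hz, hPg z hz]

theorem chart_of_local {Y : Type*} [TopologicalSpace Y] (p : ℂ → Y) (hp : Continuous p)
    (ho : IsOpenMap p) (hl : ∀ x, ∃ u ∈ 𝓝 x, InjOn p u) (z : ℂ) :
    ∃ ψ : ℂ → Y, IsOpenEmbedding ψ ∧ p z ∈ range ψ := by
  obtain ⟨u, hu, hi⟩ := hl z
  obtain ⟨O, hO1, hO2, hO3⟩ := _root_.mem_nhds_iff.1 hu
  obtain ⟨φ, hφ, h0, hr⟩ := chart_at (φ := id) IsOpenEmbedding.id z O hO2 hO3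
  refine ⟨p ∘ φ, IsOpenEmbedding.of_continuous_injective_isOpenMap (hp.comp hφ.continuous) ?_
    (ho.comp hφ.isOpenMap), 0, by simp [h0]⟩
  intro a b hab
  exact hφ.injective (hi (hO1 (hr ⟨a, rfl⟩)) (hO1 (hr ⟨b, rfl⟩)) hab)

theorem eC_mem (z : Circle) : eC z ∈ sphere (0:E2) 1 := by
  rw [mem_sphere_zero_iff_norm, eC.norm_map]; exact Circle.norm_coe z

theorem eC_symm_mem (z : Circ) : eC.symm z ∈ Submonoid.unitSphere ℂ := by
  have : ‖(z : E2)‖ = 1 := by simp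
  simp [Submonoid.unitSphere, this]

def circHomeo : Circle ≃ₜ Circ where
  toFun z := ⟨eC z, eC_mem z⟩
  invFun z := ⟨eC.symm z, eC_symm_mem z⟩
  left_inv z := by ext; simp
  right_inv z := by apply Subtype.ext; simp
  continuous_toFun := Continuous.subtype_mk (eC.continuous.comp continuous_subtype_val) eC_mem
  continuous_invFun := Continuous.subtype_mk (eC.symm.continuous.comp continuous_subtype_val) eC_symm_mem

def torCov (z : ℂ) : Circ × Circ := (circHomeo (Circle.exp z.re), circHomeo (Circle.exp z.im))

theorem torCov_eq : torCov = Prod.map (circHomeo ∘ Circle.exp) (circHomeo ∘ Circle.exp) ∘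
    Complex.equivRealProdCLM := rfl

theorem torCov_cont : Continuous torCov := by
  unfold torCov
  exact (circHomeo.continuous.comp (Circle.exp.continuous.comp Complex.continuous_re)).prodMk
    (circHomeo.continuous.comp (Circle.exp.continuous.comp Complex.continuous_im))

theorem torCov_open : IsOpenMap torCov := by
  rw [torCov_eq]
  have h : IsOpenMap (circHomeo ∘ Circle.exp) := circHomeo.isOpenMap.comp isLocalHomeomorph_circleExp.isOpenMap
  exact (h.prodMap h).comp Complex.equivRealProdCLM.toHomeomorph.isOpenMap

theorem torCov_inj (x : ℂ) : ∃ u ∈ 𝓝 x, InjOn torCov u := by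
  have key : ∀ t : ℝ, ∃ u ∈ 𝓝 t, InjOn Circle.exp u := by
    intro t
    obtain ⟨e, h1, h2⟩ := isLocalHomeomorph_circleExp t
    refine ⟨e.source, e.open_source.mem_nhds h1, ?_⟩
    rw [h2]; exact e.injOn
  obtain ⟨u, hu, hui⟩ := key x.re
  obtain ⟨v, hv, hvi⟩ := key x.im
  refine ⟨Complex.re ⁻¹' u ∩ Complex.im ⁻¹' v, Filter.inter_mem
    (Complex.continuous_re.continuousAt hu) (Complex.continuous_im.continuousAt hv), ?_⟩
  intro a ha b hb hab
  have h1 := circHomeo.injective (congrArg Prod.fst hab)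
  have h2 := circHomeo.injective (congrArg Prod.snd hab)
  exact Complex.ext (hui ha.1 hb.1 h1) (hvi ha.2 hb.2 h2)

theorem circleExp_surj : Function.Surjective Circle.exp := fun z => ⟨_, Circle.exp_arg z⟩

theorem torCov_surj : Function.Surjective torCov := by
  rintro ⟨x, y⟩
  obtain ⟨s, hs⟩ := circleExp_surj (circHomeo.symm x)
  obtain ⟨t, ht⟩ := circleExp_surj (circHomeo.symm y)
  exact ⟨⟨s, t⟩, by simp [torCov, hs, ht]⟩

theorem surf_tor : Surf (Circ × Circ) := by
  refine ⟨inferInstance, inferInstance, ?_, ?_⟩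
  · exact torCov_surj.denseRange.preconnectedSpace torCov_cont
  · intro x
    obtain ⟨z, rfl⟩ := torCov_surj x
    exact chart_of_local torCov torCov_cont torCov_open torCov_inj z

theorem lift_circle (f : ℂ → Circ) (hf : Continuous f) : ∃ F : ℂ → ℝ, Continuous F ∧
    ∀ z, circHomeo (Circle.exp (F z)) = f z := by
  obtain ⟨e, he⟩ := circleExp_surj (circHomeo.symm (f 0))
  obtain ⟨F, ⟨-, hF⟩, -⟩ := Circle.isCoveringMap_exp.existsUnique_continuousMap_lifts
    (⟨fun z => circHomeo.symm (f z), circHomeo.symm.continuous.comp hf⟩ : C(ℂ, Circle)) 0 e he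
  refine ⟨F, F.continuous, fun z => ?_⟩
  have := congrFun hF z
  simp only [Function.comp_apply, ContinuousMap.coe_mk] at this
  rw [this]; simp

theorem collared_tor : Collared (Circ × Circ) := by
  intro g hg
  have hc : Continuous (g ∘ plRetr) := hg.cont.comp_continuous plRetr_continuous plRetr_mem
  obtain ⟨F, hF, hF'⟩ := lift_circle _ (continuous_fst.comp hc)
  obtain ⟨G, hG, hG'⟩ := lift_circle _ (continuous_snd.comp hc)
  refine collar_of_lift torCov torCov_cont torCov_open torCov_inj hg (fun z => (⟨F z, G z⟩ : ℂ)) ?_ ?_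
  · exact (Complex.equivRealProdCLM.symm.continuous.comp (hF.prodMk hG)).continuousOn
  · intro z hz
    simp only [torCov, hF', hG', Function.comp_apply, plRetr_eq (z := z) (by simpa using hz)]

abbrev S2 : Type := sphere (0 : E3) 1
abbrev PRel : S2 → S2 → Prop := fun x y => (y : E3) = -(x : E3)
abbrev PP : Type := Quot PRel

def pq (x : S2) : PP := Quot.mk PRel x

theorem pq_eq {x y : S2} : pq x = pq y ↔ (y : E3) = x ∨ (y : E3) = -x := by
  constructor
  · intro h
    have h' := Quot.eqvGen_exact h
    clear h
    induction h' with
    | rel a b h => exact Or.inr h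
    | refl a => exact Or.inl rfl
    | symm a b _ ih => rcases ih with h | h <;> simp [h]
    | trans a b c _ _ ih1 ih2 => rcases ih1 with h | h <;> rcases ih2 with h' | h' <;> simp [h, h']
  · rintro (h | h)
    · rw [Subtype.ext h]
    · exact Quot.sound h

theorem pq_surj : Function.Surjective pq := Quot.mk_surjective
theorem pq_cont : Continuous pq := continuous_quot_mk

theorem pq_open : IsOpenMap pq := by
  intro O hO
  rw [← (isQuotientMap_quot_mk (r := PRel)).isOpen_preimage]
  have : Quot.mk PRel ⁻¹' (pq '' O) = O ∪ (fun x : S2 => -x) ⁻¹' O := by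
    ext x
    constructor
    · rintro ⟨y, hy, h⟩
      rcases pq_eq.1 h with h | h
      · left; rwa [Subtype.ext h]
      · right
        have : -x = y := Subtype.ext (by simp [h])
        change -x ∈ O
        rwa [this]
    · rintro (h | h)
      · exact ⟨x, h, rfl⟩
      · exact ⟨-x, h, pq_eq.2 (Or.inr (by simp))⟩
  rw [this]
  exact hO.union (hO.preimage continuous_neg)

theorem pq_inj (x : S2) : ∃ u ∈ 𝓝 x, InjOn pq u := by
  refine ⟨ball x 1, ball_mem_nhds x one_pos, ?_⟩
  intro a ha b hb hab
  rcases pq_eq.1 hab with h | h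
  · exact (Subtype.ext h).symm
  · exfalso
    have h1 : dist a b < 2 := by
      have := dist_triangle_right a b x
      have h1 := mem_ball.1 ha
      have h2 := mem_ball.1 hb
      linarith
    have ha' : ‖(a : E3)‖ = 1 := by simp
    rw [Subtype.dist_eq, h, dist_eq_norm, sub_neg_eq_add, ← two_smul ℝ, norm_smul, ha'] at h1
    norm_num at h1

theorem pq_openQuotient : IsOpenQuotientMap pq := ⟨pq_surj, pq_cont, pq_open⟩

theorem sphere_eq_pm {x y : E3} (hx : x ≠ 0) (h : ∀ a b, x a * x b = y a * y b) : y = x ∨ y = -x := by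
  have : ∃ a, x a ≠ 0 := by
    by_contra hc
    push Not at hc
    exact hx (by ext a; simpa using hc a)
  obtain ⟨a, ha⟩ := this
  have h1 : (y a - x a) * (y a + x a) = 0 := by have := h a a; linarith
  rcases mul_eq_zero.1 h1 with h2 | h2
  · left
    ext b
    have := h a b
    rw [sub_eq_zero.1 h2] at this
    exact (mul_left_cancel₀ ha this).symm
  · right
    ext b
    have := h a b
    rw [eq_neg_of_add_eq_zero_left h2] at this
    have h3 : x a * x b = x a * -y b := by linarith
    have := mul_left_cancel₀ ha h3
    simp; linarith

theorem s2_ne (x : S2) : (x : E3) ≠ 0 := by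
  have : ‖(x : E3)‖ = 1 := by simp
  intro h; rw [h] at this; simp at this

theorem e3_self_neg {x : E3} (h : x = -x) : x = 0 := by
  ext a
  have := congrArg (fun v : E3 => v a) h
  simp only [PiLp.neg_apply] at this
  simp only [PiLp.zero_apply]
  linarith

instance pp_t2 : T2Space PP := by
  let V : PP → Fin 3 → Fin 3 → ℝ := Quot.lift (fun x a b => (x : E3) a * (x : E3) b) (by
    intro x y h
    funext a b
    simp [h])
  have hV : Continuous V := by
    refine continuous_quot_lift _ ?_
    fun_prop
  refine T2Space.of_injective_continuous (f := V) ?_ hV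
  intro P Q h
  obtain ⟨x, rfl⟩ := pq_surj P
  obtain ⟨y, rfl⟩ := pq_surj Q
  refine pq_eq.2 (sphere_eq_pm (s2_ne x) ?_)
  intro a b
  exact congrFun (congrFun h a) b

theorem pq_cov : IsCoveringMap pq := by
  rw [← isLocalHomeomorph_iff_isCoveringMap, isLocalHomeomorph_iff_isOpenEmbedding_restrict]
  intro x
  obtain ⟨u, hu, hi⟩ := pq_inj x
  obtain ⟨O, hO1, hO2, hO3⟩ := _root_.mem_nhds_iff.1 hu
  refine ⟨O, hO2.mem_nhds hO3, ?_⟩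
  refine IsOpenEmbedding.of_continuous_injective_isOpenMap (pq_cont.comp continuous_subtype_val) ?_
    (pq_open.comp hO2.isOpenMap_subtype_val)
  intro a b hab
  exact Subtype.ext (hi (hO1 a.2) (hO1 b.2) hab)

instance : Fact (Module.finrank ℝ E3 = 2 + 1) := ⟨by simp⟩

/-- parametrisation of `RP²` minus nothing by inverse stereographic projection -/
def stP (v : S2) (z : ℂ) : PP := pq ((stereographic' 2 v).symm (eC z))

theorem stS_cont (v : S2) : Continuous (stereographic' 2 v).symm := by
  have := (stereographic' 2 v).continuousOn_symm
  simpa [← continuousOn_univ] using this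

theorem stP_cont (v : S2) : Continuous (stP v) := pq_cont.comp ((stS_cont v).comp eC.continuous)

theorem stS_openEmb (v : S2) : IsOpenEmbedding (fun z : ℂ => (stereographic' 2 v).symm (eC z)) := by
  have h := (stereographic' 2 v).symm.isOpenEmbedding (by simp)
  exact h.comp eC.toHomeomorph.isOpenEmbedding

theorem stP_open (v : S2) : IsOpenMap (stP v) := pq_open.comp (stS_openEmb v).isOpenMap

theorem stP_inj (v : S2) (x : ℂ) : ∃ u ∈ 𝓝 x, InjOn (stP v) u := by
  obtain ⟨u, hu, hi⟩ := pq_inj ((stereographic' 2 v).symm (eC x))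
  refine ⟨_, (stS_openEmb v).continuous.continuousAt hu, ?_⟩
  intro a ha b hb hab
  exact (stS_openEmb v).injective (hi ha hb hab)

theorem surf_pp : Surf PP := by
  have : PreconnectedSpace S2 := Subtype.preconnectedSpace
    (isPreconnected_sphere (by rw [← Module.finrank_eq_rank]; norm_num) 0 1)
  refine ⟨inferInstance, inferInstance, pq_surj.denseRange.preconnectedSpace pq_cont, ?_⟩
  intro P
  obtain ⟨x, rfl⟩ := pq_surj P
  have hx : x ∈ (stereographic' 2 (-x)).source := by
    simp only [stereographic'_source, mem_compl_iff, mem_singleton_iff]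
    intro h
    have := congrArg Subtype.val h
    simp only [coe_neg_sphere] at this
    exact s2_ne x (e3_self_neg this)
  have := chart_of_local (stP (-x)) (stP_cont _) (stP_open _) (stP_inj _)
    (eC.symm (stereographic' 2 (-x) x))
  simpa [stP, (stereographic' 2 (-x)).left_inv hx] using this

theorem collared_pp : Collared PP := by
  intro g hg
  have hc : Continuous (g ∘ plRetr) := hg.cont.comp_continuous plRetr_continuous plRetr_mem
  obtain ⟨e, he⟩ := pq_surj ((g ∘ plRetr) 0)
  obtain ⟨F, ⟨hF0, hF⟩, -⟩ := pq_cov.existsUnique_continuousMap_lifts (⟨_, hc⟩ : C(ℂ, PP)) 0 e he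
  have hF' : ∀ z, ‖z‖ ≤ 1 → pq (F z) = g z := by
    intro z hz
    have := congrFun hF z
    simpa [plRetr_eq (z := z) (by simpa using hz)] using this
  have hsrc : ∀ z, ‖z‖ ≤ 1 → F z ∈ (stereographic' 2 (-F 0)).source := by
    intro z hz
    simp only [stereographic'_source, mem_compl_iff, mem_singleton_iff]
    intro h
    have h1 : pq (F 0) = pq (F z) := pq_eq.2 (Or.inr (by rw [h]; simp))
    rw [hF' z hz, hF' 0 (by simp)] at h1
    have := hg.inj (by simp) (by simpa using hz) h1
    subst this
    have := congrArg Subtype.val h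
    simp only [coe_neg_sphere] at this
    exact s2_ne _ (e3_self_neg this)
  refine collar_of_lift (stP (-F 0)) (stP_cont _) (stP_open _) (stP_inj _) hg
    (fun z => eC.symm (stereographic' 2 (-F 0) (F z))) ?_ ?_
  · refine eC.symm.continuous.comp_continuousOn ?_
    exact (stereographic' 2 (-F 0)).continuousOn.comp F.continuous.continuousOn
      (fun z hz => hsrc z (by simpa using hz))
  · intro z hz
    simp only [stP, LinearIsometryEquiv.apply_symm_apply]
    rw [(stereographic' 2 (-F 0)).left_inv (hsrc z hz), hF' z hz]

theorem cone_lift {c : ℂ ≃ₜ ℂ} (hc : IsCone c) : ∃ T : ℝ → ℝ, Continuous T ∧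
    ∀ x, (Circle.exp (T x) : ℂ) = c (Circle.exp x) := by
  have hm : ∀ u : Circle, c u ∈ Submonoid.unitSphere ℂ := fun u => by
    have : ‖c u‖ = 1 := by rw [hc.norm]; exact Circle.norm_coe u
    simp [Submonoid.unitSphere, this]
  have hcont : Continuous (fun x : ℝ => (⟨c (Circle.exp x), hm _⟩ : Circle)) :=
    Continuous.subtype_mk (c.continuous.comp (continuous_subtype_val.comp Circle.exp.continuous)) (fun x => hm _)
  obtain ⟨e, he⟩ := circleExp_surj (⟨c (Circle.exp 0), hm _⟩ : Circle)
  obtain ⟨F, ⟨-, hF⟩, -⟩ := Circle.isCoveringMap_exp.existsUnique_continuousMap_lifts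
    (⟨_, hcont⟩ : C(ℝ, Circle)) 0 e he
  refine ⟨F, F.continuous, fun x => ?_⟩
  exact congrArg Subtype.val (congrFun hF x)

/-- a continuous real function with values in `2 π ℤ` is constant -/
theorem const_of_exp_one (P : ℝ → ℝ) (hP : Continuous P) (h : ∀ x, Circle.exp (P x) = 1) :
    ∃ m : ℤ, ∀ x, P x = m * (2 * Real.pi) := by
  have hz : ∀ x, ∃ m : ℤ, P x = m * (2 * Real.pi) := by
    intro x
    have := h x
    rw [← Circle.exp_zero, Circle.exp_eq_exp] at this
    obtain ⟨m, hm⟩ := this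
    exact ⟨m, by rw [hm]; ring⟩
  obtain ⟨F, ⟨-, -⟩, hu⟩ := Circle.isCoveringMap_exp.existsUnique_continuousMap_lifts
    (ContinuousMap.const ℝ (1 : Circle)) 0 (P 0) (h 0)
  have h1 := hu ⟨P, hP⟩ ⟨rfl, funext h⟩
  have h2 := hu (ContinuousMap.const ℝ (P 0)) ⟨rfl, funext fun x => h 0⟩
  obtain ⟨m, hm⟩ := hz 0
  refine ⟨m, fun x => ?_⟩
  have := congrArg (fun f : C(ℝ, ℝ) => f x) (h1.trans h2.symm)
  rw [← hm]; exact this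

theorem lift_shift {T : ℝ → ℝ} (hT : Continuous T) {c : ℂ → ℂ}
    (h : ∀ x, (Circle.exp (T x) : ℂ) = c (Circle.exp x)) :
    ∃ d : ℤ, ∀ x, T (x + 2 * Real.pi) = T x + d * (2 * Real.pi) := by
  obtain ⟨d, hd⟩ := const_of_exp_one (fun x => T (x + 2 * Real.pi) - T x)
    ((hT.comp (continuous_add_const _)).sub hT) (fun x => by
      rw [Circle.exp_sub, div_eq_one]
      apply Circle.ext
      rw [h, h, Circle.exp_add, Circle.exp_two_pi, mul_one])
  exact ⟨d, fun x => by have := hd x; linarith⟩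

theorem shift_int {T : ℝ → ℝ} {d : ℤ} (h : ∀ x, T (x + 2 * Real.pi) = T x + d * (2 * Real.pi)) (k : ℤ) (x : ℝ) :
    T (x + k * (2 * Real.pi)) = T x + d * k * (2 * Real.pi) := by
  have hp : Function.Periodic (fun x => T x - d * x) (2 * Real.pi) := fun x => by
    change T (x + 2 * Real.pi) - d * (x + 2 * Real.pi) = T x - d * x
    rw [h x]; ring
  have := hp.int_mul k x
  linarith

/-- either the lift is increasing of degree one, or decreasing of degree minus one -/
theorem cone_lift_mono {c : ℂ ≃ₜ ℂ} (hc : IsCone c) : ∃ T : ℝ → ℝ, Continuous T ∧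
    (∀ x, (Circle.exp (T x) : ℂ) = c (Circle.exp x)) ∧
    ((StrictMono T ∧ ∀ x, T (x + 2 * Real.pi) = T x + 2 * Real.pi) ∨
     (StrictAnti T ∧ ∀ x, T (x + 2 * Real.pi) = T x - 2 * Real.pi)) := by
  obtain ⟨T, hT, hTc⟩ := cone_lift hc
  obtain ⟨S, hS, hSc⟩ := cone_lift hc.symm
  obtain ⟨d, hd⟩ := lift_shift hT hTc
  obtain ⟨d', hd'⟩ := lift_shift hS hSc
  obtain ⟨m, hm⟩ := const_of_exp_one (fun x => S (T x) - x) ((hS.comp hT).sub continuous_id) (fun x => by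
    rw [Circle.exp_sub, div_eq_one]
    apply Circle.ext
    rw [hSc, hTc, c.symm_apply_apply])
  have hpi := Real.pi_pos
  have hdd : d' * d = 1 := by
    have h1 := hm 0
    have h2 := hm (0 + 2 * Real.pi)
    rw [hd, shift_int hd'] at h2
    have h3 : ((d' * d : ℤ) : ℝ) * (2 * Real.pi) = 1 * (2 * Real.pi) := by push_cast; linarith
    have h4 := mul_right_cancel₀ (by positivity) h3
    exact_mod_cast h4
  have hinj : Function.Injective T := by
    intro x y hxy
    have h1 := hm x
    have h2 := hm y
    simp only [hxy] at h1 h2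
    linarith
  refine ⟨T, hT, hTc, ?_⟩
  have hd1 : d = 1 ∨ d = -1 := Int.isUnit_iff.1 (IsUnit.of_mul_eq_one d' (by rw [mul_comm]; exact hdd))
  rcases hT.strictMono_of_inj hinj with h | h
  · left
    refine ⟨h, fun x => ?_⟩
    rcases hd1 with rfl | rfl
    · rw [hd]; simp
    · have := h (show x < x + 2 * Real.pi by linarith)
      rw [hd] at this
      push_cast at this
      linarith
  · right
    refine ⟨h, fun x => ?_⟩
    rcases hd1 with rfl | rfl
    · have := h (show x < x + 2 * Real.pi by linarith)
      rw [hd] at this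
      push_cast at this
      linarith
    · rw [hd]; push_cast; ring

theorem cone_ext_mono {c : ℂ ≃ₜ ℂ} (hc : IsCone c) {T : ℝ → ℝ} (hT : Continuous T)
    (hTc : ∀ x, (Circle.exp (T x) : ℂ) = c (Circle.exp x)) (hTm : StrictMono T)
    (hT2 : ∀ x, T (x + 2 * Real.pi) = T x + 2 * Real.pi) :
    ∃ H : ℂ ≃ₜ ℂ, (∀ z, ‖z‖ ≤ 1 → H z = c z) ∧ ∀ z, 2 ≤ ‖z‖ → H z = z := by
  have hpi := Real.pi_pos
  set P : ℝ → ℝ := fun x => T x - x with hP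
  have hPc : Continuous P := hT.sub continuous_id
  have hPp : Function.Periodic P (2 * Real.pi) := fun x => by simp only [hP]; rw [hT2]; ring
  set δ : Circle → ℝ := fun u => P (Complex.arg u) with hδ
  have hδe : ∀ x, δ (Circle.exp x) = P x := by
    intro x
    have h1 : Circle.exp (Complex.arg (Circle.exp x)) = Circle.exp x := Circle.exp_arg _
    rw [Circle.exp_eq_exp] at h1
    obtain ⟨m, hm⟩ := h1
    simp only [hδ]
    rw [hm]
    exact hPp.int_mul m x
  have hδc : Continuous δ := by
    have hq : IsOpenQuotientMap Circle.exp :=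
      ⟨circleExp_surj, Circle.exp.continuous, isLocalHomeomorph_circleExp.isOpenMap⟩
    rw [← hq.continuous_comp_iff]
    exact hPc.congr (fun x => (hδe x).symm)
  have hδn : ∀ (u : Circle), c u = u * Circle.exp (δ u) := by
    intro u
    obtain ⟨x, rfl⟩ := circleExp_surj u
    rw [hδe, ← hTc, ← Circle.coe_mul, ← Circle.exp_add]
    simp [hP]
  -- the interpolation parameter
  set s : ℝ → ℝ := fun r => max 0 (min 1 (2 - r)) with hs
  have hsc : Continuous s := by fun_prop
  have hs0 : ∀ r, 0 ≤ s r := fun r => le_max_left _ _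
  have hs1 : ∀ r, s r ≤ 1 := fun r => max_le zero_le_one (min_le_left _ _)
  set Q : ℝ → ℝ → ℝ := fun r x => x + s r * P x with hQ
  have hQm : ∀ r, StrictMono (Q r) := by
    intro r x y hxy
    have h1 := hTm hxy
    simp only [hQ, hP]
    have := hs0 r
    have h2 := hs1 r
    rcases eq_or_lt_of_le h2 with h3 | h3
    · rw [h3]; linarith
    · nlinarith
  have hQ2 : ∀ r (k : ℤ) x, Q r (x + k * (2 * Real.pi)) = Q r x + k * (2 * Real.pi) := by
    intro r k x
    simp only [hQ]
    rw [hPp.int_mul k x]; ring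
  have hQs : ∀ r, Function.Surjective (Q r) := by
    intro r t
    have hQc : Continuous (Q r) := by simp only [hQ]; fun_prop
    have harch : ∀ b : ℝ, ∃ k : ℤ, b ≤ k * (2 * Real.pi) := by
      intro b
      obtain ⟨n, hn⟩ := exists_int_gt (b / (2 * Real.pi))
      exact ⟨n, ((div_lt_iff₀ (by positivity)).1 hn).le⟩
    obtain ⟨k, hk⟩ := harch (t - Q r 0)
    obtain ⟨l, hl⟩ := harch (Q r 0 - t)
    refine mem_range_of_exists_le_of_exists_ge hQc ⟨0 + (-l : ℤ) * (2 * Real.pi), ?_⟩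
      ⟨0 + k * (2 * Real.pi), ?_⟩
    · rw [hQ2]; push_cast; linarith
    · rw [hQ2]; linarith
  -- the direction of a nonzero complex number
  have hum : ∀ z : ℂ, z ≠ 0 → z / ‖z‖ ∈ Submonoid.unitSphere ℂ := fun z hz => by
    simp [Submonoid.unitSphere, hz]
  classical
  set dir : ℂ → Circle := fun z => if h : z ≠ 0 then ⟨z / ‖z‖, hum z h⟩ else 1 with hdir
  have hdirv : ∀ z, z ≠ 0 → (dir z : ℂ) = z / ‖z‖ := fun z h => by
    have : dir z = ⟨z / ‖z‖, hum z h⟩ := dif_pos h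
    rw [this]
  have hdirz : ∀ z, z = ‖z‖ * (dir z : ℂ) := by
    intro z
    by_cases h : z = 0
    · simp [h]
    · rw [hdirv z h]
      have : (‖z‖ : ℂ) ≠ 0 := by simpa using h
      field_simp
  have hdirr : ∀ (r : ℝ) (u : Circle), 0 < r → dir (r * u) = u := by
    intro r u hr
    have hne : (r * u : ℂ) ≠ 0 := mul_ne_zero (by exact_mod_cast hr.ne') (Circle.coe_ne_zero u)
    apply Circle.ext
    rw [hdirv _ hne]
    have h0 : (r:ℂ) ≠ 0 := by exact_mod_cast hr.ne'
    simp [abs_of_pos hr]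
    field_simp
    rw [Circle.norm_coe]; simp
  have hdirc : ContinuousOn dir {0}ᶜ := by
    have : IsInducing (Subtype.val : Submonoid.unitSphere ℂ → ℂ) := IsInducing.subtypeVal
    refine (this.continuousOn_iff (f := dir)).2 ?_
    refine ContinuousOn.congr (f := fun z : ℂ => z / ‖z‖) ?_ (fun z hz => hdirv z hz)
    refine ContinuousOn.div continuousOn_id (by fun_prop) ?_
    intro z hz
    simpa using hz
  set f : ℂ → ℂ := fun z => z * Circle.exp (s ‖z‖ * δ (dir z)) with hf
  have hfn : ∀ z, ‖f z‖ = ‖z‖ := fun z => by simp only [hf, norm_mul, Circle.norm_coe, mul_one]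
  have hfv : ∀ (r : ℝ) (x : ℝ), 0 < r → f (r * Circle.exp x) = r * Circle.exp (Q r x) := by
    intro r x hr
    have hn : ‖(r * Circle.exp x : ℂ)‖ = r := by simp [abs_of_pos hr]
    simp only [hf, hQ]
    rw [hn, hdirr r _ hr, hδe, Circle.exp_add, Circle.coe_mul, mul_assoc]
  have hfc : Continuous f := by
    rw [continuous_iff_continuousAt]
    intro z
    by_cases hz : z = 0
    · subst hz
      have h0 : f 0 = 0 := by simp [hf]
      rw [ContinuousAt, h0, tendsto_zero_iff_norm_tendsto_zero]
      simp only [hfn]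
      exact tendsto_norm_zero
    · have hn : ({0}ᶜ : Set ℂ) ∈ 𝓝 z := isOpen_compl_singleton.mem_nhds hz
      have h1 : ContinuousAt dir z := hdirc.continuousAt hn
      have h2 : ContinuousAt (fun z => s ‖z‖ * δ (dir z)) z :=
        (hsc.comp continuous_norm).continuousAt.mul (hδc.continuousAt.comp h1)
      have h3 : Continuous (fun x : ℝ => (Circle.exp x : ℂ)) := continuous_subtype_val.comp Circle.exp.continuous
      exact continuousAt_id.mul (h3.continuousAt.comp h2)
  have hpol : ∀ z : ℂ, z ≠ 0 → ∃ x : ℝ, z = ‖z‖ * (Circle.exp x : ℂ) := by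
    intro z hz
    obtain ⟨x, hx⟩ := circleExp_surj (dir z)
    exact ⟨x, by rw [hx]; exact hdirz z⟩
  have hfi : Function.Injective f := by
    intro z w hzw
    have hn : ‖z‖ = ‖w‖ := by rw [← hfn z, ← hfn w, hzw]
    by_cases hz : z = 0
    · subst hz
      rw [norm_zero] at hn
      exact (norm_eq_zero.1 hn.symm).symm
    have hw : w ≠ 0 := by
      rintro rfl; exact hz (norm_eq_zero.1 (by simpa using hn))
    have hr : 0 < ‖w‖ := norm_pos_iff.2 hw
    obtain ⟨x, hx⟩ := hpol z hz
    obtain ⟨y, hy⟩ := hpol w hw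
    rw [hn] at hx
    have h0 : (‖w‖ : ℂ) ≠ 0 := by exact_mod_cast hr.ne'
    rw [hx, hy, ← hy, hfv _ _ hr] at hzw
    nth_rewrite 3 [hy] at hzw
    rw [hfv _ _ hr] at hzw
    have h1 := Circle.ext (mul_left_cancel₀ h0 hzw)
    rw [Circle.exp_eq_exp] at h1
    obtain ⟨m, hm⟩ := h1
    rw [← hQ2] at hm
    have h2 := (hQm _).injective hm
    rw [hx, hy, ← hy, h2, Circle.exp_add]
    have : Circle.exp (m * (2 * Real.pi)) = 1 := by
      rw [← Circle.exp_zero, Circle.exp_eq_exp]; exact ⟨m, by ring⟩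
    rw [this, mul_one]; exact hy.symm
  have hfs : Function.Surjective f := by
    intro w
    by_cases hw : w = 0
    · exact ⟨0, by rw [hw]; simp [hf]⟩
    · obtain ⟨y, hy⟩ := hpol w hw
      obtain ⟨x, hx⟩ := hQs ‖w‖ y
      refine ⟨‖w‖ * Circle.exp x, ?_⟩
      rw [hfv _ _ (norm_pos_iff.2 hw), hx, ← hy]
  obtain ⟨H, hH⟩ := homeoOfProper f hfc hfi hfs (fun R => ⟨R, fun z hz => by rwa [hfn] at hz⟩)
  refine ⟨H, ?_, ?_⟩
  · intro z hz
    rw [hH]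
    have h1 : s ‖z‖ = 1 := by
      simp only [hs]
      rw [min_eq_left (by linarith), max_eq_right zero_le_one]
    simp only [hf, h1, one_mul]
    conv_rhs => rw [hdirz z, hc.smul _ _ (norm_nonneg _), hδn, ← mul_assoc, ← hdirz z]
  · intro z hz
    rw [hH]
    have h1 : s ‖z‖ = 0 := by
      simp only [hs]
      rw [max_eq_left]
      exact (min_le_right _ _).trans (by linarith)
    simp [hf, h1]

theorem cone_ext {c : ℂ ≃ₜ ℂ} (hc : IsCone c) : ∃ H : ℂ ≃ₜ ℂ, (∀ z, ‖z‖ ≤ 1 → H z = c z) ∧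
    ((∀ z, 2 ≤ ‖z‖ → H z = z) ∨ ∀ z, 2 ≤ ‖z‖ → H z = (starRingEnd ℂ) z) := by
  obtain ⟨T, hT, hTc, ⟨hm, h2⟩ | ⟨hm, h2⟩⟩ := cone_lift_mono hc
  · obtain ⟨H, h1, h3⟩ := cone_ext_mono hc hT hTc hm h2
    exact ⟨H, h1, Or.inl h3⟩
  · set C : ℂ ≃ₜ ℂ := Complex.conjLIE.toHomeomorph with hC
    have hCv : ∀ z, C z = (starRingEnd ℂ) z := fun z => rfl
    have hcc : IsCone (c.trans C) := by
      refine ⟨fun z => ?_, fun r z hr => ?_⟩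
      · rw [Homeomorph.trans_apply, hCv, Complex.norm_conj, hc.norm]
      · rw [Homeomorph.trans_apply, Homeomorph.trans_apply, hCv, hCv, hc.smul r z hr]; simp
    obtain ⟨H, h1, h3⟩ := cone_ext_mono hcc (T := fun x => -T x) hT.neg (fun x => by
      rw [Homeomorph.trans_apply, hCv, ← hTc, Circle.exp_neg, Circle.coe_inv_eq_conj])
      (fun x y h => neg_lt_neg (hm h)) (fun x => by rw [h2]; ring)
    refine ⟨H.trans C, fun z hz => ?_, Or.inr fun z hz => ?_⟩
    · rw [Homeomorph.trans_apply, h1 z hz, Homeomorph.trans_apply, hCv, hCv, Complex.conj_conj]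
    · rw [Homeomorph.trans_apply, h3 z hz, hCv]

theorem openEmb_of_inv {W : Type*} [TopologicalSpace W] {ψ : ℂ → W} (hc : Continuous ψ) (g : W → ℂ)
    (hg : ∀ z, g (ψ z) = z) (hgc : ∀ z, ContinuousAt g (ψ z)) (ho : IsOpen (range ψ)) :
    IsOpenEmbedding ψ := by
  have hi : Function.Injective ψ := Function.LeftInverse.injective hg
  refine ⟨⟨isInducing_iff_nhds.2 fun z => le_antisymm hc.continuousAt.le_comap ?_, hi⟩, ho⟩
  have h1 : Filter.Tendsto (g ∘ ψ) (Filter.comap ψ (𝓝 (ψ z))) (𝓝 (g (ψ z))) :=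
    (hgc z).tendsto.comp Filter.tendsto_comap
  rw [hg] at h1
  have h2 : g ∘ ψ = id := funext hg
  rw [h2] at h1
  exact h1

theorem contOn_of_comp_compact {A B X : Type*} [TopologicalSpace A] [TopologicalSpace B] [T2Space B]
    [TopologicalSpace X] {K : Set A} (hK : IsCompact K) {q : A → B} (hq : ContinuousOn q K) {j : B → X}
    (hj : ContinuousOn (j ∘ q) K) : ContinuousOn j (q '' K) := by
  rw [continuousOn_iff_isClosed]
  intro t ht
  have h2 : IsCompact (K ∩ (j ∘ q) ⁻¹' t) := by
    obtain ⟨u, hu, hu2⟩ := continuousOn_iff_isClosed.1 hj t ht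
    rw [inter_comm, hu2, inter_comm]
    exact hK.inter_right hu
  refine ⟨q '' (K ∩ (j ∘ q) ⁻¹' t), (h2.image_of_continuousOn (hq.mono inter_subset_left)).isClosed, ?_⟩
  ext b
  constructor
  · rintro ⟨h, a, ha, rfl⟩
    exact ⟨⟨a, ⟨ha, h⟩, rfl⟩, a, ha, rfl⟩
  · rintro ⟨⟨a, ⟨ha, h⟩, rfl⟩, -⟩
    exact ⟨h, a, ha, rfl⟩

theorem unit_mem {v : E3} (h : v ≠ 0) : ‖v‖⁻¹ • v ∈ sphere (0 : E3) 1 := by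
  rw [mem_sphere_zero_iff_norm, norm_smul, norm_inv, norm_norm, inv_mul_cancel₀ (norm_ne_zero_iff.2 h)]

open Classical in
/-- homogeneous coordinates -/
def mkP (v : E3) : PP :=
  if h : v ≠ 0 then pq ⟨‖v‖⁻¹ • v, unit_mem h⟩ else pq ⟨EuclideanSpace.single 0 1, by simp⟩

theorem mkP_of {v : E3} (h : v ≠ 0) : mkP v = pq ⟨‖v‖⁻¹ • v, unit_mem h⟩ := dif_pos h

theorem mkP_coe (x : S2) : mkP x = pq x := by
  rw [mkP_of (s2_ne x)]
  congr 1
  apply Subtype.ext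
  simp

theorem mkP_surj (P : PP) : ∃ v : E3, ‖v‖ = 1 ∧ mkP v = P := by
  obtain ⟨x, rfl⟩ := pq_surj P
  exact ⟨x, by simp, mkP_coe x⟩

theorem mkP_smul {v : E3} (h : v ≠ 0) {t : ℝ} (ht : t ≠ 0) : mkP (t • v) = mkP v := by
  have hv : ‖v‖ ≠ 0 := norm_ne_zero_iff.2 h
  rw [mkP_of h, mkP_of (smul_ne_zero ht h)]
  refine pq_eq.2 ?_
  simp only [norm_smul, smul_smul, Real.norm_eq_abs]
  rcases lt_or_gt_of_ne ht with h0 | h0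
  · right
    rw [abs_of_neg h0, ← neg_smul]
    congr 1
    field_simp
  · left
    rw [abs_of_pos h0]
    congr 1
    field_simp

theorem mkP_eq {v w : E3} (hv : v ≠ 0) (hw : w ≠ 0) (h : mkP v = mkP w) : ∃ t : ℝ, t ≠ 0 ∧ w = t • v := by
  have h1 : ‖v‖ ≠ 0 := norm_ne_zero_iff.2 hv
  have h2 : ‖w‖ ≠ 0 := norm_ne_zero_iff.2 hw
  rw [mkP_of hv, mkP_of hw, pq_eq] at h
  simp only at h
  have h3 : w = ‖w‖ • (‖w‖⁻¹ • w) := by rw [smul_smul, mul_inv_cancel₀ h2, one_smul]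
  rcases h with h | h
  · exact ⟨‖w‖ * ‖v‖⁻¹, by positivity, by rw [h, smul_smul] at h3; exact h3⟩
  · refine ⟨-(‖w‖ * ‖v‖⁻¹), neg_ne_zero.2 (by positivity), ?_⟩
    rw [h, smul_neg, smul_smul, ← neg_smul] at h3; exact h3

theorem mkP_cont : ContinuousOn mkP {0}ᶜ := by
  rw [continuousOn_iff_continuous_domRestrict]
  have : ({0}ᶜ : Set E3).domRestrict mkP =
      fun v : ({0}ᶜ : Set E3) => pq ⟨‖(v : E3)‖⁻¹ • (v : E3), unit_mem v.2⟩ := by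
    funext v
    exact mkP_of v.2
  rw [this]
  refine pq_cont.comp (Continuous.subtype_mk ?_ _)
  refine Continuous.smul (Continuous.inv₀ (by fun_prop) fun v => norm_ne_zero_iff.2 v.2) (by fun_prop)

theorem mkP_contAt {v : E3} (h : v ≠ 0) : ContinuousAt mkP v :=
  mkP_cont.continuousAt (isOpen_compl_singleton.mem_nhds h)

def liftP {X : Type*} (F : E3 → X) (P : PP) : X := F (Classical.choose (mkP_surj P))

theorem liftP_mk {X : Type*} {F : E3 → X} (hF : ∀ t : ℝ, t ≠ 0 → ∀ v, v ≠ 0 → F (t • v) = F v) {v : E3}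
    (h : v ≠ 0) : liftP F (mkP v) = F v := by
  obtain ⟨h1, h2⟩ := Classical.choose_spec (mkP_surj (mkP v))
  have h0 : Classical.choose (mkP_surj (mkP v)) ≠ 0 := by
    rw [← norm_ne_zero_iff, h1]; exact one_ne_zero
  obtain ⟨t, ht, h3⟩ := mkP_eq h h0 h2.symm
  unfold liftP
  rw [h3, hF t ht v h]

theorem liftP_contAt {X : Type*} [TopologicalSpace X] {F : E3 → X}
    (hF : ∀ t : ℝ, t ≠ 0 → ∀ v, v ≠ 0 → F (t • v) = F v) {P : PP}
    (h : ∀ v, v ≠ 0 → mkP v = P → ContinuousAt F v) : ContinuousAt (liftP F) P := by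
  obtain ⟨x, rfl⟩ := pq_surj P
  rw [← pq_openQuotient.continuousAt_comp_iff]
  have : liftP F ∘ pq = fun y : S2 => F y := by
    funext y
    rw [Function.comp_apply, ← mkP_coe, liftP_mk hF (s2_ne y)]
  rw [this]
  exact (h x (s2_ne x) (mkP_coe x)).comp continuous_subtype_val.continuousAt

theorem mkP_isOpen (l : Fin 3) : IsOpen {P | ∃ v : E3, v l ≠ 0 ∧ mkP v = P} := by
  have : {P | ∃ v : E3, v l ≠ 0 ∧ mkP v = P} = pq '' {x : S2 | (x : E3) l ≠ 0} := by
    ext P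
    constructor
    · rintro ⟨v, hv, rfl⟩
      have h0 : v ≠ 0 := fun h => hv (by rw [h]; rfl)
      refine ⟨⟨‖v‖⁻¹ • v, unit_mem h0⟩, ?_, (mkP_of h0).symm⟩
      have : ‖v‖ ≠ 0 := norm_ne_zero_iff.2 h0
      change ‖v‖⁻¹ * v l ≠ 0
      positivity
    · rintro ⟨x, hx, rfl⟩
      exact ⟨x, hx, mkP_coe x⟩
  rw [this]
  refine pq_open _ ?_
  refine isOpen_ne_fun ?_ continuous_const
  fun_prop

theorem e3_ne {v : E3} (l : Fin 3) (h : v l ≠ 0) : v ≠ 0 := by rintro rfl; exact h rfl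

/-- an affine coordinate on the projective plane -/
def ratP (m l : Fin 3) : PP → ℝ := liftP fun v => v m / v l

theorem rat_hom (m l : Fin 3) (t : ℝ) (ht : t ≠ 0) (v : E3) (_ : v ≠ 0) :
    (t • v) m / (t • v) l = v m / v l := by
  change (t * v m) / (t * v l) = _
  exact mul_div_mul_left _ _ ht

theorem ratP_mk (m l : Fin 3) {v : E3} (h : v ≠ 0) : ratP m l (mkP v) = v m / v l :=
  liftP_mk (F := fun v : E3 => v m / v l) (rat_hom m l) h

theorem ratP_cont (m l : Fin 3) {v : E3} (h : v l ≠ 0) : ContinuousAt (ratP m l) (mkP v) := by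
  refine liftP_contAt (F := fun v : E3 => v m / v l) (rat_hom m l) ?_
  intro w hw hvw
  obtain ⟨t, ht, rfl⟩ := mkP_eq hw (e3_ne l h) hvw
  have : w l ≠ 0 := fun h' => h (by change t * w l = 0; rw [h', mul_zero])
  refine ContinuousAt.div ?_ ?_ this <;> fun_prop

/-- the standard affine chart `z = 1` -/
def aff (z : ℂ) : PP := mkP !₂[z.re, z.im, 1]

theorem aff_cont : Continuous aff := by
  refine mkP_cont.comp_continuous (by fun_prop) fun z => ?_
  exact e3_ne 2 (by simp)

theorem aff_openEmb : IsOpenEmbedding aff := by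
  have hne : ∀ z : ℂ, (!₂[z.re, z.im, 1] : E3) 2 ≠ 0 := fun z => by simp
  refine openEmb_of_inv aff_cont (fun P => (⟨ratP 0 2 P, ratP 1 2 P⟩ : ℂ)) ?_ ?_ ?_
  · intro z
    unfold aff
    rw [ratP_mk 0 2 (e3_ne 2 (hne z)), ratP_mk 1 2 (e3_ne 2 (hne z))]
    simp
  · intro z
    have h1 := ratP_cont 0 2 (hne z)
    have h2 := ratP_cont 1 2 (hne z)
    have h3 : Continuous (fun p : ℝ × ℝ => (⟨p.1, p.2⟩ : ℂ)) := Complex.equivRealProdCLM.symm.continuous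
    exact h3.continuousAt.comp (f := fun P => (ratP 0 2 P, ratP 1 2 P)) (h1.prodMk h2)
  · convert mkP_isOpen 2 using 1
    ext P
    constructor
    · rintro ⟨z, rfl⟩
      exact ⟨_, hne z, rfl⟩
    · rintro ⟨v, hv, rfl⟩
      refine ⟨⟨v 0 / v 2, v 1 / v 2⟩, ?_⟩
      unfold aff
      rw [← mkP_smul (e3_ne 2 (hne _)) hv]
      congr 1
      ext l
      fin_cases l <;> simp <;> field_simp

/-- reflection of the projective plane -/
theorem pp_refl : ∃ ρ : PP ≃ₜ PP, ∀ z, ρ (aff z) = aff ((starRingEnd ℂ) z) := by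
  set r : E3 → E3 := fun v => !₂[v 0, -v 1, v 2] with hr
  have hr2 : ∀ v, r (r v) = v := fun v => by ext l; fin_cases l <;> simp [hr]
  have hr0 : ∀ v, v ≠ 0 → r v ≠ 0 := by
    intro v hv h
    apply hv
    rw [← hr2 v, h]
    ext l; fin_cases l <;> simp [hr]
  have hrt : ∀ (t : ℝ) v, r (t • v) = t • r v := fun t v => by ext l; fin_cases l <;> simp [hr]
  have hrc : Continuous r := by fun_prop
  have hF : ∀ t : ℝ, t ≠ 0 → ∀ v, v ≠ 0 → mkP (r (t • v)) = mkP (r v) := fun t ht v hv => by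
    rw [hrt, mkP_smul (hr0 v hv) ht]
  set f : PP → PP := liftP (fun v => mkP (r v)) with hf
  have hfv : ∀ v, v ≠ 0 → f (mkP v) = mkP (r v) := fun v hv => liftP_mk hF hv
  have hfc : Continuous f := continuous_iff_continuousAt.2 fun P => liftP_contAt hF fun v hv _ =>
    ContinuousAt.comp (g := mkP) (mkP_contAt (hr0 v hv)) hrc.continuousAt
  have hff : ∀ P, f (f P) = P := by
    intro P
    obtain ⟨v, hv, rfl⟩ := mkP_surj P
    have h0 : v ≠ 0 := by rw [← norm_ne_zero_iff, hv]; exact one_ne_zero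
    rw [hfv v h0, hfv _ (hr0 v h0), hr2]
  refine ⟨⟨⟨f, f, hff, hff⟩, hfc, hfc⟩, fun z => ?_⟩
  change f (aff z) = _
  unfold aff
  rw [hfv _ (e3_ne 2 (by simp))]
  congr 1

theorem pp_cone {c : ℂ ≃ₜ ℂ} (hc : IsCone c) : ∃ k : PP ≃ₜ PP, ∀ z, ‖z‖ ≤ 1 → k (aff z) = aff (c z) := by
  obtain ⟨H, h1, h2⟩ := cone_ext hc
  rcases h2 with h2 | h2
  · obtain ⟨k, hk, -⟩ := chartHomeo aff_openEmb H 2 h2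
    exact ⟨k, fun z hz => by rw [hk, h1 z hz]⟩
  · obtain ⟨ρ, hρ⟩ := pp_refl
    obtain ⟨k, hk, -⟩ := chartHomeo aff_openEmb (H.trans Complex.conjLIE.toHomeomorph) 2 (fun z hz => by
      rw [Homeomorph.trans_apply, h2 z hz]; exact Complex.conj_conj z)
    refine ⟨k.trans ρ, fun z hz => ?_⟩
    rw [Homeomorph.trans_apply, hk, hρ, Homeomorph.trans_apply, h1 z hz]
    congr 1
    exact Complex.conj_conj _

/-- summing with a projective plane does not depend on the charts -/
theorem CSum.normalize {Z W : Type*} [TopologicalSpace Z] [TopologicalSpace W] (hW : Surf W) {ψ ψ' : ℂ → W}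
    {η : ℂ → PP} (hψ' : IsOpenEmbedding ψ') (h : CSum Z W ψ PP η) : CSum Z W ψ' PP aff := by
  have hψ : IsOpenEmbedding ψ := by obtain ⟨i, j, h⟩ := h; exact h.hψ
  have hη : IsOpenEmbedding η := by obtain ⟨i, j, h⟩ := h; exact h.hη
  obtain ⟨k, c, hc, hk⟩ := surf_pp.straighten hη aff_openEmb
  have h1 := (h.symm.change k c hc aff_openEmb hk).symm
  obtain ⟨k', c', hc', hk'⟩ := hW.straighten (hψ.comp c.symm.isOpenEmbedding) hψ'
  have h2 := (h1.change k' c' hc' hψ' hk').symm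
  obtain ⟨l, hl⟩ := pp_cone hc'
  have h3 := h2.change l (Homeomorph.refl ℂ) IsCone.refl aff_openEmb (fun z hz => by
    rw [Function.comp_apply, hl _ (by rwa [hc'.symm.norm]), c'.apply_symm_apply]; rfl)
  exact h3.symm

theorem CSum.unique_pp {Z Z' W : Type*} [TopologicalSpace Z] [TopologicalSpace Z'] [TopologicalSpace W]
    [T2Space Z] [T2Space Z'] (hW : Surf W) {ψ ψ' : ℂ → W} {η η' : ℂ → PP} (h : CSum Z W ψ PP η)
    (h' : CSum Z' W ψ' PP η') : Nonempty (Z ≃ₜ Z') := by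
  have hψ : IsOpenEmbedding ψ := by obtain ⟨i, j, h⟩ := h; exact h.hψ
  have := hW.compact
  have := surf_pp.compact
  exact (h.normalize hW hψ).unique (h'.normalize hW hψ)

/-- the points of the projective plane outside the affine unit disc -/
def qP (p : ℂ × ℝ) : PP := mkP !₂[p.1.re, p.1.im, p.2]

def qDom : Set (ℂ × ℝ) := sphere 0 1 ×ˢ Icc (-1) 1

theorem qP_ne {p : ℂ × ℝ} (hp : ‖p.1‖ = 1) : (!₂[p.1.re, p.1.im, p.2] : E3) ≠ 0 := by
  intro h
  have h0 : p.1.re = 0 := congrArg (fun v : E3 => v 0) h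
  have h1 : p.1.im = 0 := congrArg (fun v : E3 => v 1) h
  have : p.1 = 0 := Complex.ext h0 h1
  rw [this] at hp; simp at hp

theorem qP_cont : ContinuousOn qP qDom := by
  refine mkP_cont.comp (by fun_prop) fun p hp => ?_
  exact qP_ne (by simpa using hp.1)

theorem qP_neg {p : ℂ × ℝ} (hp : ‖p.1‖ = 1) : qP (-p) = qP p := by
  unfold qP
  rw [← mkP_smul (qP_ne hp) (t := -1) (by norm_num)]
  congr 1
  ext l; fin_cases l <;> simp

theorem qP_eq {p q : ℂ × ℝ} (hp : ‖p.1‖ = 1) (hq : ‖q.1‖ = 1) (h : qP p = qP q) : q = p ∨ q = -p := by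
  obtain ⟨t, ht, h1⟩ := mkP_eq (qP_ne hp) (qP_ne hq) h
  have e0 : q.1.re = t * p.1.re := congrArg (fun v : E3 => v 0) h1
  have e1 : q.1.im = t * p.1.im := congrArg (fun v : E3 => v 1) h1
  have e2 : q.2 = t * p.2 := congrArg (fun v : E3 => v 2) h1
  have e3 : q.1 = t * p.1 := by apply Complex.ext <;> simp [e0, e1]
  have h2 : |t| = 1 := by rw [e3, norm_mul, hp, Complex.norm_real] at hq; simpa using hq
  rcases eq_or_eq_neg_of_abs_eq h2 with rfl | rfl
  · left; exact Prod.ext (by simpa using e3) (by simpa using e2)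
  · right; exact Prod.ext (by simpa using e3) (by simpa using e2)

theorem qP_aff {ζ : ℂ} {r : ℝ} (hr : r ≠ 0) : qP (ζ, r) = aff (r⁻¹ * ζ) := by
  have h0 : (!₂[ζ.re, ζ.im, r] : E3) ≠ 0 := e3_ne 2 (by simpa using hr)
  unfold qP aff
  simp only
  rw [← mkP_smul h0 (inv_ne_zero hr)]
  congr 1
  ext l; fin_cases l <;> simp [hr]

theorem qP_image : qP '' qDom = (aff '' ball 0 1)ᶜ := by
  ext P
  constructor
  · rintro ⟨⟨u, r⟩, ⟨hu, hr⟩, rfl⟩ ⟨z, hz, h⟩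
    have hu : ‖u‖ = 1 := by simpa using hu
    obtain ⟨t, ht, h1⟩ := mkP_eq (e3_ne 2 (by simp)) (qP_ne (p := (u, r)) hu) h
    have e0 : u.re = t * z.re := congrArg (fun v : E3 => v 0) h1
    have e1 : u.im = t * z.im := congrArg (fun v : E3 => v 1) h1
    have e2 : r = t * 1 := congrArg (fun v : E3 => v 2) h1
    have e3 : u = t * z := by apply Complex.ext <;> simp [e0, e1]
    rw [e3, norm_mul, Complex.norm_real, Real.norm_eq_abs] at hu
    have hz : ‖z‖ < 1 := by simpa using hz
    have : |t| ≤ 1 := abs_le.2 (by rw [mul_one] at e2; rw [← e2]; exact hr)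
    nlinarith [norm_nonneg z, abs_pos.2 ht]
  · intro hP
    obtain ⟨v, hv, rfl⟩ := mkP_surj P
    have hv0 : v ≠ 0 := by rw [← norm_ne_zero_iff, hv]; exact one_ne_zero
    set w : ℂ := ⟨v 0, v 1⟩ with hw
    have hle : |v 2| ≤ ‖w‖ := by
      by_contra hlt
      push Not at hlt
      have h2 : v 2 ≠ 0 := abs_pos.1 ((norm_nonneg w).trans_lt hlt)
      apply hP
      refine ⟨((v 2)⁻¹ : ℝ) * w, ?_, ?_⟩
      · rw [mem_ball_zero_iff, norm_mul, Complex.norm_real, norm_inv, Real.norm_eq_abs, inv_mul_lt_iff₀ (abs_pos.2 h2)]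
        linarith
      · rw [← qP_aff h2]
        unfold qP
        congr 1
        ext l; fin_cases l <;> rfl
    have hw0 : 0 < ‖w‖ := by
      rcases (norm_nonneg w).eq_or_lt with h | h
      · exfalso
        rw [← h] at hle
        have h3 : v 2 = 0 := abs_nonpos_iff.1 hle
        have h4 : w = 0 := norm_eq_zero.1 h.symm
        apply hv0
        ext l
        fin_cases l
        · exact congrArg Complex.re h4
        · exact congrArg Complex.im h4
        · exact h3
      · exact h
    refine ⟨((‖w‖⁻¹ : ℝ) * w, ‖w‖⁻¹ * v 2), ⟨?_, ?_⟩, ?_⟩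
    · rw [mem_sphere_zero_iff_norm, norm_mul, Complex.norm_real, norm_inv, norm_norm, inv_mul_cancel₀ hw0.ne']
    · rw [mem_Icc, ← abs_le, abs_mul, abs_inv, abs_norm, inv_mul_le_iff₀ hw0]
      simpa using hle
    · unfold qP
      rw [← mkP_smul hv0 (inv_ne_zero hw0.ne')]
      congr 1
      ext l; fin_cases l <;> simp [hw]

/-- real blow-up at a point is connected sum with a projective plane -/
theorem blowup {M W : Type*} [TopologicalSpace M] [TopologicalSpace W] [CompactSpace M] [T2Space W]
    {ψ : ℂ → W} (hψ : IsOpenEmbedding ψ) {π : M → W} (hπ : Continuous π) (hs : Function.Surjective π)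
    (hi : ∀ m m', π m = π m' → π m ≠ ψ 0 → m = m') (b : ℂ × ℝ → M) (hb : ContinuousOn b qDom)
    (hbn : ∀ p ∈ qDom, b (-p) = b p) (hbp : ∀ p ∈ qDom, π (b p) = ψ (p.2 * p.1))
    (hf : ∀ m, π m = ψ 0 → ∃ u : ℂ, ‖u‖ = 1 ∧ b (u, 0) = m)
    (hbi : ∀ u u' : ℂ, ‖u‖ = 1 → ‖u'‖ = 1 → b (u, 0) = b (u', 0) → u' = u ∨ u' = -u) :
    CSum M W ψ PP aff := by
  have hqd : ∀ p : ℂ × ℝ, p ∈ qDom ↔ ‖p.1‖ = 1 ∧ |p.2| ≤ 1 := fun p => by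
    simp [qDom, mem_prod, abs_le]
  have hK : IsCompact qDom := (isCompact_sphere 0 1).prod isCompact_Icc
  set j : PP → M := fun P => b (Function.invFunOn qP qDom P) with hj
  have hjq : ∀ p ∈ qDom, j (qP p) = b p := by
    intro p hp
    have h1 : Function.invFunOn qP qDom (qP p) ∈ qDom := Function.invFunOn_mem ⟨p, hp, rfl⟩
    have h2 : qP (Function.invFunOn qP qDom (qP p)) = qP p := Function.invFunOn_eq ⟨p, hp, rfl⟩
    simp only [hj]
    rcases qP_eq ((hqd p).1 hp).1 ((hqd _).1 h1).1 h2.symm with h | h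
    · rw [h]
    · rw [h, hbn p hp]
  have hbinj : ∀ p ∈ qDom, ∀ q ∈ qDom, b p = b q → qP p = qP q := by
    rintro ⟨u, r⟩ hp ⟨u', r'⟩ hq h
    have h1 := hψ.injective ((hbp _ hp).symm.trans ((congrArg π h).trans (hbp _ hq)))
    simp only at h1
    have hu := ((hqd _).1 hp).1
    have hu' := ((hqd _).1 hq).1
    simp only at hu hu'
    have h2 := congrArg norm h1
    rw [norm_mul, norm_mul, hu, hu', Complex.norm_real, Complex.norm_real, mul_one, mul_one] at h2
    have h3 : u' = u ∧ r' = r ∨ u' = -u ∧ r' = -r ∨ (r = 0 ∧ r' = 0) := by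
      by_cases hr : r = 0
      · right; right; rw [hr] at h2; exact ⟨hr, by simpa using h2.symm⟩
      · have hr0 : (r : ℂ) ≠ 0 := by exact_mod_cast hr
        rcases abs_eq_abs.1 h2 with h3 | h3
        · left; rw [← h3] at h1; exact ⟨(mul_left_cancel₀ hr0 h1).symm, h3.symm⟩
        · right; left
          have h4 : r' = -r := by linarith
          refine ⟨?_, h4⟩
          rw [h4] at h1
          apply mul_left_cancel₀ hr0
          push_cast at h1
          linear_combination h1
    have h4 : (u', r') = (u, r) ∨ (u', r') = -(u, r) := by
      rcases h3 with ⟨h, h'⟩ | ⟨h, h'⟩ | ⟨rfl, rfl⟩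
      · left; rw [h, h']
      · right; rw [h, h']; rfl
      · rcases hbi u u' hu hu' h with h5 | h5
        · left; rw [h5]
        · right; rw [h5]; simp
    rcases h4 with h4 | h4
    · rw [h4]
    · rw [h4, qP_neg hu]
  have hmem : ∀ y ∉ aff '' ball (0 : ℂ) 1, ∃ p ∈ qDom, qP p = y := by
    intro y hy
    have : y ∈ qP '' qDom := by rw [qP_image]; exact hy
    exact this
  have hπi : ∀ w, π (Function.surjInv hs w) = w := Function.surjInv_eq hs
  have hmi : ∀ m, π m ≠ ψ 0 → Function.surjInv hs (π m) = m := fun m hm =>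
    (hi m _ (hπi _).symm hm).symm
  have h0 : ∀ w ∉ ψ '' ball 0 1, w ≠ ψ 0 := by
    rintro w hw rfl; exact hw ⟨0, by simp, rfl⟩
  have h1q : ∀ ζ : ℂ, ‖ζ‖ = 1 → (ζ, (1:ℝ)) ∈ qDom := fun ζ hζ => (hqd _).2 ⟨hζ, by simp⟩
  have hqa : ∀ ζ : ℂ, qP (ζ, 1) = aff ζ := fun ζ => by rw [qP_aff one_ne_zero]; simp
  refine ⟨Function.surjInv hs, j, hψ, aff_openEmb, ?_, ?_, fun w _ w' _ h => by rw [← hπi w, h, hπi], ?_, ?_, ?_, ?_⟩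
  · have hc : IsCompact (π ⁻¹' (ψ '' ball 0 1)ᶜ) := ((isClosed_compl_chart hψ 1).preimage hπ).isCompact
    have h1 : ContinuousOn (Function.surjInv hs) (π '' (π ⁻¹' (ψ '' ball 0 1)ᶜ)) := by
      refine contOn_of_comp_compact hc hπ.continuousOn ?_
      refine continuousOn_id.congr fun m hm => ?_
      exact hmi m (h0 _ hm)
    rwa [image_preimage_eq _ hs] at h1
  · rw [← qP_image]
    exact contOn_of_comp_compact hK qP_cont (hb.congr hjq)
  · intro y hy y' hy' h
    obtain ⟨p, hp, rfl⟩ := hmem y hy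
    obtain ⟨p', hp', rfl⟩ := hmem y' hy'
    rw [hjq p hp, hjq p' hp'] at h
    exact hbinj p hp p' hp' h
  · intro ζ hζ
    have h1 := h1q ζ hζ
    have h2 : π (b (ζ, 1)) = ψ ζ := by rw [hbp _ h1]; simp
    rw [← hqa, hjq _ h1, ← h2, hmi]
    rw [h2]
    intro h
    rw [hψ.injective h] at hζ; simp at hζ
  · intro w hw y hy h
    obtain ⟨⟨u, r⟩, hp, rfl⟩ := hmem y hy
    rw [hjq _ hp] at h
    have h1 : w = ψ (r * u) := by rw [← hπi w, h, hbp _ hp]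
    obtain ⟨hu, hr⟩ := (hqd _).1 hp
    simp only at hu hr
    have h2 : 1 ≤ |r| := by
      rw [h1, not_mem_chart_ball hψ, norm_mul, hu, Complex.norm_real] at hw
      simpa using hw
    have h3 : |r| = 1 := le_antisymm hr h2
    refine ⟨r * u, by rw [norm_mul, hu, Complex.norm_real, Real.norm_eq_abs, h3, one_mul], h1, ?_⟩
    have hr0 : r ≠ 0 := by rintro rfl; simp at h3
    rw [qP_aff hr0]
    rcases eq_or_eq_neg_of_abs_eq h3 with rfl | rfl <;> simp
  · intro m
    by_cases hm : π m ∈ ψ '' ball 0 1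
    · right
      obtain ⟨w, hw, hwm⟩ := hm
      have hw : ‖w‖ < 1 := by simpa using hw
      have : ∃ p ∈ qDom, b p = m := by
        by_cases hw0 : w = 0
        · rw [hw0] at hwm
          obtain ⟨u, hu, hum⟩ := hf m hwm.symm
          exact ⟨(u, 0), (hqd _).2 ⟨hu, by simp⟩, hum⟩
        · have hn : (‖w‖ : ℂ) ≠ 0 := by simpa using hw0
          have hd : (w / ‖w‖, ‖w‖) ∈ qDom := (hqd _).2 ⟨by simp [hw0], by simpa using hw.le⟩
          refine ⟨(w / ‖w‖, ‖w‖), hd, ?_⟩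
          symm
          refine hi _ _ ?_ ?_
          · rw [hbp _ hd, ← hwm]
            congr 1
            simp only
            field_simp
          · rw [← hwm]; exact fun h => hw0 (hψ.injective h)
      obtain ⟨p, hp, hpm⟩ := this
      refine ⟨qP p, ?_, by rw [hjq p hp, hpm]⟩
      have : qP p ∈ qP '' qDom := ⟨p, hp, rfl⟩
      rwa [qP_image] at this
    · exact Or.inl ⟨π m, hm, hmi m (h0 _ hm)⟩

theorem dc_mem (x y : ℝ) (h : x ^ 2 + y ^ 2 ≠ 0) :
    (!₂[(x ^ 2 - y ^ 2) / (x ^ 2 + y ^ 2), 2 * x * y / (x ^ 2 + y ^ 2)] : E2) ∈ sphere (0 : E2) 1 := by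
  rw [mem_sphere_zero_iff_norm, EuclideanSpace.norm_eq, Real.sqrt_eq_one, Fin.sum_univ_two]
  simp only [Real.norm_eq_abs, sq_abs]
  simp
  field_simp
  ring

open Classical in
/-- the circle as the space of directions -/
def dc (x y : ℝ) : Circ :=
  if h : x ^ 2 + y ^ 2 ≠ 0 then
    ⟨!₂[(x ^ 2 - y ^ 2) / (x ^ 2 + y ^ 2), 2 * x * y / (x ^ 2 + y ^ 2)], dc_mem x y h⟩
  else ⟨EuclideanSpace.single 0 1, by simp⟩

theorem dc_of {x y : ℝ} (h : x ^ 2 + y ^ 2 ≠ 0) : dc x y =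
    ⟨!₂[(x ^ 2 - y ^ 2) / (x ^ 2 + y ^ 2), 2 * x * y / (x ^ 2 + y ^ 2)], dc_mem x y h⟩ := dif_pos h

theorem dc_zero {x y : ℝ} (h : x ^ 2 + y ^ 2 ≠ 0) :
    (dc x y : E2) 0 = (x ^ 2 - y ^ 2) / (x ^ 2 + y ^ 2) := by rw [dc_of h]; rfl

theorem dc_one {x y : ℝ} (h : x ^ 2 + y ^ 2 ≠ 0) :
    (dc x y : E2) 1 = 2 * x * y / (x ^ 2 + y ^ 2) := by rw [dc_of h]; rfl

theorem circ_ext {s t : Circ} (h0 : (s : E2) 0 = (t : E2) 0) (h1 : (s : E2) 1 = (t : E2) 1) : s = t := by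
  apply Subtype.ext
  ext l
  fin_cases l
  · exact h0
  · exact h1

theorem circ_eq (t : Circ) : (t : E2) 0 ^ 2 + (t : E2) 1 ^ 2 = 1 := by
  have h : ‖(t : E2)‖ = 1 := by simp
  rw [EuclideanSpace.norm_eq, Real.sqrt_eq_one, Fin.sum_univ_two] at h
  simpa using h

def par (t : Circ) (a b : ℝ) : Prop :=
  a * (t : E2) 1 = b * (1 + (t : E2) 0) ∧ a * (1 - (t : E2) 0) = b * (t : E2) 1

theorem par_smul {t : Circ} {a b : ℝ} (h : par t a b) (k : ℝ) : par t (k * a) (k * b) :=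
  ⟨by linear_combination k * h.1, by linear_combination k * h.2⟩

theorem par_zero (t : Circ) : par t 0 0 := ⟨by simp, by simp⟩

theorem par_uniq {t : Circ} {a b : ℝ} (h : par t a b) (h0 : a ^ 2 + b ^ 2 ≠ 0) : t = dc a b := by
  obtain ⟨h1, h2⟩ := h
  refine circ_ext ?_ ?_
  · rw [dc_zero h0, eq_div_iff h0]; linear_combination -a * h2 - b * h1
  · rw [dc_one h0, eq_div_iff h0]; linear_combination a * h1 - b * h2

theorem par_dc {x y : ℝ} (h : x ^ 2 + y ^ 2 ≠ 0) {a b : ℝ} : par (dc x y) a b ↔ a * y = b * x := by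
  unfold par
  rw [dc_zero h, dc_one h]
  constructor
  · rintro ⟨h1, h2⟩
    field_simp at h1 h2
    have h3 : (x ^ 2 + y ^ 2) * (a * y - b * x) = 0 := by linear_combination x / 2 * h1 + y / 2 * h2
    have := (mul_eq_zero.1 h3).resolve_left h
    linarith
  · intro h1
    constructor
    · field_simp; linear_combination 2 * x * h1
    · field_simp; linear_combination 2 * y * h1

theorem dc_surj (t : Circ) : ∃ x y : ℝ, x ^ 2 + y ^ 2 = 1 ∧ t = dc x y := by
  have hc := circ_eq t
  set c := (t : E2) 0 with hc0
  set s := (t : E2) 1 with hs0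
  by_cases h : 1 + c = 0
  · have hs : s = 0 := by
      have : s ^ 2 = 0 := by have : c = -1 := by linarith
                             rw [this] at hc; linarith
      simpa using this
    refine ⟨0, 1, by norm_num, par_uniq ⟨?_, ?_⟩ (by norm_num)⟩
    · rw [← hc0, h]; ring
    · rw [← hs0, hs]; ring
  · have h2 : (1 + c) ^ 2 + s ^ 2 ≠ 0 := by positivity
    have hn : 0 < (1 + c) ^ 2 + s ^ 2 := by positivity
    set n := Real.sqrt ((1 + c) ^ 2 + s ^ 2) with hnd
    have hn2 : n ^ 2 = (1 + c) ^ 2 + s ^ 2 := Real.sq_sqrt hn.le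
    have hn0 : n ≠ 0 := (Real.sqrt_pos.2 hn).ne'
    have h1 : (n⁻¹ * (1 + c)) ^ 2 + (n⁻¹ * s) ^ 2 = 1 := by
      field_simp; linarith
    refine ⟨n⁻¹ * (1 + c), n⁻¹ * s, h1, par_uniq (par_smul ⟨?_, ?_⟩ _) (by rw [h1]; exact one_ne_zero)⟩
    · rw [← hc0, ← hs0]; ring
    · rw [← hc0, ← hs0]; linear_combination -hc

theorem dc_prop {x y x' y' : ℝ} (h : x ^ 2 + y ^ 2 ≠ 0) (h' : x' ^ 2 + y' ^ 2 ≠ 0) :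
    dc x y = dc x' y' ↔ x' * y = y' * x := by
  constructor
  · intro e
    rw [← par_dc h, e, par_dc h']; ring
  · intro e
    exact par_uniq ((par_dc h).2 e) h'

theorem one_sq_ne (a : ℝ) : (1:ℝ) ^ 2 + a ^ 2 ≠ 0 := by positivity

theorem unit_ne {u : ℂ} (h : ‖u‖ = 1) : u.re ^ 2 + u.im ^ 2 = 1 := by
  have := Complex.sq_norm u
  rw [h, Complex.normSq_apply] at this
  nlinarith

theorem unit_norm {x y : ℝ} (h : x ^ 2 + y ^ 2 = 1) : ‖(⟨x, y⟩ : ℂ)‖ = 1 := by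
  have := Complex.sq_norm ⟨x, y⟩
  rw [Complex.normSq_apply] at this
  simp only at this
  have h2 : ‖(⟨x, y⟩ : ℂ)‖ ^ 2 = 1 := by linarith
  nlinarith [norm_nonneg (⟨x, y⟩ : ℂ)]

theorem dc_inj {u u' : ℂ} (h : ‖u‖ = 1) (h' : ‖u'‖ = 1) (e : dc u.re u.im = dc u'.re u'.im) :
    u' = u ∨ u' = -u := by
  have h1 := unit_ne h
  have h2 := unit_ne h'
  rw [dc_prop (by rw [h1]; exact one_ne_zero) (by rw [h2]; exact one_ne_zero)] at e
  have h3 : u' = (u'.re * u.re + u'.im * u.im : ℝ) * u := by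
    apply Complex.ext
    · rw [Complex.re_ofReal_mul]; linear_combination -u'.re * h1 + u.im * e
    · rw [Complex.im_ofReal_mul]; linear_combination -u'.im * h1 - u.re * e
  have h4 := congrArg norm h3
  rw [norm_mul, h, h', mul_one, Complex.norm_real, Real.norm_eq_abs] at h4
  rcases eq_or_eq_neg_of_abs_eq h4.symm with h5 | h5
  · left; rw [h5] at h3; simpa using h3
  · right; rw [h5] at h3; simpa using h3

theorem dc_cont {X : Type*} [TopologicalSpace X] {S : Set X} {f g : X → ℝ} (hf : ContinuousOn f S)
    (hg : ContinuousOn g S) (h : ∀ x ∈ S, f x ^ 2 + g x ^ 2 ≠ 0) : ContinuousOn (fun x => dc (f x) (g x)) S := by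
  refine (IsInducing.subtypeVal.continuousOn_iff (f := fun x => dc (f x) (g x))).2 ?_
  refine ContinuousOn.congr (f := fun x => (!₂[(f x ^ 2 - g x ^ 2) / (f x ^ 2 + g x ^ 2),
    2 * f x * g x / (f x ^ 2 + g x ^ 2)] : E2)) ?_ (fun x hx => by
      rw [Function.comp_apply, dc_of (h x hx)])
  have h1 : ContinuousOn (fun x => (f x ^ 2 - g x ^ 2) / (f x ^ 2 + g x ^ 2)) S :=
    ContinuousOn.div ((hf.pow 2).sub (hg.pow 2)) ((hf.pow 2).add (hg.pow 2)) h
  have h2 : ContinuousOn (fun x => 2 * f x * g x / (f x ^ 2 + g x ^ 2)) S :=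
    ContinuousOn.div ((continuousOn_const.mul hf).mul hg) ((hf.pow 2).add (hg.pow 2)) h
  fun_prop

theorem mk_ext {v w : E3} (h0 : v 0 = w 0) (h1 : v 1 = w 1) (h2 : v 2 = w 2) : v = w := by
  ext l
  fin_cases l
  · exact h0
  · exact h1
  · exact h2

theorem chart_gen {W : Type*} [TopologicalSpace W] {pr : W → PP} (hpr : Continuous pr) {ψ : ℂ → W}
    (hψ : Continuous ψ) (e : ℂ → E3) (k m l : Fin 3) (he : ∀ z, pr (ψ z) = mkP (e z))
    (hk : ∀ z, e z k = z.re) (hm : ∀ z, e z m = z.im) (hl : ∀ z, e z l = 1)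
    (hr : ∀ w (v : E3), v l ≠ 0 → pr w = mkP v → w ∈ range ψ) : IsOpenEmbedding ψ := by
  have hne : ∀ z : ℂ, e z l ≠ 0 := fun z => by rw [hl]; exact one_ne_zero
  refine openEmb_of_inv hψ (fun w => (⟨ratP k l (pr w), ratP m l (pr w)⟩ : ℂ)) ?_ ?_ ?_
  · intro z
    rw [he, ratP_mk k l (e3_ne l (hne z)), ratP_mk m l (e3_ne l (hne z)), hk, hm, hl]
    simp
  · intro z
    have h1 := ratP_cont k l (hne z)
    have h2 := ratP_cont m l (hne z)
    rw [← he] at h1 h2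
    have h3 : Continuous (fun p : ℝ × ℝ => (⟨p.1, p.2⟩ : ℂ)) := Complex.equivRealProdCLM.symm.continuous
    exact h3.continuousAt.comp (f := fun w => (ratP k l (pr w), ratP m l (pr w)))
      ((h1.comp hpr.continuousAt).prodMk (h2.comp hpr.continuousAt))
  · have : range ψ = pr ⁻¹' {P | ∃ v : E3, v l ≠ 0 ∧ mkP v = P} := by
      ext w
      constructor
      · rintro ⟨z, rfl⟩
        exact ⟨e z, hne z, (he z).symm⟩
      · rintro ⟨v, hv, hvw⟩
        exact hr w v hv hvw.symm
    rw [this]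
    exact (mkP_isOpen l).preimage hpr

/-- the Klein bottle: blow-up of the projective plane at one point -/
def KB : Set (Circ × PP) := {p | ∃ x : S2, pq x = p.2 ∧ par p.1 ((x : E3) 1) ((x : E3) 2)}

/-- the blow-up of the projective plane at two points, which is also a blow-up of the torus -/
def MB : Set (Circ × Circ × PP) := {p | ∃ x : S2, pq x = p.2.2 ∧ par p.1 ((x : E3) 0) ((x : E3) 2) ∧
  par p.2.1 ((x : E3) 1) ((x : E3) 2)}

theorem mem_KB {t : Circ} {v : E3} (hv : v ≠ 0) : (t, mkP v) ∈ KB ↔ par t (v 1) (v 2) := by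
  constructor
  · rintro ⟨x, hx, h⟩
    rw [← mkP_coe] at hx
    obtain ⟨k, hk, rfl⟩ := mkP_eq (s2_ne x) hv hx
    exact par_smul h k
  · intro h
    exact ⟨_, (mkP_of hv).symm, par_smul h _⟩

theorem mem_MB {s t : Circ} {v : E3} (hv : v ≠ 0) :
    (s, t, mkP v) ∈ MB ↔ par s (v 0) (v 2) ∧ par t (v 1) (v 2) := by
  constructor
  · rintro ⟨x, hx, h, h'⟩
    rw [← mkP_coe] at hx
    obtain ⟨k, hk, rfl⟩ := mkP_eq (s2_ne x) hv hx
    exact ⟨par_smul h k, par_smul h' k⟩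
  · intro h
    exact ⟨_, (mkP_of hv).symm, par_smul h.1 _, par_smul h.2 _⟩

instance KB_compact : CompactSpace KB := by
  rw [← isCompact_iff_compactSpace]
  have : KB = (fun p : Circ × S2 => (p.1, pq p.2)) '' {p | par p.1 ((p.2 : E3) 1) ((p.2 : E3) 2)} := by
    ext ⟨t, P⟩
    constructor
    · rintro ⟨x, rfl, h⟩; exact ⟨(t, x), h, rfl⟩
    · rintro ⟨⟨t', x⟩, h, h2⟩
      cases h2
      exact ⟨x, rfl, h⟩
  rw [this]
  refine IsCompact.image (IsClosed.isCompact ?_) (by have := pq_cont; fun_prop)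
  exact (isClosed_eq (by fun_prop) (by fun_prop)).inter (isClosed_eq (by fun_prop) (by fun_prop))

instance MB_compact : CompactSpace MB := by
  rw [← isCompact_iff_compactSpace]
  have : MB = (fun p : Circ × Circ × S2 => (p.1, p.2.1, pq p.2.2)) ''
      ({p | par p.1 ((p.2.2 : E3) 0) ((p.2.2 : E3) 2)} ∩ {p | par p.2.1 ((p.2.2 : E3) 1) ((p.2.2 : E3) 2)}) := by
    ext ⟨s, t, P⟩
    constructor
    · rintro ⟨x, rfl, h, h'⟩; exact ⟨(s, t, x), ⟨h, h'⟩, rfl⟩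
    · rintro ⟨⟨s', t', x⟩, ⟨h, h'⟩, h2⟩
      cases h2
      exact ⟨x, rfl, h, h'⟩
  rw [this]
  refine IsCompact.image (IsClosed.isCompact (IsClosed.inter ?_ ?_)) (by have := pq_cont; fun_prop)
  · exact (isClosed_eq (by fun_prop) (by fun_prop)).inter (isClosed_eq (by fun_prop) (by fun_prop))
  · exact (isClosed_eq (by fun_prop) (by fun_prop)).inter (isClosed_eq (by fun_prop) (by fun_prop))

theorem qDom_norm {p : ℂ × ℝ} (hp : p ∈ qDom) : ‖p.1‖ = 1 := by simpa using hp.1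

theorem dc_neg (x y : ℝ) (h : x ^ 2 + y ^ 2 = 1) : dc (-x) (-y) = dc x y :=
  (dc_prop (by rw [neg_sq, neg_sq, h]; exact one_ne_zero) (by rw [h]; exact one_ne_zero)).2 (by ring)

theorem dc_one_inj {a b : ℝ} (h : dc 1 a = dc 1 b) : a = b := by
  have := (dc_prop (one_sq_ne a) (one_sq_ne b)).1 h
  linarith

theorem mk_cont {X : Type*} [TopologicalSpace X] {S : Set X} {f g h : X → ℝ} (hf : ContinuousOn f S)
    (hg : ContinuousOn g S) (hh : ContinuousOn h S) (h0 : ∀ x ∈ S, (!₂[f x, g x, h x] : E3) ≠ 0) :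
    ContinuousOn (fun x => mkP !₂[f x, g x, h x]) S :=
  mkP_cont.comp (by fun_prop) h0

theorem scale_e3 {v : E3} {k : ℝ} (hk : k ≠ 0) {x y z : ℝ} (h0 : v 0 = k * x) (h1 : v 1 = k * y)
    (h2 : v 2 = k * z) (hn : (!₂[x, y, z] : E3) ≠ 0) : mkP v = mkP !₂[x, y, z] := by
  rw [← mkP_smul hn hk]
  congr 1
  exact mk_ext h0 h1 h2

def chP (z : ℂ) : PP := mkP !₂[1, z.re, z.im]

theorem chP_ne (a b : ℝ) : (!₂[1, a, b] : E3) ≠ 0 := e3_ne 0 (by simp)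
theorem chK_ne (a b : ℝ) : (!₂[a, 1, b] : E3) ≠ 0 := e3_ne 1 (by simp)

theorem chP_openEmb : IsOpenEmbedding chP := by
  refine chart_gen (pr := id) continuous_id ?_ (fun z => !₂[1, z.re, z.im]) 1 2 0 (fun z => rfl)
    (fun z => rfl) (fun z => rfl) (fun z => rfl) ?_
  · rw [← continuousOn_univ]
    exact mk_cont (by fun_prop) (by fun_prop) (by fun_prop) fun z _ => chP_ne _ _
  · intro w v hv hw
    refine ⟨⟨v 1 / v 0, v 2 / v 0⟩, ?_⟩
    rw [show w = mkP v from hw]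
    exact (scale_e3 hv (by simp) (by field_simp) (by field_simp) (chP_ne _ _)).symm

theorem KB_surj (p : KB) : ∃ (t : Circ) (v : E3) (hv : v ≠ 0) (h : par t (v 1) (v 2)),
    p = ⟨(t, mkP v), (mem_KB hv).2 h⟩ := by
  obtain ⟨⟨t, P⟩, hp⟩ := p
  obtain ⟨v, hv, rfl⟩ := mkP_surj P
  have h0 : v ≠ 0 := by rw [← norm_ne_zero_iff, hv]; exact one_ne_zero
  exact ⟨t, v, h0, (mem_KB h0).1 hp, rfl⟩

theorem MB_surj (p : MB) : ∃ (s t : Circ) (v : E3) (hv : v ≠ 0) (h : par s (v 0) (v 2) ∧ par t (v 1) (v 2)),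
    p = ⟨(s, t, mkP v), (mem_MB hv).2 h⟩ := by
  obtain ⟨⟨s, t, P⟩, hp⟩ := p
  obtain ⟨v, hv, rfl⟩ := mkP_surj P
  have h0 : v ≠ 0 := by rw [← norm_ne_zero_iff, hv]; exact one_ne_zero
  exact ⟨s, t, v, h0, (mem_MB h0).1 hp, rfl⟩

theorem sq_ne_of {a b : ℝ} (h : ¬(a = 0 ∧ b = 0)) : a ^ 2 + b ^ 2 ≠ 0 := by
  intro h'
  exact h ⟨by nlinarith [sq_nonneg a, sq_nonneg b], by nlinarith [sq_nonneg a, sq_nonneg b]⟩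

theorem par_exists (a b : ℝ) : ∃ t, par t a b := by
  by_cases h : a = 0 ∧ b = 0
  · rw [h.1, h.2]; exact ⟨dc 1 0, par_zero _⟩
  · exact ⟨dc a b, (par_dc (sq_ne_of h)).2 (by ring)⟩

theorem par_det {s t : Circ} {a b : ℝ} (h : ¬(a = 0 ∧ b = 0)) (hs : par s a b) (ht : par t a b) : s = t :=
  (par_uniq hs (sq_ne_of h)).trans (par_uniq ht (sq_ne_of h)).symm

open Classical in
/-- force a point into a set -/
def forceIn {X : Type*} (S : Set X) [Nonempty S] (x : X) : S :=
  if h : x ∈ S then ⟨x, h⟩ else Classical.arbitrary S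

theorem forceIn_coe {X : Type*} {S : Set X} [Nonempty S] {x : X} (h : x ∈ S) : (forceIn S x : X) = x := by
  unfold forceIn; rw [dif_pos h]

instance : Nonempty KB := ⟨⟨(dc 1 0, mkP !₂[1, 0, 0]), (mem_KB (chP_ne 0 0)).2 (par_zero _)⟩⟩
instance : Nonempty MB := ⟨⟨(dc 1 0, dc 1 0, mkP !₂[1, 0, 0]), (mem_MB (chP_ne 0 0)).2
  ⟨(par_dc (one_sq_ne 0)).2 (by simp), par_zero _⟩⟩⟩

theorem force_cont {X A : Type*} [TopologicalSpace X] [TopologicalSpace A] {S : Set X} [Nonempty S] {f : A → X}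
    {D : Set A} (hf : ContinuousOn f D) (h : ∀ a ∈ D, f a ∈ S) : ContinuousOn (fun a => forceIn S (f a)) D := by
  refine (IsInducing.subtypeVal.continuousOn_iff (f := fun a => forceIn S (f a))).2 ?_
  exact hf.congr fun a ha => forceIn_coe (h a ha)

theorem csK : CSum KB PP chP PP aff := by
  have hu : ∀ p ∈ qDom, p.1.re ^ 2 + p.1.im ^ 2 = 1 := fun p hp => unit_ne (qDom_norm hp)
  have hb : ∀ p ∈ qDom, (dc p.1.re p.1.im, mkP !₂[1, p.2 * p.1.re, p.2 * p.1.im]) ∈ KB := fun p hp =>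
    (mem_KB (chP_ne _ _)).2 ((par_dc (by rw [hu p hp]; exact one_ne_zero)).2 (by simp; ring))
  refine blowup chP_openEmb (π := fun m : KB => m.1.2) (by fun_prop) ?_ ?_
    (fun p => forceIn KB (dc p.1.re p.1.im, mkP !₂[1, p.2 * p.1.re, p.2 * p.1.im])) ?_ ?_ ?_ ?_ ?_
  · intro P
    obtain ⟨v, hv, rfl⟩ := mkP_surj P
    have h0 : v ≠ 0 := by rw [← norm_ne_zero_iff, hv]; exact one_ne_zero
    obtain ⟨t, ht⟩ := par_exists (v 1) (v 2)
    exact ⟨⟨(t, mkP v), (mem_KB h0).2 ht⟩, rfl⟩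
  · intro m m' hm hm0
    obtain ⟨t, v, hv, h, rfl⟩ := KB_surj m
    obtain ⟨⟨t', P'⟩, hp'⟩ := m'
    simp only at hm hm0
    subst hm
    have h' := (mem_KB hv).1 hp'
    have h3 : ¬(v 1 = 0 ∧ v 2 = 0) := by
      rintro ⟨h1, h2⟩
      apply hm0
      have h4 : v 0 ≠ 0 := fun h4 => hv (mk_ext h4 h1 h2)
      exact scale_e3 h4 (by simp) (by simp [h1]) (by simp [h2]) (chP_ne _ _)
    rw [Subtype.mk_eq_mk, par_det h3 h h']
  · refine force_cont (ContinuousOn.prodMk ?_ ?_) hb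
    · exact dc_cont (by fun_prop) (by fun_prop) fun p hp => by rw [hu p hp]; exact one_ne_zero
    · exact mk_cont (by fun_prop) (by fun_prop) (by fun_prop) fun z _ => chP_ne _ _
  · intro p hp
    simp only [Prod.fst_neg, Prod.snd_neg, Complex.neg_re, Complex.neg_im, neg_mul_neg, dc_neg _ _ (hu p hp)]
  · intro p hp
    simp only [forceIn_coe (hb p hp)]
    unfold chP
    rw [Complex.re_ofReal_mul, Complex.im_ofReal_mul]
  · intro m hm
    obtain ⟨t, v, hv, h, rfl⟩ := KB_surj m
    obtain ⟨x, y, hxy, rfl⟩ := dc_surj t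
    refine ⟨⟨x, y⟩, unit_norm hxy, ?_⟩
    apply Subtype.ext
    have hp : ((⟨x, y⟩ : ℂ), (0:ℝ)) ∈ qDom := ⟨by simpa using unit_norm hxy, by simp⟩
    rw [forceIn_coe (hb _ hp)]
    simp only at hm ⊢
    rw [hm]
    unfold chP
    simp
  · intro u u' hu1 hu1' h
    have h1 := congrArg Subtype.val h
    have hp : ∀ u : ℂ, ‖u‖ = 1 → (u, (0:ℝ)) ∈ qDom := fun u hu => ⟨by simpa using hu, by simp⟩
    rw [forceIn_coe (hb _ (hp u hu1)), forceIn_coe (hb _ (hp u' hu1'))] at h1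
    exact dc_inj hu1 hu1' (Prod.ext_iff.1 h1).1

theorem chK_mem (z : ℂ) : (dc 1 z.im, mkP !₂[z.re, 1, z.im]) ∈ KB :=
  (mem_KB (chK_ne _ _)).2 ((par_dc (one_sq_ne _)).2 (by simp))

def chK (z : ℂ) : KB := ⟨(dc 1 z.im, mkP !₂[z.re, 1, z.im]), chK_mem z⟩

theorem chK_openEmb : IsOpenEmbedding chK := by
  refine chart_gen (pr := fun m : KB => m.1.2) (by fun_prop) ?_ (fun z => !₂[z.re, 1, z.im]) 0 2 1 (fun z => rfl)
    (fun z => rfl) (fun z => rfl) (fun z => rfl) ?_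
  · refine Continuous.subtype_mk ?_ _
    rw [← continuousOn_univ]
    refine ContinuousOn.prodMk ?_ ?_
    · exact dc_cont (by fun_prop) (by fun_prop) fun z _ => one_sq_ne _
    · exact mk_cont (by fun_prop) (by fun_prop) (by fun_prop) fun z _ => chK_ne _ _
  · rintro ⟨⟨t, P⟩, hp⟩ v hv rfl
    have h := (mem_KB (e3_ne 1 hv)).1 hp
    refine ⟨⟨v 0 / v 1, v 2 / v 1⟩, ?_⟩
    unfold chK
    rw [Subtype.mk_eq_mk, Prod.mk.injEq]
    constructor
    · have h0 : ¬(v 1 = 0 ∧ v 2 = 0) := fun h => hv h.1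
      rw [par_uniq h (sq_ne_of h0), dc_prop (one_sq_ne _) (sq_ne_of h0)]
      simp only; field_simp
    · exact (scale_e3 hv (by field_simp) (by simp) (by field_simp) (chK_ne _ _)).symm

theorem csM : CSum MB KB chK PP aff := by
  have hu : ∀ p ∈ qDom, p.1.re ^ 2 + p.1.im ^ 2 = 1 := fun p hp => unit_ne (qDom_norm hp)
  have hb : ∀ p ∈ qDom, (dc p.1.re p.1.im, dc 1 (p.2 * p.1.im), mkP !₂[p.2 * p.1.re, 1, p.2 * p.1.im]) ∈ MB :=
    fun p hp => (mem_MB (chK_ne _ _)).2 ⟨(par_dc (by rw [hu p hp]; exact one_ne_zero)).2 (by simp; ring),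
      (par_dc (one_sq_ne _)).2 (by simp)⟩
  have hpr : ∀ m : MB, (m.1.2.1, m.1.2.2) ∈ KB := by
    rintro ⟨⟨s, t, P⟩, x, h⟩
    exact ⟨x, h.1, h.2.2⟩
  refine blowup chK_openEmb (π := fun m : MB => ⟨(m.1.2.1, m.1.2.2), hpr m⟩)
    (Continuous.subtype_mk (by fun_prop) _) ?_ ?_
    (fun p => forceIn MB (dc p.1.re p.1.im, dc 1 (p.2 * p.1.im), mkP !₂[p.2 * p.1.re, 1, p.2 * p.1.im]))
    ?_ ?_ ?_ ?_ ?_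
  · intro k
    obtain ⟨t, v, hv, h, rfl⟩ := KB_surj k
    obtain ⟨s, hs⟩ := par_exists (v 0) (v 2)
    exact ⟨⟨(s, t, mkP v), (mem_MB hv).2 ⟨hs, h⟩⟩, rfl⟩
  · intro m m' hm hm0
    obtain ⟨s, t, v, hv, h, rfl⟩ := MB_surj m
    obtain ⟨⟨s', t', P'⟩, hp'⟩ := m'
    simp only [Subtype.mk_eq_mk, Prod.mk.injEq] at hm
    obtain ⟨rfl, rfl⟩ := hm
    have h' := (mem_MB hv).1 hp'
    have h3 : ¬(v 0 = 0 ∧ v 2 = 0) := by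
      rintro ⟨h1, h2⟩
      apply hm0
      have h4 : v 1 ≠ 0 := fun h4 => hv (mk_ext h1 h4 h2)
      unfold chK
      rw [Subtype.mk_eq_mk, Prod.mk.injEq]
      constructor
      · have h0 : ¬(v 1 = 0 ∧ v 2 = 0) := fun h => h4 h.1
        change t = _
        rw [par_uniq h.2 (sq_ne_of h0), dc_prop (sq_ne_of h0) (one_sq_ne _)]
        simp [h2]
      · exact scale_e3 h4 (by simp [h1]) (by simp) (by simp [h2]) (chK_ne _ _)
    rw [Subtype.mk_eq_mk, par_det h3 h.1 h'.1]
  · refine force_cont (ContinuousOn.prodMk ?_ (ContinuousOn.prodMk ?_ ?_)) hb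
    · exact dc_cont (by fun_prop) (by fun_prop) fun p hp => by rw [hu p hp]; exact one_ne_zero
    · exact dc_cont (by fun_prop) (by fun_prop) fun p hp => one_sq_ne _
    · exact mk_cont (by fun_prop) (by fun_prop) (by fun_prop) fun z _ => chK_ne _ _
  · intro p hp
    simp only [Prod.fst_neg, Prod.snd_neg, Complex.neg_re, Complex.neg_im, neg_mul_neg, dc_neg _ _ (hu p hp)]
  · intro p hp
    simp only [forceIn_coe (hb p hp)]
    unfold chK
    simp only [Complex.re_ofReal_mul, Complex.im_ofReal_mul]
  · intro m hm
    obtain ⟨s, t, v, hv, h, rfl⟩ := MB_surj m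
    obtain ⟨x, y, hxy, rfl⟩ := dc_surj s
    refine ⟨⟨x, y⟩, unit_norm hxy, ?_⟩
    apply Subtype.ext
    have hp : ((⟨x, y⟩ : ℂ), (0:ℝ)) ∈ qDom := ⟨by simpa using unit_norm hxy, by simp⟩
    rw [forceIn_coe (hb _ hp)]
    unfold chK at hm
    simp only [Subtype.mk_eq_mk, Prod.mk.injEq] at hm
    simp only
    rw [hm.1, hm.2]
    simp
  · intro u u' hu1 hu1' h
    have h1 := congrArg Subtype.val h
    have hp : ∀ u : ℂ, ‖u‖ = 1 → (u, (0:ℝ)) ∈ qDom := fun u hu => ⟨by simpa using hu, by simp⟩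
    rw [forceIn_coe (hb _ (hp u hu1)), forceIn_coe (hb _ (hp u' hu1'))] at h1
    exact dc_inj hu1 hu1' (Prod.ext_iff.1 h1).1

def chT (z : ℂ) : Circ × Circ := (dc 1 z.re, dc 1 z.im)

theorem dc_one_eq {t : Circ} (h : 1 + (t : E2) 0 ≠ 0) : t = dc 1 ((t : E2) 1 / (1 + (t : E2) 0)) := by
  have hc := circ_eq t
  refine par_uniq ⟨?_, ?_⟩ (one_sq_ne _)
  · field_simp
  · field_simp; linear_combination -hc

theorem dc_one_val (a : ℝ) : 1 + (dc 1 a : E2) 0 ≠ 0 ∧ (dc 1 a : E2) 1 / (1 + (dc 1 a : E2) 0) = a := by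
  have h := one_sq_ne a
  have h1 : 1 + (dc 1 a : E2) 0 = 2 / (1 ^ 2 + a ^ 2) := by rw [dc_zero h]; field_simp; ring
  constructor
  · rw [h1]; positivity
  · rw [h1, dc_one h]; field_simp

theorem chT_openEmb : IsOpenEmbedding chT := by
  have hc : Continuous (fun p : Circ × Circ => 1 + (p.1 : E2) 0) := by fun_prop
  have hc2 : Continuous (fun p : Circ × Circ => 1 + (p.2 : E2) 0) := by fun_prop
  refine openEmb_of_inv ?_ (fun p => (⟨(p.1 : E2) 1 / (1 + (p.1 : E2) 0), (p.2 : E2) 1 / (1 + (p.2 : E2) 0)⟩ : ℂ))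
    ?_ ?_ ?_
  · rw [← continuousOn_univ]
    refine ContinuousOn.prodMk ?_ ?_
    · exact dc_cont (by fun_prop) (by fun_prop) fun z _ => one_sq_ne _
    · exact dc_cont (by fun_prop) (by fun_prop) fun z _ => one_sq_ne _
  · intro z
    unfold chT
    simp only [(dc_one_val _).2]
  · intro z
    have h3 : Continuous (fun p : ℝ × ℝ => (⟨p.1, p.2⟩ : ℂ)) := Complex.equivRealProdCLM.symm.continuous
    have h4 : Continuous (fun p : Circ × Circ => (p.1 : E2) 1) := by fun_prop
    have h5 : Continuous (fun p : Circ × Circ => (p.2 : E2) 1) := by fun_prop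
    exact h3.continuousAt.comp (f := fun p : Circ × Circ =>
      ((p.1 : E2) 1 / (1 + (p.1 : E2) 0), (p.2 : E2) 1 / (1 + (p.2 : E2) 0)))
      ((h4.continuousAt.div hc.continuousAt (dc_one_val _).1).prodMk
        (h5.continuousAt.div hc2.continuousAt (dc_one_val _).1))
  · have : range chT = {p | 1 + (p.1 : E2) 0 ≠ 0} ∩ {p | 1 + (p.2 : E2) 0 ≠ 0} := by
      ext ⟨s, t⟩
      constructor
      · rintro ⟨z, hz⟩
        cases hz
        exact ⟨(dc_one_val _).1, (dc_one_val _).1⟩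
      · rintro ⟨h1, h2⟩
        refine ⟨⟨(s : E2) 1 / (1 + (s : E2) 0), (t : E2) 1 / (1 + (t : E2) 0)⟩, ?_⟩
        exact Prod.ext (dc_one_eq h1).symm (dc_one_eq h2).symm
    rw [this]
    exact (isOpen_ne_fun hc continuous_const).inter (isOpen_ne_fun hc2 continuous_const)

/-- away from the centre, a point of the blown-up torus is determined by its directions -/
theorem par_two {x1 z1 x2 z2 : ℝ} (h1 : x1 ^ 2 + z1 ^ 2 = 1) (h2 : x2 ^ 2 + z2 ^ 2 = 1) (hz : ¬(z1 = 0 ∧ z2 = 0))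
    {v : E3} (hv : v ≠ 0) (e1 : v 0 * z1 = v 2 * x1) (e2 : v 1 * z2 = v 2 * x2) :
    (!₂[x1 * z2, x2 * z1, z1 * z2] : E3) ≠ 0 ∧ mkP v = mkP !₂[x1 * z2, x2 * z1, z1 * z2] := by
  have key : ∃ k : ℝ, v 0 = k * (x1 * z2) ∧ v 1 = k * (x2 * z1) ∧ v 2 = k * (z1 * z2) := by
    by_cases hz1 : z1 = 0
    · have hz2 : z2 ≠ 0 := fun h => hz ⟨hz1, h⟩
      have hx1 : x1 ≠ 0 := by rintro rfl; rw [hz1] at h1; norm_num at h1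
      have hv2 : v 2 = 0 := by
        rw [hz1, mul_zero] at e1; exact (mul_eq_zero.1 e1.symm).resolve_right hx1
      have hv1 : v 1 = 0 := by
        rw [hv2, zero_mul] at e2; exact (mul_eq_zero.1 e2).resolve_right hz2
      exact ⟨v 0 / (x1 * z2), by field_simp, by rw [hv1, hz1]; ring, by rw [hv2, hz1]; ring⟩
    · by_cases hz2 : z2 = 0
      · have hx2 : x2 ≠ 0 := by rintro rfl; rw [hz2] at h2; norm_num at h2
        have hv2 : v 2 = 0 := by
          rw [hz2, mul_zero] at e2; exact (mul_eq_zero.1 e2.symm).resolve_right hx2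
        have hv0 : v 0 = 0 := by
          rw [hv2, zero_mul] at e1; exact (mul_eq_zero.1 e1).resolve_right hz1
        exact ⟨v 1 / (x2 * z1), by rw [hv0, hz2]; ring, by field_simp, by rw [hv2, hz2]; ring⟩
      · refine ⟨v 2 / (z1 * z2), ?_, ?_, by field_simp⟩
        · field_simp; linear_combination e1
        · field_simp; linear_combination e2
  obtain ⟨k, k0, k1, k2⟩ := key
  have hk : k ≠ 0 := by
    rintro rfl
    rw [zero_mul] at k0 k1 k2
    exact hv (mk_ext k0 k1 k2)
  have hn : (!₂[x1 * z2, x2 * z1, z1 * z2] : E3) ≠ 0 := by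
    intro h
    have a0 : x1 * z2 = 0 := congrArg (fun v : E3 => v 0) h
    have a1 : x2 * z1 = 0 := congrArg (fun v : E3 => v 1) h
    have a2 : z1 * z2 = 0 := congrArg (fun v : E3 => v 2) h
    rw [a0, mul_zero] at k0
    rw [a1, mul_zero] at k1
    rw [a2, mul_zero] at k2
    exact hv (mk_ext k0 k1 k2)
  exact ⟨hn, scale_e3 hk k0 k1 k2 hn⟩

theorem csMT : CSum MB (Circ × Circ) chT PP aff := by
  have hu : ∀ p ∈ qDom, p.1.re ^ 2 + p.1.im ^ 2 = 1 := fun p hp => unit_ne (qDom_norm hp)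
  have hn : ∀ p ∈ qDom, (!₂[p.1.im, p.1.re, p.2 * (p.1.re * p.1.im)] : E3) ≠ 0 := by
    intro p hp h
    have a0 : p.1.im = 0 := congrArg (fun v : E3 => v 0) h
    have a1 : p.1.re = 0 := congrArg (fun v : E3 => v 1) h
    have := hu p hp
    rw [a0, a1] at this; norm_num at this
  have hb : ∀ p ∈ qDom, (dc 1 (p.2 * p.1.re), dc 1 (p.2 * p.1.im),
      mkP !₂[p.1.im, p.1.re, p.2 * (p.1.re * p.1.im)]) ∈ MB := fun p hp =>
    (mem_MB (hn p hp)).2 ⟨(par_dc (one_sq_ne _)).2 (by simp; ring), (par_dc (one_sq_ne _)).2 (by simp; ring)⟩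
  have hxz : ∀ {x z : ℝ}, x ^ 2 + z ^ 2 = 1 → x ^ 2 + z ^ 2 ≠ 0 := fun h => by rw [h]; exact one_ne_zero
  have hp0 : ∀ u : ℂ, ‖u‖ = 1 → (u, (0:ℝ)) ∈ qDom := fun u hu => ⟨by simpa using hu, by simp⟩
  have hone : ∀ {x z : ℝ}, x ^ 2 + z ^ 2 = 1 → (dc x z = dc 1 0 ↔ z = 0) := fun h => by
    rw [dc_prop (hxz h) (one_sq_ne 0)]; simp
  have hch : chT 0 = (dc 1 0, dc 1 0) := rfl
  refine blowup chT_openEmb (π := fun m : MB => (m.1.1, m.1.2.1)) (by fun_prop) ?_ ?_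
    (fun p => forceIn MB (dc 1 (p.2 * p.1.re), dc 1 (p.2 * p.1.im),
      mkP !₂[p.1.im, p.1.re, p.2 * (p.1.re * p.1.im)])) ?_ ?_ ?_ ?_ ?_
  · rintro ⟨s, t⟩
    obtain ⟨x1, z1, h1, rfl⟩ := dc_surj s
    obtain ⟨x2, z2, h2, rfl⟩ := dc_surj t
    have : ∃ v : E3, v ≠ 0 ∧ v 0 * z1 = v 2 * x1 ∧ v 1 * z2 = v 2 * x2 := by
      by_cases hz : z1 = 0
      · refine ⟨!₂[1, 0, 0], chP_ne _ _, by simp [hz], by simp⟩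
      · by_cases hz2 : z2 = 0
        · exact ⟨!₂[0, 1, 0], chK_ne _ _, by simp, by simp [hz2]⟩
        · exact ⟨!₂[x1 * z2, x2 * z1, z1 * z2], e3_ne 2 (by simp [hz, hz2]), by simp; ring, by simp; ring⟩
    obtain ⟨v, hv, e1, e2⟩ := this
    exact ⟨⟨(dc x1 z1, dc x2 z2, mkP v), (mem_MB hv).2 ⟨(par_dc (hxz h1)).2 e1, (par_dc (hxz h2)).2 e2⟩⟩, rfl⟩
  · intro m m' hm hm0
    obtain ⟨s, t, v, hv, h, rfl⟩ := MB_surj m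
    obtain ⟨s', t', v', hv', h', rfl⟩ := MB_surj m'
    simp only [Prod.mk.injEq] at hm
    obtain ⟨rfl, rfl⟩ := hm
    obtain ⟨x1, z1, h1, rfl⟩ := dc_surj s
    obtain ⟨x2, z2, h2, rfl⟩ := dc_surj t
    rw [par_dc (hxz h1), par_dc (hxz h2)] at h h'
    have hz : ¬(z1 = 0 ∧ z2 = 0) := by
      rintro ⟨rfl, rfl⟩
      apply hm0
      rw [hch]
      exact Prod.ext ((hone h1).2 rfl) ((hone h2).2 rfl)
    rw [Subtype.mk_eq_mk, (par_two h1 h2 hz hv h.1 h.2).2, (par_two h1 h2 hz hv' h'.1 h'.2).2]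
  · refine force_cont (ContinuousOn.prodMk ?_ (ContinuousOn.prodMk ?_ ?_)) hb
    · exact dc_cont (by fun_prop) (by fun_prop) fun p hp => one_sq_ne _
    · exact dc_cont (by fun_prop) (by fun_prop) fun p hp => one_sq_ne _
    · exact mk_cont (by fun_prop) (by fun_prop) (by fun_prop) hn
  · intro p hp
    have h1 : mkP !₂[-p.1.im, -p.1.re, -p.2 * (p.1.re * p.1.im)] =
        mkP !₂[p.1.im, p.1.re, p.2 * (p.1.re * p.1.im)] :=
      scale_e3 (k := -1) (by norm_num) (by simp) (by simp) (by simp) (hn p hp)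
    simp only [Prod.fst_neg, Prod.snd_neg, Complex.neg_re, Complex.neg_im, neg_mul_neg, h1]
  · intro p hp
    simp only [forceIn_coe (hb p hp)]
    unfold chT
    rw [Complex.re_ofReal_mul, Complex.im_ofReal_mul]
  · intro m hm
    obtain ⟨s, t, v, hv, h, rfl⟩ := MB_surj m
    obtain ⟨x1, z1, h1, rfl⟩ := dc_surj s
    obtain ⟨x2, z2, h2, rfl⟩ := dc_surj t
    rw [hch] at hm
    simp only [Prod.mk.injEq] at hm
    rw [hone h1, hone h2] at hm
    obtain ⟨rfl, rfl⟩ := hm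
    have e1 := (par_dc (hxz h1)).1 h.1
    have hx1 : x1 ≠ 0 := by rintro rfl; norm_num at h1
    have hv2 : v 2 = 0 := by
      rw [mul_zero] at e1; exact (mul_eq_zero.1 e1.symm).resolve_right hx1
    set w : ℂ := ⟨v 1, v 0⟩ with hw
    have hw0 : w ≠ 0 := by
      intro h0
      exact hv (mk_ext (congrArg Complex.im h0) (congrArg Complex.re h0) hv2)
    have hwn : ‖w‖ ≠ 0 := norm_ne_zero_iff.2 hw0
    have hun : ‖((‖w‖⁻¹ : ℝ) * w : ℂ)‖ = 1 := by
      rw [norm_mul, Complex.norm_real, norm_inv, norm_norm, inv_mul_cancel₀ hwn]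
    refine ⟨(‖w‖⁻¹ : ℝ) * w, hun, ?_⟩
    apply Subtype.ext
    rw [forceIn_coe (hb _ (hp0 _ hun))]
    have h3 := scale_e3 (v := v) hwn (x := ‖w‖⁻¹ * v 0) (y := ‖w‖⁻¹ * v 1) (z := 0) (by field_simp) (by field_simp)
      (by rw [hv2, mul_zero]) (fun h0 => by
        have a0 : ‖w‖⁻¹ * v 0 = 0 := congrArg (fun v : E3 => v 0) h0
        have a1 : ‖w‖⁻¹ * v 1 = 0 := congrArg (fun v : E3 => v 1) h0
        exact hv (mk_ext ((mul_eq_zero.1 a0).resolve_left (inv_ne_zero hwn))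
          ((mul_eq_zero.1 a1).resolve_left (inv_ne_zero hwn)) hv2))
    simp only [zero_mul, Complex.re_ofReal_mul, Complex.im_ofReal_mul]
    rw [h3, (hone h1).2 rfl, (hone h2).2 rfl]
  · intro u u' hu1 hu1' h
    have h1 := congrArg Subtype.val h
    rw [forceIn_coe (hb _ (hp0 u hu1)), forceIn_coe (hb _ (hp0 u' hu1'))] at h1
    have h2 := (Prod.ext_iff.1 (Prod.ext_iff.1 h1).2).2
    simp only at h2
    obtain ⟨k, hk, h3⟩ := mkP_eq (hn _ (hp0 u hu1)) (hn _ (hp0 u' hu1')) h2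
    have a0 : u'.im = k * u.im := congrArg (fun v : E3 => v 0) h3
    have a1 : u'.re = k * u.re := congrArg (fun v : E3 => v 1) h3
    refine dc_inj hu1 hu1' ((dc_prop (hxz (unit_ne hu1)) (hxz (unit_ne hu1'))).2 ?_)
    rw [a0, a1]; ring

/-- `W` contains a double torus minus a disc, in a controlled way -/
def P3 (W : Type) [TopologicalSpace W] : Prop :=
  ∃ G : TopCat.{0}, T2Space G ∧ IsConnSum G Torus Torus ∧ ∃ (γ : ℂ → G) (e : G → W), IsOpenEmbedding γ ∧
    ContinuousOn e (γ '' ball 0 1)ᶜ ∧ InjOn e (γ '' ball 0 1)ᶜ ∧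
    ∀ O : Set G, IsOpen O → (∀ g ∈ O, g ∉ γ '' closedBall 0 1) → IsOpen (e '' O)

theorem P3.contains {X : TopCat.{0}} (h : P3 X) : ContainsDoubleTorusMinusDisk X := by
  obtain ⟨G, hT, hG, γ, e, hγ, hc, hi, ho⟩ := h
  have hr : range (γ ∘ ofD) = γ '' closedBall 0 1 := by rw [range_comp, range_ofD]
  have hcl : IsClosed (γ '' closedBall 0 1) := ((isCompact_closedBall 0 1).image hγ.continuous).isClosed
  have hsub : (γ '' closedBall 0 1)ᶜ ⊆ (γ '' ball 0 1)ᶜ := compl_subset_compl.2 (image_mono ball_subset_closedBall)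
  refine ⟨e '' (γ '' closedBall 0 1)ᶜ, ho _ hcl.isOpen_compl fun g hg => hg, G, hG, γ ∘ ofD,
    emb_of_isDisc (IsOpenEmbedding.isDisc hγ), ?_⟩
  rw [hr]
  set S : Set G := (γ '' closedBall 0 1)ᶜ with hS
  have hE : IsOpenEmbedding (fun g : S => e g) := by
    refine IsOpenEmbedding.of_continuous_injective_isOpenMap ?_ ?_ ?_
    · exact continuousOn_iff_continuous_domRestrict.1 (hc.mono hsub)
    · intro a b hab
      exact Subtype.ext (hi (hsub a.2) (hsub b.2) hab)
    · intro O hO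
      have h1 : (fun g : S => e g) '' O = e '' (Subtype.val '' O) := by rw [image_image]
      rw [h1]
      refine ho _ (hcl.isOpen_compl.isOpenMap_subtype_val _ hO) ?_
      rintro _ ⟨g, -, rfl⟩
      exact g.2
  have hrg : range (fun g : S => e g) = e '' S := by
    ext w
    constructor
    · rintro ⟨g, rfl⟩; exact ⟨g, g.2, rfl⟩
    · rintro ⟨g, hg, rfl⟩; exact ⟨⟨g, hg⟩, rfl⟩
  exact ⟨(Homeomorph.setCongr hrg.symm).trans hE.isEmbedding.toHomeomorph.symm⟩

theorem P3.step {Z W Y : Type} [TopologicalSpace Z] [TopologicalSpace W] [TopologicalSpace Y] [T2Space Z]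
    [CompactSpace Y] (hW : Surf W) {ψ : ℂ → W} {η : ℂ → Y} (h : CSum Z W ψ Y η) (hP : P3 W) : P3 Z := by
  obtain ⟨G, hT, hG, γ, e, hγ, hc, hi, ho⟩ := hP
  obtain ⟨i, j, h⟩ := h
  have := hW.compact
  obtain ⟨k, hk, -⟩ := chartScale hγ (1 / 2) (by norm_num) 2
  have hk1 : ∀ r : ℝ, r ≤ 1 → ∀ g, g ∉ γ '' ball 0 r → k g ∉ γ '' ball 0 (2 * r) := by
    rintro r hr g hg ⟨z, hz, hzg⟩
    have hz : ‖z‖ < 2 * r := by simpa using hz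
    apply hg
    refine ⟨((1 / 2 : ℝ) : ℂ) * z, ?_, ?_⟩
    · rw [mem_ball_zero_iff, norm_mul, Complex.norm_real]; norm_num; linarith
    · apply k.injective
      rw [← hzg, hk z (by linarith)]
  have hk2 : ∀ g, g ∉ γ '' ball 0 1 → k g ∉ γ '' ball 0 2 := fun g hg => by simpa using hk1 1 le_rfl g hg
  have hb12 : ∀ g, g ∉ γ '' ball 0 2 → g ∉ γ '' closedBall 0 1 := fun g hg h' => hg (image_mono (fun z hz => by
    have : ‖z‖ ≤ 1 := by simpa using hz
    rw [mem_ball_zero_iff]; linarith) h')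
  have hcb : ∀ g, g ∉ γ '' closedBall 0 1 → g ∉ γ '' ball 0 1 := fun g hg h' =>
    hg (image_mono ball_subset_closedBall h')
  set A : Set ℂ := {z | 1 < ‖z‖ ∧ ‖z‖ < 2} with hA
  have hAo : IsOpen A := (isOpen_lt continuous_const continuous_norm).inter (isOpen_lt continuous_norm continuous_const)
  have hA1 : ∀ z ∈ A, γ z ∉ γ '' ball 0 1 := fun z hz => (not_mem_chart_ball hγ).2 hz.1.le
  have hO : IsOpen (e '' (γ '' A)) := by
    refine ho _ (hγ.isOpenMap _ hAo) ?_
    rintro _ ⟨z, hz, rfl⟩ h'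
    rw [hγ.injective.mem_set_image] at h'
    have : ‖z‖ ≤ 1 := by simpa using h'
    linarith [hz.1]
  have h32 : ((3 / 2 : ℝ) : ℂ) ∈ A := by
    constructor <;> rw [Complex.norm_real] <;> norm_num
  obtain ⟨ψ', hψ', -, hr⟩ := hW.chart_at (e (γ ((3 / 2 : ℝ) : ℂ))) _ hO ⟨_, ⟨_, h32, rfl⟩, rfl⟩
  obtain ⟨κ, c, hc', hκ⟩ := hW.straighten h.hψ hψ'
  have key : ∀ g, g ∉ γ '' ball 0 2 → κ.symm (e g) ∉ ψ '' closedBall 0 1 := by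
    rintro g hg ⟨z, hz, hzg⟩
    have hz : ‖z‖ ≤ 1 := by simpa using hz
    have h1 : e g = ψ' (c z) := by rw [← hκ z hz, hzg, κ.apply_symm_apply]
    obtain ⟨_, ⟨w, hw, rfl⟩, hwe⟩ := hr ⟨c z, rfl⟩
    rw [← h1] at hwe
    have h2 := hi (hA1 w hw) (hcb g (hb12 g hg)) hwe
    exact hg ⟨w, by rw [mem_ball_zero_iff]; exact hw.2, h2⟩
  have key' : ∀ g, g ∉ γ '' ball 0 2 → κ.symm (e g) ∉ ψ '' ball 0 1 := fun g hg h' =>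
    key g hg (image_mono ball_subset_closedBall h')
  refine ⟨G, hT, hG, γ, fun g => i (κ.symm (e (k g))), hγ, ?_, ?_, ?_⟩
  · refine h.ci.comp (κ.symm.continuous.comp_continuousOn (hc.comp k.continuous.continuousOn ?_)) ?_
    · exact fun g hg => hcb _ (hb12 _ (hk2 g hg))
    · exact fun g hg => key' _ (hk2 g hg)
  · intro g hg g' hg' hgg
    have h1 := κ.symm.injective (h.ii (key' _ (hk2 g hg)) (key' _ (hk2 g' hg')) hgg)
    exact k.injective (hi (hcb _ (hb12 _ (hk2 g hg))) (hcb _ (hb12 _ (hk2 g' hg'))) h1)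
  · intro O hO hd
    have h1 : (fun g => i (κ.symm (e (k g)))) '' O = i '' (κ.symm '' (e '' (k '' O))) := by
      simp only [image_image]
    rw [h1]
    refine h.isOpen_image (κ.symm.isOpenMap _ (ho _ (k.isOpenMap _ hO) ?_)) ?_
    · rintro _ ⟨g, hg, rfl⟩
      exact hb12 _ (hk2 g (hcb g (hd g hg)))
    · rintro _ ⟨_, ⟨_, ⟨g, hg, rfl⟩, rfl⟩, rfl⟩
      exact key _ (hk2 g (hcb g (hd g hg)))

theorem CSData.glue {Z W Y P : Type*} [TopologicalSpace Z] [TopologicalSpace W] [TopologicalSpace Y] [T2Space Z]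
    [CompactSpace W] [CompactSpace Y] {ψ : ℂ → W} {η : ℂ → Y} {i : W → Z} {j : Y → Z} (h : CSData ψ η i j)
    (a : W → P) (b : Y → P) (hab : ∀ ζ, ‖ζ‖ = 1 → a (ψ ζ) = b (η ζ)) :
    ∃ F : Z → P, (∀ w ∉ ψ '' ball 0 1, F (i w) = a w) ∧ ∀ y ∉ η '' ball 0 1, F (j y) = b y := by
  let _ : TopologicalSpace P := ⊤
  obtain ⟨F, -, hF⟩ := h.desc a b continuous_top.continuousOn continuous_top.continuousOn hab
  exact ⟨F, hF⟩

/-- associativity of connected sums -/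
theorem CSum.assoc {V Z X Y R : Type} [TopologicalSpace V] [TopologicalSpace Z] [TopologicalSpace X]
    [TopologicalSpace Y] [TopologicalSpace R] [T2Space V] (hX : Surf X) (hY : Surf Y) (hR : Surf R)
    {ψ : ℂ → X} {η : ℂ → Y} {φ : ℂ → V} {ρ : ℂ → R} (h1 : CSum V X ψ Y η) (h2 : CSum Z V φ R ρ) :
    ∃ (Y' : Set (Y × R)) (φ' : ℂ → Y) (ρ' : ℂ → R) (η' : ℂ → Y'), CSum Y' Y φ' R ρ' ∧ CSum Z X ψ Y' η' := by
  have hV := h1.surf hX hY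
  have := hX.compact
  have := hY.compact
  have := hR.compact
  have := hY.t2
  have := hR.t2
  have hη : IsOpenEmbedding η := by obtain ⟨i, j, h⟩ := h1; exact h.hη
  have hφ : IsOpenEmbedding φ := by obtain ⟨i, j, h⟩ := h2; exact h.hψ
  obtain ⟨σ, hσ, hσ1, hσ2⟩ := squeeze 1 2 (by norm_num) (by norm_num)
  -- shrink the chart of `Y`
  have hη1 : IsOpenEmbedding (η ∘ σ) := hη.comp hσ
  have h3 := (h1.symm.change (Homeomorph.refl Y) (Homeomorph.refl ℂ) IsCone.refl hη1 (fun z hz => by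
    change η z = η (σ z); rw [hσ1 z hz])).symm
  obtain ⟨i, j, h⟩ := h3
  have hO : IsOpen (η '' {z | 2 < ‖z‖}) := hη.isOpenMap _ (isOpen_lt continuous_const continuous_norm)
  obtain ⟨φ', hφ', -, hr⟩ := hY.chart_at (η 3) _ hO ⟨3, by simp; norm_num, rfl⟩
  have hdis : ∀ z w, φ' z ≠ η (σ w) := by
    intro z w hzw
    obtain ⟨t, ht, hte⟩ := hr ⟨z, rfl⟩
    have h5 := hη.injective (hte.trans hzw)
    have h6 := hσ2 w
    rw [← h5] at h6
    exact absurd ht (not_lt.2 h6.le)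
  have hjφ : IsOpenEmbedding (j ∘ φ') := h.symm.chart_left hφ' (by
    rintro z ⟨w, -, hw⟩; exact hdis z w hw.symm)
  obtain ⟨κ, c, hc, hκ⟩ := hV.straighten hφ hjφ
  obtain ⟨I, J, H⟩ := h2.change κ c hc hjφ hκ
  set ρ' : ℂ → R := ρ ∘ c.symm with hρ'
  obtain ⟨Y', hY'⟩ := csum_exists hφ' H.hη
  refine ⟨Y', φ', ρ', ?_⟩
  obtain ⟨iy, jy, D⟩ := hY'
  obtain ⟨F, hF1, hF2⟩ := D.glue (fun y => I (j y)) J (fun ζ hζ => H.seam ζ hζ)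
  have hη' : IsOpenEmbedding (iy ∘ (η ∘ σ)) := D.chart_left hη1 (by
    rintro z ⟨w, -, hw⟩; exact hdis w z hw)
  -- membership facts
  have mφ : ∀ w, η (σ w) ∉ φ' '' ball 0 1 := by rintro w ⟨z, -, hz⟩; exact hdis z w hz
  have mη : ∀ z, φ' z ∉ (η ∘ σ) '' ball 0 1 := by rintro z ⟨w, -, hw⟩; exact hdis z w hw.symm
  have mi : ∀ x ∉ ψ '' ball 0 1, ∀ z, i x ≠ j (φ' z) := by
    intro x hx z hxz
    obtain ⟨ζ, -, -, hz⟩ := h.ovl x hx _ (mη z) hxz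
    exact hdis z ζ hz
  have mi' : ∀ x ∉ ψ '' ball 0 1, i x ∉ (j ∘ φ') '' ball 0 1 := by
    rintro x hx ⟨z, -, hz⟩; exact mi x hx z hz.symm
  have mj : ∀ y ∉ φ' '' ball 0 1, y ∉ (η ∘ σ) '' ball 0 1 → j y ∉ (j ∘ φ') '' ball 0 1 := by
    rintro y hy hy' ⟨z, hz, hzy⟩
    exact hy ⟨z, hz, h.ij (mη z) hy' hzy⟩
  have mY : ∀ y' ∉ (iy ∘ (η ∘ σ)) '' ball 0 1, (∃ y, y ∉ φ' '' ball 0 1 ∧ y ∉ (η ∘ σ) '' ball 0 1 ∧ iy y = y') ∨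
      ∃ r ∉ ρ' '' ball 0 1, jy r = y' := by
    intro y' hy'
    rcases D.cov y' with ⟨y, hy, rfl⟩ | h5
    · left
      refine ⟨y, hy, ?_, rfl⟩
      rintro ⟨w, hw, rfl⟩
      exact hy' ⟨w, hw, rfl⟩
    · exact Or.inr h5
  refine ⟨iy ∘ (η ∘ σ), ⟨iy, jy, D⟩, I ∘ i, F, h.hψ, hη', ?_, ?_, ?_, ?_, ?_, ?_, ?_⟩
  · exact H.ci.comp h.ci mi'
  · have kA : IsCompact ((φ' '' ball 0 1)ᶜ ∩ ((η ∘ σ) '' ball 0 1)ᶜ) :=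
      ((isClosed_compl_chart hφ' 1).inter (isClosed_compl_chart hη1 1)).isCompact
    have kB : IsCompact (ρ' '' ball 0 1)ᶜ := (isClosed_compl_chart H.hη 1).isCompact
    have cA : ContinuousOn iy ((φ' '' ball 0 1)ᶜ ∩ ((η ∘ σ) '' ball 0 1)ᶜ) := D.ci.mono inter_subset_left
    refine continuousOn_two_closed (kA.image_of_continuousOn cA).isClosed (kB.image_of_continuousOn D.cj).isClosed
      ?_ (ContinuousOn.mono (contOn_of_comp_compact kA cA ?_) inter_subset_right)
      (ContinuousOn.mono (contOn_of_comp_compact kB D.cj ?_) inter_subset_right)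
    · intro y' hy'
      rcases mY y' hy' with ⟨y, a, b, rfl⟩ | ⟨r, a, rfl⟩
      · exact Or.inl ⟨y, ⟨a, b⟩, rfl⟩
      · exact Or.inr ⟨r, a, rfl⟩
    · refine ContinuousOn.congr (f := I ∘ j) ?_ fun y hy => hF1 y hy.1
      exact H.ci.comp (h.cj.mono inter_subset_right) fun y hy => mj y hy.1 hy.2
    · exact H.cj.congr hF2
  · intro x hx x' hx' hxx
    exact h.ii hx hx' (H.ii (mi' x hx) (mi' x' hx') hxx)
  · have mixed : ∀ y, y ∉ φ' '' ball 0 1 → y ∉ (η ∘ σ) '' ball 0 1 → ∀ r ∉ ρ' '' ball 0 1,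
        F (iy y) = F (jy r) → iy y = jy r := by
      intro y hy hy2 r hr' e
      rw [hF1 y hy, hF2 r hr'] at e
      obtain ⟨ζ, hζ, e1, e2⟩ := H.ovl _ (mj y hy hy2) r hr' e
      rw [h.ij hy2 (mη ζ) e1, e2, D.seam ζ hζ]
    intro y1 hy1 y2 hy2 e
    rcases mY y1 hy1 with ⟨y, a, b, rfl⟩ | ⟨r, a, rfl⟩ <;> rcases mY y2 hy2 with ⟨y', a', b', rfl⟩ | ⟨r', a', rfl⟩
    · rw [hF1 y a, hF1 y' a'] at e
      rw [h.ij b b' (H.ii (mj y a b) (mj y' a' b') e)]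
    · exact mixed y a b r' a' e
    · exact (mixed y' a' b' r a e.symm).symm
    · rw [hF2 r a, hF2 r' a'] at e
      rw [H.ij a a' e]
  · intro ζ hζ
    simp only [Function.comp_apply]
    rw [hF1 _ (mφ ζ)]
    exact congrArg I (h.seam ζ hζ)
  · intro x hx y' hy' e
    rcases mY y' hy' with ⟨y, a, b, rfl⟩ | ⟨r, a, rfl⟩
    · rw [hF1 y a] at e
      obtain ⟨ζ, hζ, e1, e2⟩ := h.ovl x hx y b (H.ii (mi' x hx) (mj y a b) e)
      exact ⟨ζ, hζ, e1, by rw [e2]; rfl⟩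
    · rw [hF2 r a] at e
      obtain ⟨ζ, hζ, e1, e2⟩ := H.ovl _ (mi' x hx) r a e
      exact absurd e1 (mi x hx ζ)
  · intro z
    rcases H.cov z with ⟨v, hv, rfl⟩ | ⟨r, hr', rfl⟩
    · rcases h.cov v with ⟨x, hx, rfl⟩ | ⟨y, hy, rfl⟩
      · exact Or.inl ⟨x, hx, rfl⟩
      · right
        have hy1 : y ∉ φ' '' ball 0 1 := by rintro ⟨z, hz, rfl⟩; exact hv ⟨z, hz, rfl⟩
        refine ⟨iy y, ?_, hF1 y hy1⟩
        rintro ⟨w, hw, e⟩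
        exact hy ⟨w, hw, D.ii (mφ w) hy1 e⟩
    · right
      refine ⟨jy r, ?_, hF2 r hr'⟩
      rintro ⟨w, hw, e⟩
      obtain ⟨ζ, -, e1, -⟩ := D.ovl _ (mφ w) r hr' e
      exact hdis ζ w e1.symm

/-- `Z` is a connected sum of `W` and `Y`, for some choice of discs -/
def CS (Z W Y : Type) [TopologicalSpace Z] [TopologicalSpace W] [TopologicalSpace Y] : Prop :=
  ∃ (ψ : ℂ → W) (η : ℂ → Y), CSum Z W ψ Y η

section CSsection

variable {Z W Y W' Z' R : Type} [TopologicalSpace Z] [TopologicalSpace W] [TopologicalSpace Y]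
  [TopologicalSpace W'] [TopologicalSpace Z'] [TopologicalSpace R]

theorem CS.symm (h : CS Z W Y) : CS Z Y W := by
  obtain ⟨ψ, η, h⟩ := h
  exact ⟨η, ψ, h.symm⟩

theorem CS.left (h : CS Z W Y) (k : W ≃ₜ W') : CS Z W' Y := by
  obtain ⟨ψ, η, h⟩ := h
  have hψ : IsOpenEmbedding ψ := by obtain ⟨i, j, h⟩ := h; exact h.hψ
  exact ⟨k ∘ ψ, _, h.change k (Homeomorph.refl ℂ) IsCone.refl (k.isOpenEmbedding.comp hψ) fun z _ => rfl⟩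

theorem CS.map (h : CS Z W Y) (k : Z ≃ₜ Z') : CS Z' W Y := by
  obtain ⟨ψ, η, h⟩ := h
  exact ⟨ψ, η, h.transport k⟩

theorem CS.surf [T2Space Z] (h : CS Z W Y) (hW : Surf W) (hY : Surf Y) : Surf Z := by
  obtain ⟨ψ, η, h⟩ := h
  exact h.surf hW hY

theorem CS.unique_pp [T2Space Z] [T2Space Z'] (h : CS Z W PP) (h' : CS Z' W PP) (hW : Surf W) :
    Nonempty (Z ≃ₜ Z') := by
  obtain ⟨ψ, η, h⟩ := h
  obtain ⟨ψ', η', h'⟩ := h'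
  exact h.unique_pp hW h'

theorem CS.assoc [T2Space W] (h1 : CS W W' Y) (h2 : CS Z W R) (hX : Surf W') (hY : Surf Y) (hR : Surf R) :
    ∃ Y' : Set (Y × R), CS Y' Y R ∧ CS Z W' Y' := by
  obtain ⟨ψ, η, h1⟩ := h1
  obtain ⟨φ, ρ, h2⟩ := h2
  obtain ⟨Y', φ', ρ', η', a, b⟩ := h1.assoc hX hY hR h2
  exact ⟨Y', ⟨_, _, a⟩, ⟨_, _, b⟩⟩

theorem CS.step [T2Space Z] (h : CS Z W Y) (hW : Surf W) (hY : Surf Y) (hP : P3 W) : P3 Z := by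
  obtain ⟨ψ, η, h⟩ := h
  have := hY.compact
  exact P3.step hW h hP

theorem Surf.of_homeo (hW : Surf W) (k : W ≃ₜ W') : Surf W' := by
  have := hW.compact
  have := hW.t2
  have := hW.conn
  refine ⟨k.compactSpace, k.t2Space, k.surjective.denseRange.preconnectedSpace k.continuous, fun x => ?_⟩
  obtain ⟨ψ, hψ, z, hz⟩ := hW.chart (k.symm x)
  exact ⟨k ∘ ψ, k.isOpenEmbedding.comp hψ, z, by simp [hz]⟩

end CSsection

theorem P3.of_genus2 {G : TopCat.{0}} [T2Space G] (h : CS G (Circ × Circ) (Circ × Circ)) : P3 G := by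
  have hG := h.surf surf_tor surf_tor
  obtain ⟨ψ, η, h⟩ := h
  have hne : Nonempty G := by
    obtain ⟨i, j, -⟩ := h
    exact ⟨i (ψ 0)⟩
  obtain ⟨x⟩ := hne
  obtain ⟨γ, hγ, -⟩ := hG.chart x
  have : T2Space Torus := surf_tor.t2
  have : CompactSpace Torus := surf_tor.compact
  refine ⟨G, inferInstance, CSum.isConnSum (X := Torus) (Y := Torus) h, γ, id, hγ, continuousOn_id,
    injOn_id _, fun O hO _ => by simpa using hO⟩

theorem tor_sum : ∀ (n : ℕ) (Z : TopCat.{0}), IsSumToriWith Torus n Z → Surf Z ∧ (1 ≤ n → P3 Z)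
  | 0, Z, h => by
    obtain ⟨k⟩ := h
    exact ⟨surf_tor.of_homeo k.symm, fun h => absurd h (by norm_num)⟩
  | n + 1, Z, h => by
    obtain ⟨W, hW, h⟩ := h
    obtain ⟨hs, hp⟩ := tor_sum n W hW
    have : T2Space Torus := surf_tor.t2
    have := hs.t2
    obtain ⟨hT, hc⟩ := h.csum (Y := Torus) collared_tor
    have hc : CS Z W (Circ × Circ) := hc
    refine ⟨hc.surf hs surf_tor, fun _ => ?_⟩
    rcases n with - | n
    · obtain ⟨k⟩ := hW
      exact P3.of_genus2 (hc.left k)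
    · exact hc.step hs surf_tor (hp (by omega))

theorem proj_step {n : ℕ} {Z : TopCat.{0}} (h : IsProjSum (n + 2) Z)
    (ih : ∀ W : TopCat.{0}, IsProjSum (n + 1) W → Surf W) :
    T2Space Z ∧ ∃ W : TopCat.{0}, IsProjSum (n + 1) W ∧ Surf W ∧ CS Z W PP := by
  obtain ⟨W, hW, h⟩ := h
  have hs := ih W hW
  have : T2Space RP2 := pp_t2
  have := hs.t2
  obtain ⟨hT, hc⟩ := h.csum (Y := RP2) collared_pp
  exact ⟨hT, W, hW, hs, hc⟩

theorem proj_surf : ∀ (n : ℕ) (Z : TopCat.{0}), IsProjSum (n + 1) Z → Surf Z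
  | 0, Z, h => by
    obtain ⟨k⟩ := h
    exact surf_pp.of_homeo (W := PP) k.symm
  | n + 1, Z, h => by
    obtain ⟨hT, W, -, hs, hc⟩ := proj_step h (proj_surf n)
    exact hc.surf hs surf_pp

theorem proj_two {Z : TopCat.{0}} (h : IsProjSum 2 Z) : Nonempty (Z ≃ₜ KB) := by
  obtain ⟨hT, W, hW, hs, hc⟩ := proj_step h (proj_surf 0)
  obtain ⟨k⟩ := hW
  exact CS.unique_pp (hc.left (W' := PP) k) ⟨_, _, csK⟩ surf_pp

theorem surf_KB : Surf KB := csK.surf surf_pp surf_pp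

theorem proj_three {Z : TopCat.{0}} (h : IsProjSum 3 Z) : Nonempty (Z ≃ₜ MB) := by
  obtain ⟨hT, W, hW, hs, hc⟩ := proj_step h (proj_surf 1)
  obtain ⟨k⟩ := proj_two hW
  exact CS.unique_pp (hc.left k) ⟨_, _, csM⟩ surf_KB

theorem proj_five {Z : TopCat.{0}} (h : IsProjSum 5 Z) : P3 Z := by
  obtain ⟨hT, Z4, h4, hs4, hc5⟩ := proj_step h (proj_surf 3)
  obtain ⟨hT4, Z3, h3, hs3, hc4⟩ := proj_step h4 (proj_surf 2)
  have := hs3.t2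
  obtain ⟨k3⟩ := proj_three h3
  have hc3 : CS Z3 (Circ × Circ) PP := CS.map (Z := MB) ⟨_, _, csMT⟩ k3.symm
  obtain ⟨Y1, a1, b1⟩ := hc3.assoc hc4 surf_tor surf_pp surf_pp
  have hY1 : Surf Y1 := a1.surf surf_pp surf_pp
  obtain ⟨Y2, a2, b2⟩ := b1.assoc hc5 surf_tor hY1 surf_pp
  have hY2 : Surf Y2 := a2.surf hY1 surf_pp
  obtain ⟨k1⟩ := CS.unique_pp a1 ⟨_, _, csK⟩ surf_pp
  obtain ⟨k2⟩ := CS.unique_pp (a2.left k1) ⟨_, _, csM⟩ surf_KB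
  have hcY : CS Y2 (Circ × Circ) PP := CS.map (Z := MB) ⟨_, _, csMT⟩ k2.symm
  obtain ⟨G, a3, b3⟩ := hcY.symm.assoc b2.symm surf_pp surf_tor surf_tor
  have hG : Surf G := a3.surf surf_tor surf_tor
  exact b3.symm.step hG surf_pp (P3.of_genus2 (G := TopCat.of G) a3)

theorem proj_ge : ∀ (m : ℕ) (Z : TopCat.{0}), IsProjSum (m + 5) Z → P3 Z
  | 0, Z, h => proj_five h
  | m + 1, Z, h => by
    obtain ⟨hT, W, hW, hs, hc⟩ := proj_step (n := m + 4) h (proj_surf (m + 4))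
    exact hc.step hs surf_pp (proj_ge m W hW)

/-- for `n ≥ 2` the connected sum of `n` tori contains an open
subset homeomorphic to `T² # T²` minus a closed disk, and for `n ≥ 5` so does
the connected sum of `n` projective planes. -/
theorem stmt_11 :
    (∀ n : ℕ, 2 ≤ n → ∀ Z : TopCat.{0}, IsTorSum n Z →
      ContainsDoubleTorusMinusDisk Z) ∧
    (∀ n : ℕ, 5 ≤ n → ∀ Z : TopCat.{0}, IsProjSum n Z →
      ContainsDoubleTorusMinusDisk Z) := by
  refine ⟨fun n hn Z h => ((tor_sum _ Z h.2).2 (by omega)).contains, fun n hn Z h => ?_⟩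
  obtain ⟨m, rfl⟩ := Nat.exists_eq_add_of_le' hn
  exact (proj_ge m Z h).contains

end
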